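/- Bilateral flatness controlled by flatness and energy: There exist constants ε₀ > 0 and C ≥ 1, depending only on N and ℂ, such that the following holds. Let (u,K) be a topological Griffith almost-minimizer with gauge h in an open set Ω ⊂ ℝ^N. Then for all x₀ ∈ K and r₀ > 0 with B(x₀,r₀) ⊂ Ω and h(r₀) ≤ ε₀: β^bil_K(x₀, r₀/2) ≤ C (β_K(x₀,r₀) + ω₂(x₀,r₀)^{1/(6(N−1))}). -/

import Mathlib

open MeasureTheory Metric Set Filter Topology Matrix
open scoped ENNReal NNReal RealInnerProductSpace

noncomputable section

namespace Griffith

abbrev Euc (N : ℕ) := EuclideanSpace ℝ (Fin N)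
abbrev Mat (N : ℕ) := Matrix (Fin N) (Fin N) ℝ

variable {N : ℕ}

/-- Frobenius inner product of two matrices. -/
def frob (ξ η : Mat N) : ℝ := ∑ i, ∑ j, ξ i j * η i j

/-- Frobenius norm of a matrix. -/
def frobNorm (ξ : Mat N) : ℝ := Real.sqrt (frob ξ ξ)

/-- Euclidean norm of a plain vector. -/
def vecNorm (w : Fin N → ℝ) : ℝ := Real.sqrt (∑ i, w i ^ 2)

/-- Real inner product on `ℝ^N`. -/
def rInner (x y : Euc N) : ℝ := @inner ℝ _ _ x y

/-- The gradient matrix `(∇u)_{ij} = ∂_j u_i` of `u` at `x`. -/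
def gradm (u : Euc N → Euc N) (x : Euc N) : Mat N :=
  fun i j => fderiv ℝ u x (EuclideanSpace.single j (1 : ℝ)) i

/-- The symmetrized gradient `e(u) = (∇u + ∇uᵀ)/2`. -/
def eSym (u : Euc N → Euc N) (x : Euc N) : Mat N :=
  (1 / 2 : ℝ) • (gradm u x + (gradm u x)ᵀ)

/-- The hypotheses on the elasticity tensor `𝓒`. -/
structure IsElasticityTensor (𝓒 : Mat N →ₗ[ℝ] Mat N) (c₀ : ℝ) : Prop where
  one_le : 1 ≤ c₀
  symm : ∀ ξ η : Mat N, frob (𝓒 ξ) η = frob ξ (𝓒 η)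
  skew_vanish : ∀ ξ : Mat N, 𝓒 (ξ - ξᵀ) = 0
  coercive : ∀ ξ : Mat N, c₀⁻¹ * frobNorm (ξ + ξᵀ) ^ 2 ≤ frob (𝓒 ξ) ξ

/-- `(N-1)`-dimensional Hausdorff measure on `ℝ^N`. -/
def Hm (N : ℕ) : Measure (Euc N) := μH[(N : ℝ) - 1]

/-- `K` is relatively closed in `Ω`. -/
def RelClosedIn (K Ω : Set (Euc N)) : Prop := K ⊆ Ω ∧ closure K ∩ Ω ⊆ K

/-- `K` is coral. -/
def Coral (K : Set (Euc N)) : Prop :=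
  ∀ x ∈ K, ∀ r : ℝ, 0 < r → 0 < Hm N (K ∩ ball x r)

/-- Admissible pair `(u,K)` in the open set `Ω` : `K` relatively closed
and `u ∈ W^{1,2}_loc(Ω \ K ; ℝ^N)`. -/
structure AdmissiblePair (Ω : Set (Euc N)) (u : Euc N → Euc N) (K : Set (Euc N)) : Prop where
  open_amb : IsOpen Ω
  relClosed : RelClosedIn K Ω
  diffOn : ∀ x ∈ Ω \ K, DifferentiableAt ℝ u x
  locSobolev : ∀ x ∈ Ω \ K, ∃ ε > (0:ℝ), ball x ε ⊆ Ω \ K ∧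
    IntegrableOn (fun y => ‖u y‖ ^ 2 + frobNorm (gradm u y) ^ 2) (ball x ε) volume

/-- Elastic energy `∫_A ℂ e(u) : e(u) dx`. -/
def elastic (𝓒 : Mat N →ₗ[ℝ] Mat N) (u : Euc N → Euc N) (A : Set (Euc N)) : ℝ≥0∞ :=
  ∫⁻ x in A, ENNReal.ofReal (frob (𝓒 (eSym u x)) (eSym u x))

/-- Elastic energy with exponent `p/2` : `∫_A (ℂ e(u) : e(u))^{p/2} dx`. -/
def elasticP (𝓒 : Mat N →ₗ[ℝ] Mat N) (u : Euc N → Euc N) (p : ℝ) (A : Set (Euc N)) : ℝ≥0∞ :=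
  ∫⁻ x in A, ENNReal.ofReal (frob (𝓒 (eSym u x)) (eSym u x)) ^ (p / 2)

/-- The pair `(u,K)` has locally finite energy in `Ω`. -/
def LocFiniteEnergy (Ω : Set (Euc N)) (u : Euc N → Euc N) (K : Set (Euc N)) : Prop :=
  ∀ (x : Euc N) (r : ℝ), 0 < r → closedBall x r ⊆ Ω →
    (∫⁻ y in ball x r \ K, ENNReal.ofReal (frobNorm (eSym u y) ^ 2)) + Hm N (K ∩ ball x r) < ⊤

/-- `(v,L)` is a competitor of `(u,K)` in `B`. -/
structure Competitor (Ω : Set (Euc N)) (u : Euc N → Euc N) (K : Set (Euc N))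
    (B : Set (Euc N)) (v : Euc N → Euc N) (L : Set (Euc N)) : Prop where
  pair : AdmissiblePair Ω v L
  eq_outside : L \ B = K \ B
  ae_eq : ∀ᵐ x ∂volume, x ∈ Ω \ (K ∪ B) → v x = u x

/-- Points of `Ω \ (K ∪ B)` separated by `K` stay separated by `L`. -/
def KeepsSeparation (Ω K B L : Set (Euc N)) : Prop :=
  ∀ x ∈ Ω \ (K ∪ B), ∀ y ∈ Ω \ (K ∪ B),
    y ∉ connectedComponentIn (Ω \ K) x → y ∉ connectedComponentIn (Ω \ L) x

/-- `(v,L)` is a topological competitor of `(u,K)` in `B`. -/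
structure TopCompetitor (Ω : Set (Euc N)) (u : Euc N → Euc N) (K : Set (Euc N))
    (B : Set (Euc N)) (v : Euc N → Euc N) (L : Set (Euc N)) : Prop where
  compet : Competitor Ω u K B v L
  sep : KeepsSeparation Ω K B L

/-- `L` is a topological competitor of the set `K` in `B`. -/
structure TopSetCompetitor (Ω K B L : Set (Euc N)) : Prop where
  relClosed : RelClosedIn L Ω
  eq_outside : L \ B = K \ B
  sep : KeepsSeparation Ω K B L

/-- A gauge. -/
structure IsGauge (h : ℝ → ℝ≥0∞) : Prop where
  mono : ∀ ⦃r s : ℝ⦄, 0 < r → r ≤ s → h r ≤ h s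
  eventually_finite : ∃ r₀ > (0:ℝ), ∀ r : ℝ, 0 < r → r < r₀ → h r ≠ ⊤

/-- Topological Griffith `M`-quasiminimizer with gauge `h` in `Ω`. -/
structure TopQuasiMin (𝓒 : Mat N →ₗ[ℝ] Mat N) (M : ℝ) (Ω : Set (Euc N))
    (u : Euc N → Euc N) (K : Set (Euc N)) (h : ℝ → ℝ≥0∞) : Prop where
  gauge : IsGauge h
  pair : AdmissiblePair Ω u K
  coral : Coral K
  locFin : LocFiniteEnergy Ω u K
  minimality : ∀ (x : Euc N) (r : ℝ), 0 < r → closedBall x r ⊆ Ω →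
    ∀ (v : Euc N → Euc N) (L : Set (Euc N)), TopCompetitor Ω u K (ball x r) v L →
      elastic 𝓒 u (ball x r \ K) + ENNReal.ofReal M⁻¹ * Hm N (K ∩ ball x r) ≤
        elastic 𝓒 v (ball x r \ L) + ENNReal.ofReal M * Hm N (L ∩ ball x r)
          + h r * ENNReal.ofReal (r ^ (N - 1))

/-- Topological Griffith almost-minimizer with gauge `h` in `Ω`. -/
structure TopAlmostMin (𝓒 : Mat N →ₗ[ℝ] Mat N) (Ω : Set (Euc N))
    (u : Euc N → Euc N) (K : Set (Euc N)) (h : ℝ → ℝ≥0∞) : Prop where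
  gauge : IsGauge h
  gauge_zero : Tendsto h (𝓝[>] (0:ℝ)) (𝓝 0)
  pair : AdmissiblePair Ω u K
  coral : Coral K
  locFin : LocFiniteEnergy Ω u K
  minimality : ∀ (x : Euc N) (r : ℝ), 0 < r → closedBall x r ⊆ Ω →
    ∀ (v : Euc N → Euc N) (L : Set (Euc N)), TopCompetitor Ω u K (ball x r) v L →
      elastic 𝓒 u (ball x r \ K) + Hm N (K ∩ ball x r) ≤
        elastic 𝓒 v (ball x r \ L) + Hm N (L ∩ ball x r) + h r * ENNReal.ofReal (r ^ (N - 1))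

/-- Plain Griffith almost-minimizer with gauge `h` in `Ω`. -/
structure AlmostMin (𝓒 : Mat N →ₗ[ℝ] Mat N) (Ω : Set (Euc N))
    (u : Euc N → Euc N) (K : Set (Euc N)) (h : ℝ → ℝ≥0∞) : Prop where
  gauge : IsGauge h
  gauge_zero : Tendsto h (𝓝[>] (0:ℝ)) (𝓝 0)
  pair : AdmissiblePair Ω u K
  coral : Coral K
  locFin : LocFiniteEnergy Ω u K
  minimality : ∀ (x : Euc N) (r : ℝ), 0 < r → closedBall x r ⊆ Ω →
    ∀ (v : Euc N → Euc N) (L : Set (Euc N)), Competitor Ω u K (ball x r) v L →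
      elastic 𝓒 u (ball x r \ K) + Hm N (K ∩ ball x r) ≤
        elastic 𝓒 v (ball x r \ L) + Hm N (L ∩ ball x r) + h r * ENNReal.ofReal (r ^ (N - 1))

/-- Griffith global minimizer in `ℝ^N`. -/
structure GlobalMin (𝓒 : Mat N →ₗ[ℝ] Mat N) (u : Euc N → Euc N) (K : Set (Euc N)) : Prop where
  pair : AdmissiblePair univ u K
  coral : Coral K
  locFin : LocFiniteEnergy univ u K
  minimality : ∀ x ∈ K, ∀ r : ℝ, 0 < r →
    ∀ (v : Euc N → Euc N) (L : Set (Euc N)), TopCompetitor univ u K (ball x r) v L →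
      elastic 𝓒 u (ball x r \ K) + Hm N (K ∩ ball x r) ≤
        elastic 𝓒 v (ball x r \ L) + Hm N (L ∩ ball x r)

/-- Almost-minimal set with gauge `h` in `Ω`. -/
structure AlmostMinimalSet (Ω K : Set (Euc N)) (h : ℝ → ℝ≥0∞) : Prop where
  gauge : IsGauge h
  gauge_zero : Tendsto h (𝓝[>] (0:ℝ)) (𝓝 0)
  relClosed : RelClosedIn K Ω
  coral : Coral K
  minimality : ∀ x ∈ K, ∀ r : ℝ, 0 < r → closedBall x r ⊆ Ω →
    ∀ L : Set (Euc N), TopSetCompetitor Ω K (ball x r) L →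
      Hm N (K ∩ ball x r) ≤ Hm N (L ∩ ball x r) + h r * ENNReal.ofReal (r ^ (N - 1))

/-- Minimal set in `Ω`. -/
structure MinimalSet (Ω K : Set (Euc N)) : Prop where
  relClosed : RelClosedIn K Ω
  coral : Coral K
  minimality : ∀ x ∈ K, ∀ r : ℝ, 0 < r → closedBall x r ⊆ Ω →
    ∀ L : Set (Euc N), TopSetCompetitor Ω K (ball x r) L →
      Hm N (K ∩ ball x r) ≤ Hm N (L ∩ ball x r)

/-- The flatness `β_K(x₀,r₀)`. -/
def flatness (K : Set (Euc N)) (x₀ : Euc N) (r₀ : ℝ) : ℝ :=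
  sInf {t : ℝ | 0 ≤ t ∧ ∃ ν : Euc N, ‖ν‖ = 1 ∧
    ∀ x ∈ K ∩ ball x₀ r₀, |rInner ν (x - x₀)| ≤ t * r₀}

/-- The bilateral flatness `β^bil_K(x₀,r₀)`. -/
def bilFlatness (K : Set (Euc N)) (x₀ : Euc N) (r₀ : ℝ) : ℝ :=
  sInf {t : ℝ | 0 ≤ t ∧ ∃ ν : Euc N, ‖ν‖ = 1 ∧
    (∀ x ∈ K ∩ ball x₀ r₀, |rInner ν (x - x₀)| ≤ t * r₀) ∧
    (∀ y ∈ ball x₀ r₀, rInner ν (y - x₀) = 0 → infDist y K ≤ t * r₀)}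

/-- The unit vector `ν₀` is normal to a hyperplane through `x₀` attaining the flatness. -/
def AttainsFlatness (K : Set (Euc N)) (x₀ : Euc N) (r₀ : ℝ) (ν₀ : Euc N) : Prop :=
  ‖ν₀‖ = 1 ∧ ∀ x ∈ K ∩ ball x₀ r₀, |rInner ν₀ (x - x₀)| ≤ flatness K x₀ r₀ * r₀

/-- The normalized elastic energy `ω_p(x₀,r₀)`. -/
def omegaP (u : Euc N → Euc N) (K : Set (Euc N)) (p : ℝ) (x₀ : Euc N) (r₀ : ℝ) : ℝ≥0∞ :=
  ENNReal.ofReal (r₀ ^ (1 - 2 * (N : ℝ) / p)) *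
    (∫⁻ x in ball x₀ r₀ \ K, ENNReal.ofReal (frobNorm (eSym u x) ^ p)) ^ (2 / p)

/-- `ω_{N-1}`, the Lebesgue measure of the `(N-1)`-dimensional unit disk. -/
def unitDiskVol (N : ℕ) : ℝ≥0∞ := volume (ball (0 : EuclideanSpace ℝ (Fin (N - 1))) 1)

/-- The ball `D₁ = B(x₀ + (3r₀/4)ν₀, r₀/8)`. -/
def Dplus (x₀ : Euc N) (r₀ : ℝ) (ν₀ : Euc N) : Set (Euc N) :=
  ball (x₀ + (3 * r₀ / 4) • ν₀) (r₀ / 8)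

/-- The ball `D₂ = B(x₀ - (3r₀/4)ν₀, r₀/8)`. -/
def Dminus (x₀ : Euc N) (r₀ : ℝ) (ν₀ : Euc N) : Set (Euc N) :=
  ball (x₀ - (3 * r₀ / 4) • ν₀) (r₀ / 8)

/-- `b_i = ⨍_{D_i} u`. -/
def avgDisp (u : Euc N → Euc N) (D : Set (Euc N)) : Euc N := ⨍ y in D, u y

/-- `A_i = ⨍_{D_i} (∇u - ∇uᵀ)/2`. -/
def avgRot (u : Euc N → Euc N) (D : Set (Euc N)) : Mat N :=
  fun i j => ⨍ y in D, (gradm u y i j - gradm u y j i) / 2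

/-- The normalized jump `J(x₀,r₀)` (relative to an optimal normal direction `ν₀`). -/
def normJump (u : Euc N → Euc N) (x₀ : Euc N) (r₀ : ℝ) (ν₀ : Euc N) : ℝ :=
  (‖avgDisp u (Dplus x₀ r₀ ν₀) - avgDisp u (Dminus x₀ r₀ ν₀)‖ +
    r₀ * frobNorm (avgRot u (Dplus x₀ r₀ ν₀) - avgRot u (Dminus x₀ r₀ ν₀))) / Real.sqrt r₀

/-- The component `J(ν)` of the jump in the direction `ν`. -/
def dirJump (u : Euc N → Euc N) (x₀ : Euc N) (r₀ : ℝ) (ν₀ ν : Euc N) : ℝ :=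
  (|rInner (avgDisp u (Dplus x₀ r₀ ν₀) - avgDisp u (Dminus x₀ r₀ ν₀)) ν| +
    r₀ * vecNorm ((avgRot u (Dplus x₀ r₀ ν₀) - avgRot u (Dminus x₀ r₀ ν₀)).mulVec
      (fun j => ν j))) / Real.sqrt r₀

/-- Orthogonal projection onto the hyperplane `x₀ + ν^⊥`. -/
def projHyp (x₀ ν : Euc N) (y : Euc N) : Euc N := y - (rInner ν (y - x₀)) • ν

/-- The set of holes `S(x₀,r₀,ν,ε)` through slicing in the direction `ν`. -/
def slicedHoles (K : Set (Euc N)) (x₀ : Euc N) (r₀ : ℝ) (ν : Euc N) (ε : ℝ) : Set (Euc N) :=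
  ({y : Euc N | rInner ν (y - x₀) = 0} ∩ ball x₀ ((1 - 4 * ε) * r₀)) \
    (projHyp x₀ ν '' (K ∩ ball x₀ r₀))

/-- Rigid motion: `x ↦ b + Ax` with `A` skew-symmetric. -/
def IsRigidMotion (a : Euc N → Euc N) : Prop :=
  ∃ (b : Euc N) (A : Euc N →ₗ[ℝ] Euc N),
    (∀ x y : Euc N, rInner (A x) y = - rInner x (A y)) ∧ ∀ x, a x = b + A x

/-- Every compact subset of `Ω` is contained in `Ωs i` for all large `i`. -/
def ExhaustsCompacts (Ωs : ℕ → Set (Euc N)) (Ω : Set (Euc N)) : Prop :=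
  ∀ H : Set (Euc N), IsCompact H → H ⊆ Ω → ∀ᶠ i in atTop, H ⊆ Ωs i

/-- Local Hausdorff convergence of `Ks i` towards `K` inside `Ω`. -/
def LocalHausdorffConv (Ω : Set (Euc N)) (Ks : ℕ → Set (Euc N)) (K : Set (Euc N)) : Prop :=
  ∀ H : Set (Euc N), IsCompact H → H ⊆ Ω →
    Tendsto (fun i => (⨆ x ∈ Ks i ∩ H, EMetric.infEdist x K) +
      ⨆ x ∈ K ∩ H, EMetric.infEdist x (Ks i)) atTop (𝓝 0)

/-- Convergence of the pairs `(us i, Ks i)` towards the pair `(u,K)` in `Ω`. -/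
def PairsConv (Ω : Set (Euc N)) (us : ℕ → Euc N → Euc N) (Ks : ℕ → Set (Euc N))
    (u : Euc N → Euc N) (K : Set (Euc N)) : Prop :=
  RelClosedIn K Ω ∧ LocalHausdorffConv Ω Ks K ∧
  ∀ z ∈ Ω \ K, ∃ a : ℕ → Euc N → Euc N, (∀ i, IsRigidMotion (a i)) ∧
    ∀ H : Set (Euc N), IsCompact H → H ⊆ connectedComponentIn (Ω \ K) z →
      Tendsto (fun i => ∫ x in H, ‖us i x - a i x - u x‖ ^ 2) atTop (𝓝 (0 : ℝ))

/-- `h⁺(r) = lim_{t → r⁺} limsup_i hs i t` (for nondecreasing gauges, the right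
limit is the infimum over `t > r`). -/
def limsupGauge (hs : ℕ → ℝ → ℝ≥0∞) (r : ℝ) : ℝ≥0∞ :=
  ⨅ t ∈ Ioi r, Filter.limsup (fun i => hs i t) atTop

open Classical in
/-- The limit gauge, truncated at the threshold `ε'`. -/
def limitGauge (hs : ℕ → ℝ → ℝ≥0∞) (ε' : ℝ) (r : ℝ) : ℝ≥0∞ :=
  if limsupGauge hs r < ENNReal.ofReal ε' then limsupGauge hs r else ⊤

/-- `x` is a regular point of `K`. -/
def RegularPoint (K : Set (Euc N)) (x : Euc N) : Prop :=
  ∃ r : ℕ → ℝ, (∀ i, 0 < r i) ∧ Tendsto r atTop (𝓝 (0:ℝ)) ∧ ∃ ν : Euc N, ‖ν‖ = 1 ∧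
    Tendsto (fun i =>
      (ENNReal.ofReal (r i))⁻¹ *
        ((⨆ y ∈ {z : Euc N | rInner ν (z - x) = 0} ∩ ball x (r i), EMetric.infEdist y K) +
          ⨆ y ∈ K ∩ ball x (r i), EMetric.infEdist y {z : Euc N | rInner ν (z - x) = 0}))
      atTop (𝓝 0)

/-- The singular part of `K`. -/
def singularPart (K : Set (Euc N)) : Set (Euc N) := {x ∈ K | ¬ RegularPoint K x}

open ContinuousLinearMap (lsmul norm_smulRight_apply opNorm_comp_le opNorm_le_bound)
open Real (norm_eq_abs norm_of_nonneg sq_sqrt sqrt sqrt_nonneg volume_Icc)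
open Finset (measurable_sum mul_sum single_le_sum sum_add_distrib sum_congr sum_const sum_le_sum
  sum_nonneg)
open ENNReal (add_ne_top div_ne_top mul_ne_top ofReal ofReal_add ofReal_le_ofReal
  ofReal_le_ofReal_iff ofReal_mul ofReal_natCast ofReal_ne_top ofReal_one ofReal_pos ofReal_pow
  ofReal_toReal toReal_nonneg toReal_pos)

/-! ### Linear algebra of symmetrized gradients -/

def ev (i : Fin N) : Euc N := EuclideanSpace.single i (1 : ℝ)

lemma norm_ev (i : Fin N) : ‖ev i‖ = 1 := by simp [ev]

lemma ev_apply (i j : Fin N) : (ev i : Euc N) j = if j = i then 1 else 0 := by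
  simp [ev, Pi.single_apply]

lemma inner_ev (x : Euc N) (i : Fin N) : ⟪ev i, x⟫ = x i := by
  simp [ev, EuclideanSpace.inner_single_left]

lemma sum_ev (x : Euc N) : ∑ i, x i • ev i = x := by
  ext k
  simp [ev_apply]

/-- symmetrized matrix of a linear map -/
def eL : (Euc N →L[ℝ] Euc N) →ₗ[ℝ] Mat N where
  toFun L := Matrix.of fun i j => (1 / 2 : ℝ) * (L (ev j) i + L (ev i) j)
  map_add' L M := by
    ext i j
    simp only [Matrix.add_apply, Matrix.of_apply, _root_.add_apply, PiLp.add_apply]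
    ring
  map_smul' c L := by
    ext i j
    simp only [Matrix.smul_apply, Matrix.of_apply, _root_.smul_apply, PiLp.smul_apply, smul_eq_mul, RingHom.id_apply]
    ring

lemma eL_apply (L : Euc N →L[ℝ] Euc N) (i j : Fin N) :
    eL L i j = (1 / 2 : ℝ) * (L (ev j) i + L (ev i) j) := rfl

lemma eSym_eq (u : Euc N → Euc N) (x : Euc N) : eSym u x = eL (fderiv ℝ u x) := by
  ext i j
  simp [eSym, gradm, eL_apply, ev, Matrix.smul_apply, Matrix.add_apply, Matrix.transpose_apply]

lemma eL_symm (L : Euc N →L[ℝ] Euc N) : (eL L)ᵀ = eL L := by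
  ext i j
  simp only [Matrix.transpose_apply, eL_apply]
  ring

lemma frob_self_nonneg (ξ : Mat N) : 0 ≤ frob ξ ξ :=
  sum_nonneg fun i _ => sum_nonneg fun j _ => mul_self_nonneg _

lemma frobNorm_sq (ξ : Mat N) : frobNorm ξ ^ 2 = frob ξ ξ := sq_sqrt (frob_self_nonneg ξ)

lemma frobNorm_nonneg (ξ : Mat N) : 0 ≤ frobNorm ξ := sqrt_nonneg _

lemma frob_comm (ξ η : Mat N) : frob ξ η = frob η ξ := by
  simp only [frob, mul_comm]

lemma frob_add_left (ξ ξ' η : Mat N) : frob (ξ + ξ') η = frob ξ η + frob ξ' η := by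
  simp only [frob, Matrix.add_apply, add_mul, sum_add_distrib]

lemma frob_smul_left (c : ℝ) (ξ η : Mat N) : frob (c • ξ) η = c * frob ξ η := by
  simp only [frob, Matrix.smul_apply, smul_eq_mul, mul_sum, mul_assoc]

lemma frob_add_right (ξ η η' : Mat N) : frob ξ (η + η') = frob ξ η + frob ξ η' := by
  rw [frob_comm, frob_add_left, frob_comm η, frob_comm η']

lemma frob_smul_right (c : ℝ) (ξ η : Mat N) : frob ξ (c • η) = c * frob ξ η := by
  rw [frob_comm, frob_smul_left, frob_comm]

lemma frob_eq_sum (ξ η : Mat N) :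
    frob ξ η = ∑ p : Fin N × Fin N, ξ p.1 p.2 * η p.1 p.2 := by
  rw [frob, Fintype.sum_prod_type]

lemma frob_sq_le (ξ η : Mat N) : frob ξ η ^ 2 ≤ frob ξ ξ * frob η η := by
  rw [frob_eq_sum, frob_eq_sum, frob_eq_sum]
  have := Finset.sum_mul_sq_le_sq_mul_sq (Finset.univ : Finset (Fin N × Fin N))
    (fun p => ξ p.1 p.2) (fun p => η p.1 p.2)
  simpa [sq] using this

lemma abs_frob_le (ξ η : Mat N) : |frob ξ η| ≤ frobNorm ξ * frobNorm η := by
  apply abs_le_of_sq_le_sq _ (mul_nonneg (frobNorm_nonneg _) (frobNorm_nonneg _))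
  rw [mul_pow, frobNorm_sq, frobNorm_sq]
  exact frob_sq_le ξ η

lemma frobNorm_smul (c : ℝ) (ξ : Mat N) : frobNorm (c • ξ) = |c| * frobNorm ξ := by
  rw [frobNorm, frob_smul_left, frob_smul_right, ← mul_assoc, Real.sqrt_mul (mul_self_nonneg c),
    Real.sqrt_mul_self_eq_abs, frobNorm]

lemma frobNorm_add_le (ξ η : Mat N) : frobNorm (ξ + η) ≤ frobNorm ξ + frobNorm η := by
  apply abs_le_of_sq_le_sq' _ (add_nonneg (frobNorm_nonneg _) (frobNorm_nonneg _)) |>.2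
  rw [frobNorm_sq, frob_add_left, frob_add_right, frob_add_right, frob_comm η ξ, ← frobNorm_sq,
    ← frobNorm_sq]
  have := (abs_le.1 (abs_frob_le ξ η)).2
  nlinarith

lemma frobNorm_zero : frobNorm (0 : Mat N) = 0 := by simp [frobNorm, frob]

lemma frobNorm_sum_le {ι : Type*} (s : Finset ι) (f : ι → Mat N) :
    frobNorm (∑ i ∈ s, f i) ≤ ∑ i ∈ s, frobNorm (f i) := by
  classical
  induction s using Finset.induction_on with
  | empty => simp [frobNorm_zero]
  | insert a s ha ih =>
    rw [Finset.sum_insert ha, Finset.sum_insert ha]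
    exact (frobNorm_add_le _ _).trans (by gcongr)

lemma abs_coord_le (x : Euc N) (i : Fin N) : |x i| ≤ ‖x‖ := by
  have := PiLp.norm_apply_le x i
  simpa using this

lemma abs_eL_le (L : Euc N →L[ℝ] Euc N) (i j : Fin N) : |eL L i j| ≤ ‖L‖ := by
  have h : ∀ i j : Fin N, |L (ev j) i| ≤ ‖L‖ := fun i j =>
    (abs_coord_le _ _).trans ((L.le_opNorm _).trans (by rw [norm_ev, mul_one]))
  rw [eL_apply, abs_mul]
  have := abs_add_le (L (ev j) i) (L (ev i) j)
  have h1 := h i j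
  have h2 := h j i
  rw [abs_of_pos (by norm_num : (0:ℝ) < 1/2)]
  linarith

lemma frobNorm_eL_le (L : Euc N →L[ℝ] Euc N) : frobNorm (eL L) ≤ N * ‖L‖ := by
  apply abs_le_of_sq_le_sq' _ (by positivity) |>.2
  rw [frobNorm_sq, frob]
  calc ∑ i, ∑ j, eL L i j * eL L i j ≤ ∑ i : Fin N, ∑ j : Fin N, ‖L‖ ^ 2 := by
        gcongr with i _ j _
        rw [← sq, ← sq_abs]
        exact pow_le_pow_left₀ (abs_nonneg _) (abs_eL_le L i j) 2
    _ = (N * ‖L‖) ^ 2 := by simp; ring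

lemma inner_eL (L : Euc N →L[ℝ] Euc N) (ξ : Euc N) :
    ⟪L ξ, ξ⟫ = frob (eL L) (fun i j => ξ i * ξ j) := by
  have h1 : ∀ i, (L ξ) i = ∑ j, ξ j * L (ev j) i := by
    intro i
    conv_lhs => rw [← sum_ev ξ]
    simp [map_sum, Finset.sum_apply]
  have h2 : ⟪L ξ, ξ⟫ = ∑ i, ∑ j, ξ i * ξ j * L (ev j) i := by
    rw [PiLp.inner_apply]
    simp only [h1, RCLike.inner_apply, conj_trivial, mul_sum, mul_assoc]
  have h3 : ∑ i, ∑ j, ξ i * ξ j * L (ev j) i = ∑ i, ∑ j, ξ i * ξ j * L (ev i) j := by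
    rw [Finset.sum_comm]
    refine sum_congr rfl fun i _ => sum_congr rfl fun j _ => by ring
  have h4 : frob (eL L) (fun i j => ξ i * ξ j) =
      1/2 * (∑ i, ∑ j, ξ i * ξ j * L (ev j) i + ∑ i, ∑ j, ξ i * ξ j * L (ev i) j) := by
    simp only [frob]
    rw [← sum_add_distrib, mul_sum]
    refine sum_congr rfl fun i _ => ?_
    rw [← sum_add_distrib, mul_sum]
    refine sum_congr rfl fun j _ => ?_
    rw [eL_apply]; ring
  rw [h4, ← h3, h2]; ring

lemma inner_eL_sq_le (L : Euc N →L[ℝ] Euc N) (ξ : Euc N) :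
    ⟪L ξ, ξ⟫ ^ 2 ≤ frobNorm (eL L) ^ 2 * (‖ξ‖ ^ 2) ^ 2 := by
  rw [inner_eL, frobNorm_sq]
  refine (frob_sq_le _ _).trans (le_of_eq ?_)
  congr 1
  simp only [frob]
  rw [EuclideanSpace.norm_sq_eq, sq, Finset.sum_mul_sum]
  refine sum_congr rfl fun i _ => sum_congr rfl fun j _ => ?_
  simp only [norm_eq_abs, sq_abs]; ring

/-- skew linear maps have zero symmetrized part -/
lemma eL_skew (A : Euc N →L[ℝ] Euc N) (hA : ∀ x, ⟪A x, x⟫ = 0) : eL A = 0 := by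
  have h : ∀ x y, ⟪A x, y⟫ + ⟪A y, x⟫ = 0 := by
    intro x y
    have := hA (x + y)
    rw [map_add, inner_add_left, inner_add_right, inner_add_right, hA, hA] at this
    linarith
  ext i j
  have := h (ev j) (ev i)
  rw [real_inner_comm, inner_ev, real_inner_comm, inner_ev] at this
  rw [eL_apply, this]; simp

/-- energy density -/
def dens (u : Euc N → Euc N) (x : Euc N) : ℝ≥0∞ := ofReal (frobNorm (eSym u x) ^ 2)

lemma measurable_fderiv_coord (u : Euc N → Euc N) (ξ : Euc N) (i : Fin N) :
    Measurable fun x => fderiv ℝ u x ξ i := by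
  have h := measurable_fderiv_apply_const ℝ u ξ
  have h2 : Continuous fun z : Euc N => z i := by fun_prop
  exact h2.measurable.comp h

lemma measurable_eSym_coord (u : Euc N → Euc N) (i j : Fin N) :
    Measurable fun x => eSym u x i j := by
  have : (fun x => eSym u x i j) = fun x =>
      (1/2 : ℝ) * (fderiv ℝ u x (ev j) i + fderiv ℝ u x (ev i) j) := by
    ext x; rw [eSym_eq, eL_apply]
  rw [this]
  exact ((measurable_fderiv_coord u _ i).add (measurable_fderiv_coord u _ j)).const_mul _

lemma measurable_dens (u : Euc N → Euc N) : Measurable (dens u) := by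
  apply Measurable.ennreal_ofReal
  simp only [frobNorm_sq, frob]
  refine measurable_sum _ fun i _ => measurable_sum _ fun j _ => ?_
  exact (measurable_eSym_coord u i j).mul (measurable_eSym_coord u i j)

lemma measurable_gradm_sq (u : Euc N → Euc N) : Measurable fun x => frobNorm (gradm u x) ^ 2 := by
  simp only [frobNorm_sq, frob]
  refine measurable_sum _ fun i _ => measurable_sum _ fun j _ => ?_
  exact (measurable_fderiv_coord u _ i).mul (measurable_fderiv_coord u _ i)

/-! ### Segments hitting a set -/

lemma outer_le_Hm (hN : 2 ≤ N) (μ : OuterMeasure (Euc N)) (C : ℝ) (hC : 0 < C)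
    (h : ∀ (S : Set (Euc N)) (z : Euc N) (δ : ℝ), 0 < δ → δ ≤ 1 → S ⊆ closedBall z δ →
      μ S ≤ ofReal (C * δ ^ (N - 1))) (S : Set (Euc N)) :
    μ S ≤ ofReal C * Hm N S := by
  have hN1 : ((N : ℝ) - 1) = ((N - 1 : ℕ) : ℝ) := by
    rw [Nat.cast_sub (by omega)]; simp
  have hC0 : ofReal C ≠ 0 := by simpa using hC
  have key : μ ≤ OuterMeasure.mkMetric (ofReal C • fun r : ℝ≥0∞ => r ^ ((N : ℝ) - 1)) := by
    refine OuterMeasure.le_mkMetric _ μ 1 one_pos fun S hS => ?_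
    have hfin : ediam S ≠ ⊤ := ne_top_of_le_ne_top ENNReal.one_ne_top hS
    rcases S.eq_empty_or_nonempty with rfl | ⟨z, hz⟩
    · simp
    have hsub : ∀ δ : ℝ, (ediam S).toReal ≤ δ → S ⊆ closedBall z δ := by
      intro δ hδ y hy
      have := edist_le_ediam_of_mem hy hz
      rw [mem_closedBall, dist_edist]
      exact (ENNReal.toReal_mono hfin this).trans hδ
    have h1 : (ediam S).toReal ≤ 1 := by
      have := ENNReal.toReal_mono ENNReal.one_ne_top hS
      simpa using this
    simp only [Pi.smul_apply, smul_eq_mul]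
    rcases (toReal_nonneg (a := ediam S)).eq_or_lt with h0 | h0
    · have : μ S ≤ 0 := by
        have lim : Tendsto (fun δ : ℝ => ofReal (C * δ ^ (N - 1))) (𝓝[>] 0) (𝓝 0) := by
          have : Tendsto (fun δ : ℝ => ofReal (C * δ ^ (N - 1))) (𝓝 0)
              (𝓝 (ofReal (C * 0 ^ (N - 1)))) := by
            apply ENNReal.tendsto_ofReal
            exact (Continuous.tendsto (by fun_prop) _)
          rw [zero_pow (by omega), mul_zero, ENNReal.ofReal_zero] at this
          exact this.mono_left nhdsWithin_le_nhds
        refine ge_of_tendsto lim ?_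
        filter_upwards [Ioc_mem_nhdsGT (zero_lt_one' ℝ)] with δ hδ
        exact h S z δ hδ.1 hδ.2 (hsub δ (by rw [← h0]; exact hδ.1.le))
      exact this.trans bot_le
    · refine (h S z _ h0 h1 (hsub _ le_rfl)).trans (le_of_eq ?_)
      rw [ofReal_mul hC.le, hN1, ENNReal.rpow_natCast, ofReal_pow h0.le,
        ofReal_toReal hfin]
  rw [OuterMeasure.mkMetric_smul _ ofReal_ne_top hC0] at key
  have := key S
  simpa [Hm, Measure.hausdorffMeasure, ← OuterMeasure.coe_mkMetric] using this

/-- pairs of points whose segment hits `K` -/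
def hitPairs (K : Set (Euc N)) : Set (Euc N × Euc N) :=
  {p | ∃ s ∈ Icc (0:ℝ) 1, p.1 + s • (p.2 - p.1) ∈ K}

lemma vol_closedBall (x : Euc N) {r : ℝ} (hr : 0 ≤ r) :
    volume (closedBall x r) = ofReal (r ^ N) * volume (ball (0 : Euc N) 1) := by
  rw [Measure.addHaar_closedBall _ _ hr]; simp

lemma vol_ball [NeZero N] (x : Euc N) {r : ℝ} (hr : 0 ≤ r) :
    volume (ball x r) = ofReal (r ^ N) * volume (ball (0 : Euc N) 1) := by
  have : Nontrivial (Euc N) := inferInstance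
  rw [Measure.addHaar_ball _ _ hr]; simp

lemma near_pairs_le (R : ℝ) (s : ℝ) (hs : s ∈ Icc (0:ℝ) 1) (z : Euc N) (ρ : ℝ) (hρ : 0 ≤ ρ) :
    (volume.prod volume) ({p : Euc N × Euc N | ‖p.1 + s • (p.2 - p.1) - z‖ ≤ ρ} ∩
      (ball 0 R ×ˢ ball 0 R)) ≤ volume (closedBall (0 : Euc N) (2 * ρ)) *
        volume (ball (0 : Euc N) R) := by
  have hm : MeasurableSet ({p : Euc N × Euc N | ‖p.1 + s • (p.2 - p.1) - z‖ ≤ ρ} ∩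
      (ball 0 R ×ˢ ball 0 R)) := by
    refine MeasurableSet.inter ?_ (measurableSet_ball.prod measurableSet_ball)
    exact (isClosed_le (by fun_prop) continuous_const).measurableSet
  have ball_eq : ∀ c : Euc N, volume (closedBall c (2 * ρ)) = volume (closedBall (0 : Euc N) (2 * ρ)) := by
    intro c; rw [vol_closedBall _ (by positivity), vol_closedBall _ (by positivity)]
  rcases le_total s (1/2) with h | h
  · rw [Measure.prod_apply_symm hm, ← setLIntegral_const, ← lintegral_indicator measurableSet_ball]
    refine lintegral_mono fun y => ?_
    by_cases hy : y ∈ ball (0 : Euc N) R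
    · rw [indicator_of_mem hy, ← ball_eq ((1 - s)⁻¹ • (z - s • y))]
      refine measure_mono fun x hx => ?_
      have hx1 : ‖x + s • (y - x) - z‖ ≤ ρ := hx.1
      have h1s : 0 < 1 - s := by linarith
      rw [mem_closedBall, dist_eq_norm]
      have : x - (1 - s)⁻¹ • (z - s • y) = (1 - s)⁻¹ • (x + s • (y - x) - z) := by
        have e : x = (1 - s)⁻¹ • ((1 - s) • x) := by rw [smul_smul, inv_mul_cancel₀ h1s.ne', one_smul]
        conv_lhs => rw [e, ← smul_sub]
        congr 1
        rw [sub_smul, smul_sub, one_smul]; abel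
      rw [this, norm_smul, norm_eq_abs, abs_of_pos (inv_pos.2 h1s)]
      have h2 : (1 - s)⁻¹ ≤ 2 := by
        rw [inv_le_comm₀ h1s (by norm_num)]; linarith
      exact mul_le_mul h2 hx1 (norm_nonneg _) (by norm_num)
    · have : (fun x => (x, y)) ⁻¹' ({p : Euc N × Euc N | ‖p.1 + s • (p.2 - p.1) - z‖ ≤ ρ} ∩
        (ball 0 R ×ˢ ball 0 R)) = ∅ := by
        ext x; simp only [mem_preimage, mem_inter_iff, mem_prod, mem_empty_iff_false, iff_false]
        exact fun hx => hy hx.2.2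
      rw [this]; simp
  · rw [Measure.prod_apply hm, ← setLIntegral_const, ← lintegral_indicator measurableSet_ball]
    refine lintegral_mono fun x => ?_
    by_cases hy : x ∈ ball (0 : Euc N) R
    · rw [indicator_of_mem hy, ← ball_eq (s⁻¹ • (z - (1 - s) • x))]
      refine measure_mono fun y hx => ?_
      have hx1 : ‖x + s • (y - x) - z‖ ≤ ρ := hx.1
      have h1s : 0 < s := by linarith
      rw [mem_closedBall, dist_eq_norm]
      have : y - s⁻¹ • (z - (1 - s) • x) = s⁻¹ • (x + s • (y - x) - z) := by
        have e : y = s⁻¹ • (s • y) := by rw [smul_smul, inv_mul_cancel₀ h1s.ne', one_smul]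
        conv_lhs => rw [e, ← smul_sub]
        congr 1
        rw [sub_smul, smul_sub, one_smul]; abel
      rw [this, norm_smul, norm_eq_abs, abs_of_pos (inv_pos.2 h1s)]
      have h2 : s⁻¹ ≤ 2 := by
        rw [inv_le_comm₀ h1s (by norm_num)]; linarith
      exact mul_le_mul h2 hx1 (norm_nonneg _) (by norm_num)
    · have : Prod.mk x ⁻¹' ({p : Euc N × Euc N | ‖p.1 + s • (p.2 - p.1) - z‖ ≤ ρ} ∩
        (ball 0 R ×ˢ ball 0 R)) = ∅ := by
        ext y; simp only [mem_preimage, mem_inter_iff, mem_prod, mem_empty_iff_false, iff_false]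
        exact fun hx => hy hx.2.1
      rw [this]; simp

lemma hit_small (hN : 2 ≤ N) (R : ℝ) (hR : 0 < R) (S : Set (Euc N)) (z : Euc N) (δ : ℝ) (hδ : 0 < δ)
    (hδ1 : δ ≤ 1) (hS : S ⊆ closedBall z δ) :
    (volume.prod volume) (hitPairs S ∩ (ball (0 : Euc N) R ×ˢ ball (0 : Euc N) R)) ≤
      ofReal ((2 * R + 2) * 4 ^ N * δ ^ (N - 1)) *
        (volume (ball (0 : Euc N) 1) * volume (ball (0 : Euc N) R)) := by
  obtain ⟨n, hn, hn2⟩ : ∃ n : ℕ, 2 * R / δ ≤ n ∧ (n : ℝ) ≤ 2 * R / δ + 1 :=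
    ⟨⌈2 * R / δ⌉₊, Nat.le_ceil _, (Nat.ceil_lt_add_one (by positivity)).le⟩
  have hn0 : (0:ℝ) < n := lt_of_lt_of_le (by positivity) hn
  have hsub : hitPairs S ∩ (ball (0 : Euc N) R ×ˢ ball (0 : Euc N) R) ⊆
      ⋃ k ∈ Finset.range (n + 1), ({p : Euc N × Euc N | ‖p.1 + ((k : ℝ) / n) • (p.2 - p.1) - z‖ ≤ 2 * δ} ∩
      (ball 0 R ×ˢ ball 0 R)) := by
    rintro p ⟨⟨s, hs, hp⟩, hpb⟩
    have hk := Nat.floor_le (mul_nonneg hs.1 hn0.le)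
    have hk2 := Nat.lt_floor_add_one (s * n)
    set k := ⌊s * n⌋₊
    simp only [mem_iUnion]
    refine ⟨k, ?_, ?_, hpb⟩
    · rw [Finset.mem_range]
      have : (k : ℝ) ≤ n := hk.trans (by nlinarith [hs.2])
      have : k ≤ n := by exact_mod_cast this
      omega
    · have hp2 := hS hp
      rw [mem_closedBall, dist_eq_norm] at hp2
      have hd : ‖p.2 - p.1‖ ≤ 2 * R := by
        have h1 := hpb.1; have h2 := hpb.2
        rw [mem_ball_zero_iff] at h1 h2
        have := norm_sub_le p.2 p.1
        linarith
      have e : p.1 + ((k : ℝ) / n) • (p.2 - p.1) - z =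
          (p.1 + s • (p.2 - p.1) - z) + ((k : ℝ) / n - s) • (p.2 - p.1) := by
        rw [sub_smul]; abel
      have h3 : |(k : ℝ) / n - s| ≤ 1 / n := by
        rw [abs_le]
        constructor
        · rw [neg_le_sub_iff_le_add, ← add_div, le_div_iff₀ hn0]; linarith
        · have : (k : ℝ) / n ≤ s := by rw [div_le_iff₀ hn0]; exact hk
          have : (0:ℝ) ≤ 1 / n := by positivity
          linarith
      simp only [mem_setOf_eq]
      rw [e]
      refine (norm_add_le _ _).trans ?_
      rw [norm_smul, norm_eq_abs]
      have h4 : |(k : ℝ) / n - s| * ‖p.2 - p.1‖ ≤ 1 / n * (2 * R) :=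
        mul_le_mul h3 hd (norm_nonneg _) (by positivity)
      have h5 : 1 / n * (2 * R) ≤ δ := by
        rw [div_mul_eq_mul_div, one_mul, div_le_iff₀ hn0]
        rw [div_le_iff₀ hδ] at hn; linarith
      linarith
  refine (measure_mono hsub).trans ((measure_biUnion_finset_le _ _).trans ?_)
  have hb : ∀ k ∈ Finset.range (n + 1), (volume.prod volume)
      ({p : Euc N × Euc N | ‖p.1 + ((k : ℝ) / n) • (p.2 - p.1) - z‖ ≤ 2 * δ} ∩
      (ball 0 R ×ˢ ball 0 R)) ≤ volume (closedBall (0 : Euc N) (2 * (2 * δ))) *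
        volume (ball (0 : Euc N) R) := by
    intro k hk
    refine near_pairs_le R _ ⟨by positivity, ?_⟩ z _ (by positivity)
    rw [div_le_one hn0]
    have : k ≤ n := by rw [Finset.mem_range] at hk; omega
    exact_mod_cast this
  refine (Finset.sum_le_card_nsmul _ _ _ hb).trans ?_
  rw [Finset.card_range, nsmul_eq_mul, vol_closedBall _ (by positivity)]
  have assoc4 : ∀ a b c d : ℝ≥0∞, a * (b * c * d) = (a * b) * (c * d) := by intros; ring
  rw [assoc4]
  refine mul_le_mul_left ?_ _
  rw [← ofReal_natCast, ← ofReal_mul (by positivity)]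
  apply ofReal_le_ofReal
  have hp : δ ^ N = δ * δ ^ (N - 1) := by
    rw [← pow_succ']; congr 1; omega
  have e4 : (2 * (2 * δ)) ^ N = 4 ^ N * (δ * δ ^ (N - 1)) := by
    rw [← hp, ← mul_pow]; ring_nf
  rw [e4]
  have h6 : ((n + 1 : ℕ) : ℝ) * δ ≤ 2 * R + 2 := by
    push_cast
    have : (n : ℝ) * δ ≤ 2 * R + δ := by
      calc (n : ℝ) * δ ≤ (2 * R / δ + 1) * δ := by gcongr
        _ = _ := by field_simp
    linarith
  calc ((n + 1 : ℕ) : ℝ) * (4 ^ N * (δ * δ ^ (N - 1)))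
      = (((n + 1 : ℕ) : ℝ) * δ) * (4 ^ N * δ ^ (N - 1)) := by ring
    _ ≤ (2 * R + 2) * (4 ^ N * δ ^ (N - 1)) := by gcongr
    _ = _ := by ring

lemma hit_le_Hm (hN : 2 ≤ N) (R : ℝ) (hR : 0 < R) : ∃ C : ℝ, 0 < C ∧ ∀ S : Set (Euc N),
    (volume.prod volume) (hitPairs S ∩ (ball (0 : Euc N) R ×ˢ ball (0 : Euc N) R)) ≤
      ofReal C * Hm N S := by
  set V : ℝ≥0∞ := volume (ball (0 : Euc N) 1) * volume (ball (0 : Euc N) R) with hV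
  have hVfin : V ≠ ⊤ := mul_ne_top measure_ball_lt_top.ne measure_ball_lt_top.ne
  have hVpos : V ≠ 0 := mul_ne_zero (measure_ball_pos _ _ one_pos).ne' (measure_ball_pos _ _ hR).ne'
  refine ⟨(2 * R + 2) * 4 ^ N * V.toReal, by have := toReal_pos hVpos hVfin; positivity, ?_⟩
  let μ : OuterMeasure (Euc N) :=
    { measureOf := fun S => (volume.prod volume) (hitPairs S ∩ (ball (0 : Euc N) R ×ˢ ball (0 : Euc N) R))
      empty := by simp [hitPairs]
      mono := by
        intro s t hst
        refine measure_mono (inter_subset_inter_left _ ?_)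
        rintro p ⟨r, hr, hp⟩
        exact ⟨r, hr, hst hp⟩
      iUnion_nat := by
        intro s _
        refine (measure_mono ?_).trans (measure_iUnion_le _)
        rintro p ⟨⟨r, hr, hp⟩, hb⟩
        obtain ⟨i, hi⟩ := mem_iUnion.1 hp
        exact mem_iUnion.2 ⟨i, ⟨r, hr, hi⟩, hb⟩ }
  intro S
  have := outer_le_Hm hN μ ((2 * R + 2) * 4 ^ N * V.toReal)
    (by have := toReal_pos hVpos hVfin; positivity) ?_ S
  · exact this
  · intro S z δ hδ hδ1 hS
    refine (hit_small hN R hR S z δ hδ hδ1 hS).trans (le_of_eq ?_)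
    rw [← hV]
    conv_lhs => rw [← ofReal_toReal hVfin, ← ofReal_mul (by positivity)]
    congr 1; ring

/-! ### Chebyshev, Jensen, FTC on segments -/

lemma cheb {α : Type*} [MeasurableSpace α] {μ : Measure α} {f : α → ℝ≥0∞} (hf : AEMeasurable f μ)
    {c t M : ℝ≥0∞} (h : ∫⁻ x, f x ∂μ ≤ c * t) (ht : t ≠ ⊤) (hM : M ≠ 0) (hM' : M ≠ ⊤) :
    μ {x | M * t < f x} ≤ c / M := by
  rcases eq_or_ne t 0 with rfl | ht0
  · have h0 : ∫⁻ x, f x ∂μ = 0 := by simpa using h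
    rw [lintegral_eq_zero_iff' hf] at h0
    have : μ {x | M * 0 < f x} = 0 := by
      have h1 : {x | M * 0 < f x} ⊆ {x | ¬ f x = (0 : α → ℝ≥0∞) x} := by
        intro x hx
        simp only [mul_zero, mem_setOf_eq] at hx
        simpa using hx.ne'
      exact measure_mono_null h1 (ae_iff.1 h0)
    rw [this]; exact bot_le
  · have h1 := meas_ge_le_lintegral_div hf (mul_ne_zero hM ht0) (mul_ne_top hM' ht)
    have h2 : μ {x | M * t < f x} ≤ μ {x | M * t ≤ f x} := measure_mono fun x hx => by
      simp only [mem_setOf_eq] at hx ⊢; exact hx.le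
    refine h2.trans (h1.trans ?_)
    rw [ENNReal.div_le_iff (mul_ne_zero hM ht0) (mul_ne_top hM' ht)]
    refine h.trans (le_of_eq ?_)
    rw [← mul_assoc, ENNReal.div_mul_cancel hM hM']

lemma lintegral_sq_le {α : Type*} [MeasurableSpace α] {μ : Measure α} {f : α → ℝ≥0∞}
    (hf : AEMeasurable f μ) : (∫⁻ x, f x ∂μ) ^ 2 ≤ μ univ * ∫⁻ x, f x ^ 2 ∂μ := by
  have h := ENNReal.lintegral_mul_le_Lp_mul_Lq μ Real.HolderConjugate.two_two hf
    (aemeasurable_const (b := (1 : ℝ≥0∞)))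
  simp only [Pi.mul_apply, mul_one, ENNReal.one_rpow, lintegral_const, one_mul] at h
  have h2 := pow_le_pow_left' h 2
  refine h2.trans (le_of_eq ?_)
  rw [mul_pow]
  have e : ∀ a : ℝ≥0∞, (a ^ (1 / 2 : ℝ)) ^ 2 = a := by
    intro a; rw [← ENNReal.rpow_natCast, ← ENNReal.rpow_mul]; simp
  rw [e, e, mul_comm]
  congr 2
  ext x; rw [← ENNReal.rpow_natCast]; simp

/-- the average of `g` over the segment `[x,y]` -/
def segAvg (g : Euc N → ℝ≥0∞) (p : Euc N × Euc N) : ℝ≥0∞ :=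
  ∫⁻ s in Icc (0:ℝ) 1, g (p.1 + s • (p.2 - p.1))

lemma measurable_segAvg {g : Euc N → ℝ≥0∞} (hg : Measurable g) : Measurable (segAvg g) := by
  unfold segAvg
  refine Measurable.lintegral_prod_right (f := fun (p : Euc N × Euc N) (s : ℝ) =>
    g (p.1 + s • (p.2 - p.1))) ?_
  exact hg.comp (by fun_prop)

lemma lintegral_comp_affine (g : Euc N → ℝ≥0∞) (hg : Measurable g) (r : ℝ) (hr : r ≠ 0) (c : Euc N) :
    ∫⁻ x, g (r • x + c) = ofReal |(r ^ N)⁻¹| * ∫⁻ x, g x := by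
  have h1 := Measure.map_addHaar_smul (volume : Measure (Euc N)) hr
  have h2 : ∫⁻ x, g (x + c) ∂(Measure.map (r • ·) (volume : Measure (Euc N))) =
      ∫⁻ x, g (r • x + c) := by
    rw [lintegral_map]
    · exact hg.comp (by fun_prop)
    · fun_prop
  rw [← h2, h1, lintegral_smul_measure, lintegral_add_right_eq_self]
  simp

lemma segAvg_le (R : ℝ) (g : Euc N → ℝ≥0∞) (hg : Measurable g) :
    ∫⁻ x in ball (0 : Euc N) R, ∫⁻ y in ball (0 : Euc N) R, segAvg g (x, y) ≤
      (2 ^ N * volume (ball (0 : Euc N) R)) * ∫⁻ x, g x := by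
  set B := ball (0 : Euc N) R
  have hmeas : Measurable fun q : (Euc N × Euc N) × ℝ => g (q.1.1 + q.2 • (q.1.2 - q.1.1)) :=
    hg.comp (by fun_prop)
  have e1 : ∫⁻ x in B, ∫⁻ y in B, segAvg g (x, y) =
      ∫⁻ p, segAvg g p ∂((volume.restrict B).prod (volume.restrict B)) := by
    rw [lintegral_prod _ (measurable_segAvg hg).aemeasurable]
  have e2 : ∫⁻ p, segAvg g p ∂((volume.restrict B).prod (volume.restrict B)) =
      ∫⁻ s in Icc (0:ℝ) 1, ∫⁻ p, g (p.1 + s • (p.2 - p.1))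
        ∂((volume.restrict B).prod (volume.restrict B)) := by
    unfold segAvg
    rw [lintegral_lintegral_swap]
    exact hmeas.aemeasurable
  have key : ∀ r : ℝ, 1 / 2 ≤ r → ∀ c : Euc N, ∫⁻ x in B, g (r • x + c) ≤ 2 ^ N * ∫⁻ x, g x := by
    intro r hr c
    refine (setLIntegral_le_lintegral _ _).trans ?_
    rw [lintegral_comp_affine g hg r (by linarith) c]
    gcongr
    have : |(r ^ N)⁻¹| ≤ 2 ^ N := by
      rw [abs_inv, abs_pow, abs_of_pos (by linarith), ← inv_pow]
      gcongr
      rw [inv_le_comm₀ (by linarith) (by norm_num)]; linarith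
    refine (ofReal_le_ofReal this).trans (le_of_eq ?_)
    rw [ofReal_pow (by norm_num)]; norm_num
  rw [e1, e2]
  have hs : ∀ s ∈ Icc (0:ℝ) 1, ∫⁻ p, g (p.1 + s • (p.2 - p.1))
        ∂((volume.restrict B).prod (volume.restrict B)) ≤ (2 ^ N * volume B) * ∫⁻ x, g x := by
    intro s hs
    have hm : Measurable fun p : Euc N × Euc N => g (p.1 + s • (p.2 - p.1)) :=
      hg.comp (by fun_prop)
    have const : ∫⁻ _ in B, 2 ^ N * ∫⁻ x, g x = (2 ^ N * volume B) * ∫⁻ x, g x := by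
      rw [setLIntegral_const]; ring
    rw [← const]
    rcases le_total s (1/2) with h | h
    · rw [lintegral_prod_symm _ hm.aemeasurable]
      refine lintegral_mono fun y => ?_
      refine le_trans (le_of_eq ?_) (key (1 - s) (by linarith) (s • y))
      refine lintegral_congr fun x => ?_
      congr 1
      simp only [smul_sub, sub_smul, one_smul]; abel
    · rw [lintegral_prod _ hm.aemeasurable]
      refine lintegral_mono fun x => ?_
      refine le_trans (le_of_eq ?_) (key s h ((1 - s) • x))
      refine lintegral_congr fun y => ?_
      congr 1
      simp only [smul_sub, sub_smul, one_smul]; abel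
  calc _ ≤ ∫⁻ s in Icc (0:ℝ) 1, (2 ^ N * volume B) * ∫⁻ x, g x :=
        setLIntegral_mono measurable_const hs
    _ = _ := by rw [setLIntegral_const]; simp

lemma seg_ftc {u : Euc N → Euc N} {x y : Euc N} {R : ℝ} (hR : ‖y - x‖ ≤ R)
    (hd : ∀ s ∈ Icc (0:ℝ) 1, DifferentiableAt ℝ u (x + s • (y - x))) :
    ofReal (⟪u y - u x, y - x⟫ ^ 2) ≤ ofReal (R ^ 4) *
      ∫⁻ s in Icc (0:ℝ) 1, dens u (x + s • (y - x)) := by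
  rcases eq_or_ne x y with rfl | hxy
  · simp
  have hR0 : 0 < R := lt_of_lt_of_le (norm_pos_iff.2 (sub_ne_zero.2 hxy.symm)) hR
  set ξ := y - x with hξ
  set I := ∫⁻ s in Icc (0:ℝ) 1, dens u (x + s • ξ) with hI
  by_cases hfin : I = ⊤
  · rw [hfin, ENNReal.mul_top]; · exact le_top
    simpa using by positivity
  let f' : ℝ → ℝ := fun s => ⟪fderiv ℝ u (x + s • ξ) ξ, ξ⟫
  have hf'm : Measurable f' := by
    have h1 : Measurable fun z => fderiv ℝ u z ξ := measurable_fderiv_apply_const ℝ u ξ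
    have h2 : Measurable fun s : ℝ => x + s • ξ := by fun_prop
    exact (h1.comp h2).inner measurable_const
  have hder : ∀ s ∈ Icc (0:ℝ) 1, HasDerivAt (fun s : ℝ => ⟪u (x + s • ξ), ξ⟫) (f' s) s := by
    intro s hs
    have h1 : HasDerivAt (fun s : ℝ => x + s • ξ) ξ s := by
      simpa using ((hasDerivAt_id s).smul_const ξ).const_add x
    have h2 := (hd s hs).hasFDerivAt.comp_hasDerivAt s h1
    have h3 := h2.inner ℝ (hasDerivAt_const s ξ)
    simpa [f', Function.comp_def] using h3
  have hsq : ∀ s, ofReal |f' s| ^ 2 ≤ ofReal (R ^ 4) * dens u (x + s • ξ) := by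
    intro s
    rw [← ofReal_pow (abs_nonneg _), sq_abs, dens, ← ofReal_mul (by positivity)]
    apply ofReal_le_ofReal
    rw [eSym_eq]
    refine (inner_eL_sq_le _ _).trans ?_
    rw [mul_comm]
    gcongr
    calc (‖ξ‖ ^ 2) ^ 2 = ‖ξ‖ ^ 4 := by ring
      _ ≤ R ^ 4 := by gcongr
  have hJ : (∫⁻ s in Icc (0:ℝ) 1, ofReal |f' s|) ^ 2 ≤ ofReal (R ^ 4) * I := by
    refine (lintegral_sq_le (by fun_prop)).trans ?_
    simp only [MeasurableSet.univ, Measure.restrict_apply, univ_inter, volume_Icc, sub_zero,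
      ofReal_one, one_mul]
    refine (lintegral_mono hsq).trans (le_of_eq ?_)
    rw [lintegral_const_mul']; exact ofReal_ne_top
  have hJfin : ∫⁻ s in Icc (0:ℝ) 1, ofReal |f' s| < ⊤ := by
    by_contra hc
    rw [not_lt, top_le_iff] at hc
    rw [hc] at hJ
    have : ofReal (R ^ 4) * I ≠ ⊤ := mul_ne_top ofReal_ne_top hfin
    simp at hJ
    exact this hJ
  have hInt : IntegrableOn f' (Icc 0 1) := by
    refine ⟨hf'm.aestronglyMeasurable, ?_⟩
    rw [hasFiniteIntegral_iff_norm]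
    exact hJfin
  have hftc : ∫ s in (0:ℝ)..1, f' s = ⟪u y - u x, ξ⟫ := by
    rw [intervalIntegral.integral_eq_sub_of_hasDerivAt (f := fun s : ℝ => ⟪u (x + s • ξ), ξ⟫)]
    · simp [hξ, inner_sub_left]
    · intro s hs; rw [uIcc_of_le zero_le_one] at hs; exact hder s hs
    · rw [intervalIntegrable_iff_integrableOn_Icc_of_le zero_le_one]; exact hInt
  rw [← hftc, ← sq_abs, ofReal_pow (abs_nonneg _)]
  refine le_trans (pow_le_pow_left' ?_ 2) hJ
  rw [intervalIntegral.integral_of_le zero_le_one, ← integral_Icc_eq_integral_Ioc]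
  have := enorm_integral_le_lintegral_enorm (μ := volume.restrict (Icc (0:ℝ) 1)) f'
  simpa [← ofReal_norm_eq_enorm] using this

/-! ### Selection of good simplices -/

/-- reference points `0, e_0/2, e_1/2, …` -/
def refPt (N : ℕ) (n : ℕ) : Euc N :=
  if h : n - 1 < N ∧ 1 ≤ n then (1 / 2 : ℝ) • ev ⟨n - 1, h.1⟩ else 0

/-- the radius used for perturbing the reference points -/
def rad (N : ℕ) : ℝ := 1 / (16 * (N + 1))

lemma rad_pos (N : ℕ) : 0 < rad N := by unfold rad; positivity

lemma rad_le (N : ℕ) : rad N ≤ 1 / 16 := by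
  unfold rad
  apply div_le_div_of_nonneg_left (by norm_num) (by norm_num)
  have : (0:ℝ) ≤ N := by positivity
  linarith

lemma norm_refPt (n : ℕ) : ‖refPt N n‖ ≤ 1 / 2 := by
  unfold refPt
  split_ifs
  · rw [norm_smul, norm_ev]; norm_num
  · simp

lemma ball_refPt (n : ℕ) : ball (refPt N n) (rad N) ⊆ ball 0 1 := by
  intro x hx
  rw [mem_ball, dist_eq_norm] at hx
  rw [mem_ball_zero_iff]
  have h1 := norm_refPt (N := N) n
  have h2 := rad_le N
  have : ‖x‖ ≤ ‖x - refPt N n‖ + ‖refPt N n‖ := by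
    simpa using norm_add_le (x - refPt N n) (refPt N n)
  linarith

/-- a simplex close to the reference simplex controls vectors -/
lemma simplex_coercive (x : ℕ → Euc N) (hx : ∀ i ≤ N, x i ∈ ball (refPt N i) (rad N)) (w : Euc N) :
    ‖w‖ ≤ 8 * ∑ i : Fin N, |⟪w, x (i + 1) - x 0⟫| := by
  have h0 : x 0 ∈ ball (0 : Euc N) (rad N) := by
    have := hx 0 (Nat.zero_le _); simpa [refPt] using this
  have hcoord : ∀ i : Fin N, |w i| ≤ 2 * |⟪w, x (i + 1) - x 0⟫| + 4 * rad N * ‖w‖ := by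
    intro i
    have h1 := hx (i + 1) (by omega)
    have hr : refPt N (i + 1) = (1 / 2 : ℝ) • ev i := by
      unfold refPt
      rw [dif_pos ⟨by simp, by omega⟩]; simp
    rw [hr, mem_ball, dist_eq_norm] at h1
    rw [mem_ball_zero_iff] at h0
    have e : w i = 2 * ⟪w, x (i + 1) - x 0⟫ - 2 * ⟪w, (x (i + 1) - (1 / 2 : ℝ) • ev i) - x 0⟫ := by
      have : ⟪w, ev i⟫ = w i := by rw [real_inner_comm, inner_ev]
      simp only [inner_sub_right, inner_smul_right, this]; ring
    have h3 : |⟪w, (x (i + 1) - (1 / 2 : ℝ) • ev i) - x 0⟫| ≤ ‖w‖ * (2 * rad N) := by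
      refine (abs_real_inner_le_norm _ _).trans ?_
      gcongr
      refine (norm_sub_le _ _).trans ?_
      linarith
    have h4 := abs_sub (2 * ⟪w, x (i + 1) - x 0⟫) (2 * ⟪w, (x (i + 1) - (1 / 2 : ℝ) • ev i) - x 0⟫)
    rw [← e, abs_mul, abs_mul, abs_two] at h4
    linarith
  have hn : ‖w‖ ≤ ∑ i, |w i| := by
    conv_lhs => rw [← sum_ev w]
    refine (norm_sum_le _ _).trans ?_
    gcongr with i _
    rw [norm_smul, norm_ev, mul_one, norm_eq_abs]
  have hs : ∑ i, |w i| ≤ 2 * ∑ i : Fin N, |⟪w, x (i + 1) - x 0⟫| + N * (4 * rad N * ‖w‖) := by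
    refine (sum_le_sum fun i _ => hcoord i).trans (le_of_eq ?_)
    rw [sum_add_distrib, ← mul_sum]; simp
  have hr : N * (4 * rad N * ‖w‖) ≤ 1 / 4 * ‖w‖ := by
    have : (N : ℝ) * (4 * rad N) ≤ 1 / 4 := by
      unfold rad
      rw [mul_one_div, mul_div, div_le_div_iff₀ (by positivity) (by norm_num)]
      nlinarith
    calc N * (4 * rad N * ‖w‖) = (N * (4 * rad N)) * ‖w‖ := by ring
      _ ≤ _ := by gcongr
  have hpos : 0 ≤ ∑ i : Fin N, |⟪w, x (i + 1) - x 0⟫| := sum_nonneg fun _ _ => abs_nonneg _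
  linarith

/-- Existence of a good point in a ball avoiding finitely many small bad sets -/
lemma exists_good {b : ℝ} (hb : 0 < b) (p : Euc N) (bad : Set (Euc N))
    (h : volume (bad ∩ ball p b) < volume (ball (0 : Euc N) b)) : ∃ x ∈ ball p b, x ∉ bad := by
  by_contra hc
  push Not at hc
  have : bad ∩ ball p b = ball p b := inter_eq_right.2 hc
  rw [this] at h
  have : volume (ball p b) = volume (ball (0 : Euc N) b) := by
    rw [Measure.addHaar_ball_center]
  exact (lt_irrefl _ (this ▸ h))

/-- The abstract selection lemma. -/
lemma select (c : ℝ≥0∞) (hc : c ≠ ⊤) (hc0 : c ≠ 0) (R : ℝ) (hR : 1 ≤ R) :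
    ∃ δ0 M : ℝ≥0∞, δ0 ≠ 0 ∧ M ≠ ⊤ ∧ ∀ (T : Set (Euc N × Euc N)) (q : Euc N × Euc N → ℝ≥0∞)
      (s κ : ℝ≥0∞), MeasurableSet T → Measurable q → κ ≠ ⊤ → s ≤ δ0 →
      (∫⁻ x in ball 0 R, volume ({y | (x, y) ∈ T} ∩ ball 0 R) ≤ c * s) →
      (∫⁻ x in ball 0 R, ∫⁻ y in ball 0 R, q (x, y) ≤ c * κ) →
      ∃ x : ℕ → Euc N, (∀ i ≤ N, x i ∈ ball (refPt N i) (rad N)) ∧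
        (∀ i ≤ N, volume ({y | (x i, y) ∈ T} ∩ ball 0 R) ≤ M * s) ∧
        (∀ i ≤ N, ∫⁻ y in ball 0 R, q (x i, y) ≤ M * κ) ∧
        (∀ j ≤ N, ∀ i < j, (x i, x j) ∉ T ∧ q (x i, x j) ≤ M * κ) := by
  set b := volume (ball (0 : Euc N) (rad N)) with hb
  have hb0 : b ≠ 0 := (measure_ball_pos _ _ (rad_pos N)).ne'
  have hbt : b ≠ ⊤ := measure_ball_lt_top.ne
  have hN1 : ((N : ℝ≥0∞) + 1) ≠ 0 := by simp
  have hN1t : ((N : ℝ≥0∞) + 1) ≠ ⊤ := by simp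
  set M := 8 * c / b with hM
  have hM0 : M ≠ 0 := by simp [hM, hc0, hbt]
  have hMt : M ≠ ⊤ := by
    rw [hM]; exact div_ne_top (mul_ne_top (by simp) hc) hb0
  set δ0 := b / (8 * (N + 1) * M) with hδ0
  set M3 := 8 * (N + 1) * M / b with hM3
  have hM30 : M3 ≠ 0 := by
    rw [hM3]
    exact (ENNReal.div_pos (mul_ne_zero (mul_ne_zero (by simp) hN1) hM0) hbt).ne'
  have hM3t : M3 ≠ ⊤ := div_ne_top
    (mul_ne_top (mul_ne_top (by simp) hN1t) hMt) hb0
  have hδne : δ0 ≠ 0 := (ENNReal.div_pos hb0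
    (mul_ne_top (mul_ne_top (by simp) hN1t) hMt)).ne'
  refine ⟨δ0, max M M3, hδne, by simp [hMt, hM3t], ?_⟩
  intro T q s κ hT hq hκ hs h1 h2
  have hδt : δ0 ≠ ⊤ := div_ne_top hbt (mul_ne_zero (mul_ne_zero (by simp) hN1) hM0)
  have hst : s ≠ ⊤ := ne_top_of_le_ne_top hδt hs
  set B := ball (0 : Euc N) R
  set F1 : Euc N → ℝ≥0∞ := fun x => volume ({y | (x, y) ∈ T} ∩ B) with hF1
  set F2 : Euc N → ℝ≥0∞ := fun x => ∫⁻ y in B, q (x, y) with hF2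
  have hF1m : Measurable F1 := by
    have := measurable_measure_prodMk_left (ν := (volume : Measure (Euc N)).restrict B) hT
    have e : F1 = fun x => ((volume : Measure (Euc N)).restrict B) (Prod.mk x ⁻¹' T) := by
      ext x; rw [Measure.restrict_apply (measurable_prodMk_left hT)]; rfl
    rw [e]; exact this
  have hF2m : Measurable F2 := Measurable.lintegral_prod_right (f := fun x y => q (x, y)) hq
  have bad1 := cheb hF1m.aemeasurable h1 hst hM0 hMt
  have bad2 := cheb hF2m.aemeasurable h2 hκ hM0 hMt
  have hcM : c / M = b / 8 := by
    rw [ENNReal.div_eq_div_iff (by simp) (by simp) hM0 hMt, hM]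
    rw [ENNReal.div_mul_cancel hb0 hbt]
  have hsub : ∀ n, ball (refPt N n) (rad N) ⊆ B := fun n =>
    (ball_refPt n).trans (ball_subset_ball hR)
  rw [hcM] at bad1 bad2
  suffices H : ∀ n : ℕ, ∃ x : ℕ → Euc N, (∀ i < n, i ≤ N → x i ∈ ball (refPt N i) (rad N)) ∧
        (∀ i < n, i ≤ N → F1 (x i) ≤ M * s) ∧
        (∀ i < n, i ≤ N → F2 (x i) ≤ M * κ) ∧
        (∀ j < n, j ≤ N → ∀ i < j, (x i, x j) ∉ T ∧ q (x i, x j) ≤ M3 * κ) by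
    obtain ⟨x, a1, a2, a3, a4⟩ := H (N + 1)
    refine ⟨x, fun i hi => a1 i (by omega) hi, fun i hi => (a2 i (by omega) hi).trans ?_,
      fun i hi => (a3 i (by omega) hi).trans ?_, fun j hj i hi => ⟨(a4 j (by omega) hj i hi).1,
      (a4 j (by omega) hj i hi).2.trans ?_⟩⟩
    · gcongr; exact le_max_left _ _
    · gcongr; exact le_max_left _ _
    · gcongr; exact le_max_right _ _
  intro n
  induction n with
  | zero => exact ⟨fun _ => 0, by simp, by simp, by simp, by simp⟩
  | succ n ih =>
    obtain ⟨x, a1, a2, a3, a4⟩ := ih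
    by_cases hn : n ≤ N
    swap
    · refine ⟨x, ?_, ?_, ?_, ?_⟩
      · intro i hi hiN; exact a1 i (by omega) hiN
      · intro i hi hiN; exact a2 i (by omega) hiN
      · intro i hi hiN; exact a3 i (by omega) hiN
      · intro i hi hiN; exact a4 i (by omega) hiN
    have bad3 : ∀ i ∈ Finset.range n, (volume.restrict B) {y | (x i, y) ∈ T} ≤ b / (8 * (N + 1)) := by
      intro i hi
      rw [Finset.mem_range] at hi
      rw [Measure.restrict_apply' measurableSet_ball]
      refine (a2 i hi (by omega)).trans ?_
      calc M * s ≤ M * δ0 := by gcongr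
        _ = b / (8 * (N + 1)) := by
          rw [hδ0, mul_comm, ENNReal.div_eq_inv_mul, ENNReal.mul_inv (Or.inr hMt) (Or.inr hM0)]
          rw [mul_assoc, mul_assoc, mul_comm b M, ← mul_assoc M⁻¹, ENNReal.inv_mul_cancel hM0 hMt,
            one_mul, ENNReal.div_eq_inv_mul]
    have bad4 : ∀ i ∈ Finset.range n, (volume.restrict B) {y | M3 * κ < q (x i, y)} ≤
        b / (8 * (N + 1)) := by
      intro i hi
      rw [Finset.mem_range] at hi
      have h3 := cheb (μ := volume.restrict B) (f := fun y => q (x i, y))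
        (hq.comp measurable_prodMk_left).aemeasurable (a3 i hi (by omega)) hκ hM30 hM3t
      refine h3.trans (le_of_eq ?_)
      rw [ENNReal.div_eq_div_iff (mul_ne_zero (by simp) hN1) (mul_ne_top (by simp) hN1t)
        hM30 hM3t, hM3]
      rw [ENNReal.div_mul_cancel hb0 hbt]
    set bad : Set (Euc N) := {y | M * s < F1 y} ∪ {y | M * κ < F2 y} ∪
      ((⋃ i ∈ Finset.range n, {y | (x i, y) ∈ T}) ∪ ⋃ i ∈ Finset.range n, {y | M3 * κ < q (x i, y)})
    have hbad : (volume.restrict B) bad ≤ b / 2 := by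
      have hcard : ∀ f : ℕ → Set (Euc N), (∀ i ∈ Finset.range n, (volume.restrict B) (f i) ≤
          b / (8 * (N + 1))) → (volume.restrict B) (⋃ i ∈ Finset.range n, f i) ≤ b / 8 := by
        intro f hf
        refine (measure_biUnion_finset_le _ _).trans ((Finset.sum_le_card_nsmul _ _ _ hf).trans ?_)
        rw [Finset.card_range, nsmul_eq_mul]
        calc (n : ℝ≥0∞) * (b / (8 * (N + 1))) ≤ (N + 1) * (b / (8 * (N + 1))) := by
              gcongr
              exact_mod_cast (by omega : n ≤ N + 1)
          _ = b / 8 := by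
              rw [← mul_div_assoc, mul_comm (8 : ℝ≥0∞), ENNReal.mul_div_mul_left _ _ hN1 hN1t]
      refine (measure_union_le _ _).trans ?_
      calc _ ≤ (b / 8 + b / 8) + (b / 8 + b / 8) := by
            gcongr
            · exact (measure_union_le _ _).trans (add_le_add bad1 bad2)
            · exact (measure_union_le _ _).trans (add_le_add (hcard _ bad3) (hcard _ bad4))
        _ = b / 2 := by
            rw [ENNReal.eq_div_iff (by simp) (by simp)]
            have h8 : 2 * (b / 8 + b / 8 + (b / 8 + b / 8)) = 8 * (b / 8) := by ring
            rw [h8, ENNReal.mul_div_cancel (by simp) (by simp)]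
    obtain ⟨y, hyb, hybad⟩ := exists_good (rad_pos N) (refPt N n) bad (by
      have h5 : volume (bad ∩ ball (refPt N n) (rad N)) ≤ (volume.restrict B) bad := by
        rw [Measure.restrict_apply' measurableSet_ball]
        exact measure_mono (inter_subset_inter_right _ (hsub n))
      refine lt_of_le_of_lt (h5.trans hbad) ?_
      exact ENNReal.half_lt_self hb0 hbt)
    simp only [bad, mem_union, mem_setOf_eq, mem_iUnion, not_or, not_exists, not_lt] at hybad
    obtain ⟨⟨g1, g2⟩, g3, g4⟩ := hybad
    refine ⟨Function.update x n y, ?_, ?_, ?_, ?_⟩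
    · intro i hi hiN
      rcases eq_or_ne i n with rfl | hin
      · simpa using hyb
      · rw [Function.update_of_ne hin]; exact a1 i (by omega) hiN
    · intro i hi hiN
      rcases eq_or_ne i n with rfl | hin
      · simpa using g1
      · rw [Function.update_of_ne hin]; exact a2 i (by omega) hiN
    · intro i hi hiN
      rcases eq_or_ne i n with rfl | hin
      · simpa using g2
      · rw [Function.update_of_ne hin]; exact a3 i (by omega) hiN
    · intro j hj hjN i hi
      have hin : i ≠ n := by omega
      rw [Function.update_of_ne hin]
      rcases eq_or_ne j n with rfl | hjn
      · rw [Function.update_self]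
        exact ⟨g3 i (Finset.mem_range.2 hi), g4 i (Finset.mem_range.2 hi)⟩
      · rw [Function.update_of_ne hjn]; exact a4 j (by omega) hjN i hi

/-! ### Korn–Poincaré inequality with a small exceptional set -/

lemma exists_dual (v : Fin N → Euc N) (hv : ∀ w : Euc N, (∀ i, ⟪w, v i⟫ = 0) → w = 0) :
    ∃ d : Fin N → Euc N, ∀ i j, ⟪d i, v j⟫ = if i = j then 1 else 0 := by
  let Φ : Euc N →ₗ[ℝ] (Fin N → ℝ) := LinearMap.pi fun j => (innerₛₗ ℝ).flip (v j)
  have hΦ : ∀ w j, Φ w j = ⟪w, v j⟫ := fun w j => rfl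
  have hinj : Function.Injective Φ := by
    rw [← LinearMap.ker_eq_bot, LinearMap.ker_eq_bot']
    intro w hw
    apply hv
    intro i
    rw [← hΦ, hw]; rfl
  have hsurj : Function.Surjective Φ :=
    (LinearMap.injective_iff_surjective_of_finrank_eq_finrank (by simp)).1 hinj
  choose d hd using fun i : Fin N => hsurj (Pi.single i 1)
  refine ⟨d, fun i j => ?_⟩
  rw [← hΦ, hd]
  simp [Pi.single_apply, eq_comm]

lemma skew_fit (v U : Fin N → Euc N) (hv : ∀ w : Euc N, (∀ i, ⟪w, v i⟫ = 0) → w = 0) :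
    ∃ A : Euc N →L[ℝ] Euc N, (∀ x, ⟪A x, x⟫ = 0) ∧
      ∀ i j, ⟪U i - A (v i), v j⟫ = (⟪U i, v j⟫ + ⟪U j, v i⟫) / 2 := by
  obtain ⟨d, hd⟩ := exists_dual v hv
  set S : Fin N → Fin N → ℝ := fun i j => (⟪U i, v j⟫ - ⟪U j, v i⟫) / 2 with hS
  let A : Euc N →L[ℝ] Euc N := ∑ k, ∑ j, S k j • (innerSL ℝ (d k)).smulRight (d j)
  have hA : ∀ z, A z = ∑ k, ∑ j, S k j • (⟪d k, z⟫ • d j) := by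
    intro z; simp [A, ContinuousLinearMap.sum_apply]
  refine ⟨A, ?_, ?_⟩
  · intro x
    rw [hA]
    simp only [sum_inner, inner_smul_left, RCLike.conj_to_real]
    have : ∑ k, ∑ j, S k j * (⟪d k, x⟫ * ⟪d j, x⟫) = - ∑ k, ∑ j, S k j * (⟪d k, x⟫ * ⟪d j, x⟫) := by
      conv_lhs => rw [Finset.sum_comm]
      rw [← Finset.sum_neg_distrib]
      refine sum_congr rfl fun k _ => ?_
      rw [← Finset.sum_neg_distrib]
      refine sum_congr rfl fun j _ => ?_
      simp only [hS]; ring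
    linarith
  · intro i j
    have : ⟪A (v i), v j⟫ = S i j := by
      rw [hA]
      simp only [sum_inner, inner_smul_left, RCLike.conj_to_real, hd]
      simp [Finset.sum_ite_eq, mul_ite]
    rw [inner_sub_left, this, hS]; ring

lemma sq_sum_le {n : ℕ} (f : Fin n → ℝ) : (∑ i, f i) ^ 2 ≤ n * ∑ i, f i ^ 2 := by
  have := sq_sum_le_card_mul_sum_sq (s := Finset.univ) (f := f)
  simpa using this

/-- pointwise consequence of the simplex construction -/
lemma kp_alg (R m : ℝ) (hR : 1 ≤ R) (hm : 0 ≤ m) (u : Euc N → Euc N) (x : ℕ → Euc N)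
    (hx : ∀ i ≤ N, x i ∈ ball (refPt N i) (rad N))
    (hP : ∀ j ≤ N, ∀ i < j, |⟪u (x j) - u (x i), x j - x i⟫| ≤ m) :
    ∃ (b : Euc N) (A : Euc N →L[ℝ] Euc N), (∀ x, ⟪A x, x⟫ = 0) ∧
      ∀ y ∈ ball (0 : Euc N) R, ‖u y - (b + A y)‖ ^ 2 ≤
        192 * N * (N + 1) * (∑ i ∈ Finset.range (N + 1), ⟪u y - u (x i), y - x i⟫ ^ 2 +
          (24 * N * R * m) ^ 2) := by
  set v : Fin N → Euc N := fun i => x (i + 1) - x 0 with hv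
  set U : Fin N → Euc N := fun i => u (x (i + 1)) - u (x 0) with hU
  have hco : ∀ w : Euc N, ‖w‖ ≤ 8 * ∑ i : Fin N, |⟪w, v i⟫| := fun w => simplex_coercive x hx w
  obtain ⟨A, hA, hAU⟩ := skew_fit v U (by
    intro w hw
    have := hco w
    simp only [hw, abs_zero, Finset.sum_const_zero, mul_zero] at this
    exact norm_le_zero_iff.1 this)
  refine ⟨u (x 0) - A (x 0), A, hA, ?_⟩
  set w : Euc N → Euc N := fun y => u y - (u (x 0) - A (x 0) + A y) with hw
  have hw0 : w (x 0) = 0 := by simp [hw]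
  have hwi : ∀ i : Fin N, w (x (i + 1)) = U i - A (v i) := by
    intro i; simp only [hw, hU, hv, map_sub]; abel
  have hPw : ∀ y z, ⟪w y - w z, y - z⟫ = ⟪u y - u z, y - z⟫ := by
    intro y z
    have : w y - w z = u y - u z - A (y - z) := by simp only [hw, map_sub]; abel
    rw [this, inner_sub_left, hA]; ring
  have hwv : ∀ i j : Fin N, |⟪w (x (i + 1)), v j⟫| ≤ 3 / 2 * m := by
    intro i j
    rw [hwi, hAU]
    have p0 : ∀ k : Fin N, |⟪U k, v k⟫| ≤ m := fun k => hP (k + 1) (by omega) 0 (by omega)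
    have pij : ∀ i j : Fin N, |⟪U i - U j, v i - v j⟫| ≤ m := by
      intro i j
      have e1 : U i - U j = u (x (i + 1)) - u (x (j + 1)) := by simp [hU]
      have e2 : v i - v j = x (i + 1) - x (j + 1) := by simp [hv]
      rw [e1, e2]
      rcases lt_trichotomy (i : ℕ) (j : ℕ) with h | h | h
      · have := hP (j + 1) (by omega) (i + 1) (by omega)
        rwa [← neg_sub, inner_neg_left, ← neg_sub (x (j + 1)), inner_neg_right, neg_neg]
      · rw [h]; simpa using hm
      · exact hP (i + 1) (by omega) (j + 1) (by omega)
    have h1 := abs_le.1 (p0 i); have h2 := abs_le.1 (p0 j); have h3 := abs_le.1 (pij i j)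
    simp only [inner_sub_left, inner_sub_right] at h3
    rw [abs_le]; constructor <;> linarith
  have hwn : ∀ i : Fin N, ‖w (x (i + 1))‖ ≤ 12 * N * m := by
    intro i
    refine (hco _).trans ?_
    have : ∑ j : Fin N, |⟪w (x (i + 1)), v j⟫| ≤ ∑ j : Fin N, 3 / 2 * m :=
      sum_le_sum fun j _ => hwv i j
    simp only [sum_const, Finset.card_univ, Fintype.card_fin, nsmul_eq_mul] at this
    linarith
  intro y hy
  rw [mem_ball_zero_iff] at hy
  set P : ℕ → ℝ := fun i => ⟪u y - u (x i), y - x i⟫ with hPdef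
  change ‖w y‖ ^ 2 ≤ _
  have hterm : ∀ i : Fin N, |⟪w y, v i⟫| ≤ |P 0| + |P (i + 1)| + 24 * N * R * m := by
    intro i
    have e1 : ⟪w y, v i⟫ = P 0 - P (i + 1) - ⟪w (x (i + 1)), y - x (i + 1)⟫ := by
      have a1 := hPw y (x 0)
      have a2 := hPw y (x (i + 1))
      rw [hw0, sub_zero] at a1
      rw [inner_sub_left] at a2
      have : v i = (y - x 0) - (y - x (i + 1)) := by simp [hv]
      rw [this, inner_sub_right, a1]
      simp only [hPdef]; linarith
    have hxn : ‖x (i + 1)‖ < 1 := by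
      have := ball_refPt _ (hx (i + 1) (by omega)); rwa [mem_ball_zero_iff] at this
    have e2 : |⟪w (x (i + 1)), y - x (i + 1)⟫| ≤ (12 * N * m) * (2 * R) := by
      refine (abs_real_inner_le_norm _ _).trans ?_
      have h1 : ‖y - x (i + 1)‖ ≤ 2 * R := (norm_sub_le _ _).trans (by linarith)
      exact mul_le_mul (hwn i) h1 (norm_nonneg _) (by positivity)
    rw [e1]
    refine (abs_sub _ _).trans ?_
    have := abs_sub (P 0) (P (i + 1))
    linarith
  have h1 : ‖w y‖ ^ 2 ≤ 64 * (N * ∑ i : Fin N, |⟪w y, v i⟫| ^ 2) := by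
    calc ‖w y‖ ^ 2 ≤ (8 * ∑ i : Fin N, |⟪w y, v i⟫|) ^ 2 := by gcongr; exact hco _
      _ = 64 * (∑ i : Fin N, |⟪w y, v i⟫|) ^ 2 := by ring
      _ ≤ _ := by gcongr; exact sq_sum_le _
  have h2 : ∀ i : Fin N, |⟪w y, v i⟫| ^ 2 ≤ 3 * (∑ i ∈ Finset.range (N + 1), P i ^ 2 +
      (24 * N * R * m) ^ 2) := by
    intro i
    have hh : P 0 ^ 2 + P (i + 1) ^ 2 ≤ ∑ i ∈ Finset.range (N + 1), P i ^ 2 := by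
      have : ∑ j ∈ ({0, (i : ℕ) + 1} : Finset ℕ), P j ^ 2 ≤ ∑ i ∈ Finset.range (N + 1), P i ^ 2 := by
        apply Finset.sum_le_sum_of_subset_of_nonneg
        · intro j hj
          simp only [Finset.mem_insert, Finset.mem_singleton] at hj
          rw [Finset.mem_range]; omega
        · intros; positivity
      rwa [Finset.sum_pair (by omega)] at this
    have hk : |⟪w y, v i⟫| ^ 2 ≤ (|P 0| + |P (i + 1)| + 24 * N * R * m) ^ 2 := by
      gcongr; exact hterm i
    have : (|P 0| + |P (i + 1)| + 24 * N * R * m) ^ 2 ≤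
        3 * (|P 0| ^ 2 + |P (i + 1)| ^ 2 + (24 * N * R * m) ^ 2) := by
      nlinarith [sq_nonneg (|P 0| - |P (i + 1)|), sq_nonneg (|P 0| - 24 * N * R * m),
        sq_nonneg (|P (i + 1)| - 24 * N * R * m)]
    rw [sq_abs (P 0), sq_abs (P (i + 1))] at this
    linarith
  have h3 : ∑ i : Fin N, |⟪w y, v i⟫| ^ 2 ≤ N * (3 * (∑ i ∈ Finset.range (N + 1), P i ^ 2 +
      (24 * N * R * m) ^ 2)) := by
    refine (sum_le_sum fun i _ => h2 i).trans (le_of_eq ?_)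
    simp
  have hpos : 0 ≤ ∑ i ∈ Finset.range (N + 1), P i ^ 2 + (24 * N * R * m) ^ 2 :=
    add_nonneg (sum_nonneg fun _ _ => sq_nonneg _) (sq_nonneg _)
  calc ‖w y‖ ^ 2 ≤ 64 * (N * (N * (3 * (∑ i ∈ Finset.range (N + 1), P i ^ 2 +
      (24 * N * R * m) ^ 2)))) := h1.trans (by gcongr)
    _ = 192 * N * N * (∑ i ∈ Finset.range (N + 1), P i ^ 2 + (24 * N * R * m) ^ 2) := by ring
    _ ≤ _ := by gcongr; linarith

lemma isOpen_diff_of_relclosed {D K : Set (Euc N)} (hD : IsOpen D) (hK : closure K ∩ D ⊆ K) :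
    IsOpen (D \ K) := by
  have : D \ K = D \ closure K := by
    ext x
    constructor
    · rintro ⟨h1, h2⟩; exact ⟨h1, fun h => h2 (hK ⟨h, h1⟩)⟩
    · rintro ⟨h1, h2⟩; exact ⟨h1, fun h => h2 (subset_closure h)⟩
  rw [this]
  exact hD.sdiff isClosed_closure

/-- Korn–Poincaré at unit scale -/
lemma kp_unit (hN : 2 ≤ N) (R : ℝ) (hR : 1 ≤ R) : ∃ δ0 > (0:ℝ), ∃ C > (0:ℝ),
    ∀ (D K : Set (Euc N)) (u : Euc N → Euc N), Convex ℝ D → IsOpen D → ball 0 1 ⊆ D → D ⊆ ball 0 R →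
      closure K ∩ D ⊆ K → (∀ x ∈ D \ K, DifferentiableAt ℝ u x) →
      (∫⁻ x in D \ K, dens u x) ≠ ⊤ → Hm N (K ∩ D) ≤ ofReal δ0 →
      ∃ (b : Euc N) (A : Euc N →L[ℝ] Euc N), (∀ x, ⟪A x, x⟫ = 0) ∧ ∃ G ⊆ D, MeasurableSet G ∧
        volume (D \ G) ≤ ofReal C * Hm N (K ∩ D) ∧
        ∫⁻ x in G, ofReal (‖u x - (b + A x)‖ ^ 2) ≤
          ofReal C * ∫⁻ x in D \ K, dens u x ∧
        (K ∩ D = ∅ → G = D) ∧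
        ∃ x1 ∈ D, ∀ x ∈ G, ∀ s ∈ Icc (0:ℝ) 1, x1 + s • (x - x1) ∈ D \ K := by
  obtain ⟨C1, hC1, hit⟩ := hit_le_Hm hN R (by linarith)
  set B := ball (0 : Euc N) R with hB
  set L4 : ℝ≥0∞ := ofReal ((2 * R) ^ 4) with hL4
  set C2 : ℝ≥0∞ := L4 * (2 ^ N * volume B) with hC2
  have hC2t : C2 ≠ ⊤ := mul_ne_top ofReal_ne_top
    (mul_ne_top (by simp) measure_ball_lt_top.ne)
  set c : ℝ≥0∞ := ofReal C1 + C2 with hcdef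
  have hct : c ≠ ⊤ := add_ne_top.2 ⟨ofReal_ne_top, hC2t⟩
  have hc0 : c ≠ 0 := by
    rw [hcdef]; intro h
    rw [add_eq_zero] at h
    exact (ofReal_pos.2 hC1).ne' h.1
  obtain ⟨δ0, M, hδ0, hMt, hsel⟩ := select (N := N) c hct hc0 R hR
  set δ : ℝ := (min δ0 1).toReal with hδ
  have hmin_t : min δ0 1 ≠ ⊤ := by simp
  have hδpos : 0 < δ := toReal_pos (by simp [hδ0]) hmin_t
  set Mr : ℝ := M.toReal with hMr
  set k : ℝ := 192 * N * (N + 1) with hk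
  have hk0 : 0 ≤ k := by positivity
  set C3 : ℝ := k * ((N + 1) * Mr + (24 * N * R) ^ 2 * Mr * (volume B).toReal) with hC3
  have hMr0 : 0 ≤ Mr := toReal_nonneg
  have hC30 : 0 ≤ C3 := by positivity
  refine ⟨δ, hδpos, (N + 1) * Mr + C3 + 1, by positivity, ?_⟩
  intro D K u hconv hDo hBD hDB hK hu hκ hH
  set κ := ∫⁻ x in D \ K, dens u x with hκdef
  set s := Hm N (K ∩ D) with hs
  have hsδ : s ≤ δ0 := by
    refine hH.trans ?_
    rw [hδ, ofReal_toReal hmin_t]; exact min_le_left _ _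
  have hDKo : IsOpen (D \ K) := isOpen_diff_of_relclosed hDo hK
  set g : Euc N → ℝ≥0∞ := (D \ K).indicator (dens u) with hg
  have hgm : Measurable g := (measurable_dens u).indicator hDKo.measurableSet
  have hgint : ∫⁻ x, g x = κ := lintegral_indicator hDKo.measurableSet _
  classical
  set T0 := hitPairs (K ∩ D) ∩ (B ×ˢ B) with hT0
  set T : Set (Euc N × Euc N) := if K ∩ D = ∅ then ∅ else toMeasurable (volume.prod volume) T0 with hT
  have hTm : MeasurableSet T := by
    rw [hT]; split_ifs; exact MeasurableSet.empty; exact measurableSet_toMeasurable _ _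
  have hT0T : T0 ⊆ T := by
    rw [hT]; split_ifs with h
    · rintro p ⟨⟨t, _, ht⟩, _⟩; rw [h] at ht; exact ht.elim
    · exact subset_toMeasurable _ _
  have hTv : (volume.prod volume) T ≤ ofReal C1 * s := by
    rw [hT]; split_ifs with h
    · simp
    · rw [measure_toMeasurable]; exact hit _
  set q : Euc N × Euc N → ℝ≥0∞ := fun p => L4 * segAvg g p with hq
  have hqm : Measurable q := (measurable_segAvg hgm).const_mul _
  have hseg : ∀ x ∈ D, ∀ y ∈ D, (x, y) ∉ T → ∀ t ∈ Icc (0:ℝ) 1, x + t • (y - x) ∈ D \ K := by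
    intro x hx y hy hxy t ht
    have h1 : x + t • (y - x) ∈ D := hconv.add_smul_sub_mem hx hy ht
    refine ⟨h1, fun h2 => hxy (hT0T ⟨⟨t, ht, h2, h1⟩, hDB hx, hDB hy⟩)⟩
  have hPq : ∀ x ∈ D, ∀ y ∈ D, (x, y) ∉ T →
      ofReal (⟪u y - u x, y - x⟫ ^ 2) ≤ q (x, y) := by
    intro x hx y hy hxy
    have hn : ‖y - x‖ ≤ 2 * R := by
      have h1 := hDB hx; have h2 := hDB hy
      rw [hB, mem_ball_zero_iff] at h1 h2
      exact (norm_sub_le _ _).trans (by linarith)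
    refine (seg_ftc hn fun t ht => hu _ (hseg x hx y hy hxy t ht)).trans (le_of_eq ?_)
    simp only [hq, segAvg, hL4]
    congr 1
    refine setLIntegral_congr_fun measurableSet_Icc fun t ht => ?_
    simp only [hg]
    rw [indicator_of_mem (hseg x hx y hy hxy t ht)]
  obtain ⟨x, hx, hx1, hx2, hx3⟩ := hsel T q s κ hTm hqm hκ hsδ (by
    have e : ∫⁻ x in B, volume ({y | (x, y) ∈ T} ∩ B) =
        ((volume.restrict B).prod (volume.restrict B)) T := by
      rw [Measure.prod_apply hTm]
      refine lintegral_congr fun x => ?_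
      rw [Measure.restrict_apply' measurableSet_ball]; rfl
    rw [e, Measure.prod_restrict]
    refine (Measure.restrict_apply_le _ _).trans (hTv.trans ?_)
    gcongr; exact le_self_add) (by
    have e : ∫⁻ x in B, ∫⁻ y in B, q (x, y) = L4 * ∫⁻ x in B, ∫⁻ y in B, segAvg g (x, y) := by
      rw [← lintegral_const_mul']
      · refine lintegral_congr fun x => ?_
        rw [← lintegral_const_mul' _ _ ofReal_ne_top]
      · exact ofReal_ne_top
    rw [e]
    calc L4 * ∫⁻ x in B, ∫⁻ y in B, segAvg g (x, y) ≤ L4 * (2 ^ N * volume B * ∫⁻ x, g x) := by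
          gcongr; exact segAvg_le R g hgm
      _ = C2 * κ := by rw [hgint, hC2]; ring
      _ ≤ c * κ := by gcongr; exact le_add_self)
  have hxD : ∀ i ≤ N, x i ∈ D := fun i hi => hBD (ball_refPt i (hx i hi))
  have hMκ : M * κ ≠ ⊤ := mul_ne_top hMt hκ
  set m := sqrt (M * κ).toReal with hm
  obtain ⟨b, A, hA, hbA⟩ := kp_alg R m hR (sqrt_nonneg _) u x hx (by
    intro j hj i hi
    obtain ⟨h1, h2⟩ := hx3 j hj i hi
    have h3 := (hPq (x i) (hxD i (by omega)) (x j) (hxD j hj) h1).trans h2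
    rw [ENNReal.ofReal_le_iff_le_toReal hMκ] at h3
    rw [hm]
    exact Real.abs_le_sqrt h3)
  set G : Set (Euc N) := D ∩ ⋂ i ∈ Finset.range (N + 1), {y | (x i, y) ∉ T} with hG
  have hGm : MeasurableSet G := by
    refine hDo.measurableSet.inter (Finset.measurableSet_biInter _ fun i _ => ?_)
    exact (measurable_prodMk_left hTm).compl
  have hGT : ∀ y ∈ G, ∀ i ≤ N, (x i, y) ∉ T := by
    rintro y ⟨_, hy⟩ i hi
    rw [mem_iInter₂] at hy
    exact hy i (Finset.mem_range.2 (by omega))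
  refine ⟨b, A, hA, G, inter_subset_left, hGm, ?_, ?_, ?_, x 0, hxD 0 (by omega), ?_⟩
  · have hsub : D \ G ⊆ ⋃ i ∈ Finset.range (N + 1), ({y | (x i, y) ∈ T} ∩ B) := by
      rintro y ⟨hy, hyG⟩
      by_contra hcon
      apply hyG
      refine ⟨hy, ?_⟩
      rw [mem_iInter₂]
      intro i hi hiT
      exact hcon (mem_iUnion₂.2 ⟨i, hi, hiT, hDB hy⟩)
    refine (measure_mono hsub).trans ((measure_biUnion_finset_le _ _).trans ?_)
    refine (Finset.sum_le_card_nsmul _ _ (M * s) fun i hi => hx1 i ?_).trans ?_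
    · rw [Finset.mem_range] at hi; omega
    rw [Finset.card_range, nsmul_eq_mul, ← mul_assoc]
    gcongr
    have : ((N + 1 : ℕ) : ℝ≥0∞) * M = ofReal ((N + 1) * Mr) := by
      rw [ofReal_mul (by positivity), hMr, ofReal_toReal hMt]
      congr 1
      rw [← Nat.cast_succ, ofReal_natCast]
    rw [this]
    exact ofReal_le_ofReal (by linarith)
  · have hpt : ∀ y ∈ G, ofReal (‖u y - (b + A y)‖ ^ 2) ≤ ofReal k *
        (∑ i ∈ Finset.range (N + 1), q (x i, y) + ofReal ((24 * N * R) ^ 2) * (M * κ)) := by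
      intro y hy
      refine (ofReal_le_ofReal (hbA y (hDB hy.1))).trans ?_
      rw [ofReal_mul hk0, ofReal_add (sum_nonneg fun _ _ => sq_nonneg _)
        (sq_nonneg _), ENNReal.ofReal_sum_of_nonneg (fun _ _ => sq_nonneg _)]
      gcongr with i hi
      · rw [Finset.mem_range] at hi
        exact hPq _ (hxD i (by omega)) _ hy.1 (hGT y hy i (by omega))
      · rw [mul_pow, ofReal_mul (sq_nonneg _), hm, sq_sqrt toReal_nonneg,
          ofReal_toReal hMκ]
    have hGB : G ⊆ B := inter_subset_left.trans hDB
    calc ∫⁻ x in G, ofReal (‖u x - (b + A x)‖ ^ 2)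
        ≤ ∫⁻ y in G, ofReal k * (∑ i ∈ Finset.range (N + 1), q (x i, y) +
            ofReal ((24 * N * R) ^ 2) * (M * κ)) := setLIntegral_mono' hGm hpt
      _ ≤ ∫⁻ y in B, ofReal k * (∑ i ∈ Finset.range (N + 1), q (x i, y) +
            ofReal ((24 * N * R) ^ 2) * (M * κ)) := lintegral_mono_set hGB
      _ = ofReal k * ((∑ i ∈ Finset.range (N + 1), ∫⁻ y in B, q (x i, y)) +
            ofReal ((24 * N * R) ^ 2) * (M * κ) * volume B) := by
          rw [lintegral_const_mul' _ _ ofReal_ne_top, lintegral_add_right _ measurable_const,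
            lintegral_finset_sum (Finset.range (N + 1)) (f := fun i y => q (x i, y))
              fun i _ => hqm.comp measurable_prodMk_left,
            setLIntegral_const]
      _ ≤ ofReal k * (((N + 1 : ℕ) : ℝ≥0∞) * (M * κ) +
            ofReal ((24 * N * R) ^ 2) * (M * κ) * volume B) := by
          gcongr
          refine (Finset.sum_le_card_nsmul _ _ (M * κ) fun i hi => hx2 i ?_).trans ?_
          · rw [Finset.mem_range] at hi; omega
          · rw [Finset.card_range, nsmul_eq_mul]
      _ = ofReal C3 * κ := by
          have hMe : M = ofReal Mr := (ofReal_toReal hMt).symm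
          have hBe : volume B = ofReal (volume B).toReal :=
            (ofReal_toReal measure_ball_lt_top.ne).symm
          have hNe : ((N + 1 : ℕ) : ℝ≥0∞) = ofReal (N + 1) := by
            rw [← Nat.cast_succ, ofReal_natCast]
          rw [hC3, ofReal_mul hk0, ofReal_add (by positivity) (by positivity),
            ofReal_mul (p := (N:ℝ) + 1) (by positivity),
            ofReal_mul (p := (24 * N * R) ^ 2 * Mr) (by positivity),
            ofReal_mul (p := (24 * N * R) ^ 2) (by positivity), ← hMe, ← hBe, ← hNe]
          ring
      _ ≤ _ := by gcongr; linarith [mul_nonneg (by positivity : (0:ℝ) ≤ N + 1) hMr0]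
  · intro h0
    have hTe : T = ∅ := by rw [hT, if_pos h0]
    rw [hG, hTe]; simp
  · intro y hy t ht
    exact hseg _ (hxD 0 (by omega)) y hy.1 (hGT y hy 0 (by omega)) t ht

/-! ### Scaling -/

/-- the homothety `y ↦ z + r y` -/
def hmt (z : Euc N) (r : ℝ) (y : Euc N) : Euc N := z + r • y

lemma hmt_inv (z : Euc N) {r : ℝ} (hr : 0 < r) (x : Euc N) : hmt z r (r⁻¹ • (x - z)) = x := by
  unfold hmt; rw [smul_smul, mul_inv_cancel₀ hr.ne', one_smul]; abel

lemma hmt_surj (z : Euc N) {r : ℝ} (hr : 0 < r) : Function.Surjective (hmt z r) :=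
  fun x => ⟨_, hmt_inv z hr x⟩

def hmtH (z : Euc N) {r : ℝ} (hr : 0 < r) : Euc N ≃ₜ Euc N :=
  (Homeomorph.smulOfNeZero r hr.ne').trans (Homeomorph.addLeft z)

lemma hmtH_coe (z : Euc N) {r : ℝ} (hr : 0 < r) : ⇑(hmtH z hr) = hmt z r := rfl

lemma continuous_hmt (z : Euc N) (r : ℝ) : Continuous (hmt z r) := by unfold hmt; fun_prop

lemma map_hmt (z : Euc N) {r : ℝ} (hr : 0 < r) :
    ofReal (r ^ N) • Measure.map (hmt z r) (volume : Measure (Euc N)) = volume := by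
  have h1 : Measure.map (hmt z r) (volume : Measure (Euc N)) =
      Measure.map (fun x => z + x) (Measure.map (r • ·) (volume : Measure (Euc N))) := by
    rw [Measure.map_map (by fun_prop) (by fun_prop)]; rfl
  rw [h1, Measure.map_addHaar_smul _ hr.ne', Measure.map_smul, map_add_left_eq_self, smul_smul,
    ← ofReal_mul (by positivity)]
  simp only [finrank_euclideanSpace, Fintype.card_fin]
  rw [abs_of_pos (by positivity), mul_inv_cancel₀ (by positivity)]
  simp

lemma lint_scale (z : Euc N) {r : ℝ} (hr : 0 < r) (S : Set (Euc N)) (hS : MeasurableSet S)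
    (g : Euc N → ℝ≥0∞) :
    ofReal (r ^ N) * ∫⁻ y in hmt z r ⁻¹' S, g (hmt z r y) = ∫⁻ x in S, g x := by
  conv_rhs => rw [← map_hmt z hr]
  have he : MeasurableEmbedding (hmt z r) := (hmtH z hr).measurableEmbedding
  rw [Measure.restrict_smul, lintegral_smul_measure, he.restrict_map, he.lintegral_map, smul_eq_mul]

lemma vol_scale (z : Euc N) {r : ℝ} (hr : 0 < r) (S : Set (Euc N)) (hS : MeasurableSet S) :
    ofReal (r ^ N) * volume (hmt z r ⁻¹' S) = volume S := by
  have := lint_scale z hr S hS 1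
  simpa using this

open scoped Pointwise in
lemma Hm_scale (hN : 2 ≤ N) (z : Euc N) {r : ℝ} (hr : 0 < r) (S : Set (Euc N)) :
    ofReal (r ^ (N - 1)) * Hm N (hmt z r ⁻¹' S) = Hm N S := by
  have hS : S = (IsometryEquiv.addLeft z) '' (r • (hmt z r ⁻¹' S)) := by
    conv_lhs => rw [← image_preimage_eq S (hmt_surj z hr)]
    rw [← image_smul, image_image]; rfl
  have hN0 : (0:ℝ) ≤ (N:ℝ) - 1 := by
    have : (2:ℝ) ≤ N := by exact_mod_cast hN
    linarith
  conv_rhs => rw [hS]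
  unfold Hm
  rw [(IsometryEquiv.addLeft z).isometry.hausdorffMeasure_image (Or.inl hN0),
    Measure.hausdorffMeasure_smul₀ hN0 hr.ne', ENNReal.smul_def, smul_eq_mul]
  congr 1
  have : (N:ℝ) - 1 = ((N - 1 : ℕ) : ℝ) := by rw [Nat.cast_sub (by omega)]; simp
  rw [this]
  rw [← ENNReal.ofReal_coe_nnreal]
  congr 1
  simp [abs_of_pos hr]

/-- rescaled displacement -/
def scl (c : ℝ) (z : Euc N) (r : ℝ) (u : Euc N → Euc N) (y : Euc N) : Euc N := c • u (hmt z r y)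

lemma hasFDerivAt_scl (c : ℝ) (z : Euc N) (r : ℝ) {u : Euc N → Euc N} {y : Euc N}
    (h : DifferentiableAt ℝ u (hmt z r y)) :
    HasFDerivAt (scl c z r u) ((c * r) • fderiv ℝ u (hmt z r y)) y := by
  have h1 : HasFDerivAt (hmt z r) (r • ContinuousLinearMap.id ℝ (Euc N)) y := by
    unfold hmt
    exact ((hasFDerivAt_id y).const_smul r).const_add z
  have h2 := (h.hasFDerivAt.comp y h1).const_smul c
  have e : (c * r) • fderiv ℝ u (hmt z r y) =
      c • (fderiv ℝ u (hmt z r y)).comp (r • ContinuousLinearMap.id ℝ (Euc N)) := by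
    ext x; simp [mul_assoc]
  rw [e]
  exact h2

lemma eSym_scl (c : ℝ) (z : Euc N) (r : ℝ) {u : Euc N → Euc N} {y : Euc N}
    (h : DifferentiableAt ℝ u (hmt z r y)) :
    eSym (scl c z r u) y = (c * r) • eSym u (hmt z r y) := by
  rw [eSym_eq, eSym_eq, (hasFDerivAt_scl c z r h).fderiv, map_smul]

lemma dens_scl (c : ℝ) (z : Euc N) (r : ℝ) {u : Euc N → Euc N} {y : Euc N}
    (h : DifferentiableAt ℝ u (hmt z r y)) :
    dens (scl c z r u) y = ofReal ((c * r) ^ 2) * dens u (hmt z r y) := by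
  unfold dens
  rw [eSym_scl c z r h, frobNorm_smul, mul_pow, sq_abs, ofReal_mul (sq_nonneg _)]

lemma hmt_preimage_ball (z : Euc N) {r : ℝ} (hr : 0 < r) (x : Euc N) (t : ℝ) :
    hmt z r ⁻¹' ball (hmt z r x) (r * t) = ball x t := by
  ext y
  simp only [mem_preimage, mem_ball, hmt, dist_add_left, dist_smul₀, norm_eq_abs, abs_of_pos hr]
  exact mul_lt_mul_iff_right₀ hr

lemma hmt_preimage_ball0 (z : Euc N) {r : ℝ} (hr : 0 < r) (t : ℝ) :
    hmt z r ⁻¹' ball z (r * t) = ball 0 t := by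
  have := hmt_preimage_ball z hr 0 t
  simpa [hmt] using this

/-- Korn–Poincaré at all scales -/
lemma kp (hN : 2 ≤ N) (R : ℝ) (hR : 1 ≤ R) : ∃ δ0 > (0:ℝ), ∃ C > (0:ℝ),
    ∀ (z : Euc N) (r : ℝ), 0 < r →
    ∀ (D K : Set (Euc N)) (u : Euc N → Euc N), Convex ℝ D → IsOpen D → ball z r ⊆ D →
      D ⊆ ball z (R * r) →
      closure K ∩ D ⊆ K → (∀ x ∈ D \ K, DifferentiableAt ℝ u x) →
      (∫⁻ x in D \ K, dens u x) ≠ ⊤ → Hm N (K ∩ D) ≤ ofReal (δ0 * r ^ (N - 1)) →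
      ∃ (b : Euc N) (A : Euc N →L[ℝ] Euc N), (∀ x, ⟪A x, x⟫ = 0) ∧ ∃ G ⊆ D, MeasurableSet G ∧
        volume (D \ G) ≤ ofReal (C * r) * Hm N (K ∩ D) ∧
        ∫⁻ x in G, ofReal (‖u x - (b + A x)‖ ^ 2) ≤
          ofReal (C * r ^ 2) * ∫⁻ x in D \ K, dens u x ∧
        (K ∩ D = ∅ → G = D) ∧
        ∃ x1 ∈ D, ∀ x ∈ G, ∀ s ∈ Icc (0:ℝ) 1, x1 + s • (x - x1) ∈ D \ K := by
  obtain ⟨δ0, hδ0, C, hC, H⟩ := kp_unit hN R hR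
  refine ⟨δ0, hδ0, C, hC, ?_⟩
  intro z r hr D K u hDc hDo hBD hDB hK hu hfin hH
  set φ := hmt z r with hφ
  have hφc : Continuous φ := continuous_hmt z r
  have hφopen : IsOpenMap φ := (hmtH z hr).isOpenMap
  have hDKo : IsOpen (D \ K) := isOpen_diff_of_relclosed hDo hK
  have hrN : ofReal (r ^ N) ≠ 0 := (ofReal_pos.2 (by positivity)).ne'
  have hrN1 : ofReal (r ^ (N - 1)) ≠ 0 := (ofReal_pos.2 (by positivity)).ne'
  have hpow : r ^ N = r ^ (N - 1) * r := by
    rw [← pow_succ]; congr 1; omega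
  have hdens : ofReal (r ^ N) * ∫⁻ y in φ ⁻¹' D \ φ ⁻¹' K, dens (scl 1 z r u) y =
      ofReal (r ^ 2) * ∫⁻ x in D \ K, dens u x := by
    rw [← lint_scale z hr (D \ K) hDKo.measurableSet, ← preimage_diff]
    have e : ∫⁻ y in φ ⁻¹' (D \ K), dens (scl 1 z r u) y =
        ofReal (r ^ 2) * ∫⁻ y in φ ⁻¹' (D \ K), dens u (φ y) := by
      rw [← lintegral_const_mul' _ _ ofReal_ne_top]
      refine setLIntegral_congr_fun (hφc.measurable hDKo.measurableSet) fun y hy => ?_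
      rw [dens_scl 1 z r (hu _ hy), one_mul]
    rw [e]; ring
  have hHm := Hm_scale hN z hr (K ∩ D)
  obtain ⟨b, A, hA, G, hGD, hGm, hG1, hG2, hG3, x1, hx1, hG4⟩ :=
    H (φ ⁻¹' D) (φ ⁻¹' K) (scl 1 z r u) (by
      intro x hx y hy a b ha hb hab
      have := hDc hx hy ha hb hab
      have e : φ (a • x + b • y) = a • φ x + b • φ y := by
        simp only [hφ, hmt, smul_add, smul_smul]
        rw [mul_comm r a, mul_comm r b]
        have : z = a • z + b • z := by rw [← add_smul, hab, one_smul]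
        nth_rewrite 1 [this]; abel
      change φ _ ∈ D
      rwa [e]) (hDo.preimage hφc)
      (by rw [← hmt_preimage_ball0 z hr, mul_one]; exact preimage_mono hBD)
      (by rw [← hmt_preimage_ball0 z hr, mul_comm]; exact preimage_mono hDB)
      (by
        rintro y ⟨hy1, hy2⟩
        refine hK ⟨?_, hy2⟩
        exact hφc.closure_preimage_subset _ hy1)
      (fun y hy => (hasFDerivAt_scl 1 z r (hu (φ y) hy)).differentiableAt)
      (by
        intro htop
        rw [htop, ENNReal.mul_top hrN] at hdens
        exact mul_ne_top ofReal_ne_top hfin hdens.symm)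
      (by
        rw [← hHm, mul_comm δ0, ofReal_mul (by positivity)] at hH
        exact (ENNReal.mul_le_mul_iff_right hrN1 ofReal_ne_top).1 hH)
  set ψ : Euc N → Euc N := fun x => r⁻¹ • (x - z) with hψ
  have hψφ : ∀ y, ψ (φ y) = y := by
    intro y; simp [hψ, hφ, hmt, smul_smul, inv_mul_cancel₀ hr.ne']
  have hφψ : ∀ x, φ (ψ x) = x := fun x => hmt_inv z hr x
  have hψc : Continuous ψ := by fun_prop
  set G' := ψ ⁻¹' G with hG'
  have hGG' : φ ⁻¹' G' = G := by
    ext y; simp only [hG', mem_preimage, hψφ]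
  have hG'm : MeasurableSet G' := hψc.measurable hGm
  refine ⟨b - r⁻¹ • A z, r⁻¹ • A, ?_, G', ?_, hG'm, ?_, ?_, ?_, φ x1, hx1, ?_⟩
  · intro x
    simp [inner_smul_left, hA]
  · intro x hx
    have := hGD hx
    rwa [mem_preimage, hφψ] at this
  · rw [← vol_scale z hr (D \ G') (hDo.measurableSet.diff hG'm), ← hHm]
    rw [preimage_diff, hGG']
    calc ofReal (r ^ N) * volume (φ ⁻¹' D \ G)
        ≤ ofReal (r ^ N) * (ofReal C * Hm N (φ ⁻¹' K ∩ φ ⁻¹' D)) := by gcongr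
      _ = _ := by
        rw [hpow, ofReal_mul (by positivity), ofReal_mul hC.le, preimage_inter]; ring
  · rw [← lint_scale z hr G' hG'm, hGG']
    have e : ∀ y, u (φ y) - (b - r⁻¹ • A z + (r⁻¹ • A) (φ y)) = scl 1 z r u y - (b + A y) := by
      intro y
      have : (r⁻¹ • A) (φ y) = r⁻¹ • A z + A y := by
        simp [hφ, hmt, smul_smul, inv_mul_cancel₀ hr.ne']
      rw [this, scl, one_smul]; abel
    have e2 : ∫⁻ y in G, ofReal (‖u (φ y) - (b - r⁻¹ • A z + (r⁻¹ • A) (φ y))‖ ^ 2) =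
        ∫⁻ y in G, ofReal (‖scl 1 z r u y - (b + A y)‖ ^ 2) :=
      lintegral_congr fun y => by rw [e]
    rw [e2]
    calc _ ≤ ofReal (r ^ N) * (ofReal C * _) := by gcongr
      _ = ofReal C * (ofReal (r ^ N) *
          ∫⁻ y in φ ⁻¹' D \ φ ⁻¹' K, dens (scl 1 z r u) y) := by ring
      _ = _ := by rw [hdens, ofReal_mul hC.le]; ring
  · intro h0
    have := hG3 (by rw [← preimage_inter, h0]; simp)
    rw [hG', this]
    ext x; simp [hφψ]
  · intro x hx s hs
    have := hG4 _ hx s hs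
    have e : φ (x1 + s • (ψ x - x1)) = φ x1 + s • (x - φ x1) := by
      have h1 : x = φ (ψ x) := (hφψ x).symm
      conv_rhs => rw [h1]
      simp only [hφ, hmt, smul_add, smul_sub, smul_smul, mul_comm r s]
      abel
    rw [← preimage_diff, mem_preimage, e] at this
    exact this

/-! ### Affine maps controlled on large subsets -/

lemma aff_sup_unit (hN : 2 ≤ N) : ∃ δ1 > (0:ℝ), ∃ C > (0:ℝ), ∀ (b : Euc N) (A : Euc N →L[ℝ] Euc N)
    (G : Set (Euc N)), MeasurableSet G → volume (ball 0 1 \ G) ≤ ofReal δ1 →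
    ofReal (‖b‖ ^ 2 + ‖A‖ ^ 2) ≤
      ofReal C * ∫⁻ x in G, ofReal (‖b + A x‖ ^ 2) := by
  set β := volume (ball (0 : Euc N) (rad N)) with hβ
  have hβ0 : β ≠ 0 := (measure_ball_pos _ _ (rad_pos N)).ne'
  have hβt : β ≠ ⊤ := measure_ball_lt_top.ne
  set C1 : ℝ := ((1 + 16 * N) ^ 2 + (16 * N) ^ 2) with hC1
  set M : ℝ≥0∞ := 4 / β with hM
  have hM0 : M ≠ 0 := (ENNReal.div_pos (by simp) hβt).ne'
  have hMt : M ≠ ⊤ := div_ne_top (by simp) hβ0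
  refine ⟨(β / 4).toReal, toReal_pos (ENNReal.div_pos hβ0 (by simp)).ne'
    (div_ne_top hβt (by simp)), C1 * M.toReal, ?_, ?_⟩
  · have : 0 < M.toReal := toReal_pos hM0 hMt
    positivity
  intro b A G hGm hG
  rw [ofReal_toReal (div_ne_top hβt (by simp))] at hG
  set t := ∫⁻ x in G, ofReal (‖b + A x‖ ^ 2) with ht
  rcases eq_or_ne t ⊤ with htt | htt
  · rw [htt, ENNReal.mul_top]
    · exact le_top
    · refine (ofReal_pos.2 ?_).ne'
      have : 0 < M.toReal := toReal_pos hM0 hMt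
      positivity
  have hmeas : Measurable fun x => ofReal (‖b + A x‖ ^ 2) := by
    apply Measurable.ennreal_ofReal
    exact (Continuous.measurable (by fun_prop))
  have hch := cheb (μ := volume.restrict G) (f := fun x => ofReal (‖b + A x‖ ^ 2))
    hmeas.aemeasurable (c := 1) (t := t) (by rw [one_mul]) htt hM0 hMt
  have h1M : 1 / M = β / 4 := by
    rw [hM, one_div, ENNReal.inv_div (by simp) (by simp)]
  rw [h1M] at hch
  have hex : ∀ i : ℕ, ∃ x ∈ ball (refPt N i) (rad N), ofReal (‖b + A x‖ ^ 2) ≤ M * t := by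
    intro i
    obtain ⟨x, hx, hxb⟩ := exists_good (rad_pos N) (refPt N i)
      ((ball 0 1 \ G) ∪ ({x | M * t < ofReal (‖b + A x‖ ^ 2)} ∩ G)) (by
        refine lt_of_le_of_lt (measure_mono inter_subset_left) ?_
        refine lt_of_le_of_lt (measure_union_le _ _) ?_
        rw [Measure.restrict_apply' hGm] at hch
        calc _ ≤ β / 4 + β / 4 := add_le_add hG hch
          _ = β / 2 := by
            rw [ENNReal.eq_div_iff (by simp) (by simp)]
            have h8 : 2 * (β / 4 + β / 4) = 4 * (β / 4) := by ring
            rw [h8, ENNReal.mul_div_cancel (by simp) (by simp)]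
          _ < β := ENNReal.half_lt_self hβ0 hβt)
    refine ⟨x, hx, ?_⟩
    by_contra hcon
    push Not at hcon
    apply hxb
    by_cases hxG : x ∈ G
    · right; exact ⟨hcon, hxG⟩
    · left; exact ⟨ball_refPt i hx, hxG⟩
  choose x hx hxt using hex
  have hMt' : M * t ≠ ⊤ := mul_ne_top hMt htt
  set m := sqrt (M * t).toReal with hm
  have hm0 : 0 ≤ m := sqrt_nonneg _
  have hxm : ∀ i, ‖b + A (x i)‖ ≤ m := by
    intro i
    apply Real.le_sqrt_of_sq_le
    exact (ENNReal.ofReal_le_iff_le_toReal hMt').1 (hxt i)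
  have hAv : ∀ i : Fin N, ‖A (x (i + 1) - x 0)‖ ≤ 2 * m := by
    intro i
    have : A (x (i + 1) - x 0) = (b + A (x (i + 1))) - (b + A (x 0)) := by rw [map_sub]; abel
    rw [this]
    refine (norm_sub_le _ _).trans ?_
    linarith [hxm (i + 1), hxm 0]
  have hAn : ‖A‖ ≤ 16 * N * m := by
    rw [← ContinuousLinearMap.adjoint.norm_map A]
    refine opNorm_le_bound _ (by positivity) fun y => ?_
    refine (simplex_coercive x (fun i _ => hx i) _).trans ?_
    have : ∑ i : Fin N, |⟪A.adjoint y, x (i + 1) - x 0⟫| ≤ ∑ i : Fin N, ‖y‖ * (2 * m) := by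
      refine sum_le_sum fun i _ => ?_
      rw [ContinuousLinearMap.adjoint_inner_left]
      refine (abs_real_inner_le_norm _ _).trans ?_
      gcongr; exact hAv i
    simp only [sum_const, Finset.card_univ, Fintype.card_fin, nsmul_eq_mul] at this
    linarith
  have hbn : ‖b‖ ≤ (1 + 16 * N) * m := by
    have h0 : ‖x 0‖ ≤ 1 := by
      have := ball_refPt _ (hx 0); rw [mem_ball_zero_iff] at this; exact this.le
    have : b = (b + A (x 0)) - A (x 0) := by abel
    rw [this]
    refine (norm_sub_le _ _).trans ?_
    have h2 : ‖A (x 0)‖ ≤ ‖A‖ * 1 := (A.le_opNorm _).trans (by gcongr)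
    linarith [hxm 0]
  calc ofReal (‖b‖ ^ 2 + ‖A‖ ^ 2)
      ≤ ofReal (((1 + 16 * N) * m) ^ 2 + (16 * N * m) ^ 2) := by gcongr
    _ = ofReal (C1 * m ^ 2) := by congr 1; rw [hC1]; ring
    _ = ofReal C1 * (M * t) := by
      rw [hm, sq_sqrt toReal_nonneg, ofReal_mul (by positivity),
        ofReal_toReal hMt']
    _ = _ := by
      rw [ofReal_mul (by positivity), ofReal_toReal hMt]; ring

lemma aff_sup (hN : 2 ≤ N) : ∃ δ1 > (0:ℝ), ∃ C > (0:ℝ), ∀ (z : Euc N) (r : ℝ), 0 < r →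
    ∀ (b : Euc N) (A : Euc N →L[ℝ] Euc N)
    (G : Set (Euc N)), MeasurableSet G → volume (ball z r \ G) ≤ ofReal (δ1 * r ^ N) →
    ofReal (‖b + A z‖ ^ 2 + r ^ 2 * ‖A‖ ^ 2) * ofReal (r ^ N) ≤
      ofReal C * ∫⁻ x in G, ofReal (‖b + A x‖ ^ 2) := by
  obtain ⟨δ1, hδ1, C, hC, H⟩ := aff_sup_unit hN
  refine ⟨δ1, hδ1, C, hC, ?_⟩
  intro z r hr b A G hGm hG
  have hrN : ofReal (r ^ N) ≠ 0 := (ofReal_pos.2 (by positivity)).ne'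
  have h := H (b + A z) (r • A) (hmt z r ⁻¹' G) ((continuous_hmt z r).measurable hGm) (by
    rw [← vol_scale z hr _ (measurableSet_ball.diff hGm), preimage_diff, mul_comm δ1,
      ofReal_mul (by positivity)] at hG
    have hb := hmt_preimage_ball0 z hr 1
    rw [mul_one] at hb
    rw [hb] at hG
    exact (ENNReal.mul_le_mul_iff_right hrN ofReal_ne_top).1 hG)
  rw [← lint_scale z hr G hGm]
  rw [norm_smul, norm_eq_abs, mul_pow, sq_abs] at h
  calc _ ≤ (ofReal C * ∫⁻ x in hmt z r ⁻¹' G,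
        ofReal (‖b + A z + (r • A) x‖ ^ 2)) * ofReal (r ^ N) := by gcongr
    _ = _ := by
      rw [mul_assoc, mul_comm (∫⁻ x in hmt z r ⁻¹' G, _)]
      congr 2
      refine lintegral_congr fun y => ?_
      congr 3
      simp [hmt, add_assoc]

/-! ### Scaling of almost minimizers -/

lemma gradm_scl (c : ℝ) (z : Euc N) (r : ℝ) {u : Euc N → Euc N} {y : Euc N}
    (h : DifferentiableAt ℝ u (hmt z r y)) :
    gradm (scl c z r u) y = (c * r) • gradm u (hmt z r y) := by
  ext i j
  simp [gradm, (hasFDerivAt_scl c z r h).fderiv]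

lemma integrableOn_hmt (z : Euc N) {r : ℝ} (hr : 0 < r) {S : Set (Euc N)} {f : Euc N → ℝ}
    (hf : IntegrableOn f S volume) : IntegrableOn (fun y => f (hmt z r y)) (hmt z r ⁻¹' S) volume := by
  have he : MeasurableEmbedding (hmt z r) := (hmtH z hr).measurableEmbedding
  have h1 : IntegrableOn f S (Measure.map (hmt z r) (volume : Measure (Euc N))) := by
    rw [← map_hmt z hr] at hf
    unfold IntegrableOn at hf ⊢
    rw [Measure.restrict_smul] at hf
    rwa [integrable_smul_measure (ofReal_pos.2 (by positivity)).ne' ofReal_ne_top] at hf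
  exact (he.integrableOn_map_iff).1 h1

lemma relClosed_preimage {φ : Euc N → Euc N} (hφ : Continuous φ) {K Ω : Set (Euc N)}
    (h : RelClosedIn K Ω) : RelClosedIn (φ ⁻¹' K) (φ ⁻¹' Ω) := by
  refine ⟨preimage_mono h.1, ?_⟩
  rintro y ⟨hy1, hy2⟩
  exact h.2 ⟨hφ.closure_preimage_subset _ hy1, hy2⟩

lemma AdmissiblePair.scale {Ω K : Set (Euc N)} {u : Euc N → Euc N} (h : AdmissiblePair Ω u K)
    (c : ℝ) (z : Euc N) {r : ℝ} (hr : 0 < r) :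
    AdmissiblePair (hmt z r ⁻¹' Ω) (scl c z r u) (hmt z r ⁻¹' K) := by
  refine ⟨h.open_amb.preimage (continuous_hmt z r), relClosed_preimage (continuous_hmt z r) h.relClosed,
    fun y hy => (hasFDerivAt_scl c z r (h.diffOn _ hy)).differentiableAt, ?_⟩
  intro y hy
  obtain ⟨ε, hε, hsub, hInt⟩ := h.locSobolev _ hy
  have hb : hmt z r ⁻¹' ball (hmt z r y) ε = ball y (ε / r) := by
    rw [← hmt_preimage_ball z hr y, mul_div_cancel₀ _ hr.ne']
  refine ⟨ε / r, by positivity, ?_, ?_⟩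
  · rw [← hb, ← preimage_diff]; exact preimage_mono hsub
  rw [← hb]
  have hcont := h.open_amb
  have hm1 : ∀ y' ∈ hmt z r ⁻¹' ball (hmt z r y) ε, ‖scl c z r u y'‖ ^ 2 +
      frobNorm (gradm (scl c z r u) y') ^ 2 = c ^ 2 * ‖u (hmt z r y')‖ ^ 2 +
        (c * r) ^ 2 * frobNorm (gradm u (hmt z r y')) ^ 2 := by
    intro y' hy'
    rw [gradm_scl c z r (h.diffOn _ (hsub hy')), frobNorm_smul, scl, norm_smul, mul_pow, mul_pow,
      sq_abs, norm_eq_abs, sq_abs]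
  have hi2 : IntegrableOn (fun y => frobNorm (gradm u y) ^ 2) (ball (hmt z r y) ε) volume := by
    refine Integrable.mono hInt (measurable_gradm_sq u).aestronglyMeasurable (Eventually.of_forall fun x => ?_)
    rw [norm_of_nonneg (by positivity), norm_of_nonneg (by positivity)]
    linarith [sq_nonneg ‖u x‖]
  have hi1 : IntegrableOn (fun y => ‖u y‖ ^ 2) (ball (hmt z r y) ε) volume := by
    have := hInt.sub hi2
    refine this.congr (Eventually.of_forall fun x => ?_)
    simp
  have := ((integrableOn_hmt z hr hi1).const_mul (c ^ 2)).add
    ((integrableOn_hmt z hr hi2).const_mul ((c * r) ^ 2))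
  refine IntegrableOn.congr_fun this (fun y' hy' => (hm1 y' hy').symm) ?_
  exact (continuous_hmt z r).measurable measurableSet_ball

lemma frob_tensor_nonneg {𝓒 : Mat N →ₗ[ℝ] Mat N} {c₀ : ℝ} (h𝓒 : IsElasticityTensor 𝓒 c₀) (ξ : Mat N) :
    0 ≤ frob (𝓒 ξ) ξ := by
  refine le_trans ?_ (h𝓒.coercive ξ)
  have := h𝓒.one_le
  positivity

lemma elastic_scale (𝓒 : Mat N →ₗ[ℝ] Mat N) (c : ℝ) (z : Euc N) {r : ℝ} (hr : 0 < r)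
    {S : Set (Euc N)} (hS : MeasurableSet S) {u : Euc N → Euc N} (hu : ∀ x ∈ S, DifferentiableAt ℝ u x) :
    ofReal (r ^ N) * elastic 𝓒 (scl c z r u) (hmt z r ⁻¹' S) =
      ofReal ((c * r) ^ 2) * elastic 𝓒 u S := by
  unfold elastic
  rw [← lint_scale z hr S hS]
  have e : ∫⁻ y in hmt z r ⁻¹' S, ofReal (frob (𝓒 (eSym (scl c z r u) y))
      (eSym (scl c z r u) y)) = ofReal ((c * r) ^ 2) *
      ∫⁻ y in hmt z r ⁻¹' S, ofReal (frob (𝓒 (eSym u (hmt z r y))) (eSym u (hmt z r y))) := by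
    rw [← lintegral_const_mul' _ _ ofReal_ne_top]
    refine setLIntegral_congr_fun ((continuous_hmt z r).measurable hS) fun y hy => ?_
    rw [eSym_scl c z r (hu _ hy), map_smul, frob_smul_left, frob_smul_right, ← mul_assoc, ← sq,
      ofReal_mul (sq_nonneg _)]
  rw [e]; ring

lemma dens_scale (c : ℝ) (z : Euc N) {r : ℝ} (hr : 0 < r)
    {S : Set (Euc N)} (hS : MeasurableSet S) {u : Euc N → Euc N} (hu : ∀ x ∈ S, DifferentiableAt ℝ u x) :
    ofReal (r ^ N) * ∫⁻ y in hmt z r ⁻¹' S, dens (scl c z r u) y =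
      ofReal ((c * r) ^ 2) * ∫⁻ x in S, dens u x := by
  rw [← lint_scale z hr S hS]
  have e : ∫⁻ y in hmt z r ⁻¹' S, dens (scl c z r u) y = ofReal ((c * r) ^ 2) *
      ∫⁻ y in hmt z r ⁻¹' S, dens u (hmt z r y) := by
    rw [← lintegral_const_mul' _ _ ofReal_ne_top]
    refine setLIntegral_congr_fun ((continuous_hmt z r).measurable hS) fun y hy => ?_
    rw [dens_scl c z r (hu _ hy)]
  rw [e]; ring

/-- Almost minimality at unit scale, as used in the whole argument -/
structure UnitMin (𝓒 : Mat N →ₗ[ℝ] Mat N) (Ω : Set (Euc N)) (u : Euc N → Euc N) (K : Set (Euc N))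
    (η : ℝ≥0∞) : Prop where
  pair : AdmissiblePair Ω u K
  sub : ball 0 1 ⊆ Ω
  finE : ∀ ρ : ℝ, 0 < ρ → ρ < 1 → (∫⁻ y in ball 0 ρ \ K, dens u y) ≠ ⊤
  finH : ∀ ρ : ℝ, 0 < ρ → ρ < 1 → Hm N (K ∩ ball 0 ρ) ≠ ⊤
  minimality : ∀ ρ : ℝ, 0 < ρ → ρ < 1 → ∀ (v : Euc N → Euc N) (L : Set (Euc N)),
    TopCompetitor Ω u K (ball 0 ρ) v L →
      elastic 𝓒 u (ball 0 ρ \ K) + Hm N (K ∩ ball 0 ρ) ≤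
        elastic 𝓒 v (ball 0 ρ \ L) + Hm N (L ∩ ball 0 ρ) + η

lemma measSet_diff {Ω K : Set (Euc N)} {u : Euc N → Euc N} (h : AdmissiblePair Ω u K) :
    IsOpen (Ω \ K) := isOpen_diff_of_relclosed h.open_amb h.relClosed.2

lemma AdmissiblePair.open_ball_diff {Ω K : Set (Euc N)} {u : Euc N → Euc N} (h : AdmissiblePair Ω u K)
    {D : Set (Euc N)} (hD : IsOpen D) (hsub : D ⊆ Ω) : IsOpen (D \ K) := by
  have : D \ K = D ∩ (Ω \ K) := by
    ext x; constructor
    · rintro ⟨h1, h2⟩; exact ⟨h1, hsub h1, h2⟩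
    · rintro ⟨h1, _, h2⟩; exact ⟨h1, h2⟩
  rw [this]; exact hD.inter (measSet_diff h)

lemma sqrt_inv_mul_sq {r : ℝ} (hr : 0 < r) : ((sqrt r)⁻¹ * r) ^ 2 = r := by
  rw [mul_pow, inv_pow, sq_sqrt hr.le, sq, inv_mul_cancel_left₀ hr.ne']

lemma rpow_split (hN : 2 ≤ N) {r : ℝ} (hr : 0 < r) :
    ofReal (r ^ N) = ofReal (r ^ (N - 1)) * ofReal r := by
  rw [← ofReal_mul (by positivity), ← pow_succ]; congr 2; omega

lemma mul_cancel_r {r : ℝ} (hr : 0 < r) {a b : ℝ≥0∞} (h : ofReal r * a = ofReal r * b) :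
    a = b :=
  (ENNReal.mul_right_inj (ofReal_pos.2 hr).ne' ofReal_ne_top).1 h

lemma dens_scale1 (hN : 2 ≤ N) (z : Euc N) {r : ℝ} (hr : 0 < r)
    {S : Set (Euc N)} (hS : MeasurableSet S) {u : Euc N → Euc N} (hu : ∀ x ∈ S, DifferentiableAt ℝ u x) :
    ofReal (r ^ (N - 1)) * ∫⁻ y in hmt z r ⁻¹' S, dens (scl (sqrt r)⁻¹ z r u) y =
      ∫⁻ x in S, dens u x := by
  have h := dens_scale (sqrt r)⁻¹ z hr hS hu
  rw [sqrt_inv_mul_sq hr, rpow_split hN hr] at h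
  apply mul_cancel_r hr
  rw [← h]; ring

lemma elastic_scale1 (hN : 2 ≤ N) (𝓒 : Mat N →ₗ[ℝ] Mat N) (z : Euc N) {r : ℝ} (hr : 0 < r)
    {S : Set (Euc N)} (hS : MeasurableSet S) {u : Euc N → Euc N} (hu : ∀ x ∈ S, DifferentiableAt ℝ u x) :
    ofReal (r ^ (N - 1)) * elastic 𝓒 (scl (sqrt r)⁻¹ z r u) (hmt z r ⁻¹' S) =
      elastic 𝓒 u S := by
  have h := elastic_scale 𝓒 (sqrt r)⁻¹ z hr hS hu
  rw [sqrt_inv_mul_sq hr, rpow_split hN hr] at h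
  apply mul_cancel_r hr
  rw [← h]; ring

lemma keepsSep_homeo (e : Euc N ≃ₜ Euc N) {Ω K B L : Set (Euc N)}
    (h : KeepsSeparation (e ⁻¹' Ω) (e ⁻¹' K) (e ⁻¹' B) (e ⁻¹' L)) : KeepsSeparation Ω K B L := by
  intro x hx y hy hxy hc
  have hcomp : ∀ (F : Set (Euc N)) (p : Euc N), p ∈ F →
      connectedComponentIn (e ⁻¹' F) (e.symm p) = e ⁻¹' connectedComponentIn F p := by
    intro F p hp
    have hp' : e.symm p ∈ e ⁻¹' F := by simpa using hp
    have := e.image_connectedComponentIn hp'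
    rw [e.image_preimage, e.apply_symm_apply] at this
    rw [← this, preimage_image_eq _ e.injective]
  have hxL : x ∈ Ω \ L := by
    by_contra hcon
    rw [connectedComponentIn_eq_empty hcon] at hc
    exact hc
  refine h (e.symm x) (by simpa using hx) (e.symm y) (by simpa using hy) ?_ ?_
  · rw [← preimage_diff, hcomp (Ω \ K) x ⟨hx.1, fun h => hx.2 (Or.inl h)⟩]
    simpa using hxy
  · rw [← preimage_diff, hcomp (Ω \ L) x hxL]
    simpa using hc

lemma UnitMin.of_topAlmostMin (hN : 2 ≤ N) {𝓒 : Mat N →ₗ[ℝ] Mat N} {Ω : Set (Euc N)}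
    {u : Euc N → Euc N} {K : Set (Euc N)} {h : ℝ → ℝ≥0∞} (H : TopAlmostMin 𝓒 Ω u K h)
    {z : Euc N} {r : ℝ} (hr : 0 < r) (hsub : ball z r ⊆ Ω) :
    UnitMin 𝓒 (hmt z r ⁻¹' Ω) (scl (sqrt r)⁻¹ z r u) (hmt z r ⁻¹' K) (h r) := by
  have hrN1 : ofReal (r ^ (N - 1)) ≠ 0 := (ofReal_pos.2 (by positivity)).ne'
  have hcb : ∀ ρ : ℝ, ρ < 1 → closedBall z (r * ρ) ⊆ Ω := fun ρ hρ =>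
    (closedBall_subset_ball (by nlinarith)).trans hsub
  have hb : ∀ ρ : ℝ, ρ < 1 → ball z (r * ρ) ⊆ Ω := fun ρ hρ =>
    ball_subset_closedBall.trans (hcb ρ hρ)
  have hloc := fun (ρ : ℝ) (h0 : 0 < ρ) (h1 : ρ < 1) => H.locFin z (r * ρ) (by positivity) (hcb ρ h1)
  refine ⟨H.pair.scale _ z hr, ?_, ?_, ?_, ?_⟩
  · rw [← hmt_preimage_ball0 z hr, mul_one]; exact preimage_mono hsub
  · intro ρ h0 h1
    have h2 : (∫⁻ y in ball z (r * ρ) \ K, dens u y) ≠ ⊤ :=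
      (lt_of_le_of_lt le_self_add (hloc ρ h0 h1)).ne
    rw [← hmt_preimage_ball0 z hr, ← preimage_diff]
    intro htop
    have := dens_scale1 hN z hr (H.pair.open_ball_diff isOpen_ball (hb ρ h1)).measurableSet
      (fun x hx => H.pair.diffOn x ⟨hb ρ h1 hx.1, hx.2⟩)
    rw [htop, ENNReal.mul_top hrN1] at this
    exact h2 this.symm
  · intro ρ h0 h1
    have h2 : Hm N (K ∩ ball z (r * ρ)) ≠ ⊤ := (lt_of_le_of_lt le_add_self (hloc ρ h0 h1)).ne
    rw [← hmt_preimage_ball0 z hr, ← preimage_inter]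
    intro htop
    have := Hm_scale hN z hr (K ∩ ball z (r * ρ))
    rw [htop, ENNReal.mul_top hrN1] at this
    exact h2 this.symm
  · intro ρ h0 h1 v L hcomp
    set B := ball z (r * ρ) with hB
    have hBpre : hmt z r ⁻¹' B = ball 0 ρ := hmt_preimage_ball0 z hr ρ
    set c := (sqrt r)⁻¹ with hc
    have hcpos : 0 < c := inv_pos.2 (Real.sqrt_pos.2 hr)
    have hri : 0 < r⁻¹ := inv_pos.2 hr
    set z' := -(r⁻¹ • z) with hz'
    have hψφ : ∀ y, hmt z' r⁻¹ (hmt z r y) = y := by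
      intro y; simp [hmt, hz', smul_smul, inv_mul_cancel₀ hr.ne']
    have hφψ : ∀ x, hmt z r (hmt z' r⁻¹ x) = x := by
      intro y; simp [hmt, hz', smul_smul, mul_inv_cancel₀ hr.ne']
    have hpp : ∀ S : Set (Euc N), hmt z' r⁻¹ ⁻¹' (hmt z r ⁻¹' S) = S := by
      intro S; ext x; simp [hφψ]
    have hpp' : ∀ S : Set (Euc N), hmt z r ⁻¹' (hmt z' r⁻¹ ⁻¹' S) = S := by
      intro S; ext x; simp [hψφ]
    set L' := hmt z' r⁻¹ ⁻¹' L with hL'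
    set v' := scl c⁻¹ z' r⁻¹ v with hv'
    have hv : scl c z r v' = v := by
      ext1 y
      simp only [scl, hv', hψφ, smul_smul, mul_inv_cancel₀ hcpos.ne', one_smul]
    have hL : hmt z r ⁻¹' L' = L := hpp' L
    have hpair' : AdmissiblePair Ω v' L' := by
      have := hcomp.compet.pair.scale c⁻¹ z' hri
      rwa [hpp] at this
    have hcomp' : TopCompetitor Ω u K B v' L' := by
      refine ⟨⟨hpair', ?_, ?_⟩, ?_⟩
      · have := hcomp.compet.eq_outside
        have := congrArg (fun S => hmt z' r⁻¹ ⁻¹' S) this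
        simp only [preimage_diff] at this
        rwa [← hBpre, hpp, hpp] at this
      · have hae := hcomp.compet.ae_eq
        have hq : Measure.QuasiMeasurePreserving (hmt z' r⁻¹) (volume : Measure (Euc N)) volume := by
          refine ⟨(continuous_hmt _ _).measurable, ?_⟩
          intro s hs
          rw [← map_hmt z' hri, Measure.smul_apply, smul_eq_mul, mul_eq_zero] at hs
          exact hs.resolve_left (ofReal_pos.2 (by positivity)).ne'
        have := hq.ae hae
        filter_upwards [this] with x hx hxΩ
        have h3 := hx (by
          rw [← hBpre, ← preimage_union, ← preimage_diff, mem_preimage, hφψ]; exact hxΩ)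
        simp only [hv', scl, h3, hφψ, smul_smul, inv_mul_cancel₀ hcpos.ne', one_smul]
      · refine keepsSep_homeo (hmtH z hr) ?_
        rw [hmtH_coe, hBpre, hL]
        exact hcomp.sep
    have hmin := H.minimality z (r * ρ) (by positivity) (hcb ρ h1) v' L' hcomp'
    have e1 := elastic_scale1 hN 𝓒 z hr (H.pair.open_ball_diff isOpen_ball (hb ρ h1)).measurableSet
      (fun x hx => H.pair.diffOn x ⟨hb ρ h1 hx.1, hx.2⟩)
    have e2 := elastic_scale1 hN 𝓒 z hr (hpair'.open_ball_diff isOpen_ball (hb ρ h1)).measurableSet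
      (fun x hx => hpair'.diffOn x ⟨hb ρ h1 hx.1, hx.2⟩)
    have e3 := Hm_scale hN z hr (K ∩ B)
    have e4 := Hm_scale hN z hr (L' ∩ B)
    rw [preimage_diff, hBpre] at e1 e2
    rw [preimage_inter, hBpre] at e3 e4
    rw [hL] at e2 e4
    rw [← hc, hv] at e2
    rw [← e1, ← e2, ← e3, ← e4] at hmin
    have h5 : h (r * ρ) * ofReal ((r * ρ) ^ (N - 1)) ≤
        ofReal (r ^ (N - 1)) * h r := by
      rw [mul_comm]
      gcongr
      · nlinarith
      · exact H.gauge.mono (by positivity) (by nlinarith)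
    have h6 := hmin.trans (add_le_add_right h5 _)
    rw [← mul_add, ← mul_add, ← mul_add] at h6
    exact (ENNReal.mul_le_mul_iff_right hrN1 ofReal_ne_top).1 h6

/-! ### Hausdorff measure of spherical slices, density contradiction -/

lemma haus_vol (N : ℕ) : ∃ c : ℝ, 0 < c ∧ (μH[(N:ℝ)] : Measure (Euc N)) = ofReal c • volume := by
  have h1 : (μH[(N:ℝ)] : Measure (Euc N)).IsAddHaarMeasure := by
    have := isAddHaarMeasure_hausdorffMeasure (E := Euc N)
    simpa using this
  obtain ⟨c, hc⟩ : ∃ c : ℝ≥0, (μH[(N:ℝ)] : Measure (Euc N)) = c • volume :=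
    ⟨_, Measure.isAddLeftInvariant_eq_smul _ _⟩
  refine ⟨c, ?_, ?_⟩
  · rcases eq_or_ne c 0 with h | h
    · exfalso
      have h2 := measure_ball_pos (μH[(N:ℝ)] : Measure (Euc N)) 0 one_pos
      rw [hc, h] at h2
      simp at h2
    · exact NNReal.coe_pos.2 (pos_iff_ne_zero.2 h)
  · rw [hc]; ext s; simp

lemma vol_zero_of_Hm {S : Set (Euc N)} (h : Hm N S ≠ ⊤) : volume S = 0 := by
  obtain ⟨c, hc, hcv⟩ := haus_vol N
  have h1 := Measure.hausdorffMeasure_zero_or_top (show (N:ℝ) - 1 < N by linarith) S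
  rcases h1 with h1 | h1
  · rw [hcv] at h1
    simpa [hc.not_ge] using h1
  · exact absurd h1 h

/-- cost of a covering -/
lemma cover_cost (hN : 2 ≤ N) {A : Set (Euc N)} {M : ℝ≥0∞} (h : μH[(N:ℝ)] A < M) {δ : ℝ≥0∞} (hδ : 0 < δ) :
    ∃ t : ℕ → Set (Euc N), A ⊆ ⋃ n, t n ∧ (∀ n, ediam (t n) ≤ δ) ∧ ∑' n, ediam (t n) ^ N < M := by
  rw [Measure.hausdorffMeasure_apply] at h
  have h1 := lt_of_le_of_lt (le_iSup₂ (f := fun (r : ℝ≥0∞) (_ : 0 < r) =>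
    ⨅ (t : ℕ → Set (Euc N)) (_ : A ⊆ ⋃ n, t n) (_ : ∀ n, ediam (t n) ≤ r),
          ∑' n, ⨆ _ : (t n).Nonempty, ediam (t n) ^ (N:ℝ)) δ hδ) h
  simp only [iInf_lt_iff] at h1
  obtain ⟨t, ht1, ht2, ht3⟩ := h1
  refine ⟨t, ht1, ht2, lt_of_le_of_lt (ENNReal.tsum_le_tsum fun n => ?_) ht3⟩
  rcases (t n).eq_empty_or_nonempty with h0 | h0
  · rw [h0]; simp [show N ≠ 0 by omega]
  · simp [h0]

lemma eilenberg (hN : 2 ≤ N) : ∃ C : ℝ, 0 < C ∧ ∀ (A : Set (Euc N)) (a b m : ℝ), a < b →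
    volume A < ofReal m →
    ∃ ρ ∈ Ioo a b, Hm N (A ∩ sphere 0 ρ) ≤ ofReal (C * m / (b - a)) := by
  obtain ⟨c, hc, hcv⟩ := haus_vol N
  refine ⟨2 * c, by positivity, fun A a b m hab hm => ?_⟩
  have hba : 0 < b - a := sub_pos.2 hab
  set M : ℝ≥0∞ := ofReal (c * m) with hM
  have hlt : μH[(N:ℝ)] A < M := by
    rw [hcv, hM, ofReal_mul hc.le, Measure.smul_apply, smul_eq_mul]
    exact (ENNReal.mul_lt_mul_iff_right (by simpa using hc) ofReal_ne_top).2 hm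
  have hδ : ∀ n : ℕ, (0:ℝ≥0∞) < ofReal (1 / ((n:ℝ) + 1)) := fun n =>
    ofReal_pos.2 (by positivity)
  choose t ht1 ht2 ht3 using fun n : ℕ => cover_cost hN hlt (hδ n)
  classical
  set y : ℕ → ℕ → Euc N := fun n i => if h : (t n i).Nonempty then h.some else 0 with hy
  have hfin : ∀ n i, ediam (t n i) ≠ ⊤ := fun n i => ((ht2 n i).trans_lt ENNReal.ofReal_lt_top).ne
  set D : ℕ → ℕ → ℝ := fun n i => (ediam (t n i)).toReal with hD
  have hDe : ∀ n i, ofReal (D n i) = ediam (t n i) := fun n i => ofReal_toReal (hfin n i)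
  set f : ℕ → ℝ → ℝ≥0∞ := fun n ρ => ∑' i, (Icc (‖y n i‖ - D n i) (‖y n i‖ + D n i)).indicator
    (fun _ => ediam (t n i) ^ (N - 1)) ρ with hf
  have hmeas : ∀ n, Measurable (f n) := fun n =>
    Measurable.ennreal_tsum fun i => measurable_const.indicator measurableSet_Icc
  have hInt : ∀ n, ∫⁻ ρ in Ioo a b, f n ρ ≤ 2 * M := by
    intro n
    calc ∫⁻ ρ in Ioo a b, f n ρ ≤ ∫⁻ ρ, f n ρ := setLIntegral_le_lintegral _ _
      _ = ∑' i, 2 * ediam (t n i) ^ N := by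
          rw [hf]
          simp only
          rw [lintegral_tsum fun i => (measurable_const.indicator measurableSet_Icc).aemeasurable]
          congr 1; ext i
          rw [lintegral_indicator_const measurableSet_Icc, volume_Icc,
            show ‖y n i‖ + D n i - (‖y n i‖ - D n i) = 2 * D n i by ring,
            ofReal_mul (by norm_num), hDe]
          obtain ⟨k, rfl⟩ : ∃ k, N = k + 1 := ⟨N - 1, by omega⟩
          simp [pow_succ]; ring
      _ ≤ 2 * M := by
          rw [ENNReal.tsum_mul_left]
          gcongr
          exact (ht3 n).le
  have hfat : ∫⁻ ρ in Ioo a b, liminf (fun n => f n ρ) atTop ≤ 2 * M :=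
    (lintegral_liminf_le hmeas).trans (liminf_le_of_le (by isBoundedDefault)
      (fun q hq => by
        obtain ⟨n, hn⟩ := hq.exists
        exact hn.trans (hInt n)))
  obtain ⟨ρ, hρ, hρ2⟩ : ∃ ρ ∈ Ioo a b, liminf (fun n => f n ρ) atTop ≤
      ofReal (2 * c * m / (b - a)) := by
    by_contra hcon
    push Not at hcon
    have h0 : (∫⁻ ρ in Ioo a b, ofReal (2 * c * m / (b - a))) <
        ∫⁻ ρ in Ioo a b, liminf (fun n => f n ρ) atTop := by
      refine setLIntegral_strict_mono measurableSet_Ioo (by simp [hab]) (Measurable.liminf hmeas) ?_ ?_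
      · simp [ENNReal.mul_eq_top]
      · exact Eventually.of_forall fun x hx => hcon x hx
    rw [setLIntegral_const, Real.volume_Ioo, ← ENNReal.ofReal_mul' hba.le,
      div_mul_cancel₀ _ hba.ne', mul_assoc, ofReal_mul (by norm_num)] at h0
    exact absurd (h0.trans_le hfat) (by simp [hM])
  refine ⟨ρ, hρ, le_trans ?_ hρ2⟩
  have hr0 : Tendsto (fun n : ℕ => ofReal (1 / ((n:ℝ) + 1))) atTop (𝓝 0) := by
    rw [← ENNReal.ofReal_zero]
    exact ENNReal.tendsto_ofReal tendsto_one_div_add_atTop_nhds_zero_nat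
  have hmain := Measure.hausdorffMeasure_le_liminf_tsum ((N:ℝ) - 1) (A ∩ sphere 0 ρ) _ hr0
    (fun n i => t n i ∩ sphere 0 ρ)
    (Eventually.of_forall fun n i => (ediam_mono inter_subset_left).trans (ht2 n i))
    (Eventually.of_forall fun n => by rw [← iUnion_inter]; exact inter_subset_inter_left _ (ht1 n))
  refine hmain.trans (liminf_le_liminf (Eventually.of_forall fun n => ?_) (by isBoundedDefault) (by isBoundedDefault))
  refine ENNReal.tsum_le_tsum fun i => ?_
  have hN1 : ((N : ℝ) - 1) = ((N - 1 : ℕ) : ℝ) := by rw [Nat.cast_sub (by omega)]; simp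
  rw [hN1, ENNReal.rpow_natCast]
  rcases (t n i ∩ sphere 0 ρ).eq_empty_or_nonempty with h0 | ⟨x, hx1, hx2⟩
  · rw [h0]; simp [show N - 1 ≠ 0 by omega]
  · have hne : (t n i).Nonempty := ⟨x, hx1⟩
    have hyt : y n i ∈ t n i := by simp only [hy, hne, dif_pos]; exact hne.some_mem
    have hxρ : ‖x‖ = ρ := by simpa using hx2
    have hd : dist x (y n i) ≤ D n i := by
      have := edist_le_ediam_of_mem hx1 hyt
      rw [edist_dist, ← hDe] at this
      exact (ofReal_le_ofReal_iff toReal_nonneg).1 this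
    have hd2 : |‖x‖ - ‖y n i‖| ≤ D n i := (abs_norm_sub_norm_le _ _).trans (by rwa [← dist_eq_norm])
    rw [abs_le, hxρ] at hd2
    rw [indicator_of_mem (by constructor <;> linarith)]
    gcongr
    exact inter_subset_left

lemma density_contra (hN : 2 ≤ N) {F K : Set (Euc N)} (hF : MeasurableSet F) (hFK : F ⊆ K)
    (hfin : Hm N F ≠ ⊤) (hpos : 0 < Hm N F) {r1 : ℝ} (hr1 : 0 < r1)
    (h : ∀ x ∈ F, ∀ r : ℝ, 0 < r → r < r1 →
      Hm N (K ∩ ball x r) ≤ ofReal ((1 / 4) ^ N * r ^ (N - 1))) : False := by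
  have hN1 : ((N : ℝ) - 1) = ((N - 1 : ℕ) : ℝ) := by rw [Nat.cast_sub (by omega)]; simp
  have key : ((2:ℝ≥0∞) • (Hm N).restrict F) ≤ Hm N := by
    refine Measure.le_hausdorffMeasure _ _ (ofReal (r1 / 4)) (ofReal_pos.2 (by positivity)) ?_
    intro s hs
    rw [Measure.smul_apply, Measure.restrict_apply' hF, smul_eq_mul, hN1, ENNReal.rpow_natCast]
    rcases (s ∩ F).eq_empty_or_nonempty with h0 | ⟨x, hxs, hxF⟩
    · rw [h0]; simp
    have hfd : ediam s ≠ ⊤ := (hs.trans_lt ENNReal.ofReal_lt_top).ne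
    set D := (ediam s).toReal with hD
    have hDe : ofReal D = ediam s := ofReal_toReal hfd
    rcases eq_or_lt_of_le (toReal_nonneg : 0 ≤ D) with h0 | h0
    · have : ediam s = 0 := by rw [← hDe, show D = 0 from h0.symm]; simp
      have hsub : s.Subsingleton := ediam_eq_zero_iff.1 this
      have : Hm N (s ∩ F) = 0 := by
        have : NullSingletonClass (Hm N) := Measure.nullSingletonClass_hausdorff (Euc N) (d := (N:ℝ) - 1)
          (by have : (2:ℝ) ≤ N := by exact_mod_cast hN
              linarith)
        exact (hsub.anti inter_subset_left).measure_zero _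
      rw [this]; simp
    · have hD4 : D ≤ r1 / 4 := by
        rw [← hDe] at hs
        exact (ofReal_le_ofReal_iff (by positivity)).1 hs
      have hsub : s ∩ F ⊆ K ∩ ball x (2 * D) := by
        rintro y ⟨hy1, hy2⟩
        refine ⟨hFK hy2, ?_⟩
        have := edist_le_ediam_of_mem hy1 hxs
        rw [edist_dist, ← hDe] at this
        have := (ofReal_le_ofReal_iff h0.le).1 this
        rw [mem_ball]; linarith
      calc 2 * Hm N (s ∩ F) ≤ 2 * ofReal ((1 / 4) ^ N * (2 * D) ^ (N - 1)) := by
            gcongr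
            exact (measure_mono hsub).trans (h x hxF _ (by positivity) (by linarith))
        _ = ofReal (2 * ((1 / 4) ^ N * (2 * D) ^ (N - 1))) := by
            rw [ofReal_mul (p := 2) (by norm_num)]; simp
        _ ≤ ofReal (D ^ (N - 1)) := by
            apply ofReal_le_ofReal
            rw [mul_pow]
            obtain ⟨k, rfl⟩ : ∃ k, N = k + 1 := ⟨N - 1, by omega⟩
            simp only [Nat.add_sub_cancel]
            have e : 2 * ((1 / 4 : ℝ) ^ (k + 1) * (2 ^ k * D ^ k)) = (1 / 2) ^ (k + 1) * D ^ k := by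
              rw [show (1 / 4 : ℝ) = 1 / 2 * (1 / 2) by norm_num, mul_pow]
              have : (1 / 2 : ℝ) ^ (k + 1) * 2 ^ (k + 1) = 1 := by rw [← mul_pow]; norm_num
              linear_combination ((1 / 2 : ℝ) ^ (k + 1) * D ^ k) * this
            rw [e]
            have : (1 / 2 : ℝ) ^ (k + 1) ≤ 1 := pow_le_one₀ (by norm_num) (by norm_num)
            nlinarith [pow_pos h0 k]
        _ = ediam s ^ (N - 1) := by rw [ofReal_pow h0.le, hDe]
  have := key F
  rw [Measure.smul_apply, Measure.restrict_apply_self, smul_eq_mul, two_mul] at this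
  exact absurd this (not_le.2 (ENNReal.lt_add_right hfin hpos.ne'))

/-! ### The local scale function -/

/-- balls in which `K` has large density -/
def Dns (δ : ℝ) (K : Set (Euc N)) : Set (Euc N × ℝ) :=
  {p | p.1 ∈ K ∧ 0 < p.2 ∧ ofReal (δ * p.2 ^ (N - 1)) ≤ Hm N (K ∩ ball p.1 p.2)}

def scaleSet (δ σ : ℝ) (K : Set (Euc N)) (x : Euc N) : Set ℝ :=
  {t | t = σ ∨ ∃ p ∈ Dns δ K, t = p.2 - dist x p.1 / 100}

lemma dns_le (hN : 2 ≤ N) {δ τ : ℝ} (hδ : 0 < δ) (hτ : 0 < τ) {K : Set (Euc N)}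
    (hK : Hm N K ≤ ofReal (δ * τ ^ (N - 1))) {p : Euc N × ℝ} (hp : p ∈ Dns δ K) : p.2 ≤ τ := by
  have h1 := (hp.2.2.trans (measure_mono inter_subset_left)).trans hK
  rw [ofReal_le_ofReal_iff (by positivity)] at h1
  have h2 := le_of_mul_le_mul_left h1 hδ
  exact (pow_le_pow_iff_left₀ hp.2.1.le hτ.le (by omega)).1 h2

lemma dns_volume (hN : 2 ≤ N) {δ : ℝ} (hδ : 0 < δ) : ∃ C : ℝ, 0 < C ∧ ∀ (K : Set (Euc N)) (τ : ℝ),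
    0 < τ → IsCompact K → Hm N K ≤ ofReal (δ * τ ^ (N - 1)) →
    volume (⋃ p ∈ Dns δ K, closedBall p.1 (100 * p.2)) ≤ ofReal (C * τ) * Hm N K := by
  have : NeZero N := ⟨by omega⟩
  set V := volume (ball (0 : Euc N) 1) with hV
  have hVf : V ≠ ⊤ := measure_ball_lt_top.ne
  have hVp : V ≠ 0 := (measure_ball_pos _ _ one_pos).ne'
  have hVr : 0 < V.toReal := toReal_pos hVp hVf
  refine ⟨500 ^ N * V.toReal / δ, by positivity, fun K τ hτ hKc hK => ?_⟩
  obtain ⟨u, hut, hdis, hcov⟩ := Vitali.exists_disjoint_subfamily_covering_enlargement_closedBall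
    (Dns δ K) (fun p => p.1) (fun p => 100 * p.2) (100 * τ)
    (fun p hp => by have := dns_le hN hδ hτ hK hp; linarith) 5 (by norm_num)
  have hcount : u.Countable := by
    refine hdis.countable_of_nonempty_interior fun p hp => ?_
    have h2 := (hut hp).2.1
    exact (nonempty_ball.2 (by positivity)).mono ball_subset_interior_closedBall
  have : Countable u := hcount.to_subtype
  have hsub : (⋃ p ∈ Dns δ K, closedBall p.1 (100 * p.2)) ⊆ ⋃ p : u, closedBall p.1.1 (500 * p.1.2) := by
    intro x hx
    simp only [mem_iUnion] at hx
    obtain ⟨p, hp, hx⟩ := hx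
    obtain ⟨q, hq, hpq⟩ := hcov p hp
    refine mem_iUnion.2 ⟨⟨q, hq⟩, ?_⟩
    have := hpq hx
    rwa [← mul_assoc, show (5:ℝ) * 100 = 500 by norm_num] at this
  have hone : ∀ p : u, volume (closedBall p.1.1 (500 * p.1.2)) ≤
      ofReal (500 ^ N * V.toReal / δ * τ) * Hm N (K ∩ ball p.1.1 p.1.2) := by
    intro p
    have hp := hut p.2
    have h0 := hp.2.1
    have h1 := dns_le hN hδ hτ hK hp
    rw [vol_closedBall _ (by positivity), ← hV]
    refine le_trans ?_ (mul_le_mul_right hp.2.2 _)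
    rw [← ofReal_mul (by positivity), ← ofReal_toReal hVf, ← ofReal_mul (by positivity),
      ENNReal.toReal_ofReal hVr.le]
    apply ofReal_le_ofReal
    have e : 500 ^ N * V.toReal / δ * τ * (δ * p.1.2 ^ (N - 1)) = 500 ^ N * V.toReal * (p.1.2 ^ (N - 1) * τ) := by
      field_simp
    rw [e, mul_pow, show p.1.2 ^ N = p.1.2 ^ (N - 1) * p.1.2 by rw [← pow_succ]; congr 1; omega]
    have : p.1.2 ^ (N - 1) * p.1.2 ≤ p.1.2 ^ (N - 1) * τ := by gcongr
    nlinarith [mul_le_mul_of_nonneg_left this (show 0 ≤ (500:ℝ) ^ N * V.toReal by positivity)]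
  calc volume (⋃ p ∈ Dns δ K, closedBall p.1 (100 * p.2))
      ≤ ∑' p : u, volume (closedBall p.1.1 (500 * p.1.2)) :=
        (measure_mono hsub).trans (measure_iUnion_le _)
    _ ≤ ∑' p : u, ofReal (500 ^ N * V.toReal / δ * τ) * Hm N (K ∩ ball p.1.1 p.1.2) :=
        ENNReal.tsum_le_tsum hone
    _ = ofReal (500 ^ N * V.toReal / δ * τ) * ∑' p : u, Hm N (K ∩ ball p.1.1 p.1.2) :=
        ENNReal.tsum_mul_left
    _ ≤ _ := by
        gcongr
        refine (tsum_meas_le_meas_iUnion_of_disjoint (Hm N)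
          (fun p => hKc.measurableSet.inter measurableSet_ball) ?_).trans
          (measure_mono (iUnion_subset fun p => inter_subset_left))
        intro p q hpq
        have := hdis p.2 q.2 (fun h => hpq (Subtype.ext h))
        refine this.mono ?_ ?_
        · exact inter_subset_right.trans (ball_subset_closedBall.trans (closedBall_subset_closedBall
            (by have := (hut p.2).2.1; linarith)))
        · exact inter_subset_right.trans (ball_subset_closedBall.trans (closedBall_subset_closedBall
            (by have := (hut q.2).2.1; linarith)))

lemma exists_scale (hN : 2 ≤ N) {δ : ℝ} (hδ : 0 < δ) : ∃ C : ℝ, 0 < C ∧ ∀ (K : Set (Euc N)) (τ m : ℝ),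
    0 < τ → 0 < m → IsCompact K → K.Nonempty → Hm N K ≤ ofReal (δ * τ ^ (N - 1)) →
    ∃ (d : Euc N → ℝ) (σ : ℝ), 0 < σ ∧ (∀ x, σ ≤ d x ∧ d x ≤ τ) ∧
      (∀ x y, |d x - d y| ≤ dist x y / 100) ∧
      (∀ x, Hm N (K ∩ ball x (20 * d x)) ≤ ofReal (δ * (40 * d x) ^ (N - 1))) ∧
      volume {x | infDist x K ≤ 30 * d x} ≤ ofReal (C * τ) * Hm N K + ofReal m := by
  obtain ⟨C, hC, hvol⟩ := dns_volume hN hδ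
  refine ⟨C, hC, fun K τ m hτ hm hKc hKne hK => ?_⟩
  have hKv : volume K = 0 := vol_zero_of_Hm (hK.trans_lt ENNReal.ofReal_lt_top).ne
  obtain ⟨σ, hσ0, hστ, hσm⟩ : ∃ σ : ℝ, 0 < σ ∧ σ ≤ τ ∧
      volume (cthickening (60 * σ) K) ≤ ofReal m := by
    have h1 := tendsto_measure_cthickening_of_isCompact (μ := (volume : Measure (Euc N))) hKc
    rw [hKv] at h1
    have h2 : Tendsto (fun σ : ℝ => 60 * σ) (𝓝[>] 0) (𝓝 0) := by
      refine tendsto_nhdsWithin_of_tendsto_nhds ?_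
      have : Continuous fun σ : ℝ => 60 * σ := by fun_prop
      simpa using this.tendsto 0
    have h3 := (h1.comp h2).eventually_le_const (ofReal_pos.2 hm)
    have h4 : ∀ᶠ σ : ℝ in 𝓝[>] 0, σ ∈ Ioc 0 τ := Ioc_mem_nhdsGT hτ
    obtain ⟨σ, h5, h6⟩ := (h3.and h4).exists
    exact ⟨σ, h6.1, h6.2, h5⟩
  set d : Euc N → ℝ := fun x => sSup (scaleSet δ σ K x) with hd
  have hne : ∀ x, (scaleSet δ σ K x).Nonempty := fun x => ⟨σ, Or.inl rfl⟩
  have hub : ∀ x, ∀ t ∈ scaleSet δ σ K x, t ≤ τ := by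
    rintro x t (rfl | ⟨p, hp, rfl⟩)
    · exact hστ
    · have := dns_le hN hδ hτ hK hp
      have : 0 ≤ dist x p.1 := dist_nonneg
      linarith
  have hbdd : ∀ x, BddAbove (scaleSet δ σ K x) := fun x => ⟨τ, hub x⟩
  have hσd : ∀ x, σ ≤ d x := fun x => le_csSup (hbdd x) (Or.inl rfl)
  have hle : ∀ x y, d x ≤ d y + dist x y / 100 := by
    intro x y
    refine csSup_le (hne x) ?_
    rintro t (rfl | ⟨p, hp, rfl⟩)
    · have := hσd y
      have : 0 ≤ dist x y := dist_nonneg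
      linarith
    · have h1 : p.2 - dist y p.1 / 100 ≤ d y := le_csSup (hbdd y) (Or.inr ⟨p, hp, rfl⟩)
      have := dist_triangle_left y p.1 x
      linarith
  refine ⟨d, σ, hσ0, fun x => ⟨hσd x, csSup_le (hne x) (hub x)⟩, ?_, ?_, ?_⟩
  · intro x y
    rw [abs_le]
    have h1 := hle x y
    have h2 := hle y x
    rw [dist_comm] at h2
    constructor <;> linarith
  · intro x
    have hdx : 0 < d x := hσ0.trans_le (hσd x)
    by_contra hcon
    push Not at hcon
    obtain ⟨y, hyK, hy⟩ : (K ∩ ball x (20 * d x)).Nonempty := by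
      by_contra hemp
      rw [not_nonempty_iff_eq_empty] at hemp
      rw [hemp] at hcon
      simp at hcon
    rw [mem_ball] at hy
    have hD : (y, 40 * d x) ∈ Dns δ K := by
      refine ⟨hyK, by positivity, hcon.le.trans (measure_mono (inter_subset_inter_right _ ?_))⟩
      refine ball_subset_ball' ?_
      rw [dist_comm]; linarith
    have h1 : 40 * d x - dist x y / 100 ≤ d x := le_csSup (hbdd x) (Or.inr ⟨_, hD, rfl⟩)
    rw [dist_comm] at hy
    linarith
  · have hsub : {x | infDist x K ≤ 30 * d x} ⊆ (⋃ p ∈ Dns δ K, closedBall p.1 (100 * p.2)) ∪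
        cthickening (60 * σ) K := by
      intro x hx
      simp only [mem_setOf_eq] at hx
      by_cases h2 : d x ≤ 2 * σ
      · right
        rw [mem_cthickening_iff, ENNReal.le_ofReal_iff_toReal_le (infEDist_ne_top hKne) (by positivity)]
        have h3 : (infEDist x K).toReal = infDist x K := rfl
        rw [h3]; linarith
      · left
        push Not at h2
        obtain ⟨t, ht, hlt⟩ := exists_lt_of_lt_csSup (hne x) (show 2 * σ < sSup (scaleSet δ σ K x) from h2)
        rcases ht with rfl | ⟨p, hp, rfl⟩
        · linarith
        · refine mem_iUnion₂.2 ⟨p, hp, ?_⟩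
          rw [mem_closedBall]; linarith
    refine (measure_mono hsub).trans ((measure_union_le _ _).trans ?_)
    exact add_le_add (hvol K τ hτ hKc hK) hσm

/-! ### Covering and partition of unity adapted to a scale function -/

lemma count_balls (hN : 2 ≤ N) (t : Finset (Euc N)) (z : Euc N) (r : Euc N → ℝ) {ρ R : ℝ} (hρ : 0 < ρ)
    (hR : 0 ≤ R) (hr : ∀ x ∈ t, ρ ≤ r x) (hdis : (t : Set (Euc N)).PairwiseDisjoint fun x => closedBall x (r x))
    (hd : ∀ x ∈ t, dist x z ≤ R * ρ) : (t.card : ℝ) ≤ (R + 1) ^ N := by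
  have hVf : volume (ball (0 : Euc N) 1) ≠ ⊤ := measure_ball_lt_top.ne
  have hVp : volume (ball (0 : Euc N) 1) ≠ 0 := (measure_ball_pos _ _ one_pos).ne'
  have h1 : volume (⋃ x ∈ t, closedBall x ρ) = ∑ x ∈ t, volume (closedBall x ρ) := by
    refine measure_biUnion_finset (fun x hx y hy hxy => ?_) (fun x _ => measurableSet_closedBall)
    exact (hdis hx hy hxy).mono (closedBall_subset_closedBall (hr x hx)) (closedBall_subset_closedBall (hr y hy))
  have h2 : volume (⋃ x ∈ t, closedBall x ρ) ≤ volume (closedBall z ((R + 1) * ρ)) := by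
    refine measure_mono (iUnion₂_subset fun x hx => closedBall_subset_closedBall' ?_)
    have := hd x hx; linarith
  rw [h1, vol_closedBall _ (by positivity), sum_congr rfl (fun x _ => vol_closedBall x hρ.le),
    sum_const, nsmul_eq_mul, ← mul_assoc] at h2
  have h3 := (ENNReal.mul_le_mul_iff_left hVp hVf).1 h2
  rw [← ofReal_natCast, ← ofReal_mul (by positivity),
    ofReal_le_ofReal_iff (by positivity), mul_pow] at h3
  exact le_of_mul_le_mul_right h3 (by positivity)

structure ScaleFn (d : Euc N → ℝ) (σ τ : ℝ) : Prop where
  σ_pos : 0 < σ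
  ge : ∀ x, σ ≤ d x
  le : ∀ x, d x ≤ τ
  lip : ∀ x y, |d x - d y| ≤ dist x y / 100

lemma ScaleFn.pos {d : Euc N → ℝ} {σ τ : ℝ} (h : ScaleFn d σ τ) (x : Euc N) : 0 < d x :=
  h.σ_pos.trans_le (h.ge x)

lemma ScaleFn.comp {d : Euc N → ℝ} {σ τ : ℝ} (h : ScaleFn d σ τ) {x y : Euc N} (hxy : dist x y ≤ 20 * d y) :
    d x ≤ 6 / 5 * d y ∧ d y ≤ 5 / 4 * d x := by
  have := abs_le.1 (h.lip x y)
  constructor <;> linarith [this.1, this.2]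

structure Centers (d : Euc N → ℝ) (J : Finset (Euc N)) : Prop where
  mem : ∀ j ∈ J, j ∈ closedBall (0 : Euc N) (3 / 4)
  disj : (J : Set (Euc N)).PairwiseDisjoint fun x => closedBall x (d x / 6)
  cover : ∀ x ∈ closedBall (0 : Euc N) (3 / 4), ∃ j ∈ J, x ∈ ball j (d j)

lemma exists_centers (hN : 2 ≤ N) {d : Euc N → ℝ} {σ τ : ℝ} (h : ScaleFn d σ τ) :
    ∃ J : Finset (Euc N), Centers d J := by
  obtain ⟨u, hut, hdis, hcov⟩ := Vitali.exists_disjoint_subfamily_covering_enlargement_closedBall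
    (closedBall (0 : Euc N) (3 / 4)) (fun p => p) (fun p => d p / 6) (τ / 6)
    (fun p hp => by have := h.le p; linarith) 5 (by norm_num)
  have hσ := h.σ_pos
  have hfin : u.Finite := by
    by_contra hinf
    obtain ⟨n, hn⟩ := exists_nat_gt ((3 / 4 / (σ / 6) + 1 : ℝ) ^ N)
    obtain ⟨t, htu, htc⟩ := Set.Infinite.exists_subset_card_eq hinf n
    have := count_balls hN t 0 (fun p => d p / 6) (ρ := σ / 6) (R := 3 / 4 / (σ / 6)) (by positivity)
      (by positivity) (fun x _ => by have := h.ge x; linarith) (hdis.subset htu)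
      (fun x hx => by
        rw [div_mul_cancel₀ _ (by positivity)]
        exact hut (htu hx))
    rw [htc] at this
    linarith
  refine ⟨hfin.toFinset, fun j hj => hut (hfin.mem_toFinset.1 hj), by simpa using hdis, ?_⟩
  intro x hx
  obtain ⟨j, hj, hsub⟩ := hcov x hx
  refine ⟨j, hfin.mem_toFinset.2 hj, ?_⟩
  have h1 := hsub (mem_closedBall_self (by have := h.pos x; positivity))
  rw [mem_closedBall] at h1
  have := h.pos j
  rw [mem_ball]; linarith

def ovl (N : ℕ) : ℝ := (201 : ℝ) ^ N

lemma ovl_pos : 0 < ovl N := by unfold ovl; positivity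

lemma overlap (hN : 2 ≤ N) {d : Euc N → ℝ} {σ τ : ℝ} (h : ScaleFn d σ τ) {J : Finset (Euc N)}
    (hJ : Centers d J) (x : Euc N) (t : Finset (Euc N)) (htJ : t ⊆ J)
    (ht : ∀ j ∈ t, dist x j ≤ 20 * d j) : (t.card : ℝ) ≤ ovl N := by
  have hx := h.pos x
  have := count_balls hN t x (fun p => d p / 6) (ρ := d x / 8) (R := 200) (by positivity) (by norm_num)
    (fun j hj => by have := (h.comp (ht j hj)).1; linarith)
    (hJ.disj.subset (by exact_mod_cast htJ))
    (fun j hj => by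
      have h1 := (h.comp (ht j hj)).2
      have := ht j hj
      rw [dist_comm]; linarith)
  rw [ovl]
  norm_num at this ⊢
  exact this

structure PartUnity (d : Euc N → ℝ) (J : Finset (Euc N)) (C : ℝ) (φ : Euc N → Euc N → ℝ) : Prop where
  nonneg : ∀ j ∈ J, ∀ x, 0 ≤ φ j x
  sum : ∀ x ∈ closedBall (0 : Euc N) (3 / 4), ∑ j ∈ J, φ j x = 1
  smooth : ∀ j ∈ J, ∀ x ∈ closedBall (0 : Euc N) (3 / 4), ContDiffAt ℝ 1 (φ j) x
  grad : ∀ j ∈ J, ∀ x ∈ closedBall (0 : Euc N) (3 / 4), ‖fderiv ℝ (φ j) x‖ ≤ C / d x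
  supp : ∀ j ∈ J, ∀ x, x ∉ closedBall j (2 * d j) → φ j =ᶠ[𝓝 x] 0

lemma exists_bump (N : ℕ) : ∃ (f : Euc N → ℝ) (C : ℝ), 0 < C ∧ ContDiff ℝ 1 f ∧ (∀ x, 0 ≤ f x ∧ f x ≤ 1) ∧
    (∀ x ∈ closedBall (0 : Euc N) 1, f x = 1) ∧ (∀ x ∉ ball (0 : Euc N) 2, f x = 0) ∧ ∀ x, ‖fderiv ℝ f x‖ ≤ C := by
  set f : ContDiffBump (0 : Euc N) := ⟨1, 2, one_pos, by norm_num⟩ with hf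
  have hc : ContDiff ℝ 1 f := f.contDiff
  obtain ⟨C, hC⟩ := (f.hasCompactSupport.fderiv (𝕜 := ℝ)).exists_bound_of_continuous
    (hc.continuous_fderiv one_ne_zero)
  refine ⟨f, max C 1, by positivity, hc, fun x => ⟨f.nonneg, f.le_one⟩, fun x hx => f.one_of_mem_closedBall hx,
    fun x hx => f.zero_of_le_dist (by simpa using hx), fun x => (hC x).trans (le_max_left _ _)⟩

lemma exists_partUnity (hN : 2 ≤ N) : ∃ C : ℝ, 0 < C ∧ ∀ (d : Euc N → ℝ) (σ τ : ℝ) (J : Finset (Euc N)),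
    ScaleFn d σ τ → Centers d J → ∃ φ, PartUnity d J C φ := by
  obtain ⟨f, C, hC, hfs, hf01, hf1, hf0, hfd⟩ := exists_bump N
  have hov := ovl_pos (N := N)
  refine ⟨6 / 5 * C + ovl N * (6 / 5 * C), by positivity, fun d σ τ J h hJ => ?_⟩
  set ψ : Euc N → Euc N → ℝ := fun j x => f ((d j)⁻¹ • (x - j)) with hψ
  set Ψ : Euc N → ℝ := fun x => ∑ j ∈ J, ψ j x with hΨ
  have hψs : ∀ j, ContDiff ℝ 1 (ψ j) := fun j => hfs.comp (by fun_prop)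
  have hψ0 : ∀ j x, 0 ≤ ψ j x := fun j x => (hf01 _).1
  have hψ1 : ∀ j x, ψ j x ≤ 1 := fun j x => (hf01 _).2
  have hψz : ∀ j x, x ∉ ball j (2 * d j) → ψ j x = 0 := by
    intro j x hx
    refine hf0 _ ?_
    have hj := h.pos j
    rw [mem_ball, not_lt, dist_eq_norm] at hx
    rw [mem_ball_zero_iff, norm_smul, not_lt, norm_inv, norm_of_nonneg hj.le, inv_mul_eq_div,
      le_div_iff₀ hj]
    exact hx
  have hψev : ∀ j x, x ∉ closedBall j (2 * d j) → ψ j =ᶠ[𝓝 x] 0 := by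
    intro j x hx
    filter_upwards [isClosed_closedBall.isOpen_compl.mem_nhds hx] with y hy
    exact hψz j y (fun h => hy (ball_subset_closedBall h))
  have hψd : ∀ j x, ‖fderiv ℝ (ψ j) x‖ ≤ C / d j := by
    intro j x
    have hj := h.pos j
    have h1 : HasFDerivAt (fun x : Euc N => (d j)⁻¹ • (x - j)) ((d j)⁻¹ • ContinuousLinearMap.id ℝ (Euc N)) x :=
      ((hasFDerivAt_id x).sub_const j).const_smul (d j)⁻¹
    have h2 := ((hfs.differentiable (by norm_num)) ((d j)⁻¹ • (x - j))).hasFDerivAt.comp x h1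
    rw [show fderiv ℝ (ψ j) x = _ from h2.fderiv]
    rw [ContinuousLinearMap.comp_smul, norm_smul, norm_inv, norm_of_nonneg hj.le, inv_mul_eq_div,
      ContinuousLinearMap.comp_id]
    gcongr; exact hfd _
  have hψd2 : ∀ j ∈ J, ∀ x, ‖fderiv ℝ (ψ j) x‖ ≤ 6 / 5 * C / d x := by
    intro j _ x
    have hx := h.pos x
    by_cases hxj : x ∈ closedBall j (2 * d j)
    · have hj := h.pos j
      have h1 := (h.comp (x := x) (y := j) (by rw [mem_closedBall] at hxj; linarith)).1
      refine (hψd j x).trans ?_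
      rw [div_le_div_iff₀ hj hx]
      nlinarith
    · rw [(hψev j x hxj).fderiv_eq]
      simp; positivity
  have hΨ1 : ∀ x ∈ closedBall (0 : Euc N) (3 / 4), 1 ≤ Ψ x := by
    intro x hx
    obtain ⟨j, hj, hxj⟩ := hJ.cover x hx
    have hdj := h.pos j
    have : ψ j x = 1 := by
      refine hf1 _ ?_
      rw [mem_ball, dist_eq_norm] at hxj
      rw [mem_closedBall_zero_iff, norm_smul, norm_inv, norm_of_nonneg hdj.le, inv_mul_eq_div,
        div_le_one hdj]
      exact hxj.le
    rw [← this]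
    exact single_le_sum (f := fun j => ψ j x) (fun i _ => hψ0 i x) hj
  have hΨs : ContDiff ℝ 1 Ψ := ContDiff.sum fun j _ => hψs j
  have hΨ0 : ∀ x, 0 ≤ Ψ x := fun x => sum_nonneg fun j _ => hψ0 j x
  have hΨd : ∀ x, ‖fderiv ℝ Ψ x‖ ≤ ovl N * (6 / 5 * C / d x) := by
    intro x
    have hx := h.pos x
    classical
    have e : fderiv ℝ Ψ x = ∑ j ∈ J, fderiv ℝ (ψ j) x :=
      fderiv_fun_sum fun j _ => ((hψs j).differentiable (by norm_num)) x
    rw [e]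
    set t := J.filter fun j => x ∈ closedBall j (2 * d j) with ht
    have e2 : ∑ j ∈ J, fderiv ℝ (ψ j) x = ∑ j ∈ t, fderiv ℝ (ψ j) x := by
      refine (Finset.sum_subset (Finset.filter_subset _ _) fun j hj hjt => ?_).symm
      rw [(hψev j x (fun hh => hjt (Finset.mem_filter.2 ⟨hj, hh⟩))).fderiv_eq]; simp
    rw [e2]
    have hcard := overlap hN h hJ x t (Finset.filter_subset _ _) (fun j hj => by
      have := (Finset.mem_filter.1 hj).2
      have h2 := h.pos j
      rw [mem_closedBall] at this; linarith)
    calc ‖∑ j ∈ t, fderiv ℝ (ψ j) x‖ ≤ ∑ j ∈ t, 6 / 5 * C / d x :=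
          norm_sum_le_of_le _ fun j hj => hψd2 j (Finset.mem_filter.1 hj).1 x
      _ = t.card * (6 / 5 * C / d x) := by rw [sum_const, nsmul_eq_mul]
      _ ≤ _ := by gcongr
  refine ⟨fun j x => ψ j x / Ψ x, ?_, ?_, ?_, ?_, ?_⟩
  · exact fun j _ x => div_nonneg (hψ0 j x) (hΨ0 x)
  · intro x hx
    rw [← Finset.sum_div]
    exact div_self (by have := hΨ1 x hx; positivity)
  · intro j _ x hx
    exact (hψs j).contDiffAt.div hΨs.contDiffAt (by have := hΨ1 x hx; positivity)
  · intro j hj x hx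
    have h1 := hΨ1 x hx
    have hne : Ψ x ≠ 0 := by positivity
    have hdx := h.pos x
    have hd := ((((hψs j).differentiable (by norm_num)) x).hasFDerivAt).mul
      ((hasDerivAt_inv hne).comp_hasFDerivAt x ((hΨs.differentiable (by norm_num)) x).hasFDerivAt)
    have hfun : (fun x => ψ j x / Ψ x) = fun x => ψ j x * (Ψ x)⁻¹ := by ext; rw [div_eq_mul_inv]
    rw [hfun, show fderiv ℝ (fun x => ψ j x * (Ψ x)⁻¹) x = _ from hd.fderiv]
    have hi1 : (Ψ x)⁻¹ ≤ 1 := inv_le_one_of_one_le₀ h1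
    have hi0 : 0 ≤ (Ψ x)⁻¹ := inv_nonneg.2 (hΨ0 x)
    have b1 := hψd2 j hj x
    have b2 := hΨd x
    refine (norm_add_le _ _).trans ?_
    rw [norm_smul, norm_smul, norm_smul, norm_of_nonneg (hψ0 j x), Function.comp_apply, norm_of_nonneg hi0,
      norm_neg, norm_inv, norm_pow, norm_of_nonneg (hΨ0 x)]
    have hq : (Ψ x ^ 2)⁻¹ ≤ 1 := inv_le_one_of_one_le₀ (one_le_pow₀ h1)
    have hq0 : 0 ≤ (Ψ x ^ 2)⁻¹ := by positivity
    calc ψ j x * ((Ψ x ^ 2)⁻¹ * ‖fderiv ℝ Ψ x‖) + (Ψ x)⁻¹ * ‖fderiv ℝ (ψ j) x‖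
        ≤ 1 * (1 * (ovl N * (6 / 5 * C / d x))) + 1 * (6 / 5 * C / d x) := by
          gcongr
          exact hψ1 j x
      _ = _ := by ring
  · intro j _ x hx
    filter_upwards [hψev j x hx] with y hy
    simp [hy]

/-! ### Local Sobolev regularity -/

def H1At (f : Euc N → Euc N) (p : Euc N) : Prop :=
  ∃ ε > (0:ℝ), (∀ x ∈ ball p ε, DifferentiableAt ℝ f x) ∧
    ∫⁻ x in ball p ε, (ofReal (‖f x‖ ^ 2) + ofReal (‖fderiv ℝ f x‖ ^ 2)) ≠ ⊤

lemma gradm_apply (u : Euc N → Euc N) (x : Euc N) (i j : Fin N) : gradm u x i j = fderiv ℝ u x (ev j) i := rfl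

lemma norm_fderiv_le_grad (u : Euc N → Euc N) (x : Euc N) : ‖fderiv ℝ u x‖ ≤ frobNorm (gradm u x) := by
  refine opNorm_le_bound _ (frobNorm_nonneg _) fun y => ?_
  refine (pow_le_pow_iff_left₀ (norm_nonneg _) (by have := frobNorm_nonneg (gradm u x); positivity) two_ne_zero).1 ?_
  rw [mul_pow, frobNorm_sq, EuclideanSpace.norm_sq_eq, EuclideanSpace.norm_sq_eq, frob, Finset.sum_mul]
  refine sum_le_sum fun i _ => ?_
  have e : fderiv ℝ u x y i = ∑ j, gradm u x i j * y j := by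
    conv_lhs => rw [← sum_ev y]
    rw [map_sum]
    simp only [map_smul, gradm_apply]
    rw [WithLp.ofLp_sum, Finset.sum_apply]
    refine sum_congr rfl fun j _ => ?_
    simp [mul_comm]
  rw [e, norm_eq_abs, sq_abs]
  refine (Finset.sum_mul_sq_le_sq_mul_sq _ _ _).trans (le_of_eq ?_)
  simp only [norm_eq_abs, sq_abs]
  simp only [sq]

lemma grad_le_norm_fderiv (u : Euc N → Euc N) (x : Euc N) :
    frobNorm (gradm u x) ^ 2 ≤ N * N * ‖fderiv ℝ u x‖ ^ 2 := by
  rw [frobNorm_sq, frob]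
  have : ∀ i j, gradm u x i j * gradm u x i j ≤ ‖fderiv ℝ u x‖ ^ 2 := by
    intro i j
    rw [← sq, ← sq_abs (gradm u x i j), gradm_apply]
    refine pow_le_pow_left₀ (abs_nonneg _) ?_ 2
    refine (abs_coord_le _ i).trans (((fderiv ℝ u x).le_opNorm _).trans ?_)
    rw [norm_ev, mul_one]
  calc _ ≤ ∑ i : Fin N, ∑ j : Fin N, ‖fderiv ℝ u x‖ ^ 2 :=
        sum_le_sum fun i _ => sum_le_sum fun j _ => this i j
    _ = _ := by simp; ring

lemma H1At.mono {f : Euc N → Euc N} {p : Euc N} (h : H1At f p) {η : ℝ} (hη : 0 < η) :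
    ∃ ε > (0:ℝ), ε ≤ η ∧ (∀ x ∈ ball p ε, DifferentiableAt ℝ f x) ∧
    ∫⁻ x in ball p ε, (ofReal (‖f x‖ ^ 2) + ofReal (‖fderiv ℝ f x‖ ^ 2)) ≠ ⊤ := by
  obtain ⟨ε, hε, h1, h2⟩ := h
  refine ⟨min ε η, lt_min hε hη, min_le_right _ _, fun x hx => h1 x (ball_subset_ball (min_le_left _ _) hx), ?_⟩
  exact ne_top_of_le_ne_top h2 (lintegral_mono_set (ball_subset_ball (min_le_left _ _)))

lemma H1At.congr {f g : Euc N → Euc N} {p : Euc N} (h : H1At f p) (hfg : f =ᶠ[𝓝 p] g) : H1At g p := by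
  obtain ⟨η, hη, hsub⟩ := Metric.eventually_nhds_iff_ball.1 hfg
  obtain ⟨ε, hε, hεη, h1, h2⟩ := h.mono hη
  have hev : ∀ x ∈ ball p ε, f =ᶠ[𝓝 x] g := fun x hx => by
    filter_upwards [isOpen_ball.mem_nhds hx] with y hy
    exact hsub y (ball_subset_ball hεη hy)
  refine ⟨ε, hε, fun x hx => (h1 x hx).congr_of_eventuallyEq (hev x hx).symm, ?_⟩
  convert h2 using 1
  refine setLIntegral_congr_fun measurableSet_ball fun x hx => ?_
  rw [(hev x hx).fderiv_eq, (hev x hx).eq_of_nhds]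

lemma sq_add_le (a b : ℝ) : (a + b) ^ 2 ≤ 2 * a ^ 2 + 2 * b ^ 2 := by nlinarith [sq_nonneg (a - b)]

lemma H1At.add {f g : Euc N → Euc N} {p : Euc N} (hf : H1At f p) (hg : H1At g p) :
    H1At (fun x => f x + g x) p := by
  obtain ⟨η, hη, h1, h2⟩ := hf
  obtain ⟨ε, hε, hεη, h3, h4⟩ := hg.mono hη
  refine ⟨ε, hε, fun x hx => (h1 x (ball_subset_ball hεη hx)).add (h3 x hx), ?_⟩
  have h2' := ne_top_of_le_ne_top h2 (lintegral_mono_set (ball_subset_ball hεη))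
  have h5 : ∫⁻ x in ball p ε, ofReal 2 * ((ofReal (‖f x‖ ^ 2) + ofReal (‖fderiv ℝ f x‖ ^ 2)) +
      (ofReal (‖g x‖ ^ 2) + ofReal (‖fderiv ℝ g x‖ ^ 2))) ≠ ⊤ := by
    rw [lintegral_const_mul' _ _ (by simp)]
    refine mul_ne_top (by simp) ?_
    rw [lintegral_add_left']
    · exact add_ne_top.2 ⟨h2', h4⟩
    · have hcf : ContinuousOn f (ball p ε) := fun x hx =>
        (h1 x (ball_subset_ball hεη hx)).continuousAt.continuousWithinAt
      refine AEMeasurable.add (f := fun x => ofReal (‖f x‖ ^ 2))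
        (g := fun x => ofReal (‖fderiv ℝ f x‖ ^ 2)) ?_ ?_
      · exact ((hcf.norm.pow 2).aemeasurable measurableSet_ball).ennreal_ofReal
      · exact ((measurable_fderiv ℝ f).norm.pow_const 2).ennreal_ofReal.aemeasurable
  refine ne_top_of_le_ne_top h5 (setLIntegral_mono' measurableSet_ball fun x hx => ?_)
  rw [fderiv_fun_add (h1 x (ball_subset_ball hεη hx)) (h3 x hx)]
  rw [← ofReal_add (by positivity) (by positivity), ← ofReal_add (by positivity) (by positivity),
    ← ofReal_add (by positivity) (by positivity), ← ofReal_add (by positivity) (by positivity),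
    ← ofReal_mul (by norm_num)]
  apply ofReal_le_ofReal
  have a1 := pow_le_pow_left₀ (norm_nonneg _) (norm_add_le (f x) (g x)) 2
  have a2 := pow_le_pow_left₀ (norm_nonneg _) (norm_add_le (fderiv ℝ f x) (fderiv ℝ g x)) 2
  nlinarith [sq_add_le ‖f x‖ ‖g x‖, sq_add_le ‖fderiv ℝ f x‖ ‖fderiv ℝ g x‖]

lemma ContDiffAt.bounds {F : Type*} [NormedAddCommGroup F] [NormedSpace ℝ F] {φ : Euc N → F} {p : Euc N}
    (h : ContDiffAt ℝ 1 φ p) : ∃ ε > (0:ℝ), ∃ M > (0:ℝ), ∀ x ∈ ball p ε, DifferentiableAt ℝ φ x ∧ ‖φ x‖ ≤ M ∧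
      ‖fderiv ℝ φ x‖ ≤ M := by
  have h1 : ∀ᶠ x in 𝓝 p, ContDiffAt ℝ 1 φ x := h.eventually (by simp)
  have h2 : ∀ᶠ x in 𝓝 p, ‖φ x‖ < ‖φ p‖ + 1 :=
    h.continuousAt.norm.eventually_lt continuousAt_const (by linarith)
  have h3 : ∀ᶠ x in 𝓝 p, ‖fderiv ℝ φ x‖ < ‖fderiv ℝ φ p‖ + 1 :=
    (h.continuousAt_fderiv one_ne_zero).norm.eventually_lt continuousAt_const (by linarith)
  obtain ⟨ε, hε, hb⟩ := Metric.eventually_nhds_iff_ball.1 (h1.and (h2.and h3))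
  refine ⟨ε, hε, ‖φ p‖ + ‖fderiv ℝ φ p‖ + 1, by positivity, fun x hx => ?_⟩
  obtain ⟨b1, b2, b3⟩ := hb x hx
  exact ⟨b1.differentiableAt (by norm_num), by linarith [norm_nonneg (fderiv ℝ φ p)],
    by linarith [norm_nonneg (φ p)]⟩

lemma H1At.of_contDiffAt {f : Euc N → Euc N} {p : Euc N} (h : ContDiffAt ℝ 1 f p) : H1At f p := by
  obtain ⟨ε, hε, M, hM, hb⟩ := ContDiffAt.bounds h
  refine ⟨ε, hε, fun x hx => (hb x hx).1, ?_⟩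
  refine ne_top_of_le_ne_top (b := ∫⁻ x in ball p ε, (ofReal (M ^ 2) + ofReal (M ^ 2))) ?_
    (setLIntegral_mono' measurableSet_ball fun x hx => ?_)
  · rw [setLIntegral_const]
    exact mul_ne_top (by simp) measure_ball_lt_top.ne
  · gcongr
    · exact (hb x hx).2.1
    · exact (hb x hx).2.2

lemma H1At.smul {φ : Euc N → ℝ} {f : Euc N → Euc N} {p : Euc N} (hφ : ContDiffAt ℝ 1 φ p) (hf : H1At f p) :
    H1At (fun x => φ x • f x) p := by
  obtain ⟨η, hη, M, hM, hb⟩ := ContDiffAt.bounds hφ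
  obtain ⟨ε, hε, hεη, h3, h4⟩ := hf.mono hη
  have hb' := fun x (hx : x ∈ ball p ε) => hb x (ball_subset_ball hεη hx)
  refine ⟨ε, hε, fun x hx => (hb' x hx).1.smul (h3 x hx), ?_⟩
  have h5 : ∫⁻ x in ball p ε, ofReal (3 * M ^ 2) * (ofReal (‖f x‖ ^ 2) +
      ofReal (‖fderiv ℝ f x‖ ^ 2)) ≠ ⊤ := by
    rw [lintegral_const_mul' _ _ ofReal_ne_top]
    exact mul_ne_top ofReal_ne_top h4
  refine ne_top_of_le_ne_top h5 (setLIntegral_mono' measurableSet_ball fun x hx => ?_)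
  obtain ⟨b1, b2, b3⟩ := hb' x hx
  rw [← ofReal_add (by positivity) (by positivity), ← ofReal_add (by positivity) (by positivity),
    ← ofReal_mul (by positivity)]
  apply ofReal_le_ofReal
  have e1 : ‖φ x • f x‖ ≤ M * ‖f x‖ := by rw [norm_smul]; gcongr
  have e2 : ‖fderiv ℝ (fun x => φ x • f x) x‖ ≤ M * ‖fderiv ℝ f x‖ + M * ‖f x‖ := by
    rw [fderiv_fun_smul b1 (h3 x hx)]
    refine (norm_add_le _ _).trans (add_le_add ?_ ?_)
    · rw [norm_smul]; gcongr
    · refine (norm_smulRight_apply _ _).le.trans ?_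
      gcongr
  have a1 := pow_le_pow_left₀ (norm_nonneg _) e1 2
  have a2 := pow_le_pow_left₀ (norm_nonneg _) e2 2
  nlinarith [sq_add_le (M * ‖fderiv ℝ f x‖) (M * ‖f x‖), sq_nonneg (M * ‖fderiv ℝ f x‖)]

lemma H1At.sum {ι : Type*} (s : Finset ι) (f : ι → Euc N → Euc N) {p : Euc N} (h : ∀ i ∈ s, H1At (f i) p) :
    H1At (fun x => ∑ i ∈ s, f i x) p := by
  classical
  induction s using Finset.induction_on with
  | empty => simpa using H1At.of_contDiffAt (contDiffAt_const (c := (0 : Euc N)))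
  | insert a s ha ih =>
    have h1 := (h a (Finset.mem_insert_self _ _)).add (ih fun i hi => h i (Finset.mem_insert_of_mem hi))
    simpa [Finset.sum_insert ha] using h1

lemma H1At.diff {f : Euc N → Euc N} {p : Euc N} (h : H1At f p) : DifferentiableAt ℝ f p := by
  obtain ⟨ε, hε, h1, _⟩ := h
  exact h1 p (mem_ball_self hε)

lemma AdmissiblePair.h1At {Ω K : Set (Euc N)} {u : Euc N → Euc N} (h : AdmissiblePair Ω u K) {p : Euc N}
    (hp : p ∈ Ω \ K) : H1At u p := by
  obtain ⟨ε, hε, hsub, hInt⟩ := h.locSobolev p hp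
  refine ⟨ε, hε, fun x hx => h.diffOn x (hsub hx), ?_⟩
  refine ne_top_of_le_ne_top hInt.lintegral_lt_top.ne (lintegral_mono fun x => ?_)
  rw [← ofReal_add (by positivity) (by positivity)]
  apply ofReal_le_ofReal
  have := pow_le_pow_left₀ (norm_nonneg _) (norm_fderiv_le_grad u x) 2
  linarith

lemma AdmissiblePair.of_h1At {Ω K : Set (Euc N)} {u : Euc N → Euc N} (hΩ : IsOpen Ω) (hK : RelClosedIn K Ω)
    (h : ∀ p ∈ Ω \ K, H1At u p) : AdmissiblePair Ω u K := by
  refine ⟨hΩ, hK, fun p hp => (h p hp).diff, fun p hp => ?_⟩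
  obtain ⟨η, hη, hsub⟩ := Metric.isOpen_iff.1 (isOpen_diff_of_relclosed hΩ hK.2) p hp
  obtain ⟨ε, hε, hεη, h1, h2⟩ := (h p hp).mono hη
  refine ⟨ε, hε, (ball_subset_ball hεη).trans hsub, ?_⟩
  have hcf : ContinuousOn u (ball p ε) := fun x hx => (h1 x hx).continuousAt.continuousWithinAt
  have hm : AEStronglyMeasurable (fun y => ‖u y‖ ^ 2 + frobNorm (gradm u y) ^ 2) (volume.restrict (ball p ε)) :=
    ((hcf.norm.pow 2).aestronglyMeasurable measurableSet_ball).add (measurable_gradm_sq u).aestronglyMeasurable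
  refine ⟨hm, ?_⟩
  rw [hasFiniteIntegral_iff_ofReal (Eventually.of_forall fun x => by positivity)]
  have h5 : ∫⁻ x in ball p ε, ofReal (1 + N * N) * (ofReal (‖u x‖ ^ 2) +
      ofReal (‖fderiv ℝ u x‖ ^ 2)) < ⊤ := by
    rw [lintegral_const_mul' _ _ (by simp)]
    exact (mul_ne_top (by simp) h2).lt_top
  refine lt_of_le_of_lt (lintegral_mono fun x => ?_) h5
  rw [← ofReal_add (by positivity) (by positivity), ← ofReal_mul (by positivity)]
  apply ofReal_le_ofReal
  have := grad_le_norm_fderiv u x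
  nlinarith [sq_nonneg ‖u x‖, sq_nonneg ‖fderiv ℝ u x‖, mul_nonneg (Nat.cast_nonneg (α := ℝ) N) (Nat.cast_nonneg (α := ℝ) N),
    mul_nonneg (mul_nonneg (Nat.cast_nonneg (α := ℝ) N) (Nat.cast_nonneg (α := ℝ) N)) (sq_nonneg ‖u x‖)]

/-! ### Local rigid fits and comparison of neighbours -/

structure Fit (u : Euc N → Euc N) (K : Set (Euc N)) (z : Euc N) (r C θ : ℝ) (b : Euc N)
    (A : Euc N →L[ℝ] Euc N) (G : Set (Euc N)) : Prop where
  skew : ∀ x, ⟪A x, x⟫ = 0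
  sub : G ⊆ ball z r
  meas : MeasurableSet G
  vol : volume (ball z r \ G) ≤ ofReal (θ * r ^ N)
  est : ∫⁻ x in G, ofReal (‖u x - (b + A x)‖ ^ 2) ≤
          ofReal (C * r ^ 2) * ∫⁻ x in ball z r \ K, dens u x
  free : K ∩ ball z r = ∅ → G = ball z r
  star : ∃ x1 ∈ ball z r, ∀ x ∈ G, ∀ s ∈ Icc (0:ℝ) 1, x1 + s • (x - x1) ∈ ball z r \ K

lemma exists_fit (hN : 2 ≤ N) : ∃ C > (0:ℝ), ∀ θ > (0:ℝ), ∃ δ > (0:ℝ),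
    ∀ (z : Euc N) (r : ℝ), 0 < r → ∀ (K : Set (Euc N)) (u : Euc N → Euc N), IsClosed K →
      (∀ x ∈ ball z r \ K, DifferentiableAt ℝ u x) →
      (∫⁻ x in ball z r \ K, dens u x) ≠ ⊤ → Hm N (K ∩ ball z r) ≤ ofReal (δ * r ^ (N - 1)) →
      ∃ b A G, Fit u K z r C θ b A G := by
  obtain ⟨δ0, hδ0, C, hC, H⟩ := kp hN 1 le_rfl
  refine ⟨C, hC, fun θ hθ => ⟨min δ0 (θ / C), lt_min hδ0 (by positivity), ?_⟩⟩
  intro z r hr K u hK hu hfin hH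
  obtain ⟨b, A, hA, G, hG, hGm, hGv, hGe, hGf, hGs⟩ := H z r hr (ball z r) K u (convex_ball _ _) isOpen_ball
    Subset.rfl (by rw [one_mul]) (by rw [hK.closure_eq]; exact inter_subset_left) hu hfin
    (hH.trans (ofReal_le_ofReal (by gcongr; exact min_le_left _ _)))
  refine ⟨b, A, G, hA, hG, hGm, hGv.trans ?_, hGe, hGf, hGs⟩
  refine (mul_le_mul_right hH _).trans ?_
  rw [← ofReal_mul (by positivity)]
  apply ofReal_le_ofReal
  have h1 : min δ0 (θ / C) ≤ θ / C := min_le_right _ _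
  calc C * r * (min δ0 (θ / C) * r ^ (N - 1)) ≤ C * r * (θ / C * r ^ (N - 1)) := by gcongr
    _ = θ * (r ^ (N - 1) * r) := by field_simp
    _ = θ * r ^ N := by rw [← pow_succ]; congr 2; omega

lemma lintegral_sq_tri {S : Set (Euc N)} {f g : Euc N → ℝ} {w : Euc N → ℝ}
    (hf : AEMeasurable (fun x => ofReal (f x ^ 2)) (volume.restrict S)) (hS : MeasurableSet S)
    (hw : ∀ x ∈ S, |w x| ≤ |f x| + |g x|) :
    ∫⁻ x in S, ofReal (w x ^ 2) ≤ (ofReal 2 * ∫⁻ x in S, ofReal (f x ^ 2)) +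
      ofReal 2 * ∫⁻ x in S, ofReal (g x ^ 2) := by
  rw [← lintegral_const_mul' _ _ ofReal_ne_top, ← lintegral_const_mul' _ _ ofReal_ne_top,
    ← lintegral_add_left' (hf.const_mul _)]
  refine setLIntegral_mono' hS fun x hx => ?_
  rw [← ofReal_mul (by norm_num), ← ofReal_mul (by norm_num),
    ← ofReal_add (by positivity) (by positivity)]
  apply ofReal_le_ofReal
  have h1 := pow_le_pow_left₀ (abs_nonneg _) (hw x hx) 2
  have h2 := sq_add_le |f x| |g x|
  rw [sq_abs, sq_abs] at h2
  rw [sq_abs] at h1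
  linarith

lemma fit_compare (hN : 2 ≤ N) : ∃ θ > (0:ℝ), ∃ C' > (0:ℝ), ∀ (C : ℝ), 0 < C →
    ∀ (u : Euc N → Euc N) (K : Set (Euc N)) (z z' y : Euc N) (r r' ρ : ℝ) (b b' : Euc N)
    (A A' : Euc N →L[ℝ] Euc N) (G G' : Set (Euc N)),
    Fit u K z r C θ b A G → Fit u K z' r' C θ b' A' G' → 0 < ρ → r ≤ 20 * ρ → r' ≤ 20 * ρ → 0 < r → 0 < r' →
    ball y ρ ⊆ ball z r → ball y ρ ⊆ ball z' r' → IsClosed K →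
    (∀ x ∈ ball z r \ K, DifferentiableAt ℝ u x) → volume K = 0 →
    ofReal (‖(b - b') + (A - A') y‖ ^ 2 + ρ ^ 2 * ‖A - A'‖ ^ 2) * ofReal (ρ ^ N) ≤
      ofReal (C' * C * ρ ^ 2) * ((∫⁻ x in ball z r \ K, dens u x) + ∫⁻ x in ball z' r' \ K, dens u x) := by
  obtain ⟨δ1, hδ1, C1, hC1, H⟩ := aff_sup hN
  refine ⟨δ1 / 2 / 20 ^ N, by positivity, C1 * (2 * 400), by positivity, ?_⟩
  intro C hC u K z z' y r r' ρ b b' A A' G G' hF hF' hρ hr hr' hr0 hr0' hs hs' hK hu hK0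
  have hvol : ∀ s : ℝ, 0 < s → s ≤ 20 * ρ → δ1 / 2 / 20 ^ N * s ^ N ≤ δ1 / 2 * ρ ^ N := by
    intro s hs0 hs
    have : s ^ N ≤ (20 * ρ) ^ N := by gcongr
    calc δ1 / 2 / 20 ^ N * s ^ N ≤ δ1 / 2 / 20 ^ N * (20 * ρ) ^ N := by gcongr
      _ = _ := by rw [mul_pow]; field_simp
  have h1 := H y ρ hρ (b - b') (A - A') (G ∩ G') (hF.meas.inter hF'.meas) (by
    have : ball y ρ \ (G ∩ G') ⊆ (ball z r \ G) ∪ (ball z' r' \ G') := by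
      rintro x ⟨hx1, hx2⟩
      by_cases hx : x ∈ G
      · exact Or.inr ⟨hs' hx1, fun h => hx2 ⟨hx, h⟩⟩
      · exact Or.inl ⟨hs hx1, hx⟩
    refine (measure_mono this).trans ((measure_union_le _ _).trans ((add_le_add hF.vol hF'.vol).trans ?_))
    rw [← ofReal_add (by positivity) (by positivity)]
    apply ofReal_le_ofReal
    linarith [hvol r hr0 hr, hvol r' hr0' hr'])
  refine h1.trans ?_
  have hGm := hF.meas.inter hF'.meas
  have hcont : ContinuousOn u (ball z r \ K) := fun x hx => (hu x hx).continuousAt.continuousWithinAt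
  have haem : AEMeasurable (fun x => ofReal (‖u x - (b + A x)‖ ^ 2)) (volume.restrict (ball z r)) := by
    have e : volume.restrict (ball z r) = volume.restrict (ball z r \ K) := by
      refine Measure.restrict_congr_set ?_
      exact (diff_null_ae_eq_self hK0).symm
    rw [e]
    refine (ContinuousOn.aemeasurable ?_ (measurableSet_ball.diff hK.measurableSet)).ennreal_ofReal
    exact (hcont.sub (by fun_prop)).norm.pow 2
  have h2 := lintegral_sq_tri (S := G ∩ G') (f := fun x => ‖u x - (b + A x)‖) (g := fun x => ‖u x - (b' + A' x)‖)
    (w := fun x => ‖(b - b') + (A - A') x‖)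
    (haem.mono_measure (Measure.restrict_mono (inter_subset_left.trans hF.sub) le_rfl)) hGm (fun x _ => by
      rw [abs_norm, abs_norm, abs_norm]
      have : (b - b') + (A - A') x = (u x - (b' + A' x)) - (u x - (b + A x)) := by
        simp only [ContinuousLinearMap.sub_apply]; abel
      rw [this]
      exact (norm_sub_le _ _).trans (by rw [add_comm]))
  have h3 : ∫⁻ x in G ∩ G', ofReal (‖u x - (b + A x)‖ ^ 2) ≤
      ofReal (C * 400 * ρ ^ 2) * ∫⁻ x in ball z r \ K, dens u x := by
    refine (lintegral_mono_set inter_subset_left).trans (hF.est.trans ?_)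
    refine mul_le_mul_left (ofReal_le_ofReal ?_) _
    have : r ^ 2 ≤ (20 * ρ) ^ 2 := by gcongr
    nlinarith
  have h4 : ∫⁻ x in G ∩ G', ofReal (‖u x - (b' + A' x)‖ ^ 2) ≤
      ofReal (C * 400 * ρ ^ 2) * ∫⁻ x in ball z' r' \ K, dens u x := by
    refine (lintegral_mono_set inter_subset_right).trans (hF'.est.trans ?_)
    refine mul_le_mul_left (ofReal_le_ofReal ?_) _
    have : r' ^ 2 ≤ (20 * ρ) ^ 2 := by gcongr
    nlinarith
  refine (mul_le_mul_right (h2.trans (add_le_add (mul_le_mul_right h3 _) (mul_le_mul_right h4 _))) _).trans ?_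
  rw [← mul_assoc, ← mul_assoc, ← ofReal_mul (by norm_num), ← mul_add, ← mul_assoc,
    ← ofReal_mul hC1.le]
  apply le_of_eq
  congr 2
  ring

/-! ### Gluing estimates -/

lemma frobNorm_smulRight (L : Euc N →L[ℝ] ℝ) (c : Euc N) : frobNorm (eL (L.smulRight c)) ≤ N * (‖L‖ * ‖c‖) := by
  refine (frobNorm_eL_le _).trans ?_
  rw [norm_smulRight_apply]

lemma hasFDerivAt_rigid (b : Euc N) (A : Euc N →L[ℝ] Euc N) (x : Euc N) :
    HasFDerivAt (fun y => b + A y) A x := by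
  simpa using A.hasFDerivAt.const_add b

lemma dens_rigid {A : Euc N →L[ℝ] Euc N} (hA : ∀ x, ⟪A x, x⟫ = 0) (b : Euc N) (x : Euc N) :
    dens (fun y => b + A y) x = 0 := by
  rw [dens, eSym_eq, (hasFDerivAt_rigid b A x).fderiv, eL_skew A hA, frobNorm_zero]; simp

lemma dens_glue {ι : Type*} (t : Finset ι) (φ : ι → Euc N → ℝ) (f : ι → Euc N → Euc N) (v : Euc N → Euc N)
    (b : Euc N) {A : Euc N →L[ℝ] Euc N} (hA : ∀ x, ⟪A x, x⟫ = 0) {x : Euc N} {M : ℝ}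
    (hv : v =ᶠ[𝓝 x] fun y => (b + A y) + ∑ j ∈ t, φ j y • (f j y - (b + A y)))
    (hφ : ∀ j ∈ t, DifferentiableAt ℝ (φ j) x) (hf : ∀ j ∈ t, DifferentiableAt ℝ (f j) x)
    (h0 : ∀ j ∈ t, 0 ≤ φ j x) (h1 : ∀ j ∈ t, φ j x ≤ 1) (hM : ∀ j ∈ t, ‖fderiv ℝ (φ j) x‖ ≤ M) :
    dens v x ≤ ∑ j ∈ t, (ofReal (2 * t.card) * dens (f j) x +
      ofReal (2 * t.card * (N * M) ^ 2) * ofReal (‖f j x - (b + A x)‖ ^ 2)) := by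
  have hd : HasFDerivAt (fun y => (b + A y) + ∑ j ∈ t, φ j y • (f j y - (b + A y)))
      (A + ∑ j ∈ t, (φ j x • (fderiv ℝ (f j) x - A) + (fderiv ℝ (φ j) x).smulRight (f j x - (b + A x)))) x := by
    refine (hasFDerivAt_rigid b A x).add (HasFDerivAt.fun_sum fun j hj => ?_)
    exact (hφ j hj).hasFDerivAt.smul ((hf j hj).hasFDerivAt.sub (hasFDerivAt_rigid b A x))
  have e1 : eSym v x = ∑ j ∈ t, (φ j x • eSym (f j) x + eL ((fderiv ℝ (φ j) x).smulRight (f j x - (b + A x)))) := by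
    rw [eSym_eq, hv.fderiv_eq, hd.fderiv]
    simp only [map_add, map_sum, map_smul, map_sub, eL_skew A hA, zero_add, sub_zero, eSym_eq]
  have e2 : frobNorm (eSym v x) ≤ ∑ j ∈ t, (frobNorm (eSym (f j) x) + N * M * ‖f j x - (b + A x)‖) := by
    rw [e1]
    refine (frobNorm_sum_le _ _).trans (sum_le_sum fun j hj => (frobNorm_add_le _ _).trans ?_)
    refine add_le_add ?_ ((frobNorm_smulRight _ _).trans ?_)
    · rw [frobNorm_smul, abs_of_nonneg (h0 j hj)]
      exact mul_le_of_le_one_left (frobNorm_nonneg _) (h1 j hj)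
    · rw [mul_assoc]
      have := hM j hj
      gcongr
  have e3 : frobNorm (eSym v x) ^ 2 ≤ ∑ j ∈ t, (2 * t.card * frobNorm (eSym (f j) x) ^ 2 +
      2 * t.card * (N * M) ^ 2 * ‖f j x - (b + A x)‖ ^ 2) := by
    refine (pow_le_pow_left₀ (frobNorm_nonneg _) e2 2).trans ((sq_sum_le_card_mul_sum_sq).trans ?_)
    rw [mul_sum]
    refine sum_le_sum fun j _ => ?_
    have h2 := sq_add_le (frobNorm (eSym (f j) x)) (N * M * ‖f j x - (b + A x)‖)
    have h3 : (0:ℝ) ≤ t.card := by positivity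
    nlinarith
  refine (ofReal_le_ofReal e3).trans (le_of_eq ?_)
  rw [ENNReal.ofReal_sum_of_nonneg (fun j _ => by positivity)]
  refine sum_congr rfl fun j _ => ?_
  rw [ofReal_add (by positivity) (by positivity), dens, ← ofReal_mul (by positivity),
    ← ofReal_mul (by positivity)]

section
/-! ### The smoothed function -/

structure Glue (u : Euc N → Euc N) (K : Set (Euc N)) (d : Euc N → ℝ) (σ τ : ℝ) (J : Finset (Euc N))
    (φ : Euc N → Euc N → ℝ) (Cφ C θ : ℝ) (b : Euc N → Euc N) (A : Euc N → Euc N →L[ℝ] Euc N)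
    (G : Euc N → Set (Euc N)) : Prop where
  sc : ScaleFn d σ τ
  ce : Centers d J
  pu : PartUnity d J Cφ φ
  fit : ∀ j ∈ J, Fit u K j (10 * d j) C θ (b j) (A j) (G j)
  tau : τ ≤ 1 / 400
  closed : IsClosed K
  vol : volume K = 0
  h1 : ∀ p ∈ ball (0 : Euc N) (7 / 8) \ K, H1At u p
  Cpos : 0 < C
  Cφpos : 0 < Cφ

open Classical in
def piece (u : Euc N → Euc N) (K : Set (Euc N)) (d : Euc N → ℝ) (b : Euc N → Euc N)
    (A : Euc N → Euc N →L[ℝ] Euc N) (j : Euc N) : Euc N → Euc N :=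
  if K ∩ ball j (20 * d j) = ∅ then u else fun x => b j + A j x

def glued (u : Euc N → Euc N) (K : Set (Euc N)) (d : Euc N → ℝ) (J : Finset (Euc N))
    (φ : Euc N → Euc N → ℝ) (b : Euc N → Euc N)
    (A : Euc N → Euc N →L[ℝ] Euc N) (x : Euc N) : Euc N := ∑ j ∈ J, φ j x • piece u K d b A j x

variable {u : Euc N → Euc N} {K : Set (Euc N)} {d : Euc N → ℝ} {σ τ : ℝ} {J : Finset (Euc N)}
    {φ : Euc N → Euc N → ℝ} {Cφ C θ : ℝ} {b : Euc N → Euc N} {A : Euc N → Euc N →L[ℝ] Euc N}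
    {G : Euc N → Set (Euc N)}

lemma ScaleFn.near (h : ScaleFn d σ τ) {x j k : Euc N} (hk : x ∈ ball k (d k)) (hj : x ∈ closedBall j (2 * d j)) :
    dist j k ≤ 4 * d k ∧ d j ≤ 11 / 10 * d k ∧ d k ≤ 11 / 10 * d j := by
  have h1 := abs_le.1 (h.lip j k)
  rw [mem_ball] at hk
  rw [mem_closedBall] at hj
  have h2 := dist_triangle_left j k x
  have h3 := h.pos j
  have h4 := h.pos k
  refine ⟨?_, ?_, ?_⟩ <;> linarith [h1.1, h1.2]

lemma Glue.ball_sub (h : Glue u K d σ τ J φ Cφ C θ b A G) {j : Euc N} (hj : j ∈ J) {r : ℝ} (hr : r ≤ 20 * d j) :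
    ball j r ⊆ ball 0 (7 / 8) := by
  refine ball_subset_ball' ?_
  have h1 := mem_closedBall.1 (h.ce.mem j hj)
  have h2 := h.sc.le j
  have h3 := h.tau
  linarith

lemma Glue.not_mem (h : Glue u K d σ τ J φ Cφ C θ b A G) {x j : Euc N} (hx : x ∈ closedBall j (2 * d j))
    (hK : K ∩ ball j (20 * d j) = ∅) : x ∉ K := fun hxK => by
  have : x ∈ K ∩ ball j (20 * d j) := ⟨hxK, by
    have := h.sc.pos j
    rw [mem_ball]; rw [mem_closedBall] at hx; linarith⟩
  rw [hK] at this; exact this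

lemma Glue.piece_h1 (h : Glue u K d σ τ J φ Cφ C θ b A G) {x j : Euc N} (hj : j ∈ J) (hx : x ∈ closedBall j (2 * d j)) :
    H1At (piece u K d b A j) x := by
  unfold piece
  split_ifs with hK
  · refine h.h1 x ⟨h.ball_sub hj le_rfl ?_, h.not_mem hx hK⟩
    have := h.sc.pos j
    rw [mem_ball]; rw [mem_closedBall] at hx; linarith
  · exact H1At.of_contDiffAt (by fun_prop)

lemma Glue.h1At (h : Glue u K d σ τ J φ Cφ C θ b A G) {p : Euc N} (hp : p ∈ ball (0 : Euc N) (3 / 4)) :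
    H1At (glued u K d J φ b A) p := by
  refine H1At.sum J (fun j x => φ j x • piece u K d b A j x) fun j hj => ?_
  by_cases hx : p ∈ closedBall j (2 * d j)
  · exact H1At.smul (h.pu.smooth j hj p (ball_subset_closedBall hp)) (h.piece_h1 hj hx)
  · refine (H1At.of_contDiffAt (contDiffAt_const (c := (0 : Euc N)))).congr ?_
    filter_upwards [h.pu.supp j hj p hx] with y hy
    rw [hy]; simp

lemma Glue.eq_u (h : Glue u K d σ τ J φ Cφ C θ b A G) {p : Euc N} (hp : p ∈ ball (0 : Euc N) (3 / 4))
    (hK : 30 * d p < infDist p K) : glued u K d J φ b A p = u p := by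
  have : ∀ j ∈ J, φ j p • piece u K d b A j p = φ j p • u p := fun j hj => by
    by_cases hx : p ∈ closedBall j (2 * d j)
    · have : K ∩ ball j (20 * d j) = ∅ := by
        rw [eq_empty_iff_forall_notMem]
        rintro q ⟨hq, hqj⟩
        have h1 := infDist_le_dist_of_mem (x := p) hq
        have h2 := abs_le.1 (h.sc.lip j p)
        have h4 := h.sc.pos j
        rw [mem_ball, dist_comm] at hqj
        rw [mem_closedBall] at hx
        have h3 := dist_triangle p j q
        have h5 := dist_comm j p
        linarith [h2.1, h2.2]
      rw [piece, if_pos this]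
    · rw [(h.pu.supp j hj p hx).eq_of_nhds]; simp
  rw [glued, sum_congr rfl this, ← Finset.sum_smul, h.pu.sum p (ball_subset_closedBall hp), one_smul]

/-- distance of the pieces to the central rigid motion -/
lemma Glue.dist_int [NeZero N] (h : Glue u K d σ τ J φ Cφ C θ b A G) {C' : ℝ} (hC' : 0 < C') (hcmp : ∀ (C : ℝ), 0 < C →
    ∀ (u : Euc N → Euc N) (K : Set (Euc N)) (z z' y : Euc N) (r r' ρ : ℝ) (b b' : Euc N)
    (A A' : Euc N →L[ℝ] Euc N) (G G' : Set (Euc N)),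
    Fit u K z r C θ b A G → Fit u K z' r' C θ b' A' G' → 0 < ρ → r ≤ 20 * ρ → r' ≤ 20 * ρ → 0 < r → 0 < r' →
    ball y ρ ⊆ ball z r → ball y ρ ⊆ ball z' r' → IsClosed K →
    (∀ x ∈ ball z r \ K, DifferentiableAt ℝ u x) → volume K = 0 →
    ofReal (‖(b - b') + (A - A') y‖ ^ 2 + ρ ^ 2 * ‖A - A'‖ ^ 2) * ofReal (ρ ^ N) ≤
      ofReal (C' * C * ρ ^ 2) * ((∫⁻ x in ball z r \ K, dens u x) + ∫⁻ x in ball z' r' \ K, dens u x))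
    {j k x₀ : Euc N} (hj : j ∈ J) (hk : k ∈ J)
    (hxk : x₀ ∈ ball k (d k)) (hxj : x₀ ∈ closedBall j (2 * d j)) :
    ∫⁻ x in ball k (d k) ∩ closedBall j (2 * d j), ofReal (‖piece u K d b A j x - (b k + A k x)‖ ^ 2) ≤
      ofReal ((800 * C + 8 * (volume (ball (0 : Euc N) 1)).toReal * C' * C) * d k ^ 2) *
        ∫⁻ x in ball k (20 * d k) \ K, dens u x := by
  obtain ⟨hjk, hd1, hd2⟩ := h.sc.near hxk hxj
  have hdk := h.sc.pos k
  have hdj := h.sc.pos j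
  have hC := h.Cpos
  set V := (volume (ball (0 : Euc N) 1)).toReal with hV
  have hVV : volume (ball (0 : Euc N) 1) = ofReal V := (ofReal_toReal measure_ball_lt_top.ne).symm
  have hV0 : 0 ≤ V := toReal_nonneg
  set E := ∫⁻ x in ball k (20 * d k) \ K, dens u x with hE
  have s1 : ball j (10 * d j) ⊆ ball k (20 * d k) := ball_subset_ball' (by linarith)
  have s2 : ball k (d k) ⊆ ball j (10 * d j) := ball_subset_ball' (by rw [dist_comm] at hjk; linarith)
  have hEj : ∫⁻ x in ball j (10 * d j) \ K, dens u x ≤ E := lintegral_mono_set (diff_subset_diff_left s1)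
  have hEk : ∫⁻ x in ball k (10 * d k) \ K, dens u x ≤ E :=
    lintegral_mono_set (diff_subset_diff_left (ball_subset_ball (by linarith)))
  have hcm := hcmp C hC u K j k k (10 * d j) (10 * d k) (d k) (b j) (b k) (A j) (A k) (G j) (G k)
    (h.fit j hj) (h.fit k hk) hdk (by linarith) (by linarith) (by linarith) (by linarith) s2
    (ball_subset_ball (by linarith)) h.closed
    (fun x hx => (h.h1 x ⟨h.ball_sub hj (by linarith) hx.1, hx.2⟩).diff) h.vol
  set S := ball k (d k) ∩ closedBall j (2 * d j) with hS
  have hSm : MeasurableSet S := measurableSet_ball.inter measurableSet_closedBall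
  set Q := ‖(b j - b k) + (A j - A k) k‖ ^ 2 + d k ^ 2 * ‖A j - A k‖ ^ 2 with hQ
  have hI2 : ∫⁻ x in S, ofReal (‖(b j + A j x) - (b k + A k x)‖ ^ 2) ≤
      ofReal (4 * V * C' * C * d k ^ 2) * E := by
    calc ∫⁻ x in S, ofReal (‖(b j + A j x) - (b k + A k x)‖ ^ 2)
        ≤ ∫⁻ x in S, ofReal (2 * Q) := by
          refine setLIntegral_mono' hSm fun x hx => ofReal_le_ofReal ?_
          have e : (b j + A j x) - (b k + A k x) = ((b j - b k) + (A j - A k) k) + (A j - A k) (x - k) := by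
            simp only [ContinuousLinearMap.sub_apply, map_sub]; abel
          rw [e]
          have h1 : ‖(A j - A k) (x - k)‖ ≤ d k * ‖A j - A k‖ := by
            refine ((A j - A k).le_opNorm _).trans ?_
            rw [mul_comm]
            have : ‖x - k‖ ≤ d k := by rw [← dist_eq_norm]; exact (mem_ball.1 hx.1).le
            gcongr
          have h2 := pow_le_pow_left₀ (norm_nonneg _) ((norm_add_le _ _).trans (add_le_add_right h1 ‖(b j - b k) + (A j - A k) k‖)) 2
          have h3 := sq_add_le ‖(b j - b k) + (A j - A k) k‖ (d k * ‖A j - A k‖)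
          rw [hQ]; linarith [mul_pow (d k) ‖A j - A k‖ 2]
      _ = ofReal (2 * Q) * volume S := by rw [setLIntegral_const]
      _ ≤ ofReal (2 * Q) * (ofReal (d k ^ N) * ofReal V) := by
          gcongr
          refine (measure_mono inter_subset_left).trans ?_
          rw [vol_ball _ hdk.le, hVV]
      _ = ofReal (2 * V) * (ofReal Q * ofReal (d k ^ N)) := by
          rw [ofReal_mul (by norm_num), ofReal_mul (by norm_num)]; ring
      _ ≤ ofReal (2 * V) * (ofReal (C' * C * d k ^ 2) * (E + E)) := by
          refine mul_le_mul_right (hcm.trans (mul_le_mul_right (add_le_add hEj hEk) _)) _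
      _ = ofReal (4 * V * C' * C * d k ^ 2) * E := by
          rw [← two_mul, show (2:ℝ≥0∞) = ofReal 2 by simp, ← mul_assoc, ← mul_assoc, ← ofReal_mul (by positivity),
            ← ofReal_mul (by positivity)]
          congr 2; ring
  unfold piece
  split_ifs with hK
  · have hKj : K ∩ ball j (10 * d j) = ∅ := by
      rw [← subset_empty_iff, ← hK]
      exact inter_subset_inter_right _ (ball_subset_ball (by linarith))
    have hG := (h.fit j hj).free hKj
    have hSG : S ⊆ ball j (10 * d j) := inter_subset_left.trans s2
    have hcont : ContinuousOn u S := fun x hx => (h.h1 x ⟨h.ball_sub hj (by linarith) (hSG hx), fun hxK => by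
      have : x ∈ K ∩ ball j (10 * d j) := ⟨hxK, hSG hx⟩
      rw [hKj] at this; exact this⟩).diff.continuousAt.continuousWithinAt
    have h2 := lintegral_sq_tri (S := S) (f := fun x => ‖u x - (b j + A j x)‖)
      (g := fun x => ‖(b j + A j x) - (b k + A k x)‖) (w := fun x => ‖u x - (b k + A k x)‖)
      (ContinuousOn.aemeasurable ((hcont.sub (by fun_prop)).norm.pow 2) hSm).ennreal_ofReal hSm (fun x _ => by
        rw [abs_norm, abs_norm, abs_norm]
        exact norm_sub_le_norm_sub_add_norm_sub _ _ _)
    refine h2.trans ?_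
    have h3 : ∫⁻ x in S, ofReal (‖u x - (b j + A j x)‖ ^ 2) ≤ ofReal (400 * C * d k ^ 2) * E := by
      refine (lintegral_mono_set (hSG.trans hG.ge)).trans ((h.fit j hj).est.trans ?_)
      refine mul_le_mul' (ofReal_le_ofReal ?_) hEj
      have : (10 * d j) ^ 2 ≤ (20 * d k) ^ 2 := by gcongr ?_ ^ 2; linarith
      nlinarith
    refine (add_le_add (mul_le_mul_right h3 _) (mul_le_mul_right hI2 _)).trans (le_of_eq ?_)
    rw [← mul_assoc, ← mul_assoc, ← ofReal_mul (by norm_num), ← ofReal_mul (by norm_num), ← add_mul,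
      ← ofReal_add (by positivity) (by positivity)]
    congr 2; ring
  · refine hI2.trans ?_
    refine mul_le_mul_left (ofReal_le_ofReal ?_) _
    have : 0 ≤ V * C' * C := by positivity
    gcongr
    nlinarith

lemma PartUnity.le_one (h : PartUnity d J C φ) {j x : Euc N} (hj : j ∈ J) (hx : x ∈ closedBall (0 : Euc N) (3 / 4)) :
    φ j x ≤ 1 := by
  rw [← h.sum x hx]
  exact single_le_sum (f := fun j => φ j x) (fun i hi => h.nonneg i hi x) hj

open Classical in
lemma Glue.local_bound (hN : 2 ≤ N) (h : Glue u K d σ τ J φ Cφ C θ b A G) {D : ℝ} (hD : 0 < D) {k : Euc N} (hk : k ∈ J)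
    (hdist : ∀ j ∈ J, ∀ x₀ ∈ ball k (d k), x₀ ∈ closedBall j (2 * d j) →
      ∫⁻ x in ball k (d k) ∩ closedBall j (2 * d j), ofReal (‖piece u K d b A j x - (b k + A k x)‖ ^ 2) ≤
      ofReal (D * d k ^ 2) * ∫⁻ x in ball k (20 * d k) \ K, dens u x) :
    ∫⁻ x in ball k (d k) ∩ ball 0 (3 / 4), dens (glued u K d J φ b A) x ≤
      ofReal (ovl N * (2 * ovl N + 8 * ovl N * (N * Cφ) ^ 2 * D)) *
        ∫⁻ x in ball k (20 * d k) \ K, dens u x := by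
  set E := ∫⁻ x in ball k (20 * d k) \ K, dens u x with hE
  have hdk := h.sc.pos k
  have hov := ovl_pos (N := N)
  have hCφ := h.Cφpos
  set t := J.filter fun j => (ball k (d k) ∩ closedBall j (2 * d j)).Nonempty with ht
  have htJ : t ⊆ J := Finset.filter_subset _ _
  have htc : (t.card : ℝ) ≤ ovl N := overlap hN h.sc h.ce k t htJ fun j hj => by
    obtain ⟨x, hx1, hx2⟩ := (Finset.mem_filter.1 hj).2
    obtain ⟨h1, h2, h3⟩ := h.sc.near hx1 hx2
    rw [dist_comm]
    have := h.sc.pos j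
    linarith
  set g : Euc N → Euc N → ℝ≥0∞ := fun j x => ofReal (2 * ovl N) * dens (piece u K d b A j) x +
      ofReal (2 * ovl N * (N * (2 * Cφ / d k)) ^ 2) *
        ofReal (‖piece u K d b A j x - (b k + A k x)‖ ^ 2) with hg
  have hpt : ∀ x ∈ ball k (d k) ∩ ball (0 : Euc N) (3 / 4), dens (glued u K d J φ b A) x ≤
      ∑ j ∈ t, (closedBall j (2 * d j)).indicator (g j) x := by
    rintro x ⟨hxk, hx0⟩
    have hx0' := ball_subset_closedBall hx0
    set tx := J.filter fun j => x ∈ closedBall j (2 * d j) with htx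
    have htx1 : tx ⊆ t := fun j hj => Finset.mem_filter.2 ⟨(Finset.mem_filter.1 hj).1, x, hxk, (Finset.mem_filter.1 hj).2⟩
    have htxc : (tx.card : ℝ) ≤ ovl N := le_trans (by exact_mod_cast Finset.card_le_card htx1) htc
    have hzero : ∀ j ∈ J \ tx, φ j =ᶠ[𝓝 x] 0 := fun j hj => by
      obtain ⟨h1, h2⟩ := Finset.mem_sdiff.1 hj
      exact h.pu.supp j h1 x fun h3 => h2 (Finset.mem_filter.2 ⟨h1, h3⟩)
    have hv : glued u K d J φ b A =ᶠ[𝓝 x] fun y => (b k + A k y) + ∑ j ∈ tx, φ j y • (piece u K d b A j y - (b k + A k y)) := by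
      have hall : ∀ᶠ y in 𝓝 x, ∀ j ∈ J \ tx, φ j y = 0 := by
        rw [Finset.eventually_all]
        exact fun j hj => hzero j hj
      filter_upwards [hall, isOpen_ball.mem_nhds hx0] with y hy hyb
      have e1 : ∑ j ∈ J, φ j y • (piece u K d b A j y - (b k + A k y)) =
          ∑ j ∈ tx, φ j y • (piece u K d b A j y - (b k + A k y)) := by
        symm
        refine Finset.sum_subset (Finset.filter_subset _ _) fun j hj hj' => ?_
        rw [hy j (Finset.mem_sdiff.2 ⟨hj, hj'⟩), zero_smul]
      rw [← e1]
      simp only [smul_sub, Finset.sum_sub_distrib, ← Finset.sum_smul, h.pu.sum y (ball_subset_closedBall hyb), one_smul]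
      rw [glued]; abel
    have hgl := dens_glue tx φ (piece u K d b A) (glued u K d J φ b A) (b k) (h.fit k hk).skew (M := 2 * Cφ / d k) hv
      (fun j hj => (h.pu.smooth j (Finset.mem_filter.1 hj).1 x hx0').differentiableAt (by norm_num))
      (fun j hj => (h.piece_h1 (Finset.mem_filter.1 hj).1 (Finset.mem_filter.1 hj).2).diff)
      (fun j hj => h.pu.nonneg j (Finset.mem_filter.1 hj).1 x)
      (fun j hj => h.pu.le_one (Finset.mem_filter.1 hj).1 hx0')
      (fun j hj => by
        refine (h.pu.grad j (Finset.mem_filter.1 hj).1 x hx0').trans ?_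
        have h1 := abs_le.1 (h.sc.lip x k)
        have h2 := mem_ball.1 hxk
        have h3 := h.sc.pos x
        rw [div_le_div_iff₀ h3 hdk]
        nlinarith [h1.1, h1.2])
    refine hgl.trans ?_
    calc _ ≤ ∑ j ∈ tx, g j x := by
          refine sum_le_sum fun j _ => ?_
          refine add_le_add (mul_le_mul_left (ofReal_le_ofReal ?_) _) (mul_le_mul_left (ofReal_le_ofReal ?_) _) <;>
            gcongr
      _ = ∑ j ∈ tx, (closedBall j (2 * d j)).indicator (g j) x :=
          sum_congr rfl fun j hj => by rw [indicator_of_mem (Finset.mem_filter.1 hj).2]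
      _ ≤ _ := Finset.sum_le_sum_of_subset htx1
  have hterm : ∀ j ∈ t, ∫⁻ x in ball k (d k) ∩ closedBall j (2 * d j), g j x ≤
      ofReal (2 * ovl N + 8 * ovl N * (N * Cφ) ^ 2 * D) * E := by
    intro j hj
    obtain ⟨hjJ, x₀, hx1, hx2⟩ := Finset.mem_filter.1 hj
    obtain ⟨hn1, hn2, hn3⟩ := h.sc.near hx1 hx2
    rw [hg, lintegral_add_left ((measurable_dens _).const_mul _), lintegral_const_mul' _ _ ofReal_ne_top,
      lintegral_const_mul' _ _ ofReal_ne_top]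
    have a1 : ∫⁻ x in ball k (d k) ∩ closedBall j (2 * d j), dens (piece u K d b A j) x ≤ E := by
      by_cases hK : K ∩ ball j (20 * d j) = ∅
      · rw [piece, if_pos hK]
        refine lintegral_mono_set fun x hx => ⟨ball_subset_ball (by linarith) hx.1, h.not_mem hx.2 hK⟩
      · rw [piece, if_neg hK]
        simp [dens_rigid (h.fit j hjJ).skew]
    refine (add_le_add (mul_le_mul_right a1 _) (mul_le_mul_right (hdist j hjJ x₀ hx1 hx2) _)).trans (le_of_eq ?_)
    rw [← mul_assoc, ← ofReal_mul (by positivity), ← add_mul, ← ofReal_add (by positivity) (by positivity)]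
    congr 2
    field_simp
    ring
  calc ∫⁻ x in ball k (d k) ∩ ball 0 (3 / 4), dens (glued u K d J φ b A) x
      ≤ ∫⁻ x in ball k (d k) ∩ ball 0 (3 / 4), ∑ j ∈ t, (closedBall j (2 * d j)).indicator (g j) x :=
        setLIntegral_mono' (measurableSet_ball.inter measurableSet_ball) hpt
    _ ≤ ∫⁻ x in ball k (d k), ∑ j ∈ t, (closedBall j (2 * d j)).indicator (g j) x := lintegral_mono_set inter_subset_left
    _ = ∑ j ∈ t, ∫⁻ x in ball k (d k), (closedBall j (2 * d j)).indicator (g j) x := by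
        refine lintegral_finsetSum' _ fun j hj => ?_
        obtain ⟨hjJ, x₀, hx1, hx2⟩ := Finset.mem_filter.1 hj
        rw [aemeasurable_indicator_iff measurableSet_closedBall]
        refine AEMeasurable.add ((measurable_dens _).const_mul _).aemeasurable ?_
        refine AEMeasurable.const_mul ?_ _
        refine AEMeasurable.ennreal_ofReal ?_
        refine (AEMeasurable.mono_measure (μ := volume.restrict (closedBall j (2 * d j))) ?_
          (Measure.restrict_mono_measure Measure.restrict_le_self _))
        refine ContinuousOn.aemeasurable ?_ measurableSet_closedBall
        have : ContinuousOn (piece u K d b A j) (closedBall j (2 * d j)) := fun y hy =>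
          (h.piece_h1 hjJ hy).diff.continuousAt.continuousWithinAt
        exact (this.sub (by fun_prop)).norm.pow 2
    _ = ∑ j ∈ t, ∫⁻ x in ball k (d k) ∩ closedBall j (2 * d j), g j x := by
        refine sum_congr rfl fun j _ => ?_
        rw [lintegral_indicator measurableSet_closedBall, Measure.restrict_restrict measurableSet_closedBall, inter_comm]
    _ ≤ ∑ j ∈ t, ofReal (2 * ovl N + 8 * ovl N * (N * Cφ) ^ 2 * D) * E := sum_le_sum hterm
    _ ≤ _ := by
        rw [sum_const, nsmul_eq_mul, ← mul_assoc]
        gcongr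
        rw [ofReal_mul hov.le, ← ofReal_natCast]
        gcongr

open Classical in
lemma Glue.energy (hN : 2 ≤ N) (h : Glue u K d σ τ J φ Cφ C θ b A G) {D : ℝ} (hD : 0 < D)
    (hloc : ∀ k ∈ J, ∫⁻ x in ball k (d k) ∩ ball 0 (3 / 4), dens (glued u K d J φ b A) x ≤
      ofReal D * ∫⁻ x in ball k (20 * d k) \ K, dens u x) (S : Set (Euc N)) (hS : S ⊆ ball 0 (3 / 4)) :
    ∫⁻ x in S, dens (glued u K d J φ b A) x ≤
      ofReal (D * ovl N) * ∫⁻ x in (thickening (22 * τ) S ∩ ball 0 (7 / 8)) \ K, dens u x := by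
  have hov := ovl_pos (N := N)
  set t := J.filter fun k => (ball k (d k) ∩ S).Nonempty with ht
  set T := (thickening (22 * τ) S ∩ ball (0 : Euc N) (7 / 8)) \ K with hT
  have hTm : MeasurableSet T := (isOpen_thickening.measurableSet.inter measurableSet_ball).diff h.closed.measurableSet
  have hcov : S ⊆ ⋃ k ∈ t, ball k (d k) ∩ ball (0 : Euc N) (3 / 4) := fun x hx => by
    obtain ⟨k, hk, hxk⟩ := h.ce.cover x (ball_subset_closedBall (hS hx))
    simp only [mem_iUnion]
    exact ⟨k, Finset.mem_filter.2 ⟨hk, x, hxk, hx⟩, hxk, hS hx⟩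
  have hsub : ∀ k ∈ t, ball k (20 * d k) \ K ⊆ T := fun k hk => by
    obtain ⟨hkJ, s, hs1, hs2⟩ := Finset.mem_filter.1 hk
    refine diff_subset_diff_left (subset_inter (fun x hx => ?_) (h.ball_sub hkJ le_rfl))
    rw [mem_thickening_iff]
    refine ⟨s, hs2, ?_⟩
    rw [mem_ball] at hx hs1
    have := dist_triangle_right x s k
    have h1 := h.sc.le k
    have h2 := h.sc.pos k
    linarith
  calc ∫⁻ x in S, dens (glued u K d J φ b A) x
      ≤ ∫⁻ x in ⋃ k ∈ t, ball k (d k) ∩ ball (0 : Euc N) (3 / 4), dens (glued u K d J φ b A) x := lintegral_mono_set hcov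
    _ ≤ ∑ k ∈ t, ∫⁻ x in ball k (d k) ∩ ball (0 : Euc N) (3 / 4), dens (glued u K d J φ b A) x := by
        have e : (⋃ k ∈ t, ball k (d k) ∩ ball (0 : Euc N) (3 / 4)) = ⋃ k : t, ball (k : Euc N) (d k) ∩ ball (0 : Euc N) (3 / 4) := by
          ext x; simp only [mem_iUnion, Subtype.exists, exists_prop]
        rw [e]
        refine (lintegral_iUnion_le _ _).trans (le_of_eq ?_)
        rw [tsum_fintype]
        exact Finset.sum_coe_sort t fun k => ∫⁻ x in ball k (d k) ∩ ball (0 : Euc N) (3 / 4), dens (glued u K d J φ b A) x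
    _ ≤ ∑ k ∈ t, ofReal D * ∫⁻ x in ball k (20 * d k) \ K, dens u x :=
        sum_le_sum fun k hk => hloc k (Finset.mem_filter.1 hk).1
    _ = ofReal D * ∑ k ∈ t, ∫⁻ x in T, (ball k (20 * d k)).indicator (dens u) x := by
        rw [mul_sum]
        refine sum_congr rfl fun k hk => ?_
        rw [lintegral_indicator measurableSet_ball, Measure.restrict_restrict measurableSet_ball]
        congr 3
        ext x
        exact ⟨fun hx => ⟨hx.1, hsub k hk hx⟩, fun hx => ⟨hx.1, hx.2.2⟩⟩
    _ = ofReal D * ∫⁻ x in T, ∑ k ∈ t, (ball k (20 * d k)).indicator (dens u) x := by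
        rw [lintegral_finsetSum _ fun k _ => (measurable_dens u).indicator measurableSet_ball]
    _ ≤ ofReal D * ∫⁻ x in T, ofReal (ovl N) * dens u x := by
        refine mul_le_mul_right (lintegral_mono fun x => ?_) _
        have e : ∀ k, (ball k (20 * d k)).indicator (dens u) x = if x ∈ ball k (20 * d k) then dens u x else 0 := fun k => by
          rw [indicator_apply]
        simp only [e]
        rw [← Finset.sum_filter, sum_const, nsmul_eq_mul, ← ofReal_natCast]
        gcongr
        exact overlap hN h.sc h.ce x _ ((Finset.filter_subset _ _).trans (Finset.filter_subset _ _)) fun j hj =>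
          (mem_ball.1 (Finset.mem_filter.1 hj).2).le
    _ = _ := by
        rw [lintegral_const_mul' _ _ ofReal_ne_top, ← mul_assoc, ← ofReal_mul hD.le]
end

def SepData (K : Set (Euc N)) (d : Euc N → ℝ) (p : Euc N) : Prop :=
  ∃ (G : Set (Euc N)) (x1 : Euc N), MeasurableSet G ∧ G ⊆ ball p (10 * d p) ∧ x1 ∈ ball p (10 * d p) ∧
    (∀ x ∈ G, ∀ s ∈ Icc (0:ℝ) 1, x1 + s • (x - x1) ∈ ball p (10 * d p) \ K) ∧
    ∀ q ∈ ball p (d p), ball q (d q) ⊆ ball p (10 * d p) ∧ 2 * volume (ball p (10 * d p) \ G) < volume (ball q (d q))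

lemma exists_interp (hN : 2 ≤ N) : ∃ δ > (0:ℝ), ∃ C > (0:ℝ), ∀ (K : Set (Euc N)) (u : Euc N → Euc N)
    (d : Euc N → ℝ) (σ τ : ℝ), IsClosed K → volume K = 0 → ScaleFn d σ τ → τ ≤ 1 / 400 →
    (∀ x, Hm N (K ∩ ball x (20 * d x)) ≤ ofReal (δ * (40 * d x) ^ (N - 1))) →
    (∀ p ∈ ball (0 : Euc N) (7 / 8) \ K, H1At u p) → (∫⁻ x in ball (0 : Euc N) (7 / 8) \ K, dens u x) ≠ ⊤ →
    ∃ v : Euc N → Euc N, (∀ p ∈ ball (0 : Euc N) (3 / 4), H1At v p) ∧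
      (∀ p ∈ ball (0 : Euc N) (3 / 4), 30 * d p < infDist p K → v p = u p) ∧
      (∀ S ⊆ ball (0 : Euc N) (3 / 4), ∫⁻ x in S, dens v x ≤
        ofReal C * ∫⁻ x in (thickening (22 * τ) S ∩ ball 0 (7 / 8)) \ K, dens u x) ∧
      ∀ p ∈ ball (0 : Euc N) (3 / 4), SepData K d p := by
  have : NeZero N := ⟨by omega⟩
  obtain ⟨C, hC, hfit⟩ := exists_fit hN
  obtain ⟨θ, hθ, C', hC', hcmp⟩ := fit_compare hN
  obtain ⟨Cφ, hCφ, hpu⟩ := exists_partUnity hN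
  obtain ⟨δ0, hδ0, hfit0⟩ := hfit θ hθ
  set V := (volume (ball (0 : Euc N) 1)).toReal with hV
  have hVV : volume (ball (0 : Euc N) 1) = ofReal V := (ofReal_toReal measure_ball_lt_top.ne).symm
  have hV0 : 0 < V := toReal_pos (measure_ball_pos _ _ one_pos).ne' measure_ball_lt_top.ne
  obtain ⟨δ1, hδ1, hfit1⟩ := hfit (V / (4 * 20 ^ N)) (by positivity)
  have hov := ovl_pos (N := N)
  set D := 800 * C + 8 * V * C' * C with hD
  have hD0 : 0 < D := by positivity
  set D2 := ovl N * (2 * ovl N + 8 * ovl N * (N * Cφ) ^ 2 * D) with hD2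
  have hD20 : 0 < D2 := by positivity
  refine ⟨min δ0 δ1 / 4 ^ (N - 1), div_pos (lt_min hδ0 hδ1) (by positivity), D2 * ovl N, by positivity, ?_⟩
  intro K u d σ τ hK hK0 hsc hτ hgood hu hfin
  have hH : ∀ x, Hm N (K ∩ ball x (10 * d x)) ≤ ofReal (min δ0 δ1 * (10 * d x) ^ (N - 1)) := fun x => by
    have hdx := hsc.pos x
    refine (measure_mono (inter_subset_inter_right _ (ball_subset_ball (by linarith)))).trans ((hgood x).trans ?_)
    apply ofReal_le_ofReal (le_of_eq _)
    rw [show 40 * d x = 4 * (10 * d x) by ring, mul_pow 4 (10 * d x)]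
    field_simp
  have hb : ∀ p ∈ closedBall (0 : Euc N) (3 / 4), ball p (10 * d p) ⊆ ball 0 (7 / 8) := fun p hp => by
    refine ball_subset_ball' ?_
    have := mem_closedBall.1 hp
    have := hsc.le p
    linarith
  have hdiff : ∀ p ∈ closedBall (0 : Euc N) (3 / 4), ∀ x ∈ ball p (10 * d p) \ K, DifferentiableAt ℝ u x := fun p hp x hx =>
    (hu x ⟨hb p hp hx.1, hx.2⟩).diff
  have hfin' : ∀ p ∈ closedBall (0 : Euc N) (3 / 4), (∫⁻ x in ball p (10 * d p) \ K, dens u x) ≠ ⊤ := fun p hp =>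
    ne_top_of_le_ne_top hfin (lintegral_mono_set (diff_subset_diff_left (hb p hp)))
  obtain ⟨J, hJ⟩ := exists_centers hN hsc
  obtain ⟨φ, hφ⟩ := hpu d σ τ J hsc hJ
  have hF : ∀ j : Euc N, ∃ (b : Euc N) (A : Euc N →L[ℝ] Euc N) (G : Set (Euc N)), j ∈ J →
      Fit u K j (10 * d j) C θ b A G := fun j => by
    by_cases hj : j ∈ J
    · have hdj := hsc.pos j
      obtain ⟨b, A, G, h⟩ := hfit0 j (10 * d j) (by positivity) K u hK (hdiff j (hJ.mem j hj)) (hfin' j (hJ.mem j hj))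
        ((hH j).trans (ofReal_le_ofReal (by gcongr; exact min_le_left _ _)))
      exact ⟨b, A, G, fun _ => h⟩
    · exact ⟨0, 0, ∅, fun h => absurd h hj⟩
  choose b A G hG using hF
  have hg : Glue u K d σ τ J φ Cφ C θ b A G := ⟨hsc, hJ, hφ, hG, hτ, hK, hK0, hu, hC, hCφ⟩
  refine ⟨glued u K d J φ b A, fun p hp => hg.h1At hp, fun p hp h => hg.eq_u hp h, ?_, ?_⟩
  · exact hg.energy hN hD20 fun k hk => hg.local_bound hN hD0 hk fun j hj x₀ h1 h2 => hg.dist_int hC' hcmp hj hk h1 h2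
  · intro p hp
    have hp' := ball_subset_closedBall hp
    have hdp := hsc.pos p
    obtain ⟨b, A, G, h⟩ := hfit1 p (10 * d p) (by positivity) K u hK (hdiff p hp') (hfin' p hp')
        ((hH p).trans (ofReal_le_ofReal (by gcongr; exact min_le_right _ _)))
    obtain ⟨x1, hx1, hst⟩ := h.star
    refine ⟨G, x1, h.meas, h.sub, hx1, hst, fun q hq => ?_⟩
    have hl := abs_le.1 (hsc.lip q p)
    have hqp := mem_ball.1 hq
    refine ⟨ball_subset_ball' (by linarith [hl.1, hl.2]), ?_⟩
    rw [vol_ball _ (hsc.pos q).le, hVV, ← ofReal_mul (by have := hsc.pos q; positivity)]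
    refine (mul_le_mul_right h.vol 2).trans_lt ?_
    rw [show (2:ℝ≥0∞) = ofReal 2 by simp, ← ofReal_mul (by norm_num)]
    have h1 : (d p / 2) ^ N ≤ d q ^ N := by
      apply pow_le_pow_left₀ (by positivity); linarith [hl.1, hl.2]
    have h2 : 0 < (d p / 2) ^ N := by positivity
    have h3 : 2 * (V / (4 * 20 ^ N) * (10 * d p) ^ N) = (d p / 2) ^ N * V / 2 := by
      rw [show 10 * d p = 20 * (d p / 2) by ring, mul_pow]; field_simp; ring
    rw [h3]
    refine (ENNReal.ofReal_lt_ofReal_iff (by have := hsc.pos q; positivity)).2 ?_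
    nlinarith

open scoped ContDiff

/-! ### Regularity: Korn and Caccioppoli -/

lemma abs_entry_le (ξ : Mat N) (i j : Fin N) : |ξ i j| ≤ frobNorm ξ := by
  apply abs_le_of_sq_le_sq _ (frobNorm_nonneg _)
  rw [frobNorm_sq, frob, sq]
  exact (single_le_sum (f := fun j => ξ i j * ξ i j) (fun _ _ => mul_self_nonneg _) (Finset.mem_univ j)).trans
    (single_le_sum (f := fun i => ∑ j, ξ i j * ξ i j)
      (fun _ _ => sum_nonneg fun _ _ => mul_self_nonneg _) (Finset.mem_univ i))

lemma tensor_sum (𝓒 : Mat N →ₗ[ℝ] Mat N) (ξ : Mat N) : 𝓒 ξ = ∑ i, ∑ j, ξ i j • 𝓒 (Matrix.single i j 1) := by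
  conv_lhs => rw [Matrix.matrix_eq_sum_single ξ]
  simp only [map_sum, ← map_smul, Matrix.smul_single, smul_eq_mul, mul_one]

lemma tensor_bound (𝓒 : Mat N →ₗ[ℝ] Mat N) : ∃ Γ > (0:ℝ), ∀ ξ, frobNorm (𝓒 ξ) ≤ Γ * frobNorm ξ := by
  refine ⟨(∑ i, ∑ j, frobNorm (𝓒 (Matrix.single i j 1))) + 1, ?_, fun ξ => ?_⟩
  · have : 0 ≤ ∑ i, ∑ j, frobNorm (𝓒 (Matrix.single i j (1:ℝ))) :=
      sum_nonneg fun _ _ => sum_nonneg fun _ _ => frobNorm_nonneg _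
    linarith
  rw [tensor_sum]
  have h1 : frobNorm (∑ i, ∑ j, ξ i j • 𝓒 (Matrix.single i j 1)) ≤
      ∑ i, ∑ j, frobNorm ξ * frobNorm (𝓒 (Matrix.single i j 1)) := by
    refine (frobNorm_sum_le _ _).trans (sum_le_sum fun i _ => (frobNorm_sum_le _ _).trans
      (sum_le_sum fun j _ => ?_))
    rw [frobNorm_smul]
    exact mul_le_mul_of_nonneg_right (abs_entry_le ξ i j) (frobNorm_nonneg _)
  simp only [← mul_sum] at h1
  nlinarith [frobNorm_nonneg ξ]

lemma fderiv_coord {w : Euc N → Euc N} {x : Euc N} (hw : DifferentiableAt ℝ w x) (ξ : Euc N) (i : Fin N) :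
    fderiv ℝ (fun y => w y i) x ξ = fderiv ℝ w x ξ i := by
  have := ((EuclideanSpace.proj i : Euc N →L[ℝ] ℝ).hasFDerivAt.comp x hw.hasFDerivAt).fderiv
  have e : (fun y => w y i) = (EuclideanSpace.proj i : Euc N →L[ℝ] ℝ) ∘ w := rfl
  rw [e, this]; rfl

lemma fderiv_comm {f : Euc N → ℝ} (hf : ContDiff ℝ 2 f) (a b x : Euc N) :
    fderiv ℝ (fun y => fderiv ℝ f y a) x b = fderiv ℝ (fun y => fderiv ℝ f y b) x a := by
  have hd : DifferentiableAt ℝ (fderiv ℝ f) x :=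
    ((hf.fderiv_right (m := 1) (by norm_num)).differentiable (by norm_num)) x
  have e : ∀ a b, fderiv ℝ (fun y => fderiv ℝ f y a) x b = fderiv ℝ (fderiv ℝ f) x b a := fun a b => by
    rw [fderiv_clm_apply hd (differentiableAt_const a)]; simp
  rw [e, e]
  exact (hf.contDiffAt.isSymmSndFDerivAt (by simp)) b a

lemma ibp2 {f h : Euc N → ℝ} (hf : ContDiff ℝ 2 f) (hh : ContDiff ℝ 2 h) (hfc : HasCompactSupport f)
    (a b : Euc N) : ∫ x, fderiv ℝ f x a * fderiv ℝ h x b = ∫ x, fderiv ℝ f x b * fderiv ℝ h x a := by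
  have hf1 : ∀ a, ContDiff ℝ 1 (fun x => fderiv ℝ f x a) := fun a =>
    (hf.fderiv_right (m := 1) (by norm_num)).clm_apply contDiff_const
  have hh1 : ∀ a, ContDiff ℝ 1 (fun x => fderiv ℝ h x a) := fun a =>
    (hh.fderiv_right (m := 1) (by norm_num)).clm_apply contDiff_const
  have hf2 : ∀ a b, Continuous (fun x => fderiv ℝ (fun y => fderiv ℝ f y a) x b) := fun a b =>
    ((hf1 a).continuous_fderiv (by norm_num)).clm_apply continuous_const
  have c1 : ∀ a, HasCompactSupport (fun x => fderiv ℝ f x a) := fun a => hfc.fderiv_apply ℝ a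
  have c2 : ∀ a b, HasCompactSupport (fun x => fderiv ℝ (fun y => fderiv ℝ f y a) x b) := fun a b => (c1 a).fderiv_apply ℝ b
  have key : ∀ a b, ∫ x, fderiv ℝ f x a * fderiv ℝ h x b = - ∫ x, fderiv ℝ (fun y => fderiv ℝ f y a) x b * h x := fun a b =>
    integral_mul_fderiv_eq_neg_fderiv_mul_of_integrable
      (((hf2 a b).mul hh.continuous).integrable_of_hasCompactSupport (c2 a b).mul_right)
      (((hf1 a).continuous.mul (hh1 b).continuous).integrable_of_hasCompactSupport (c1 a).mul_right)
      (((hf1 a).continuous.mul hh.continuous).integrable_of_hasCompactSupport (c1 a).mul_right)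
      (fun x _ => (hf1 a).differentiable (by norm_num) x) (fun x _ => hh.differentiable (by norm_num) x)
  rw [key, key]
  simp only [fderiv_comm hf]

lemma continuous_frob {X : Type*} [TopologicalSpace X] {F H : X → Mat N} (hF : ∀ i j, Continuous fun x => F x i j)
    (hH : ∀ i j, Continuous fun x => H x i j) : Continuous fun x => frob (F x) (H x) := by
  unfold frob
  exact continuous_finsetSum _ fun i _ => continuous_finsetSum _ fun j _ => (hF i j).mul (hH i j)

lemma continuous_eSym {w : Euc N → Euc N} (hw : ContDiff ℝ 1 w) (i j : Fin N) : Continuous fun x => eSym w x i j := by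
  simp only [eSym_eq, eL_apply]
  have : ∀ i j : Fin N, Continuous fun x => fderiv ℝ w x (ev j) i := fun i j =>
    (EuclideanSpace.proj i : Euc N →L[ℝ] ℝ).continuous.comp
      ((hw.continuous_fderiv (by norm_num)).clm_apply continuous_const)
  exact (((this i j).add (this j i))).const_mul _

lemma continuous_gradm {w : Euc N → Euc N} (hw : ContDiff ℝ 1 w) (i j : Fin N) : Continuous fun x => gradm w x i j :=
  (EuclideanSpace.proj i : Euc N →L[ℝ] ℝ).continuous.comp
      ((hw.continuous_fderiv (by norm_num)).clm_apply continuous_const)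

lemma korn {w : Euc N → Euc N} (hw : ContDiff ℝ 2 w) (hc : HasCompactSupport w) :
    ∫ x, frobNorm (gradm w x) ^ 2 ≤ 2 * ∫ x, frobNorm (eSym w x) ^ 2 := by
  have hw1 : ContDiff ℝ 1 w := hw.of_le (by norm_num)
  have hcG : ∀ i j : Fin N, HasCompactSupport fun x => gradm w x i j := fun i j =>
    (hc.fderiv_apply ℝ (ev j)).comp_left (g := fun z : Euc N => z i) rfl
  have hInt : ∀ i j k l : Fin N, Integrable fun x => gradm w x i j * gradm w x k l := fun i j k l =>
    ((continuous_gradm hw1 i j).mul (continuous_gradm hw1 k l)).integrable_of_hasCompactSupport (hcG i j).mul_right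
  have hpt : ∀ x, 2 * frobNorm (eSym w x) ^ 2 = frobNorm (gradm w x) ^ 2 + ∑ i, ∑ j, gradm w x i j * gradm w x j i := by
    intro x
    rw [frobNorm_sq, frobNorm_sq, frob, frob]
    have e : ∀ i j, eSym w x i j * eSym w x i j = (1/4) * (gradm w x i j * gradm w x i j) +
        (1/4) * (gradm w x j i * gradm w x j i) + (1/2) * (gradm w x i j * gradm w x j i) := fun i j => by
      simp only [eSym, Matrix.smul_apply, Matrix.add_apply, Matrix.transpose_apply, smul_eq_mul]; ring
    simp only [e, sum_add_distrib, ← mul_sum]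
    rw [Finset.sum_comm (f := fun i j => gradm w x j i * gradm w x j i)]
    ring
  have hsw : ∀ i j : Fin N, ∫ x, gradm w x i j * gradm w x j i = ∫ x, gradm w x i i * gradm w x j j := fun i j => by
    have hci : ∀ i : Fin N, ContDiff ℝ 2 fun x => w x i := fun i => by fun_prop
    have hd : ∀ x, DifferentiableAt ℝ w x := fun x => hw.differentiable (by norm_num) x
    have := ibp2 (hci i) (hci j) (hc.comp_left (g := fun z : Euc N => z i) rfl) (ev j) (ev i)
    simp only [fderiv_coord (hd _)] at this
    exact this
  have h0 : 0 ≤ ∑ i, ∑ j, ∫ x, gradm w x i j * gradm w x j i := by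
    simp only [hsw]
    have : ∑ i, ∑ j, ∫ x, gradm w x i i * gradm w x j j = ∫ x, (∑ i, gradm w x i i) * ∑ j, gradm w x j j := by
      simp only [Finset.sum_mul_sum]
      rw [integral_finsetSum _ fun i _ => integrable_finsetSum _ fun j _ => hInt i i j j]
      refine sum_congr rfl fun i _ => ?_
      rw [integral_finsetSum _ fun j _ => hInt i i j j]
    rw [this]
    exact integral_nonneg fun x => mul_self_nonneg _
  have hI1 : Integrable fun x => frobNorm (gradm w x) ^ 2 := by
    simp only [frobNorm_sq, frob]
    exact integrable_finsetSum _ fun i _ => integrable_finsetSum _ fun j _ => hInt i j i j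
  have hI2 : Integrable fun x => ∑ i, ∑ j, gradm w x i j * gradm w x j i :=
    integrable_finsetSum _ fun i _ => integrable_finsetSum _ fun j _ => hInt i j j i
  rw [← integral_const_mul]
  simp only [hpt]
  rw [integral_add hI1 hI2, integral_finsetSum _ fun i _ => integrable_finsetSum _ fun j _ => hInt i j j i]
  have : ∀ i ∈ Finset.univ, ∫ x, ∑ j, gradm w x i j * gradm w x j i = ∑ j, ∫ x, gradm w x i j * gradm w x j i :=
    fun i _ => integral_finsetSum _ fun j _ => hInt i j j i
  rw [sum_congr rfl this]
  linarith

/-- weak differential inequality for the elasticity operator -/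
def Weak (𝓒 : Mat N →ₗ[ℝ] Mat N) (g : Euc N → Euc N) (t Λ : ℝ) : Prop :=
  ∀ ψ : Euc N → Euc N, ContDiff ℝ ∞ ψ → HasCompactSupport ψ → tsupport ψ ⊆ ball 0 t →
    |∫ x, frob (𝓒 (eSym g x)) (eSym ψ x)| ≤ Λ * ∫ x, ‖ψ x‖

lemma Weak.mono {𝓒 : Mat N →ₗ[ℝ] Mat N} {g : Euc N → Euc N} {s t Λ : ℝ} (h : Weak 𝓒 g t Λ) (hst : s ≤ t) :
    Weak 𝓒 g s Λ := fun ψ h1 h2 h3 => h ψ h1 h2 (h3.trans (ball_subset_ball hst))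

lemma continuous_tensor (𝓒 : Mat N →ₗ[ℝ] Mat N) {X : Type*} [TopologicalSpace X] {F : X → Mat N}
    (hF : ∀ i j, Continuous fun x => F x i j) (i j : Fin N) : Continuous fun x => 𝓒 (F x) i j := by
  have h1 : Continuous F := continuous_matrix hF
  have h2 : Continuous 𝓒 := LinearMap.continuous_of_finiteDimensional _
  exact (h2.comp h1).matrix_elem i j

lemma tensor_coercive {𝓒 : Mat N →ₗ[ℝ] Mat N} {c₀ : ℝ} (h : IsElasticityTensor 𝓒 c₀) {ξ : Mat N} (hξ : ξᵀ = ξ) :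
    4 * c₀⁻¹ * frobNorm ξ ^ 2 ≤ frob (𝓒 ξ) ξ := by
  have := h.coercive ξ
  rw [hξ, ← two_smul ℝ ξ, frobNorm_smul, mul_pow] at this
  norm_num at this; linarith

lemma eSym_smul {χ : Euc N → ℝ} {w : Euc N → Euc N} {x : Euc N} (hχ : DifferentiableAt ℝ χ x)
    (hw : DifferentiableAt ℝ w x) :
    eSym (fun y => χ y • w y) x = χ x • eSym w x + eL ((fderiv ℝ χ x).smulRight (w x)) := by
  rw [eSym_eq, fderiv_fun_smul hχ hw, map_add, map_smul, ← eSym_eq]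

lemma compactSupport_eSym {w : Euc N → Euc N} (hc : HasCompactSupport w) : HasCompactSupport (eSym w) := by
  have : eSym w = eL ∘ fderiv ℝ w := funext fun x => eSym_eq w x
  rw [this]
  exact (hc.fderiv ℝ).comp_left (map_zero eL)

lemma caccioppoli {𝓒 : Mat N →ₗ[ℝ] Mat N} {c₀ : ℝ} (h𝓒 : IsElasticityTensor 𝓒 c₀) {s t : ℝ} (hs : 0 < s) (hst : s < t) :
    ∃ C > (0:ℝ), ∀ (g : Euc N → Euc N) (Λ : ℝ), ContDiff ℝ ∞ g → 0 ≤ Λ → Weak 𝓒 g t Λ →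
      ∫ x in ball 0 s, ‖fderiv ℝ g x‖ ^ 2 ≤ C * ((∫ x in ball 0 t, ‖g x‖ ^ 2) + Λ ^ 2) := by
  obtain ⟨Γ, hΓ0, hΓ⟩ := tensor_bound 𝓒
  let f : ContDiffBump (0 : Euc N) := ⟨s, (s+t)/2, hs, by linarith⟩
  have hf : ContDiff ℝ ∞ (f : Euc N → ℝ) := f.contDiff
  have hfc : HasCompactSupport (f : Euc N → ℝ) := f.hasCompactSupport
  have hft : tsupport (f : Euc N → ℝ) ⊆ ball 0 t := by
    rw [f.tsupport_eq]; exact closedBall_subset_ball (by show (s+t)/2 < t; linarith)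
  obtain ⟨D, hD⟩ := (hfc.fderiv ℝ).exists_bound_of_continuous (hf.continuous_fderiv (by simp))
  have hD0 : 0 ≤ D := (norm_nonneg _).trans (hD 0)
  set V : ℝ := volume.real (ball (0 : Euc N) t) with hV
  have hc0 : 0 < c₀ := by linarith [h𝓒.one_le]
  set a : ℝ := Γ * (N * D) ^ 2 + 1/2 with ha
  have ha0 : 0 < a := by positivity
  refine ⟨2 * (c₀/4) * (a + V), by positivity, fun g Λ hg hΛ hW => ?_⟩
  set G : Euc N → Euc N := fun y => f y • g y with hG
  set ψ : Euc N → Euc N := fun y => f y • G y with hψ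
  have hG1 : ContDiff ℝ ∞ G := hf.smul hg
  have hψ1 : ContDiff ℝ ∞ ψ := hf.smul hG1
  have hGc : HasCompactSupport G := hfc.smul_right
  have hψc : HasCompactSupport ψ := hfc.smul_right
  have hψt : tsupport ψ ⊆ ball 0 t := (tsupport_smul_subset_left _ _).trans hft
  have hW' := hW ψ hψ1 hψc hψt
  have hdf : ∀ x, DifferentiableAt ℝ f x := fun x => hf.differentiable (by simp) x
  have hdg : ∀ x, DifferentiableAt ℝ g x := fun x => hg.differentiable (by simp) x
  have hdG : ∀ x, DifferentiableAt ℝ G x := fun x => hG1.differentiable (by simp) x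
  have hIg : IntegrableOn (fun x => ‖g x‖ ^ 2) (ball 0 t) :=
    ((hg.continuous.norm.pow 2).continuousOn.integrableOn_compact (isCompact_closedBall 0 t)).mono_set ball_subset_closedBall
  have hpt : ∀ x, 4 * c₀⁻¹ * frobNorm (eSym G x) ^ 2 ≤ frob (𝓒 (eSym g x)) (eSym ψ x) +
      (ball (0 : Euc N) t).indicator (fun x => Γ * (N * D) ^ 2 * ‖g x‖ ^ 2) x := by
    intro x
    set P := eL ((fderiv ℝ f x).smulRight (g x)) with hP
    have e1 : eSym G x = f x • eSym g x + P := eSym_smul (hdf x) (hdg x)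
    have e2 : eSym ψ x = f x • (f x • eSym g x + P) + f x • P := by
      rw [hψ, eSym_smul (hdf x) (hdG x), e1, hP, hG]
      congr 1
      rw [← map_smul]; congr 1
      ext v i; simp; ring
    have hsym : (eSym G x)ᵀ = eSym G x := by rw [eSym_eq, eL_symm]
    refine (tensor_coercive h𝓒 hsym).trans ?_
    have e3 : frob (𝓒 (eSym G x)) (eSym G x) = frob (𝓒 (eSym g x)) (eSym ψ x) + frob (𝓒 P) P := by
      rw [e1, e2]
      have : frob (𝓒 P) (eSym g x) = frob (𝓒 (eSym g x)) P := by rw [h𝓒.symm, frob_comm]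
      simp only [map_add, map_smul, frob_add_left, frob_add_right, frob_smul_left, frob_smul_right, this]
      ring
    rw [e3]
    refine add_le_add le_rfl ?_
    by_cases hx : x ∈ ball (0 : Euc N) t
    · rw [indicator_of_mem hx]
      have b1 : frobNorm P ≤ N * D * ‖g x‖ := by
        refine (frobNorm_smulRight _ _).trans ?_
        rw [mul_assoc]
        gcongr; exact hD x
      have b2 := (abs_le.1 (abs_frob_le (𝓒 P) P)).2
      have b3 : frobNorm P ^ 2 ≤ (N * D * ‖g x‖) ^ 2 := by gcongr; exact frobNorm_nonneg _
      have := mul_le_mul_of_nonneg_right (hΓ P) (frobNorm_nonneg P)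
      rw [mul_pow] at b3
      nlinarith
    · rw [indicator_of_notMem hx]
      have : fderiv ℝ f x = 0 := by
        by_contra h0
        exact hx (hft (support_fderiv_subset ℝ h0))
      have hP0 : P = 0 := by
        rw [hP, this]
        have : (0 : Euc N →L[ℝ] ℝ).smulRight (g x) = 0 := by ext; simp
        rw [this, map_zero]
      rw [hP0, map_zero]; simp [frob]
  have hGs : HasCompactSupport fun x => frobNorm (eSym G x) ^ 2 :=
    (compactSupport_eSym hGc).comp_left (g := fun ξ => frobNorm ξ ^ 2) (by simp [frobNorm_zero])
  have hI1 : Integrable fun x => frobNorm (eSym G x) ^ 2 := by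
    refine Continuous.integrable_of_hasCompactSupport ?_ hGs
    simp only [frobNorm_sq]
    exact continuous_frob (continuous_eSym (hG1.of_le (by simp))) (continuous_eSym (hG1.of_le (by simp)))
  have hI2 : Integrable fun x => frob (𝓒 (eSym g x)) (eSym ψ x) := by
    refine Continuous.integrable_of_hasCompactSupport
      (continuous_frob (continuous_tensor 𝓒 (continuous_eSym (hg.of_le (by simp)))) (continuous_eSym (hψ1.of_le (by simp)))) ?_
    refine (compactSupport_eSym hψc).mono fun x hx => ?_
    contrapose! hx
    have : eSym ψ x = 0 := by simpa using hx
    simp [this, frob]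
  have hI3 : Integrable ((ball (0 : Euc N) t).indicator (fun x => Γ * (N * D) ^ 2 * ‖g x‖ ^ 2)) :=
    (integrable_indicator_iff measurableSet_ball).2 (hIg.const_mul _)
  have hA : 4 * c₀⁻¹ * ∫ x, frobNorm (eSym G x) ^ 2 ≤ (∫ x, frob (𝓒 (eSym g x)) (eSym ψ x)) +
      Γ * (N * D) ^ 2 * ∫ x in ball 0 t, ‖g x‖ ^ 2 := by
    rw [← integral_const_mul, ← integral_const_mul, ← integral_indicator measurableSet_ball, ← integral_add hI2 hI3]
    exact integral_mono (hI1.const_mul _) (hI2.add hI3) hpt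
  have hB : Λ * ∫ x, ‖ψ x‖ ≤ (1/2) * (∫ x in ball 0 t, ‖g x‖ ^ 2) + V * Λ ^ 2 := by
    have e : ∫ x, ‖ψ x‖ = ∫ x in ball 0 t, ‖ψ x‖ := by
      refine (setIntegral_eq_integral_of_forall_compl_eq_zero fun x hx => ?_).symm
      rw [norm_eq_zero]
      exact image_eq_zero_of_notMem_tsupport fun h => hx (hψt h)
    rw [e, ← integral_const_mul]
    have h1 : ∫ x in ball 0 t, Λ * ‖ψ x‖ ≤ ∫ x in ball 0 t, ((1/2) * ‖g x‖ ^ 2 + Λ ^ 2) := by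
      refine setIntegral_mono ((hψ1.continuous.norm.integrable_of_hasCompactSupport hψc.norm).const_mul _).integrableOn
        ((hIg.const_mul _).add (integrableOn_const measure_ball_lt_top.ne)) fun x => ?_
      have : ‖ψ x‖ ≤ ‖g x‖ := by
        simp only [hψ, hG, norm_smul, norm_eq_abs, abs_of_nonneg f.nonneg]
        have := f.le_one (x := x)
        have := f.nonneg (x := x)
        have h2 : f x * ‖g x‖ ≤ ‖g x‖ := mul_le_of_le_one_left (norm_nonneg _) f.le_one
        nlinarith
      have := mul_le_mul_of_nonneg_left this hΛ
      show Λ * ‖ψ x‖ ≤ (1/2) * ‖g x‖ ^ 2 + Λ ^ 2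
      nlinarith [sq_nonneg (‖g x‖ - Λ)]
    rw [integral_add (hIg.const_mul _) (integrableOn_const measure_ball_lt_top.ne), setIntegral_const,
      integral_const_mul (1/2 : ℝ), smul_eq_mul] at h1
    exact h1
  have hK := korn (hG1.of_le (by norm_cast)) hGc
  have hI4 : Integrable fun x => frobNorm (gradm G x) ^ 2 := by
    refine Continuous.integrable_of_hasCompactSupport ?_ ?_
    · simp only [frobNorm_sq]
      exact continuous_frob (continuous_gradm (hG1.of_le (by simp))) (continuous_gradm (hG1.of_le (by simp)))
    · refine (hGc.fderiv ℝ).mono fun x hx => ?_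
      contrapose! hx
      have : fderiv ℝ G x = 0 := by simpa using hx
      have : gradm G x = 0 := by ext i j; simp [gradm, this]
      simp [this, frobNorm_zero]
  have hL : ∫ x in ball 0 s, ‖fderiv ℝ g x‖ ^ 2 ≤ ∫ x, frobNorm (gradm G x) ^ 2 := by
    refine le_trans ?_ (setIntegral_le_integral (s := ball 0 s) hI4 (ae_of_all _ fun x => sq_nonneg _))
    refine setIntegral_mono_on ?_ hI4.integrableOn measurableSet_ball fun x hx => ?_
    · exact ((((hg.continuous_fderiv (by simp)).norm.pow 2).continuousOn).integrableOn_compact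
        (isCompact_closedBall 0 s)).mono_set ball_subset_closedBall
    · have : g =ᶠ[𝓝 x] G := by
        filter_upwards [isOpen_ball.mem_nhds hx] with y hy
        simp only [hG]
        rw [f.one_of_mem_closedBall (ball_subset_closedBall hy), one_smul]
      rw [this.fderiv_eq]
      gcongr; exact norm_fderiv_le_grad _ _
  have hW2 := (abs_le.1 hW').2
  set I := ∫ x in ball 0 t, ‖g x‖ ^ 2
  have hI0 : 0 ≤ I := integral_nonneg fun _ => sq_nonneg _
  have hV0 : 0 ≤ V := measureReal_nonneg
  have hfin : 4 * c₀⁻¹ * ∫ x, frobNorm (eSym G x) ^ 2 ≤ (a + V) * (I + Λ ^ 2) := by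
    have : 0 ≤ V * I + a * Λ ^ 2 := by positivity
    nlinarith
  have : ∫ x, frobNorm (eSym G x) ^ 2 ≤ c₀/4 * ((a + V) * (I + Λ ^ 2)) := by
    have h2 := mul_le_mul_of_nonneg_left hfin (by positivity : 0 ≤ c₀/4)
    have e : c₀/4 * (4 * c₀⁻¹ * ∫ x, frobNorm (eSym G x) ^ 2) = ∫ x, frobNorm (eSym G x) ^ 2 := by
      field_simp
    linarith
  nlinarith

/-! ### Decay for smooth approximate solutions -/

/-- a family of smooth functions closed under partial derivatives -/
structure Fam (g : List (Fin N) → Euc N → Euc N) : Prop where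
  smooth : ∀ l, ContDiff ℝ ∞ (g l)
  deriv : ∀ l i x, fderiv ℝ (g l) x (ev i) = g (i :: l) x

lemma enorm_sq_eq (z : Euc N) : ‖z‖ₑ ^ 2 = ofReal (‖z‖ ^ 2) := by
  rw [ofReal_pow (norm_nonneg _), ofReal_norm]

lemma integrableOn_sq {f : Euc N → Euc N} (hf : Continuous f) (x : Euc N) (r : ℝ) :
    IntegrableOn (fun x => ‖f x‖ ^ 2) (ball x r) :=
  ((hf.norm.pow 2).continuousOn.integrableOn_compact (isCompact_closedBall x r)).mono_set ball_subset_closedBall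

lemma fam_caccioppoli {𝓒 : Mat N →ₗ[ℝ] Mat N} {c₀ : ℝ} (h𝓒 : IsElasticityTensor 𝓒 c₀) (m : ℕ) :
    ∃ C > (0:ℝ), ∀ (g : List (Fin N) → Euc N → Euc N) (Λ : ℝ), Fam g → 0 ≤ Λ →
      (∀ l, l.length ≤ m → Weak 𝓒 (g l) (1/2) Λ) → ∀ l, l.length = m →
      ∫ x in ball 0 (1/4 + (1/2)^(m+2)), ‖g l x‖ ^ 2 ≤ C * ((∫ x in ball 0 (1/2), ‖g [] x‖ ^ 2) + Λ ^ 2) := by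
  induction m with
  | zero =>
    refine ⟨1, one_pos, fun g Λ hg hΛ hW l hl => ?_⟩
    rw [List.length_eq_zero_iff.1 hl]
    norm_num; positivity
  | succ m ih =>
    obtain ⟨C, hC, h⟩ := ih
    have hp : (0:ℝ) < (1/2)^(m+3) := by positivity
    have hp2 : ((1:ℝ)/2)^(m+2) = 2 * (1/2)^(m+3) := by rw [pow_succ _ (m+2)]; ring
    have hp3 : ((1:ℝ)/2)^(m+2) ≤ 1/4 := by
      have : ((1:ℝ)/2)^m ≤ 1 := pow_le_one₀ (by norm_num) (by norm_num)
      rw [pow_add]; linarith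
    obtain ⟨C', hC', h'⟩ := caccioppoli h𝓒 (s := 1/4 + (1/2)^(m+3)) (t := 1/4 + (1/2)^(m+2)) (by positivity)
      (by rw [hp2]; linarith)
    refine ⟨C' * (C + 1), by positivity, fun g Λ hg hΛ hW l hl => ?_⟩
    obtain ⟨i, l, rfl⟩ := List.exists_of_length_succ l hl
    have hl' : l.length = m := by simpa using hl
    have h1 := h g Λ hg hΛ (fun l hl => hW l (by omega)) l hl'
    have h2 := h' (g l) Λ (hg.smooth l) hΛ ((hW l (by omega)).mono (by linarith))
    have hmono : ∫ x in ball 0 (1/4 + (1/2)^(m+1+2)), ‖g (i::l) x‖ ^ 2 ≤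
        ∫ x in ball 0 (1/4 + (1/2)^(m+3)), ‖fderiv ℝ (g l) x‖ ^ 2 := by
      refine setIntegral_mono (integrableOn_sq (hg.smooth _).continuous _ _) ?_ fun x => ?_
      · exact (((((hg.smooth l).continuous_fderiv (by simp)).norm.pow 2).continuousOn).integrableOn_compact
          (isCompact_closedBall 0 _)).mono_set ball_subset_closedBall
      · show ‖g (i::l) x‖ ^ 2 ≤ _
        rw [← hg.deriv l i x]
        have := (fderiv ℝ (g l) x).le_opNorm (ev i)
        rw [norm_ev, mul_one] at this
        gcongr
    refine hmono.trans (h2.trans ?_)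
    rw [mul_assoc]
    refine mul_le_mul_of_nonneg_left ?_ hC'.le
    have : 0 ≤ ∫ x in ball (0 : Euc N) (1/2), ‖g [] x‖ ^ 2 := integral_nonneg fun _ => sq_nonneg _
    nlinarith [sq_nonneg Λ]

lemma fam_bound {𝓒 : Mat N →ₗ[ℝ] Mat N} {c₀ : ℝ} (h𝓒 : IsElasticityTensor 𝓒 c₀) (M : ℕ) :
    ∃ C > (0:ℝ), ∀ (g : List (Fin N) → Euc N → Euc N) (Λ : ℝ), Fam g → 0 ≤ Λ →
      (∀ l, l.length ≤ M → Weak 𝓒 (g l) (1/2) Λ) → ∀ l, l.length ≤ M →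
      ∫⁻ x in ball 0 (1/4), ‖g l x‖ₑ ^ 2 ≤ ofReal (C * ((∫ x in ball 0 (1/2), ‖g [] x‖ ^ 2) + Λ ^ 2)) := by
  choose C hC h using fun m => fam_caccioppoli h𝓒 m
  refine ⟨(∑ m ∈ Finset.range (M+1), C m), Finset.sum_pos (fun m _ => hC m) (by simp), fun g Λ hg hΛ hW l hl => ?_⟩
  have h1 := h l.length g Λ hg hΛ (fun l' hl' => hW l' (by omega)) l rfl
  simp only [enorm_sq_eq]
  rw [← ofReal_integral_eq_lintegral_ofReal (integrableOn_sq (hg.smooth l).continuous _ _) (ae_of_all _ fun _ => sq_nonneg _)]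
  refine ofReal_le_ofReal (le_trans ?_ (h1.trans ?_))
  · refine setIntegral_mono_set (integrableOn_sq (hg.smooth l).continuous _ _) (ae_of_all _ fun _ => sq_nonneg _)
      (ball_subset_ball ?_).eventuallyLE
    have : (0:ℝ) < (1/2)^(l.length+2) := by positivity
    linarith
  · have : 0 ≤ ∫ x in ball (0 : Euc N) (1/2), ‖g [] x‖ ^ 2 := integral_nonneg fun _ => sq_nonneg _
    refine mul_le_mul_of_nonneg_right ?_ (by positivity)
    exact single_le_sum (f := C) (fun m _ => (hC m).le) (by simpa using hl)

lemma esq_add_le (a b : ℝ≥0∞) : (a + b) ^ 2 ≤ 2 * a ^ 2 + 2 * b ^ 2 := by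
  rcases eq_or_ne a ⊤ with rfl | ha
  · simp
  rcases eq_or_ne b ⊤ with rfl | hb
  · simp
  lift a to ℝ≥0 using ha
  lift b to ℝ≥0 using hb
  have := add_sq_le (a := a) (b := b)
  rw [mul_add] at this
  exact_mod_cast this

lemma line_sq {φ φ' : ℝ → Euc N} (hφ : ∀ t, HasDerivAt φ (φ' t) t) (hc : Continuous φ') {a : ℝ} (ha : 0 ≤ a) :
    ofReal a * ‖φ 0‖ₑ ^ 2 ≤ 2 * (∫⁻ t in Icc 0 a, ‖φ t‖ₑ ^ 2) +
      2 * ofReal a ^ 2 * ∫⁻ t in Icc 0 a, ‖φ' t‖ₑ ^ 2 := by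
  set J := ∫⁻ t in Icc 0 a, ‖φ' t‖ₑ with hJ
  have hφc : Continuous φ := continuous_iff_continuousAt.2 fun t => (hφ t).continuousAt
  have h1 : ∀ t ∈ Icc 0 a, ‖φ 0‖ₑ ≤ ‖φ t‖ₑ + J := by
    intro t ht
    have e : φ t - φ 0 = ∫ s in (0:ℝ)..t, φ' s :=
      (intervalIntegral.integral_eq_sub_of_hasDerivAt (fun s _ => hφ s) (hc.intervalIntegrable _ _)).symm
    have e2 : φ 0 = φ t - ∫ s in (0:ℝ)..t, φ' s := by rw [← e]; abel
    rw [e2]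
    refine (enorm_sub_le).trans (add_le_add le_rfl ?_)
    rw [intervalIntegral.integral_of_le ht.1]
    refine (enorm_integral_le_lintegral_enorm _).trans (lintegral_mono_set ?_)
    exact fun s hs => ⟨hs.1.le, hs.2.trans ht.2⟩
  have h2 : J ^ 2 ≤ ofReal a * ∫⁻ t in Icc 0 a, ‖φ' t‖ₑ ^ 2 := by
    have := lintegral_sq_le (μ := volume.restrict (Icc 0 a)) (f := fun t => ‖φ' t‖ₑ) hc.enorm.measurable.aemeasurable
    simpa using this
  have h3 : ∫⁻ t in Icc 0 a, ‖φ 0‖ₑ ^ 2 ≤ ∫⁻ t in Icc 0 a, (2 * ‖φ t‖ₑ ^ 2 + 2 * J ^ 2) :=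
    setLIntegral_mono' measurableSet_Icc fun t ht => (pow_le_pow_left' (h1 t ht) 2).trans (esq_add_le _ _)
  rw [lintegral_add_right _ measurable_const, lintegral_const_mul _ (hφc.enorm.measurable.pow_const 2)] at h3
  simp only [lintegral_const, Measure.restrict_apply MeasurableSet.univ, univ_inter, volume_Icc, sub_zero] at h3
  rw [mul_comm]
  refine h3.trans (add_le_add le_rfl ?_)
  calc 2 * J ^ 2 * ofReal a ≤ 2 * (ofReal a * ∫⁻ t in Icc 0 a, ‖φ' t‖ₑ ^ 2) * ofReal a := by gcongr
    _ = _ := by ring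

lemma shift_box {F : Euc N → ℝ≥0∞} (hF : Measurable F) {Q Q' : Set (Euc N)} (hQ' : MeasurableSet Q') (hQ : MeasurableSet Q)
    (i : Fin N) {r a : ℝ} (h1 : ∀ x ∈ Q', |x i| ≤ r)
    (h2 : ∀ x ∈ Q', ∀ t ∈ Icc (0:ℝ) a, x + t • ev i ∈ Q) :
    ∫⁻ x in Q', ∫⁻ t in Icc (0:ℝ) a, F (x + t • ev i) ≤ ofReal (2 * r) * ∫⁻ x in Q, F x := by
  have hm : Measurable fun p : Euc N × ℝ => F (p.1 + p.2 • ev i) := hF.comp (by fun_prop)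
  rw [lintegral_lintegral_swap hm.aemeasurable]
  have e1 : ∀ t : ℝ, ∫⁻ x in Q', F (x + t • ev i) = ∫⁻ y, (Q'.indicator 1 (y - t • ev i)) * F y := by
    intro t
    rw [← lintegral_indicator hQ',
      ← lintegral_add_right_eq_self (fun y => (Q'.indicator 1 (y - t • ev i)) * F y) (t • ev i)]
    refine lintegral_congr fun x => ?_
    by_cases hx : x ∈ Q' <;> simp [hx, Set.indicator]
  simp only [e1]
  have hm2 : Measurable fun p : ℝ × Euc N => (Q'.indicator (1 : Euc N → ℝ≥0∞) (p.2 - p.1 • ev i)) * F p.2 :=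
    ((measurable_one.indicator hQ').comp (by fun_prop)).mul (hF.comp measurable_snd)
  rw [lintegral_lintegral_swap hm2.aemeasurable, ← lintegral_const_mul _ hF, ← lintegral_indicator hQ]
  refine lintegral_mono fun y => ?_
  have e2 : ∫⁻ t in Icc (0:ℝ) a, (Q'.indicator 1 (y - t • ev i)) * F y = (∫⁻ t in Icc (0:ℝ) a, (Q'.indicator 1 (y - t • ev i))) * F y :=
    lintegral_mul_const _ ((measurable_one.indicator hQ').comp (by fun_prop))
  simp only []
  rw [e2]
  by_cases hy : y ∈ Q
  · rw [indicator_of_mem hy]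
    gcongr
    refine (lintegral_mono (g := (Icc (y i - r) (y i + r)).indicator 1) fun t => ?_).trans ?_
    · by_cases ht : y - t • ev i ∈ Q'
      · have := h1 _ ht
        simp [ev_apply] at this
        rw [abs_le] at this
        have ht2 : t ∈ Icc (y i - r) (y i + r) := ⟨by linarith, by linarith⟩
        rw [indicator_of_mem ht, indicator_of_mem ht2]; exact le_rfl
      · rw [indicator_of_notMem ht]; exact zero_le
    · refine (lintegral_mono' Measure.restrict_le_self le_rfl).trans ?_
      rw [lintegral_indicator_one measurableSet_Icc, volume_Icc]
      exact ofReal_le_ofReal (by linarith)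
  · rw [indicator_of_notMem hy]
    have : ∫⁻ t in Icc (0:ℝ) a, (Q'.indicator (1 : Euc N → ℝ≥0∞) (y - t • ev i)) = 0 := by
      rw [setLIntegral_congr_fun (g := 0) measurableSet_Icc fun t ht => ?_]
      · simp
      · have : y - t • ev i ∉ Q' := fun h => hy (by simpa using h2 _ h t ht)
        simp [this]
    rw [this, zero_mul]

def box (c r : ℝ) (S : Finset (Fin N)) : Set (Euc N) := {x | ∀ j, |x j| ≤ if j ∈ S then r else c}

lemma measurableSet_box (c r : ℝ) (S : Finset (Fin N)) : MeasurableSet (box c r S) := by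
  have : box c r S = ⋂ j, {x : Euc N | |x j| ≤ if j ∈ S then r else c} := by ext; simp [box]
  rw [this]
  exact MeasurableSet.iInter fun j => (isClosed_le (by fun_prop) continuous_const).measurableSet

lemma box_step {f f' : Euc N → Euc N} {i : Fin N} (hf : ContDiff ℝ ∞ f) (hf' : ∀ x, fderiv ℝ f x (ev i) = f' x)
    {c r : ℝ} (hc : 0 < c) (hr : 0 < r) (hrc : r ≤ c / 2) (hc1 : c ≤ 1) {S : Finset (Fin N)} (hi : i ∉ S) :
    ∫⁻ x in box c r (insert i S), ‖f x‖ₑ ^ 2 ≤ ofReal (8 / c * r) *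
      ((∫⁻ x in box c r S, ‖f x‖ₑ ^ 2) + ∫⁻ x in box c r S, ‖f' x‖ₑ ^ 2) := by
  have hdf : ∀ x, DifferentiableAt ℝ f x := fun x => hf.differentiable (by simp) x
  have hc' : Continuous f' := by
    have : f' = fun x => fderiv ℝ f x (ev i) := funext fun x => (hf' x).symm
    rw [this]; exact (hf.continuous_fderiv (by simp)).clm_apply continuous_const
  have hsub : ∀ x ∈ box c r (insert i S), ∀ t ∈ Icc (0:ℝ) (c/2), x + t • ev i ∈ box c r S := by
    intro x hx t ht j
    have hxj := hx j
    by_cases hj : j = i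
    · subst hj
      simp only [Finset.mem_insert_self, if_true] at hxj
      simp [ev_apply, hi]
      rw [abs_le] at hxj ⊢
      constructor <;> linarith [ht.1, ht.2, hxj.1, hxj.2]
    · simpa [ev_apply, hj] using hxj
  have hle : ∀ x ∈ box c r (insert i S), |x i| ≤ r := fun x hx => by simpa using hx i
  have hpt : ∀ x, ofReal (c/2) * ‖f x‖ₑ ^ 2 ≤ 2 * (∫⁻ t in Icc (0:ℝ) (c/2), ‖f (x + t • ev i)‖ₑ ^ 2) +
      2 * ∫⁻ t in Icc (0:ℝ) (c/2), ‖f' (x + t • ev i)‖ₑ ^ 2 := by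
    intro x
    have := line_sq (φ := fun t => f (x + t • ev i)) (φ' := fun t => f' (x + t • ev i)) (fun t => ?_) (by fun_prop)
      (a := c/2) (by positivity)
    · simp only [zero_smul, add_zero] at this
      refine this.trans (add_le_add le_rfl ?_)
      gcongr
      refine mul_le_of_le_one_right' (pow_le_one' ?_ 2)
      rw [← ofReal_one]; exact ofReal_le_ofReal (by linarith)
    · have h1 : HasDerivAt (fun t : ℝ => x + t • ev i) (ev i) t := by
        simpa using ((hasDerivAt_id t).smul_const (ev i)).const_add x
      have := (hdf (x + t • ev i)).hasFDerivAt.comp_hasDerivAt t h1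
      rw [hf'] at this
      exact this
  have hmeas : ∀ h : Euc N → Euc N, Continuous h → Measurable fun x => ∫⁻ t in Icc (0:ℝ) (c/2), ‖h (x + t • ev i)‖ₑ ^ 2 :=
    fun h hh => Measurable.lintegral_prod_right (f := fun (x : Euc N) (t : ℝ) => ‖h (x + t • ev i)‖ₑ ^ 2)
      (Measurable.pow_const (Continuous.measurable (by fun_prop)) 2)
  have hme : ∀ h : Euc N → Euc N, Continuous h → Measurable fun x => ‖h x‖ₑ ^ 2 :=
    fun h hh => hh.enorm.measurable.pow_const 2
  have h1 : ofReal (c/2) * ∫⁻ x in box c r (insert i S), ‖f x‖ₑ ^ 2 ≤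
      2 * (ofReal (2 * r) * ∫⁻ x in box c r S, ‖f x‖ₑ ^ 2) +
      2 * (ofReal (2 * r) * ∫⁻ x in box c r S, ‖f' x‖ₑ ^ 2) := by
    rw [← lintegral_const_mul _ (hme f hf.continuous)]
    refine (lintegral_mono hpt).trans ?_
    rw [lintegral_add_left ((hmeas f hf.continuous).const_mul _), lintegral_const_mul _ (hmeas f hf.continuous),
      lintegral_const_mul _ (hmeas f' hc')]
    gcongr
    · exact shift_box (hme f hf.continuous) (measurableSet_box _ _ _) (measurableSet_box _ _ _) i hle hsub
    · exact shift_box (hme f' hc') (measurableSet_box _ _ _) (measurableSet_box _ _ _) i hle hsub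
  have e : ofReal (8 / c * r) = ofReal (2/c) * (2 * ofReal (2 * r)) := by
    rw [show (2:ℝ≥0∞) = ofReal 2 by simp, ← ofReal_mul (by norm_num), ← ofReal_mul (by positivity)]
    congr 1; ring
  calc ∫⁻ x in box c r (insert i S), ‖f x‖ₑ ^ 2
      = ofReal (2/c) * (ofReal (c/2) * ∫⁻ x in box c r (insert i S), ‖f x‖ₑ ^ 2) := by
        rw [← mul_assoc, ← ofReal_mul (by positivity)]
        rw [show 2 / c * (c / 2) = 1 by field_simp]; simp
    _ ≤ _ := by
        refine (mul_le_mul_right h1 _).trans (le_of_eq ?_)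
        rw [e]; ring

lemma box_all {g : List (Fin N) → Euc N → Euc N} (hg : Fam g) {c r : ℝ} (hc : 0 < c) (hr : 0 < r) (hrc : r ≤ c / 2)
    (hc1 : c ≤ 1) (M : ℝ≥0∞) (n : ℕ) (hM : ∀ l, l.length ≤ n → ∫⁻ x in box c r ∅, ‖g l x‖ₑ ^ 2 ≤ M)
    (S : Finset (Fin N)) : ∀ l, l.length + S.card ≤ n →
      ∫⁻ x in box c r S, ‖g l x‖ₑ ^ 2 ≤ ofReal (16 / c * r) ^ S.card * M := by
  classical
  induction S using Finset.induction_on with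
  | empty => intro l hl; simpa using hM l (by simpa using hl)
  | insert i S hi ih =>
    intro l hl
    rw [Finset.card_insert_of_notMem hi] at hl ⊢
    refine (box_step (hg.smooth l) (hg.deriv l i) hc hr hrc hc1 hi).trans ?_
    have h1 := ih l (by omega)
    have h2 := ih (i :: l) (by simp; omega)
    refine (mul_le_mul_right (add_le_add h1 h2) _).trans (le_of_eq ?_)
    have e : ofReal (16 / c * r) = ofReal (8 / c * r) * 2 := by
      rw [show (2:ℝ≥0∞) = ofReal 2 by simp, ← ofReal_mul (by positivity)]
      congr 1; ring
    rw [pow_succ, e]; ring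

lemma dens_le_sum {w : Euc N → Euc N} (x : Euc N) : dens w x ≤ ofReal (2 * N ^ 2) * ∑ i, ‖fderiv ℝ w x (ev i)‖ₑ ^ 2 := by
  have h1 : ∀ i j : Fin N, eSym w x i j * eSym w x i j ≤ ‖fderiv ℝ w x (ev i)‖ ^ 2 + ‖fderiv ℝ w x (ev j)‖ ^ 2 := by
    intro i j
    rw [eSym_eq, eL_apply]
    have a1 := abs_coord_le (fderiv ℝ w x (ev i)) j
    have a2 := abs_coord_le (fderiv ℝ w x (ev j)) i
    have := sq_le_sq' (by linarith [abs_nonneg (fderiv ℝ w x (ev i) j)] : -‖fderiv ℝ w x (ev i)‖ ≤ |fderiv ℝ w x (ev i) j|) a1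
    have := sq_le_sq' (by linarith [abs_nonneg (fderiv ℝ w x (ev j) i)] : -‖fderiv ℝ w x (ev j)‖ ≤ |fderiv ℝ w x (ev j) i|) a2
    rw [sq_abs] at *
    nlinarith [sq_nonneg (fderiv ℝ w x (ev j) i - fderiv ℝ w x (ev i) j)]
  set T := ∑ i, ‖fderiv ℝ w x (ev i)‖ ^ 2 with hT
  have h2 : ∀ i : Fin N, ‖fderiv ℝ w x (ev i)‖ ^ 2 ≤ T := fun i =>
    single_le_sum (f := fun i => ‖fderiv ℝ w x (ev i)‖ ^ 2) (fun _ _ => sq_nonneg _) (Finset.mem_univ i)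
  have h3 : frobNorm (eSym w x) ^ 2 ≤ 2 * N ^ 2 * T := by
    rw [frobNorm_sq, frob]
    calc ∑ i, ∑ j, eSym w x i j * eSym w x i j ≤ ∑ _i : Fin N, ∑ _j : Fin N, 2 * T :=
          sum_le_sum fun i _ => sum_le_sum fun j _ => by linarith [h1 i j, h2 i, h2 j]
      _ = 2 * N ^ 2 * T := by simp; ring
  simp only [enorm_sq_eq]
  rw [← ENNReal.ofReal_sum_of_nonneg fun _ _ => sq_nonneg _, ← ofReal_mul (by positivity)]
  exact ofReal_le_ofReal h3

lemma fam_decay (hN : 2 ≤ N) {𝓒 : Mat N →ₗ[ℝ] Mat N} {c₀ : ℝ} (h𝓒 : IsElasticityTensor 𝓒 c₀) :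
    ∃ C > (0:ℝ), ∃ r₁ > (0:ℝ), ∀ (g : List (Fin N) → Euc N → Euc N) (Λ : ℝ), Fam g → 0 ≤ Λ →
      (∀ l, l.length ≤ N + 1 → Weak 𝓒 (g l) (1/2) Λ) → ∀ r, 0 < r → r ≤ r₁ →
      ∫⁻ x in ball 0 r, dens (g []) x ≤ ofReal (C * r ^ N) *
        ofReal ((∫ x in ball 0 (1/2), ‖g [] x‖ ^ 2) + Λ ^ 2) := by
  obtain ⟨C, hC, h⟩ := fam_bound h𝓒 (N+1)
  set c : ℝ := 1 / (8 * (N + 1)) with hc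
  have hc0 : 0 < c := by positivity
  have hc1 : c ≤ 1 := by
    rw [hc, div_le_one (by positivity)]; have : (0:ℝ) ≤ N := by positivity
    linarith
  have hcN : N * c < 1/4 := by
    rw [hc, mul_one_div, div_lt_div_iff₀ (by positivity) (by positivity)]; have : (0:ℝ) ≤ N := by positivity
    linarith
  refine ⟨2 * N ^ 2 * N * (16 / c) ^ N * C, by positivity, c / 2, by positivity, fun g Λ hg hΛ hW r hr hrc => ?_⟩
  set A := (∫ x in ball 0 (1/2), ‖g [] x‖ ^ 2) + Λ ^ 2 with hA
  have hA0 : 0 ≤ A := by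
    have : 0 ≤ ∫ x in ball (0 : Euc N) (1/2), ‖g [] x‖ ^ 2 := integral_nonneg fun _ => sq_nonneg _
    positivity
  have hsub : box c r (∅ : Finset (Fin N)) ⊆ ball 0 (1/4) := by
    intro x hx
    rw [mem_ball_zero_iff]
    calc ‖x‖ = ‖∑ i, x i • ev i‖ := by rw [sum_ev]
      _ ≤ ∑ i, ‖x i • ev i‖ := norm_sum_le _ _
      _ ≤ ∑ _i : Fin N, c := by
          refine sum_le_sum fun i _ => ?_
          rw [norm_smul, norm_ev, mul_one]
          simpa using hx i
      _ = N * c := by simp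
      _ < 1/4 := hcN
  have hM : ∀ l, l.length ≤ N + 1 → ∫⁻ x in box c r ∅, ‖g l x‖ₑ ^ 2 ≤ ofReal (C * A) := fun l hl =>
    (lintegral_mono_set hsub).trans (h g Λ hg hΛ hW l hl)
  have hb : ∀ i : Fin N, ∫⁻ x in ball 0 r, ‖fderiv ℝ (g []) x (ev i)‖ₑ ^ 2 ≤ ofReal ((16 / c * r) ^ N * (C * A)) := by
    intro i
    simp only [hg.deriv]
    have := box_all hg hc0 hr hrc hc1 _ (N+1) hM Finset.univ [i] (by simp; omega)
    rw [Finset.card_univ, Fintype.card_fin, ← ofReal_pow (by positivity), ← ofReal_mul (by positivity)] at this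
    refine (lintegral_mono_set ?_).trans this
    intro x hx j
    simp only [Finset.mem_univ, if_true]
    exact (abs_coord_le x j).trans (mem_ball_zero_iff.1 hx).le
  refine (lintegral_mono fun x => dens_le_sum x).trans ?_
  have hme : ∀ i : Fin N, Measurable fun x => ‖fderiv ℝ (g []) x (ev i)‖ₑ ^ 2 := fun i =>
    (((hg.smooth []).continuous_fderiv (by simp)).clm_apply continuous_const).enorm.measurable.pow_const 2
  rw [lintegral_const_mul _ (measurable_sum _ fun i _ => hme i), lintegral_finsetSum _ fun i _ => hme i]
  refine (mul_le_mul_right (sum_le_sum fun i _ => hb i) _).trans (le_of_eq ?_)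
  rw [sum_const, Finset.card_univ, Fintype.card_fin, nsmul_eq_mul, ← ofReal_natCast N,
    ← ofReal_mul (by positivity), ← ofReal_mul (by positivity), ← ofReal_mul (by positivity)]
  congr 1
  rw [mul_pow]; ring

/-! ### Mollification -/

def mol (κ : Euc N → ℝ) (f : Euc N → Euc N) (x : Euc N) : Euc N := ∫ y, κ (x - y) • f y

lemma mol_eq (κ : Euc N → ℝ) (f : Euc N → Euc N) :
    mol κ f = convolution κ f (lsmul ℝ ℝ) volume := by
  ext1 x; rw [convolution_lsmul_swap]; rfl

lemma contDiff_mol {κ : Euc N → ℝ} {f : Euc N → Euc N} (hκ : ContDiff ℝ ∞ κ) (hc : HasCompactSupport κ)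
    (hf : Integrable f) : ContDiff ℝ ∞ (mol κ f) := by
  rw [mol_eq]
  exact hc.contDiff_convolution_left _ (n := ⊤) hκ hf.locallyIntegrable

lemma integrable_mol {κ : Euc N → ℝ} {E : Type*} [NormedAddCommGroup E] [NormedSpace ℝ E] {f : Euc N → E}
    (hκ : Continuous κ) (hc : HasCompactSupport κ) {B : Set (Euc N)} (hB : MeasurableSet B) (hf : IntegrableOn f B)
    {x : Euc N} (hx : ∀ z ∈ tsupport κ, x - z ∈ B) : Integrable fun y => κ (x - y) • f y := by
  obtain ⟨C, hC⟩ := hc.exists_bound_of_continuous hκ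
  have h1 : Integrable (B.indicator f) := (integrable_indicator_iff hB).2 hf
  have h2 := h1.bdd_smul (φ := fun y => κ (x - y)) C (Continuous.aestronglyMeasurable (by fun_prop)) (ae_of_all _ fun y => hC _)
  refine h2.congr (ae_of_all _ fun y => ?_)
  simp only [Pi.smul_apply']
  by_cases hy : y ∈ B
  · rw [indicator_of_mem hy]
  · have : κ (x - y) = 0 := by
      by_contra h0
      exact hy (by simpa using hx _ (subset_tsupport _ h0))
    rw [this, zero_smul, zero_smul]

lemma compact_deriv {κ : Euc N → ℝ} (hκ : ContDiff ℝ ∞ κ) (hc : HasCompactSupport κ) (ξ : Euc N) :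
    ContDiff ℝ ∞ (fun z => fderiv ℝ κ z ξ) ∧ HasCompactSupport (fun z => fderiv ℝ κ z ξ) ∧
      tsupport (fun z => fderiv ℝ κ z ξ) ⊆ tsupport κ :=
  ⟨(hκ.fderiv_right (m := ∞) (by simp)).clm_apply contDiff_const, hc.fderiv_apply ℝ ξ, by
    exact tsupport_fderiv_apply_subset ℝ ξ⟩

lemma fderiv_mol {κ : Euc N → ℝ} {f : Euc N → Euc N} (hκ : ContDiff ℝ ∞ κ) (hc : HasCompactSupport κ)
    (hf : Integrable f) (x ξ : Euc N) : fderiv ℝ (mol κ f) x ξ = mol (fun z => fderiv ℝ κ z ξ) f x := by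
  have h := (hc.hasFDerivAt_convolution_left (lsmul ℝ ℝ) (hκ.of_le (by simp))
    (hf.locallyIntegrable) x).fderiv
  rw [mol_eq, h, convolution_eq_swap, mol, ContinuousLinearMap.integral_apply]
  · rfl
  · obtain ⟨C, hC⟩ := (hc.fderiv ℝ).exists_bound_of_continuous (hκ.continuous_fderiv (by simp))
    refine Integrable.mono' (g := fun t => ‖ContinuousLinearMap.precompL (Euc N) (lsmul ℝ ℝ (E := Euc N))‖ * C * ‖f t‖)
      (hf.norm.const_mul _) ?_ (ae_of_all _ fun t => ?_)
    · refine ContinuousLinearMap.aestronglyMeasurable_comp₂ _ ?_ hf.aestronglyMeasurable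
      exact Continuous.aestronglyMeasurable ((hκ.continuous_fderiv (by simp)).comp (by fun_prop))
    · refine (ContinuousLinearMap.le_opNorm₂ _ _ _).trans ?_
      gcongr; exact hC _

lemma mol_ibp {κ : Euc N → ℝ} {f : Euc N → Euc N} (hκ : ContDiff ℝ ∞ κ) (hc : HasCompactSupport κ)
    (hf : Integrable f) {B : Set (Euc N)} (hB : IsOpen B) (hd : ∀ y ∈ B, DifferentiableAt ℝ f y)
    (hi : ∀ ξ, IntegrableOn (fun y => fderiv ℝ f y ξ) B) {x : Euc N} (hx : ∀ z ∈ tsupport κ, x - z ∈ B) (ξ : Euc N) :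
    fderiv ℝ (mol κ f) x ξ = ∫ y, κ (x - y) • fderiv ℝ f y ξ := by
  obtain ⟨h1, h2, h3⟩ := compact_deriv hκ hc ξ
  rw [fderiv_mol hκ hc hf, mol]
  have hdk : ∀ y, fderiv ℝ (fun y => κ (x - y)) y ξ = - fderiv ℝ κ (x - y) ξ := by
    intro y
    have h := ((hκ.differentiable (by simp)) (x - y)).hasFDerivAt.comp y ((hasFDerivAt_id y).const_sub x)
    have h2 : fderiv ℝ (fun y => κ (x - y)) y = _ := h.fderiv
    rw [h2]; simp
  have ht : ∀ y ∈ tsupport (fun y => κ (x - y)), y ∈ B := by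
    intro y hy
    have : x - y ∈ tsupport κ := by
      have hcont : Continuous fun y : Euc N => x - y := by fun_prop
      exact (tsupport_comp_subset_preimage κ hcont) hy
    simpa using hx _ this
  have := integral_smul_fderiv_eq_neg_fderiv_smul_of_integrable (μ := (volume : Measure (Euc N)))
    (f := fun y => κ (x - y)) (g := f) (v := ξ) ?_ ?_ ?_ ?_ ?_
  · rw [this, ← integral_neg]
    refine integral_congr_ae (ae_of_all _ fun y => ?_)
    simp only [hdk, neg_smul, neg_neg]
  · simp only [hdk]
    have := integrable_mol (f := f) h1.continuous h2 hB.measurableSet hf.integrableOn (x := x) (fun z hz => hx z (h3 hz))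
    simpa using this.neg
  · exact integrable_mol hκ.continuous hc hB.measurableSet (hi ξ) hx
  · exact integrable_mol hκ.continuous hc hB.measurableSet hf.integrableOn hx
  · exact fun y _ => ((hκ.differentiable (by simp)) (x - y)).comp y (by fun_prop)
  · exact fun y hy => hd y (ht y hy)

lemma mol_eSym {κ : Euc N → ℝ} {f : Euc N → Euc N} (hκ : ContDiff ℝ ∞ κ) (hc : HasCompactSupport κ)
    (hf : Integrable f) {B : Set (Euc N)} (hB : IsOpen B) (hd : ∀ y ∈ B, DifferentiableAt ℝ f y)
    (hi : ∀ ξ, IntegrableOn (fun y => fderiv ℝ f y ξ) B) {x : Euc N} (hx : ∀ z ∈ tsupport κ, x - z ∈ B) (i j : Fin N) :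
    eSym (mol κ f) x i j = ∫ y, κ (x - y) * eSym f y i j := by
  have hI : ∀ ξ, Integrable fun y => κ (x - y) • fderiv ℝ f y ξ := fun ξ =>
    integrable_mol hκ.continuous hc hB.measurableSet (hi ξ) hx
  have h1 : ∀ (ξ : Euc N) (k : Fin N), fderiv ℝ (mol κ f) x ξ k = ∫ y, κ (x - y) * fderiv ℝ f y ξ k := by
    intro ξ k
    rw [mol_ibp hκ hc hf hB hd hi hx]
    have := (EuclideanSpace.proj k : Euc N →L[ℝ] ℝ).integral_comp_comm (hI ξ)
    simp only [EuclideanSpace.coe_proj] at this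
    rw [← this]
    rfl
  have hI' : ∀ (ξ : Euc N) (k : Fin N), Integrable fun y => κ (x - y) * fderiv ℝ f y ξ k := fun ξ k =>
    (EuclideanSpace.proj k : Euc N →L[ℝ] ℝ).integrable_comp (hI ξ)
  simp only [eSym_eq, eL_apply]
  rw [h1, h1, ← integral_add (hI' _ _) (hI' _ _), ← integral_const_mul]
  refine integral_congr_ae (ae_of_all _ fun y => ?_)
  simp only []; ring

/-- quantitative Euler-Lagrange inequality -/
def EL (𝓒 : Mat N →ₗ[ℝ] Mat N) (v : Euc N → Euc N) (R l : ℝ) : Prop :=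
  ∀ φ : Euc N → Euc N, ContDiff ℝ ∞ φ → HasCompactSupport φ → tsupport φ ⊆ ball 0 R → ∀ m, (∀ x, ‖fderiv ℝ φ x‖ ≤ m) →
    |∫ x, frob (𝓒 (eSym v x)) (eSym φ x)| ≤ l * m

lemma frob_tensor_expand (𝓒 : Mat N →ₗ[ℝ] Mat N) (ξ η : Mat N) :
    frob (𝓒 ξ) η = ∑ i, ∑ j, ∑ k, ∑ l, 𝓒 (Matrix.single k l 1) i j * (ξ k l * η i j) := by
  rw [frob]
  refine sum_congr rfl fun i _ => sum_congr rfl fun j _ => ?_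
  rw [tensor_sum]
  simp only [Matrix.sum_apply, Matrix.smul_apply, smul_eq_mul, Finset.sum_mul]
  refine sum_congr rfl fun k _ => sum_congr rfl fun l _ => by ring

lemma integral_tensor_expand (𝓒 : Mat N →ₗ[ℝ] Mat N) {ξ η : Euc N → Mat N}
    (h : ∀ i j k l, Integrable fun x => ξ x k l * η x i j) :
    ∫ x, frob (𝓒 (ξ x)) (η x) = ∑ i, ∑ j, ∑ k, ∑ l, 𝓒 (Matrix.single k l 1) i j * ∫ x, ξ x k l * η x i j := by
  simp only [frob_tensor_expand]
  have h' : ∀ i j k l, Integrable fun x => 𝓒 (Matrix.single k l 1) i j * (ξ x k l * η x i j) :=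
    fun i j k l => (h i j k l).const_mul _
  rw [integral_finsetSum _ fun i _ => integrable_finsetSum _ fun j _ => integrable_finsetSum _ fun k _ =>
    integrable_finsetSum _ fun l _ => h' i j k l]
  refine sum_congr rfl fun i _ => ?_
  rw [integral_finsetSum _ fun j _ => integrable_finsetSum _ fun k _ => integrable_finsetSum _ fun l _ => h' i j k l]
  refine sum_congr rfl fun j _ => ?_
  rw [integral_finsetSum _ fun k _ => integrable_finsetSum _ fun l _ => h' i j k l]
  refine sum_congr rfl fun k _ => ?_
  rw [integral_finsetSum _ fun l _ => h' i j k l]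
  exact sum_congr rfl fun l _ => integral_const_mul _ _

lemma integrable_eSym {f : Euc N → Euc N} {B : Set (Euc N)}
    (hi : ∀ ξ, IntegrableOn (fun y => fderiv ℝ f y ξ) B) (i j : Fin N) : IntegrableOn (fun y => eSym f y i j) B := by
  simp only [eSym_eq, eL_apply]
  have : ∀ (ξ : Euc N) (k : Fin N), IntegrableOn (fun y => fderiv ℝ f y ξ k) B := fun ξ k =>
    (EuclideanSpace.proj k : Euc N →L[ℝ] ℝ).integrable_comp (hi ξ)
  exact ((this _ _).add (this _ _)).const_mul _

lemma mol_weak {𝓒 : Mat N →ₗ[ℝ] Mat N} {κ : Euc N → ℝ} {f : Euc N → Euc N} (hκ : ContDiff ℝ ∞ κ) (hc : HasCompactSupport κ)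
    (hs : tsupport κ ⊆ closedBall 0 (1/16)) {D l : ℝ} (hD : ∀ x, ‖fderiv ℝ κ x‖ ≤ D)
    (hf : Integrable f) (hd : ∀ y ∈ ball (0 : Euc N) (5/8), DifferentiableAt ℝ f y)
    (hi : ∀ ξ, IntegrableOn (fun y => fderiv ℝ f y ξ) (ball 0 (5/8))) (hEL : EL 𝓒 f (5/8) l) :
    Weak 𝓒 (mol κ f) (1/2) (l * D) := by
  intro ψ hψ hψc hψt
  set κ' : Euc N → ℝ := fun z => κ (-z) with hκ'
  have hκ1 : ContDiff ℝ ∞ κ' := hκ.comp contDiff_neg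
  have hκ2 : HasCompactSupport κ' := hc.comp_homeomorph (Homeomorph.neg _)
  have hD' : ∀ x, ‖fderiv ℝ κ' x‖ ≤ D := fun x => by
    have h := ((hκ.differentiable (by simp)) (-x)).hasFDerivAt.comp x (hasFDerivAt_id x).neg
    have h2 : fderiv ℝ κ' x = _ := h.fderiv
    rw [h2]
    refine (opNorm_comp_le _ _).trans ?_
    rw [norm_neg]
    exact (mul_le_of_le_one_right (norm_nonneg _) ContinuousLinearMap.norm_id_le).trans (hD _)
  have hψI : Integrable ψ := hψ.continuous.integrable_of_hasCompactSupport hψc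
  set φ := mol κ' ψ with hφ
  have hφ1 : ContDiff ℝ ∞ φ := contDiff_mol hκ1 hκ2 hψI
  have hφs : Function.support φ ⊆ closedBall 0 (9/16) := by
    intro y hy
    by_contra h0
    apply hy
    rw [hφ, mol]
    refine integral_eq_zero_of_ae (ae_of_all _ fun x => ?_)
    by_contra h1
    have h2 : κ' (y - x) ≠ 0 := fun h => h1 (by simp [h])
    have h3 : ψ x ≠ 0 := fun h => h1 (by simp [h])
    have h4 := hψt (subset_tsupport _ h3)
    have h5 := hs (subset_tsupport _ (show -(y - x) ∈ Function.support κ from h2))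
    rw [mem_ball_zero_iff] at h4
    rw [mem_closedBall_zero_iff, norm_neg] at h5
    apply h0
    rw [mem_closedBall_zero_iff]
    have := norm_add_le (y - x) x
    rw [sub_add_cancel] at this
    linarith
  have hφt : tsupport φ ⊆ closedBall 0 (9/16) := closure_minimal hφs isClosed_closedBall
  have hφc : HasCompactSupport φ := (isCompact_closedBall 0 (9/16)).of_isClosed_subset (isClosed_tsupport _) hφt
  have hB : tsupport φ ⊆ ball 0 (5/8) := hφt.trans (closedBall_subset_ball (by norm_num))
  have hφm : ∀ y, ‖fderiv ℝ φ y‖ ≤ D * ∫ x, ‖ψ x‖ := by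
    intro y
    have hD0 : 0 ≤ D := (norm_nonneg _).trans (hD 0)
    refine opNorm_le_bound _ (by positivity) fun ξ => ?_
    rw [hφ, fderiv_mol hκ1 hκ2 hψI, mol]
    refine (norm_integral_le_integral_norm _).trans ?_
    rw [← integral_const_mul, mul_comm, ← integral_const_mul]
    obtain ⟨a1, a2, a3⟩ := compact_deriv hκ1 hκ2 ξ
    refine integral_mono (integrable_mol (B := univ) a1.continuous a2 .univ hψI.integrableOn (fun _ _ => mem_univ _)).norm
      ((hψI.norm.const_mul _).const_mul _) fun x => ?_
    show ‖fderiv ℝ κ' (y - x) ξ • ψ x‖ ≤ ‖ξ‖ * (D * ‖ψ x‖)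
    rw [norm_smul]
    calc ‖fderiv ℝ κ' (y - x) ξ‖ * ‖ψ x‖ ≤ (D * ‖ξ‖) * ‖ψ x‖ := by
          gcongr
          exact ((fderiv ℝ κ' (y-x)).le_opNorm ξ).trans (by gcongr; exact hD' _)
      _ = _ := by ring
  have hmain := hEL φ hφ1 hφc hB _ hφm
  rw [← mul_assoc] at hmain
  convert hmain using 2
  set B := ball (0 : Euc N) (5/8) with hBdef
  have hψd : ∀ ξ, IntegrableOn (fun y => fderiv ℝ ψ y ξ) univ := fun ξ =>
    (((hψ.continuous_fderiv (by simp)).clm_apply continuous_const).integrable_of_hasCompactSupport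
      (hψc.fderiv_apply ℝ ξ)).integrableOn
  have eφ : ∀ y i j, eSym φ y i j = ∫ x, κ (x - y) * eSym ψ x i j := by
    intro y i j
    rw [hφ, mol_eSym hκ1 hκ2 hψI isOpen_univ (fun y _ => hψ.differentiable (by simp) y) hψd (fun _ _ => mem_univ _)]
    simp [hκ']
  have hxB : ∀ x ∈ ball (0 : Euc N) (1/2), ∀ z ∈ tsupport κ, x - z ∈ B := by
    intro x hx z hz
    have h1 := mem_closedBall_zero_iff.1 (hs hz)
    rw [mem_ball_zero_iff] at hx
    rw [hBdef, mem_ball_zero_iff]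
    have := norm_sub_le x z
    linarith
  have eg : ∀ x ∈ ball (0 : Euc N) (1/2), ∀ k l, eSym (mol κ f) x k l = ∫ y, κ (x - y) * eSym f y k l :=
    fun x hx k l => mol_eSym hκ hc hf isOpen_ball hd hi (hxB x hx) k l
  have hψ0 : ∀ x ∉ ball (0 : Euc N) (1/2), eSym ψ x = 0 := by
    intro x hx
    rw [eSym_eq, image_eq_zero_of_notMem_tsupport (f := fderiv ℝ ψ) fun h => hx (hψt (tsupport_fderiv_subset ℝ h)), map_zero]
  have hφ0 : ∀ x ∉ B, eSym φ x = 0 := by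
    intro x hx
    rw [eSym_eq, image_eq_zero_of_notMem_tsupport (f := fderiv ℝ φ) fun h => hx (hB (tsupport_fderiv_subset ℝ h)), map_zero]
  have hψe : ∀ i j, Continuous fun x => eSym ψ x i j := continuous_eSym (hψ.of_le (by simp))
  have hφe : ∀ i j, Continuous fun x => eSym φ x i j := continuous_eSym (hφ1.of_le (by simp))
  have hψes : ∀ i j, HasCompactSupport fun x => eSym ψ x i j := fun i j =>
    (compactSupport_eSym hψc).comp_left (g := fun ξ : Mat N => ξ i j) rfl
  have hφes : ∀ i j, HasCompactSupport fun x => eSym φ x i j := fun i j =>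
    (compactSupport_eSym hφc).comp_left (g := fun ξ : Mat N => ξ i j) rfl
  have hge : ∀ i j, Continuous fun x => eSym (mol κ f) x i j := continuous_eSym ((contDiff_mol hκ hc hf).of_le (by simp))
  have hfB : ∀ k l, Integrable (B.indicator fun y => eSym f y k l) := fun k l =>
    (integrable_indicator_iff measurableSet_ball).2 (integrable_eSym hi k l)
  have hfφ : ∀ i j k l y, eSym f y k l * eSym φ y i j = eSym φ y i j * B.indicator (fun y => eSym f y k l) y := by
    intro i j k l y
    by_cases hy : y ∈ B
    · rw [indicator_of_mem hy, mul_comm]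
    · rw [hφ0 y hy]; simp
  rw [integral_tensor_expand, integral_tensor_expand]
  rotate_left
  · intro i j k l
    simp only [hfφ]
    obtain ⟨C, hC⟩ := (hφes i j).exists_bound_of_continuous (hφe i j)
    exact (hfB k l).bdd_mul (hφe i j).aestronglyMeasurable (ae_of_all _ hC)
  · intro i j k l
    exact ((hge k l).mul (hψe i j)).integrable_of_hasCompactSupport (hψes i j).mul_left
  refine sum_congr rfl fun i _ => sum_congr rfl fun j _ => sum_congr rfl fun k _ =>
    sum_congr rfl fun l _ => ?_
  congr 1
  have e1 : ∀ x, eSym (mol κ f) x k l * eSym ψ x i j =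
      ∫ y, κ (x - y) * (eSym ψ x i j * B.indicator (fun y => eSym f y k l) y) := by
    intro x
    by_cases hx : x ∈ ball (0 : Euc N) (1/2)
    · rw [eg x hx, ← integral_mul_const]
      refine integral_congr_ae (ae_of_all _ fun y => ?_)
      by_cases hy : y ∈ B
      · simp only [indicator_of_mem hy]; ring
      · have : κ (x - y) = 0 := by
          by_contra h0
          exact hy (by simpa using hxB x hx _ (subset_tsupport _ h0))
        simp [this]
    · simp [hψ0 x hx]
  have e2 : ∀ y, eSym f y k l * eSym φ y i j =
      ∫ x, κ (x - y) * (eSym ψ x i j * B.indicator (fun y => eSym f y k l) y) := by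
    intro y
    rw [hfφ, eφ, ← integral_mul_const]
    exact integral_congr_ae (ae_of_all _ fun x => by simp only []; ring)
  simp only [e1, e2]
  apply integral_integral_swap
  obtain ⟨C, hC⟩ := hc.exists_bound_of_continuous hκ.continuous
  have hψint : Integrable fun x => eSym ψ x i j := (hψe i j).integrable_of_hasCompactSupport (hψes i j)
  exact (hψint.mul_prod (hfB k l)).bdd_mul (f := fun p : Euc N × Euc N => κ (p.1 - p.2))
    (Continuous.aestronglyMeasurable (hκ.continuous.comp (by fun_prop))) (ae_of_all _ fun p => hC _)

/-- an even probability kernel of radius `θ` -/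
structure Ker (ρ : Euc N → ℝ) (θ : ℝ) : Prop where
  smooth : ContDiff ℝ ∞ ρ
  cpt : HasCompactSupport ρ
  supp : tsupport ρ ⊆ closedBall 0 θ
  nonneg : ∀ x, 0 ≤ ρ x
  even : ∀ x, ρ (-x) = ρ x
  one : ∫ x, ρ x = 1
  supp' : ∀ x, ρ x ≠ 0 → ‖x‖ < θ

lemma exists_ker {θ : ℝ} (hθ : 0 < θ) : ∃ ρ : Euc N → ℝ, Ker ρ θ := by
  let f : ContDiffBump (0 : Euc N) := ⟨θ/2, θ, by positivity, by linarith⟩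
  refine ⟨f.normed volume, f.contDiff_normed, f.hasCompactSupport_normed, ?_, f.nonneg_normed, fun x => f.normed_neg x,
    f.integral_normed, fun x hx => ?_⟩
  · rw [f.tsupport_normed_eq]
  · have : x ∈ Function.support (f.normed volume) := hx
    rw [f.support_normed_eq] at this
    exact mem_ball_zero_iff.1 this

lemma Ker.lint {ρ : Euc N → ℝ} {θ : ℝ} (h : Ker ρ θ) : ∫⁻ x, ofReal (ρ x) = 1 := by
  rw [← ofReal_integral_eq_lintegral_ofReal (h.smooth.continuous.integrable_of_hasCompactSupport h.cpt) (ae_of_all _ h.nonneg),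
    h.one, ofReal_one]

lemma Ker.jensen {ρ : Euc N → ℝ} {θ : ℝ} (h : Ker ρ θ) {f : Euc N → Euc N} (hf : AEStronglyMeasurable f volume) (x : Euc N) :
    ‖mol ρ f x‖ₑ ^ 2 ≤ ∫⁻ y, ofReal (ρ (x - y)) * ‖f y‖ₑ ^ 2 := by
  have hm : Measurable fun y => ofReal (ρ (x - y)) :=
    ENNReal.measurable_ofReal.comp (h.smooth.continuous.comp (by fun_prop)).measurable
  set μ := (volume : Measure (Euc N)).withDensity fun y => ofReal (ρ (x - y)) with hμ
  have h1 : ‖mol ρ f x‖ₑ ≤ ∫⁻ y, ‖f y‖ₑ ∂μ := by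
    rw [hμ, lintegral_withDensity_eq_lintegral_mul₀ hm.aemeasurable hf.enorm]
    refine (enorm_integral_le_lintegral_enorm _).trans (lintegral_mono fun y => le_of_eq ?_)
    rw [enorm_smul, Pi.mul_apply]
    congr 1
    rw [Real.enorm_eq_ofReal (h.nonneg _)]
  have hμ1 : μ univ = 1 := by
    rw [hμ, withDensity_apply _ MeasurableSet.univ, Measure.restrict_univ,
      lintegral_sub_left_eq_self (fun y => ofReal (ρ y)) x, h.lint]
  have hfμ : AEMeasurable (fun y => ‖f y‖ₑ) μ := hf.enorm.mono_ac (withDensity_absolutelyContinuous _ _)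
  refine (pow_le_pow_left' h1 2).trans ((lintegral_sq_le hfμ).trans ?_)
  rw [hμ1, one_mul, hμ, lintegral_withDensity_eq_lintegral_mul₀ hm.aemeasurable (hf.enorm.pow_const 2)]
  rfl

lemma Ker.contract {ρ : Euc N → ℝ} {θ : ℝ} (h : Ker ρ θ) {f : Euc N → Euc N} (hf : AEStronglyMeasurable f volume) :
    ∫⁻ x, ‖mol ρ f x‖ₑ ^ 2 ≤ ∫⁻ x, ‖f x‖ₑ ^ 2 := by
  refine (lintegral_mono fun x => h.jensen hf x).trans ?_
  have hm : Measurable fun p : Euc N × Euc N => ofReal (ρ (p.1 - p.2)) :=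
    ENNReal.measurable_ofReal.comp (h.smooth.continuous.comp (by fun_prop)).measurable
  rw [lintegral_lintegral_swap]
  · refine lintegral_mono fun y => ?_
    have hm1 : Measurable fun x => ofReal (ρ (x - y)) :=
      ENNReal.measurable_ofReal.comp (h.smooth.continuous.comp (by fun_prop)).measurable
    rw [lintegral_mul_const _ hm1,
      lintegral_sub_right_eq_self (fun x => ofReal (ρ x)) y, h.lint, one_mul]
  · exact hm.aemeasurable.mul ((hf.enorm.pow_const 2).comp_quasiMeasurePreserving Measure.quasiMeasurePreserving_snd)

lemma Ker.affine {ρ : Euc N → ℝ} {θ : ℝ} (h : Ker ρ θ) (b : Euc N) (A : Euc N →L[ℝ] Euc N) (x : Euc N) :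
    mol ρ (fun y => b + A y) x = b + A x := by
  have hI : ∀ G : Euc N → Euc N, Continuous G → Integrable fun t => ρ t • G t := fun G hG =>
    (h.smooth.continuous.smul hG).integrable_of_hasCompactSupport h.cpt.smul_right
  have e1 : mol ρ (fun y => b + A y) x = ∫ t, ρ t • (b + A (x - t)) := by
    rw [mol, ← integral_sub_left_eq_self (fun t => ρ t • (b + A (x - t))) volume x]
    simp
  have e2 : ∫ t, ρ t • A t = 0 := by
    have := integral_neg_eq_self (fun t => ρ t • A t) (volume : Measure (Euc N))
    simp only [h.even, map_neg, smul_neg, integral_neg] at this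
    have h2 : (2:ℝ) • ∫ t, ρ t • A t = 0 := by
      rw [two_smul]; nth_rewrite 1 [← this]; simp
    exact (smul_eq_zero.1 h2).resolve_left (by norm_num)
  have e3 : ∀ t, ρ t • (b + A (x - t)) = ρ t • (b + A x) - ρ t • A t := fun t => by
    rw [map_sub, ← smul_sub, add_sub_assoc]
  rw [e1]
  simp only [e3]
  rw [integral_sub (hI _ continuous_const) (hI _ A.continuous), e2, sub_zero, integral_smul_const, h.one, one_smul]

lemma eSym_add_rigid {g : Euc N → Euc N} {x : Euc N} (b : Euc N) {A : Euc N →L[ℝ] Euc N} (hA : ∀ x, ⟪A x, x⟫ = 0)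
    (hg : DifferentiableAt ℝ g x) : eSym (fun y => g y + (b + A y)) x = eSym g x := by
  rw [eSym_eq, eSym_eq, fderiv_fun_add hg (hasFDerivAt_rigid b A x).differentiableAt, (hasFDerivAt_rigid b A x).fderiv, map_add,
    eL_skew A hA, add_zero]

/-- iterated partial derivatives of a kernel -/
def kerD (ρ : Euc N → ℝ) : List (Fin N) → Euc N → ℝ
  | [] => ρ
  | i :: l => fun z => fderiv ℝ (kerD ρ l) z (ev i)

lemma kerD_props {ρ : Euc N → ℝ} {θ : ℝ} (h : Ker ρ θ) (l : List (Fin N)) :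
    ContDiff ℝ ∞ (kerD ρ l) ∧ HasCompactSupport (kerD ρ l) ∧ tsupport (kerD ρ l) ⊆ closedBall 0 θ := by
  induction l with
  | nil => exact ⟨h.smooth, h.cpt, h.supp⟩
  | cons i l ih =>
    obtain ⟨h1, h2, h3⟩ := compact_deriv ih.1 ih.2.1 (ev i)
    exact ⟨h1, h2, h3.trans ih.2.2⟩

lemma kerD_bound {ρ : Euc N → ℝ} {θ : ℝ} (h : Ker ρ θ) (n : ℕ) :
    ∃ D > (0:ℝ), ∀ l : List (Fin N), l.length ≤ n → ∀ x, ‖fderiv ℝ (kerD ρ l) x‖ ≤ D := by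
  have h1 : ∀ l : List (Fin N), ∃ D, ∀ x, ‖fderiv ℝ (kerD ρ l) x‖ ≤ D := fun l =>
    ((kerD_props h l).2.1.fderiv ℝ).exists_bound_of_continuous ((kerD_props h l).1.continuous_fderiv (by simp))
  choose D hD using h1
  obtain ⟨M, hM⟩ := ((List.finite_length_le (Fin N) n).image D).bddAbove
  exact ⟨max M 1, by positivity, fun l hl x => (hD l x).trans ((hM ⟨l, hl, rfl⟩).trans (le_max_left _ _))⟩

lemma Weak.mono' {𝓒 : Mat N →ₗ[ℝ] Mat N} {g : Euc N → Euc N} {t Λ Λ' : ℝ} (h : Weak 𝓒 g t Λ) (hst : Λ ≤ Λ') :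
    Weak 𝓒 g t Λ' := fun ψ h1 h2 h3 => (h ψ h1 h2 h3).trans (by gcongr)

lemma fam_mol {ρ : Euc N → ℝ} {θ : ℝ} (h : Ker ρ θ) {f : Euc N → Euc N} (hf : Integrable f) :
    Fam fun l => mol (kerD ρ l) f where
  smooth l := contDiff_mol (kerD_props h l).1 (kerD_props h l).2.1 hf
  deriv l i x := fderiv_mol (kerD_props h l).1 (kerD_props h l).2.1 hf x (ev i)

lemma h1_compact {v : Euc N → Euc N} {S : Set (Euc N)} (hS : IsCompact S) (h : ∀ p ∈ S, H1At v p) :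
    ∫⁻ x in S, (ofReal (‖v x‖ ^ 2) + ofReal (‖fderiv ℝ v x‖ ^ 2)) ≠ ⊤ := by
  set F := fun x => ofReal (‖v x‖ ^ 2) + ofReal (‖fderiv ℝ v x‖ ^ 2)
  refine hS.induction_on (p := fun S => ∫⁻ x in S, F x ≠ ⊤) (by simp) (fun s t hst ht => ?_) (fun s t hs ht => ?_)
    fun x hx => ?_
  · exact ne_top_of_le_ne_top ht (lintegral_mono_set hst)
  · exact ne_top_of_le_ne_top (add_ne_top.2 ⟨hs, ht⟩) (lintegral_union_le _ _ _)
  · obtain ⟨ε, hε, h1, h2⟩ := h x hx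
    exact ⟨ball x ε, mem_nhdsWithin_of_mem_nhds (ball_mem_nhds x hε), h2⟩

lemma tonelli_balls {F : Euc N → ℝ≥0∞} (hF : Measurable F) (r : ℝ) :
    ∫⁻ z, ∫⁻ x in ball z r, F x = volume (ball (0 : Euc N) r) * ∫⁻ x, F x := by
  have e : ∀ z, ∫⁻ x in ball z r, F x = ∫⁻ x, (ball (0 : Euc N) r).indicator 1 (z - x) * F x := by
    intro z
    rw [← lintegral_indicator measurableSet_ball]
    refine lintegral_congr fun x => ?_
    have : x ∈ ball z r ↔ z - x ∈ ball (0 : Euc N) r := by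
      rw [mem_ball_zero_iff, mem_ball, dist_comm, dist_eq_norm]
    by_cases hx : x ∈ ball z r
    · rw [indicator_of_mem hx, indicator_of_mem (this.1 hx)]; simp
    · rw [indicator_of_notMem hx, indicator_of_notMem (mt this.2 hx)]; simp
  simp only [e]
  have hm : Measurable fun p : Euc N × Euc N => (ball (0 : Euc N) r).indicator (1 : Euc N → ℝ≥0∞) (p.1 - p.2) :=
    (measurable_one.indicator measurableSet_ball).comp (by fun_prop)
  rw [lintegral_lintegral_swap (hm.mul (hF.comp measurable_snd)).aemeasurable, ← lintegral_const_mul _ hF]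
  refine lintegral_congr fun x => ?_
  have hm1 : Measurable fun z => (ball (0 : Euc N) r).indicator (1 : Euc N → ℝ≥0∞) (z - x) :=
    (measurable_one.indicator measurableSet_ball).comp (by fun_prop)
  rw [lintegral_mul_const _ hm1,
    lintegral_sub_right_eq_self (fun z => (ball (0 : Euc N) r).indicator (1 : Euc N → ℝ≥0∞) z) x,
    lintegral_indicator_one measurableSet_ball]

/-- Korn-Poincaré on a ball without crack -/
lemma fit_ball (hN : 2 ≤ N) : ∃ C > (0:ℝ), ∀ (z : Euc N) (r : ℝ), 0 < r → ∀ v : Euc N → Euc N,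
    (∀ x ∈ ball z r, DifferentiableAt ℝ v x) → ∫⁻ x in ball z r, dens v x ≠ ⊤ →
    ∃ (b : Euc N) (A : Euc N →L[ℝ] Euc N), (∀ x, ⟪A x, x⟫ = 0) ∧
      ∫⁻ x in ball z r, ‖v x - (b + A x)‖ₑ ^ 2 ≤ ofReal (C * r ^ 2) * ∫⁻ x in ball z r, dens v x := by
  obtain ⟨C, hC, H⟩ := exists_fit hN
  obtain ⟨δ, hδ, H⟩ := H 1 one_pos
  refine ⟨C, hC, fun z r hr v hv hf => ?_⟩
  obtain ⟨b, A, G, F⟩ := H z r hr ∅ v isClosed_empty (by simpa using hv) (by simpa using hf) (by simp)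
  refine ⟨b, A, F.skew, ?_⟩
  have := F.est
  rw [F.free (by simp)] at this
  simp only [enorm_sq_eq]
  rwa [diff_empty] at this

lemma integrable_ball {g : Euc N → Euc N} {z : Euc N} {r : ℝ} (hg : ∀ x ∈ ball z r, DifferentiableAt ℝ g x)
    (h : ∫⁻ x in ball z r, ‖g x‖ₑ ^ 2 ≠ ⊤) :
    AEStronglyMeasurable ((ball z r).indicator g) volume ∧ Integrable ((ball z r).indicator g) := by
  have hm : AEStronglyMeasurable g (volume.restrict (ball z r)) :=
    ContinuousOn.aestronglyMeasurable (fun x hx => (hg x hx).continuousAt.continuousWithinAt) measurableSet_ball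
  refine ⟨(aestronglyMeasurable_indicator_iff measurableSet_ball).2 hm, (integrable_indicator_iff measurableSet_ball).2 ?_⟩
  have hfin : IsFiniteMeasure (volume.restrict (ball z r)) := ⟨by simpa using measure_ball_lt_top⟩
  have h2 := lintegral_sq_le (μ := volume.restrict (ball z r)) hm.enorm
  refine ⟨hm, ?_⟩
  rw [HasFiniteIntegral, lt_top_iff_ne_top]
  intro h3
  rw [h3] at h2
  simp only [ne_eq, OfNat.ofNat_ne_zero, not_false_eq_true, ENNReal.top_pow, top_le_iff] at h2
  exact mul_ne_top (measure_ne_top _ _) h h2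

lemma lint_indicator_sq (g : Euc N → Euc N) (z : Euc N) (r : ℝ) :
    ∫⁻ x, ‖(ball z r).indicator g x‖ₑ ^ 2 = ∫⁻ x in ball z r, ‖g x‖ₑ ^ 2 := by
  rw [← lintegral_indicator measurableSet_ball]
  refine lintegral_congr fun x => ?_
  by_cases hx : x ∈ ball z r <;> simp [hx]

lemma smooth_local (hN : 2 ≤ N) : ∃ C > (0:ℝ), ∀ (ρ : Euc N → ℝ) (θ : ℝ), Ker ρ θ → 0 < θ → ∀ (v f : Euc N → Euc N)
    (b : Euc N) (A : Euc N →L[ℝ] Euc N) (z : Euc N), (∀ x ∈ ball z (2*θ), DifferentiableAt ℝ v x) →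
    (∀ x ∈ ball z (2*θ), f x = v x - (b + A x)) → ∫⁻ x in ball z (2*θ), dens v x ≠ ⊤ →
    ∫⁻ x in ball z θ, ‖v x - (mol ρ f x + (b + A x))‖ₑ ^ 2 ≤ ofReal (C * θ ^ 2) * ∫⁻ x in ball z (2*θ), dens v x := by
  obtain ⟨C, hC, H⟩ := fit_ball hN
  refine ⟨16 * C, by positivity, fun ρ θ hρ hθ v f b A z hv hf hfin => ?_⟩
  obtain ⟨b', A', hA', hest⟩ := H z (2*θ) (by positivity) v hv hfin
  set q := (ball z (2*θ)).indicator fun x => v x - (b' + A' x) with hq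
  obtain ⟨hqm, hqi⟩ := integrable_ball (g := fun x => v x - (b' + A' x))
    (fun x hx => (hv x hx).sub (hasFDerivAt_rigid b' A' x).differentiableAt)
    (ne_top_of_le_ne_top (mul_ne_top ofReal_ne_top hfin) hest)
  have key : ∀ x ∈ ball z θ, v x - (mol ρ f x + (b + A x)) = q x - mol ρ q x := by
    intro x hx
    have hx2 : x ∈ ball z (2*θ) := ball_subset_ball (by linarith) hx
    have e1 : mol ρ f x = ∫ y, (ρ (x - y) • q y + ρ (x - y) • ((b' - b) + (A' - A) y)) := by
      refine integral_congr_ae (ae_of_all _ fun y => ?_)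
      by_cases hy : ρ (x - y) = 0
      · simp [hy]
      · have hyb : y ∈ ball z (2*θ) := by
          have h1 := hρ.supp' _ hy
          rw [mem_ball] at hx ⊢
          have h2 := dist_triangle y x z
          rw [dist_comm y x, dist_eq_norm x y] at h2
          linarith
        simp only [hq, indicator_of_mem hyb, hf y hyb, ← smul_add]
        congr 1
        simp only [ContinuousLinearMap.sub_apply]
        abel
    have e2 : mol ρ f x = mol ρ q x + ((b' - b) + (A' - A) x) := by
      rw [e1, integral_add, ← hρ.affine]
      · rfl
      · exact integrable_mol hρ.smooth.continuous hρ.cpt MeasurableSet.univ hqi.integrableOn (fun _ _ => mem_univ _)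
      · refine integrable_mol hρ.smooth.continuous hρ.cpt (B := closedBall x θ) measurableSet_closedBall ?_ fun t ht => ?_
        · exact (Continuous.continuousOn (by fun_prop)).integrableOn_compact (isCompact_closedBall _ _)
        · have := hρ.supp ht
          simpa using this
    rw [e2]
    simp only [hq, indicator_of_mem hx2, ContinuousLinearMap.sub_apply]
    abel
  calc ∫⁻ x in ball z θ, ‖v x - (mol ρ f x + (b + A x))‖ₑ ^ 2
      ≤ ∫⁻ x in ball z θ, (2 * ‖q x‖ₑ ^ 2 + 2 * ‖mol ρ q x‖ₑ ^ 2) := by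
        refine setLIntegral_mono_ae' measurableSet_ball (ae_of_all _ fun x hx => ?_)
        rw [key x hx]
        exact (pow_le_pow_left' (enorm_sub_le) 2).trans (esq_add_le _ _)
    _ ≤ ∫⁻ x, (2 * ‖q x‖ₑ ^ 2 + 2 * ‖mol ρ q x‖ₑ ^ 2) := setLIntegral_le_lintegral _ _
    _ = 2 * (∫⁻ x, ‖q x‖ₑ ^ 2) + 2 * ∫⁻ x, ‖mol ρ q x‖ₑ ^ 2 := by
        rw [lintegral_add_left' ((hqm.enorm.pow_const 2).const_mul 2), lintegral_const_mul' _ _ (by simp),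
          lintegral_const_mul' _ _ (by simp)]
    _ ≤ 4 * ∫⁻ x, ‖q x‖ₑ ^ 2 := by
        have := hρ.contract hqm
        calc _ ≤ 2 * (∫⁻ x, ‖q x‖ₑ ^ 2) + 2 * ∫⁻ x, ‖q x‖ₑ ^ 2 := by gcongr
          _ = 4 * ∫⁻ x, ‖q x‖ₑ ^ 2 := by rw [← add_mul]; norm_num
    _ ≤ 4 * (ofReal (C * (2*θ) ^ 2) * ∫⁻ x in ball z (2*θ), dens v x) := by
        rw [hq, lint_indicator_sq]; gcongr
    _ = _ := by
        rw [← mul_assoc]; congr 1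
        rw [show (4:ℝ≥0∞) = ofReal 4 by simp, ← ofReal_mul (by norm_num)]
        congr 1; ring

lemma smooth_diff (hN : 2 ≤ N) : ∃ C > (0:ℝ), ∀ (ρ : Euc N → ℝ) (θ : ℝ), Ker ρ θ → 0 < θ → θ ≤ 1/16 → ∀ (v f : Euc N → Euc N)
    (b : Euc N) (A : Euc N →L[ℝ] Euc N), (∀ x ∈ ball 0 (3/4), DifferentiableAt ℝ v x) → Integrable f →
    (∀ x ∈ ball 0 (5/8), f x = v x - (b + A x)) → ∫⁻ x in ball 0 (3/4), dens v x ≠ ⊤ →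
    ∫⁻ x in ball 0 (1/4), ‖v x - (mol ρ f x + (b + A x))‖ₑ ^ 2 ≤
      ofReal (C * θ ^ 2) * ∫⁻ x in ball 0 (3/4), dens v x := by
  have : NeZero N := ⟨by omega⟩
  obtain ⟨C, hC, H⟩ := smooth_local hN
  refine ⟨C * 2 ^ N, by positivity, fun ρ θ hρ hθ hθ1 v f b A hv hfi hf hfin => ?_⟩
  set g := fun x => v x - (mol ρ f x + (b + A x)) with hg
  classical
  set F : Euc N → ℝ≥0∞ := (ball (0 : Euc N) (1/4)).indicator fun x => ‖g x‖ₑ ^ 2 with hF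
  set E : Euc N → ℝ≥0∞ := (ball (0 : Euc N) (3/4)).indicator (dens v) with hE
  have hEm : Measurable E := (measurable_dens v).indicator measurableSet_ball
  have hFm : Measurable F := by
    have : Measurable ((ball (0 : Euc N) (1/4)).indicator g) := by
      rw [← piecewise_eq_indicator]
      refine ContinuousOn.measurable_piecewise (fun x hx => ?_) continuousOn_const measurableSet_ball
      refine (ContinuousAt.sub (hv x (ball_subset_ball (by norm_num) hx)).continuousAt ?_).continuousWithinAt
      exact ((contDiff_mol hρ.smooth hρ.cpt hfi).continuous.add (by fun_prop)).continuousAt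
    have h2 := this.enorm.pow_const 2
    convert h2 using 1
    ext x
    by_cases hx : x ∈ ball (0 : Euc N) (1/4)
    · simp only [hF, indicator_of_mem hx]
    · simp only [hF, indicator_of_notMem hx]; simp
  have hloc : ∀ z, ∫⁻ x in ball z θ, F x ≤ ofReal (C * θ ^ 2) * ∫⁻ x in ball z (2*θ), E x := by
    intro z
    by_cases hz : z ∈ ball (0 : Euc N) (1/2)
    · have hsub : ball z (2*θ) ⊆ ball (0 : Euc N) (5/8) :=
        ball_subset_ball' (by rw [mem_ball] at hz; linarith)
      have hsub' : ball z (2*θ) ⊆ ball (0 : Euc N) (3/4) := hsub.trans (ball_subset_ball (by norm_num))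
      have e1 : ∫⁻ x in ball z (2*θ), E x = ∫⁻ x in ball z (2*θ), dens v x :=
        setLIntegral_congr_fun measurableSet_ball fun x hx => by simp only [hE, indicator_of_mem (hsub' hx)]
      rw [e1]
      refine le_trans (lintegral_mono fun x => ?_) (H ρ θ hρ hθ v f b A z (fun x hx => hv x (hsub' hx))
        (fun x hx => hf x (hsub hx)) (ne_top_of_le_ne_top hfin (lintegral_mono_set hsub')))
      exact indicator_le_self _ _ _
    · have : ∫⁻ x in ball z θ, F x = 0 := by
        rw [setLIntegral_congr_fun (g := 0) measurableSet_ball, Pi.zero_def, lintegral_zero]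
        intro x hx
        refine indicator_of_notMem (fun hx0 => hz ?_) _
        rw [mem_ball] at hx hx0 ⊢
        have := dist_triangle z x 0
        rw [dist_comm z x] at this
        linarith
      rw [this]; exact zero_le
  have h1 := lintegral_mono (μ := volume) hloc
  rw [tonelli_balls hFm, lintegral_const_mul' _ _ ofReal_ne_top, tonelli_balls hEm, vol_ball (0 : Euc N) hθ.le,
    vol_ball (0 : Euc N) (r := 2*θ) (by positivity)] at h1
  have eF : ∫⁻ x, F x = ∫⁻ x in ball 0 (1/4), ‖g x‖ₑ ^ 2 := lintegral_indicator measurableSet_ball _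
  have eE : ∫⁻ x, E x = ∫⁻ x in ball 0 (3/4), dens v x := lintegral_indicator measurableSet_ball _
  rw [eF, eE] at h1
  set X := ∫⁻ x in ball 0 (1/4), ‖g x‖ₑ ^ 2
  set Y := ∫⁻ x in ball 0 (3/4), dens v x
  set B := volume (ball (0 : Euc N) 1)
  have hB0 : ofReal (θ ^ N) * B ≠ 0 :=
    mul_ne_zero (by simpa using pow_pos hθ N) (measure_ball_pos _ _ one_pos).ne'
  have hBt : ofReal (θ ^ N) * B ≠ ⊤ := mul_ne_top ofReal_ne_top measure_ball_lt_top.ne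
  refine (ENNReal.mul_le_mul_iff_right hB0 hBt).1 (h1.trans (le_of_eq ?_))
  rw [mul_pow, ofReal_mul (by positivity : (0:ℝ) ≤ 2 ^ N), show C * 2 ^ N * θ ^ 2 = C * θ ^ 2 * 2 ^ N by ring,
    ofReal_mul (by positivity : 0 ≤ C * θ ^ 2)]
  generalize ofReal (C * θ ^ 2) = e1
  ring

lemma exists_smooth (hN : 2 ≤ N) {𝓒 : Mat N →ₗ[ℝ] Mat N} {c₀ : ℝ} (h𝓒 : IsElasticityTensor 𝓒 c₀) :
    ∃ C > (0:ℝ), ∃ r₁ > (0:ℝ), ∀ θ, 0 < θ → θ ≤ 1/16 → ∃ Cl > (0:ℝ), ∀ (v : Euc N → Euc N) (l : ℝ),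
      (∀ p ∈ ball 0 (3/4), H1At v p) → 0 ≤ l → EL 𝓒 v (5/8) l → ∫⁻ x in ball 0 (3/4), dens v x ≠ ⊤ →
      ∃ w : Euc N → Euc N, ContDiff ℝ ∞ w ∧
        (∀ r, 0 < r → r ≤ r₁ → ∫⁻ x in ball 0 r, dens w x ≤
          ofReal (C * r ^ N) * ((∫⁻ x in ball 0 (3/4), dens v x) + ofReal (Cl * l ^ 2))) ∧
        ∫⁻ x in ball 0 (1/4), ‖v x - w x‖ₑ ^ 2 ≤ ofReal (C * θ ^ 2) * ∫⁻ x in ball 0 (3/4), dens v x := by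
  obtain ⟨C1, hC1, H1⟩ := fit_ball hN
  obtain ⟨C2, hC2, H2⟩ := smooth_diff hN
  obtain ⟨C3, hC3, r₁, hr₁, H3⟩ := fam_decay hN h𝓒
  set c := max (C1 * (3/4) ^ 2) 1 with hc
  have hc1 : 1 ≤ c := le_max_right _ _
  refine ⟨max (C3 * c) C2, by positivity, r₁, hr₁, fun θ hθ hθ1 => ?_⟩
  obtain ⟨ρ, hρ⟩ := exists_ker (N := N) hθ
  obtain ⟨D, hD, hDb⟩ := kerD_bound hρ (N+1)
  refine ⟨D ^ 2, by positivity, fun v l hv hl hEL hfin => ?_⟩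
  have hvd : ∀ x ∈ ball (0 : Euc N) (3/4), DifferentiableAt ℝ v x := fun x hx => (hv x hx).diff
  obtain ⟨b, A, hA, hest⟩ := H1 0 (3/4) (by norm_num) v hvd hfin
  have hsub : ball (0 : Euc N) (5/8) ⊆ ball 0 (3/4) := ball_subset_ball (by norm_num)
  set a := fun x => v x - (b + A x) with ha
  have had : ∀ x ∈ ball (0 : Euc N) (5/8), DifferentiableAt ℝ a x := fun x hx =>
    (hvd x (hsub hx)).sub (hasFDerivAt_rigid b A x).differentiableAt
  set f := (ball (0 : Euc N) (5/8)).indicator a with hf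
  have hle : ∫⁻ x in ball 0 (5/8), ‖a x‖ₑ ^ 2 ≤ ofReal (C1 * (3/4) ^ 2) * ∫⁻ x in ball 0 (3/4), dens v x :=
    (lintegral_mono_set hsub).trans hest
  obtain ⟨hfm, hfi⟩ := integrable_ball had (ne_top_of_le_ne_top (mul_ne_top ofReal_ne_top hfin) hle)
  have hfa : ∀ x ∈ ball (0 : Euc N) (5/8), f =ᶠ[𝓝 x] a := fun x hx => by
    filter_upwards [isOpen_ball.mem_nhds hx] with y hy using indicator_of_mem hy _
  have hfd : ∀ x ∈ ball (0 : Euc N) (5/8), fderiv ℝ f x = fderiv ℝ v x - A := fun x hx => by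
    rw [(hfa x hx).fderiv_eq, ha, fderiv_fun_sub (hvd x (hsub hx)) (hasFDerivAt_rigid b A x).differentiableAt,
      (hasFDerivAt_rigid b A x).fderiv]
  have hi : ∀ ξ, IntegrableOn (fun y => fderiv ℝ f y ξ) (ball 0 (5/8)) := by
    intro ξ
    have hball : IsFiniteMeasure (volume.restrict (ball (0 : Euc N) (5/8))) := ⟨by simpa using measure_ball_lt_top⟩
    have h0 : IntegrableOn (fun y => fderiv ℝ v y ξ) (ball 0 (5/8)) := by
      have hm : AEStronglyMeasurable (fun y => fderiv ℝ v y ξ) (volume.restrict (ball (0 : Euc N) (5/8))) :=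
        (measurable_fderiv_apply_const ℝ v ξ).aestronglyMeasurable
      have hb := ne_top_of_le_ne_top (h1_compact (isCompact_closedBall (0 : Euc N) (5/8)) fun p hp =>
        hv p (closedBall_subset_ball (by norm_num) hp)) (lintegral_mono_set ball_subset_closedBall)
      have h2 : ∫⁻ x in ball 0 (5/8), ‖fderiv ℝ v x ξ‖ₑ ^ 2 ≠ ⊤ := by
        refine ne_top_of_le_ne_top (mul_ne_top (ofReal_ne_top (r := ‖ξ‖ ^ 2)) hb) ?_
        rw [← lintegral_const_mul' _ _ ofReal_ne_top]
        refine lintegral_mono fun x => ?_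
        rw [enorm_sq_eq, mul_add]
        refine le_trans ?_ le_add_self
        rw [← ofReal_mul (by positivity), ← mul_pow]
        refine ofReal_le_ofReal (pow_le_pow_left₀ (norm_nonneg _) ?_ 2)
        rw [mul_comm]; exact ContinuousLinearMap.le_opNorm _ _
      have h3 := lintegral_sq_le (μ := volume.restrict (ball (0 : Euc N) (5/8))) hm.enorm
      refine ⟨hm, lt_top_iff_ne_top.2 fun h4 => ?_⟩
      rw [h4] at h3
      simp only [ne_eq, OfNat.ofNat_ne_zero, not_false_eq_true, ENNReal.top_pow, top_le_iff] at h3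
      exact mul_ne_top (measure_ne_top _ _) h2 h3
    refine (h0.sub (integrable_const (A ξ))).congr ((ae_restrict_iff' measurableSet_ball).2 (ae_of_all _ fun x hx => ?_))
    simp only [Pi.sub_apply, hfd x hx]; rfl
  have hEL' : EL 𝓒 f (5/8) l := by
    intro φ h1 h2 h3 m hm
    refine le_of_eq_of_le ?_ (hEL φ h1 h2 h3 m hm)
    congr 1
    refine integral_congr_ae (ae_of_all _ fun x => ?_)
    by_cases hx : x ∈ ball (0 : Euc N) (5/8)
    · simp only []
      rw [eSym_eq f, hfd x hx, map_sub, eL_skew A hA, sub_zero, ← eSym_eq]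
    · have : fderiv ℝ φ x = 0 := fderiv_of_notMem_tsupport ℝ (fun h => hx (h3 h))
      simp only [eSym_eq φ, this, map_zero]
      simp [frob]
  have hfw : ∀ x ∈ ball (0 : Euc N) (5/8), f x = v x - (b + A x) := fun x hx => indicator_of_mem hx _
  refine ⟨fun x => mol ρ f x + (b + A x), (contDiff_mol hρ.smooth hρ.cpt hfi).add (contDiff_const.add A.contDiff),
    fun r hr hr1 => ?_, ?_⟩
  · have hw := H3 (fun l => mol (kerD ρ l) f) (l * D) (fam_mol hρ hfi) (by positivity)
      (fun L hL => mol_weak (kerD_props hρ L).1 (kerD_props hρ L).2.1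
        ((kerD_props hρ L).2.2.trans (closedBall_subset_closedBall hθ1)) (hDb L hL) hfi
        (fun y hy => (had y hy).congr_of_eventuallyEq (hfa y hy)) hi hEL') r hr hr1
    have e1 : ∀ x, dens (fun x => mol ρ f x + (b + A x)) x = dens (mol ρ f) x := fun x => by
      rw [dens, eSym_add_rigid b hA ((contDiff_mol hρ.smooth hρ.cpt hfi).differentiable (by simp) x), dens]
    simp only [e1]
    refine hw.trans ?_
    have hcont : Continuous (mol ρ f) := (contDiff_mol hρ.smooth hρ.cpt hfi).continuous
    have e2 : ofReal (∫ x in ball 0 (1/2), ‖mol ρ f x‖ ^ 2) ≤ ofReal c * ∫⁻ x in ball 0 (3/4), dens v x := by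
      rw [ofReal_integral_eq_lintegral_ofReal (integrableOn_sq hcont 0 _) (ae_of_all _ fun x => by positivity)]
      simp only [← enorm_sq_eq]
      refine (setLIntegral_le_lintegral _ _).trans ((hρ.contract hfm).trans ?_)
      rw [lint_indicator_sq]
      refine hle.trans ?_
      gcongr; exact le_max_left _ _
    calc ofReal (C3 * r ^ N) * ofReal ((∫ x in ball 0 (1/2), ‖mol ρ f x‖ ^ 2) + (l * D) ^ 2)
        ≤ ofReal (C3 * r ^ N) * (ofReal c * (∫⁻ x in ball 0 (3/4), dens v x) +
            ofReal c * ofReal (D ^ 2 * l ^ 2)) := by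
          gcongr
          refine ENNReal.ofReal_add_le.trans (add_le_add e2 ?_)
          rw [← ofReal_mul (by positivity)]
          refine ofReal_le_ofReal ?_
          nlinarith [mul_nonneg (sub_nonneg.2 hc1) (sq_nonneg (l * D))]
      _ = ofReal (C3 * c * r ^ N) * ((∫⁻ x in ball 0 (3/4), dens v x) + ofReal (D ^ 2 * l ^ 2)) := by
          rw [← mul_add, ← mul_assoc, ← ofReal_mul (by positivity)]
          congr 2; ring
      _ ≤ _ := by gcongr; exact le_max_left _ _
  · refine (H2 ρ θ hρ hθ hθ1 v f b A hvd hfi hfw hfin).trans ?_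
    gcongr; exact le_max_right _ _

lemma frob_tensor_le {𝓒 : Mat N →ₗ[ℝ] Mat N} {Γ : ℝ} (hΓ : ∀ ξ, frobNorm (𝓒 ξ) ≤ Γ * frobNorm ξ) (ξ η : Mat N) :
    |frob (𝓒 ξ) η| ≤ Γ * (frobNorm ξ * frobNorm η) := by
  refine (abs_frob_le _ _).trans ?_
  rw [← mul_assoc]
  exact mul_le_mul_of_nonneg_right (hΓ ξ) (frobNorm_nonneg _)

lemma eSym_symm (u : Euc N → Euc N) (x : Euc N) : (eSym u x)ᵀ = eSym u x := by rw [eSym_eq, eL_symm]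

lemma elastic_equiv {𝓒 : Mat N →ₗ[ℝ] Mat N} {c₀ : ℝ} (h𝓒 : IsElasticityTensor 𝓒 c₀) :
    ∃ Γ : ℝ, 1 ≤ Γ ∧ (∀ ξ, frobNorm (𝓒 ξ) ≤ Γ * frobNorm ξ) ∧ ∀ (u : Euc N → Euc N) (S : Set (Euc N)),
      elastic 𝓒 u S ≤ ofReal Γ * (∫⁻ x in S, dens u x) ∧
      (∫⁻ x in S, dens u x) ≤ ofReal Γ * elastic 𝓒 u S := by
  obtain ⟨Γ, hΓ, h⟩ := tensor_bound 𝓒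
  have hc := h𝓒.one_le
  have h' : ∀ ξ, frobNorm (𝓒 ξ) ≤ max Γ c₀ * frobNorm ξ := fun ξ =>
    (h ξ).trans (mul_le_mul_of_nonneg_right (le_max_left _ _) (frobNorm_nonneg _))
  have hpos : 0 ≤ max Γ c₀ := by positivity
  refine ⟨max Γ c₀, hc.trans (le_max_right _ _), h', fun u S => ⟨?_, ?_⟩⟩
  · rw [elastic, ← lintegral_const_mul' _ _ ofReal_ne_top]
    refine lintegral_mono fun x => ?_
    rw [dens, ← ofReal_mul hpos, sq]
    exact ofReal_le_ofReal ((le_abs_self _).trans (frob_tensor_le h' _ _))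
  · rw [elastic, ← lintegral_const_mul' _ _ ofReal_ne_top]
    refine lintegral_mono fun x => ?_
    rw [dens, ← ofReal_mul hpos]
    refine ofReal_le_ofReal ?_
    have h1 := tensor_coercive h𝓒 (eSym_symm u x)
    have h2 : 0 ≤ frobNorm (eSym u x) ^ 2 := by positivity
    calc frobNorm (eSym u x) ^ 2 ≤ c₀ * (4 * c₀⁻¹ * frobNorm (eSym u x) ^ 2) := by
          field_simp; linarith
      _ ≤ c₀ * frob (𝓒 (eSym u x)) (eSym u x) := by gcongr
      _ ≤ _ := mul_le_mul_of_nonneg_right (le_max_right _ _) (frob_tensor_nonneg h𝓒 _)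

lemma mem_comp_of_mem {F : Set (Euc N)} {x y : Euc N} (h : y ∈ connectedComponentIn F x) :
    connectedComponentIn F y = connectedComponentIn F x := (connectedComponentIn_eq h).symm

lemma isOpen_compl_comp {F : Set (Euc N)} (hF : IsOpen F) (x : Euc N) : IsOpen (F \ connectedComponentIn F x) := by
  rw [isOpen_iff_mem_nhds]
  rintro y ⟨hy, hyx⟩
  filter_upwards [hF.connectedComponentIn.mem_nhds (mem_connectedComponentIn hy)] with z hz
  refine ⟨connectedComponentIn_subset _ _ hz, fun hzx => hyx ?_⟩
  rw [← mem_comp_of_mem hzx, mem_comp_of_mem hz]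
  exact mem_connectedComponentIn hy

/-- replacing the crack inside a ball by a part of the sphere keeps the separation -/
lemma keepsSep_patch {Ω K S : Set (Euc N)} {ρ ρ' : ℝ} (hρ' : ρ < ρ') (hO : IsOpen (Ω \ K))
    (hK : ∀ p ∈ sphere (0 : Euc N) ρ \ S, p ∉ K)
    (hsep : ∀ p ∈ sphere (0 : Euc N) ρ \ S, ∀ q ∈ sphere (0 : Euc N) ρ \ S, q ∈ connectedComponentIn (Ω \ K) p) :
    KeepsSeparation Ω K (ball 0 ρ') (K \ ball 0 ρ ∪ sphere 0 ρ ∩ S) := by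
  intro x hx y hy hxy hc
  set L := K \ ball (0 : Euc N) ρ ∪ sphere 0 ρ ∩ S with hL
  set X := connectedComponentIn (Ω \ K) x
  have hb : ball (0 : Euc N) ρ ⊆ ball 0 ρ' := ball_subset_ball hρ'.le
  have hs : sphere (0 : Euc N) ρ ⊆ ball 0 ρ' := sphere_subset_closedBall.trans (closedBall_subset_ball hρ')
  have hout : ∀ z, z ∉ ball (0 : Euc N) ρ' → z ∉ closedBall (0 : Euc N) ρ := fun z h1 h2 =>
    h1 (closedBall_subset_ball hρ' h2)
  have hxL : x ∈ Ω \ L := ⟨hx.1, by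
    rintro (h | h)
    · exact hx.2 (Or.inl h.1)
    · exact hx.2 (Or.inr (hs h.1))⟩
  have hXo : IsOpen X := hO.connectedComponentIn
  have hYo : IsOpen ((Ω \ K) \ X) := isOpen_compl_comp hO x
  have hxX : x ∈ X := mem_connectedComponentIn ⟨hx.1, fun h => hx.2 (Or.inl h)⟩
  have hyY : y ∈ (Ω \ K) \ X := ⟨⟨hy.1, fun h => hy.2 (Or.inl h)⟩, hxy⟩
  have hx' := hout x fun h => hx.2 (Or.inr h)
  have hy' := hout y fun h => hy.2 (Or.inr h)
  have hconn : IsPreconnected (connectedComponentIn (Ω \ L) x) := isPreconnected_connectedComponentIn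
  have hsubL : connectedComponentIn (Ω \ L) x ⊆ Ω \ L := connectedComponentIn_subset _ _
  have hcl : IsOpen (closedBall (0 : Euc N) ρ)ᶜ := isClosed_closedBall.isOpen_compl
  have hxc : x ∈ connectedComponentIn (Ω \ L) x := mem_connectedComponentIn hxL
  have tri : ∀ z ∈ Ω \ L, z ∈ ball (0 : Euc N) ρ ∨ (z ∈ sphere (0 : Euc N) ρ \ S) ∨ (z ∉ closedBall (0 : Euc N) ρ ∧ z ∉ K) := by
    intro z hz
    rcases lt_trichotomy (dist z 0) ρ with h | h | h
    · exact Or.inl h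
    · exact Or.inr (Or.inl ⟨h, fun hzS => hz.2 (Or.inr ⟨h, hzS⟩)⟩)
    · exact Or.inr (Or.inr ⟨fun h' => (not_lt.2 (mem_closedBall.1 h')) h, fun hzK => hz.2 (Or.inl ⟨hzK, fun h' => lt_asymm h h'⟩)⟩)
  by_cases hcase : ∃ p ∈ sphere (0 : Euc N) ρ \ S, p ∈ X
  · obtain ⟨p, hp, hpX⟩ := hcase
    have hall : ∀ q ∈ sphere (0 : Euc N) ρ \ S, q ∈ X := fun q hq => by
      have := hsep p hp q hq
      rwa [mem_comp_of_mem hpX] at this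
    obtain ⟨z, -, hz1, hz2⟩ := hconn (X ∪ ball 0 ρ) ((Ω \ K) \ X ∩ (closedBall 0 ρ)ᶜ) (hXo.union isOpen_ball)
      (hYo.inter hcl) (fun z hz => by
        rcases tri z (hsubL hz) with h | h | ⟨h1, h2⟩
        · exact Or.inl (Or.inr h)
        · exact Or.inl (Or.inl (hall z h))
        · by_cases hzX : z ∈ X
          · exact Or.inl (Or.inl hzX)
          · exact Or.inr ⟨⟨⟨(hsubL hz).1, h2⟩, hzX⟩, h1⟩) ⟨x, hxc, Or.inl hxX⟩ ⟨y, hc, hyY, hy'⟩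
    rcases hz1 with h | h
    · exact hz2.1.2 h
    · exact hz2.2 (ball_subset_closedBall h)
  · push Not at hcase
    obtain ⟨z, -, hz1, hz2⟩ := hconn (X ∩ (closedBall 0 ρ)ᶜ) ((Ω \ K) \ X ∪ ball 0 ρ) (hXo.inter hcl)
      (hYo.union isOpen_ball) (fun z hz => by
        rcases tri z (hsubL hz) with h | h | ⟨h1, h2⟩
        · exact Or.inr (Or.inr h)
        · exact Or.inr (Or.inl ⟨⟨(hsubL hz).1, hK z h⟩, hcase z h⟩)
        · by_cases hzX : z ∈ X
          · exact Or.inl ⟨hzX, h1⟩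
          · exact Or.inr (Or.inl ⟨⟨(hsubL hz).1, h2⟩, hzX⟩)) ⟨x, hxc, hxX, hx'⟩ ⟨y, hc, Or.inl hyY⟩
    rcases hz2 with h | h
    · exact h.2 hz1.1
    · exact hz1.2 (ball_subset_closedBall h)

/-- The comparison inequality used for all surgeries. -/
lemma UnitMin.patch {𝓒 : Mat N →ₗ[ℝ] Mat N} {c₀ : ℝ} (h𝓒 : IsElasticityTensor 𝓒 c₀) {Ω K S : Set (Euc N)} {u V : Euc N → Euc N}
    {η : ℝ≥0∞} (H : UnitMin 𝓒 Ω u K η) {ρ : ℝ} (hρ : 0 < ρ) (hρ1 : ρ < 1) (hS : IsClosed S)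
    (hV : ∀ p ∈ ball 0 ρ, H1At V p) (hout : ∀ p ∈ sphere (0 : Euc N) ρ \ S, p ∉ K ∧ V =ᶠ[𝓝 p] u)
    (hsep : ∀ p ∈ sphere (0 : Euc N) ρ \ S, ∀ q ∈ sphere (0 : Euc N) ρ \ S, q ∈ connectedComponentIn (Ω \ K) p) :
    elastic 𝓒 u (ball 0 ρ \ K) + Hm N (K ∩ ball 0 ρ) ≤ elastic 𝓒 V (ball 0 ρ) + Hm N (sphere 0 ρ ∩ S) + η := by
  classical
  obtain ⟨Γ, hΓ1, hΓ, hΓe⟩ := elastic_equiv h𝓒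
  set ρ' := (ρ + 1) / 2 with hρ'
  have h1 : ρ < ρ' := by rw [hρ']; linarith
  have h2 : ρ' < 1 := by rw [hρ']; linarith
  have h0 : 0 < ρ' := hρ.trans h1
  have hb : ball (0 : Euc N) ρ ⊆ ball 0 ρ' := ball_subset_ball h1.le
  have hs : sphere (0 : Euc N) ρ ⊆ ball 0 ρ' := sphere_subset_closedBall.trans (closedBall_subset_ball h1)
  have hO : IsOpen (Ω \ K) := measSet_diff H.pair
  set L := K \ ball (0 : Euc N) ρ ∪ sphere 0 ρ ∩ S with hL
  set v := (ball (0 : Euc N) ρ).piecewise V u with hv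
  have hvV : ∀ p ∈ ball (0 : Euc N) ρ, V =ᶠ[𝓝 p] v := fun p hp => by
    filter_upwards [isOpen_ball.mem_nhds hp] with y hy using (piecewise_eq_of_mem _ _ _ hy).symm
  have hvu : ∀ p ∈ Ω \ L, p ∉ ball (0 : Euc N) ρ → p ∉ K ∧ u =ᶠ[𝓝 p] v := by
    intro p hp hpb
    rcases (not_lt.1 hpb : ρ ≤ dist p 0).lt_or_eq with h | h
    · refine ⟨fun hpK => hp.2 (Or.inl ⟨hpK, hpb⟩), ?_⟩
      have : p ∈ (closedBall (0 : Euc N) ρ)ᶜ := fun h' => (not_lt.2 (mem_closedBall.1 h')) h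
      filter_upwards [isClosed_closedBall.isOpen_compl.mem_nhds this] with y hy
      exact (piecewise_eq_of_notMem _ _ _ fun h' => hy (ball_subset_closedBall h')).symm
    · obtain ⟨h3, h4⟩ := hout p ⟨h.symm, fun hpS => hp.2 (Or.inr ⟨h.symm, hpS⟩)⟩
      refine ⟨h3, ?_⟩
      filter_upwards [h4] with y hy
      by_cases hyb : y ∈ ball (0 : Euc N) ρ
      · rw [hv, piecewise_eq_of_mem _ _ _ hyb, hy]
      · rw [hv, piecewise_eq_of_notMem _ _ _ hyb]
  have hrel : RelClosedIn L Ω := by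
    refine ⟨union_subset (diff_subset.trans H.pair.relClosed.1) (inter_subset_left.trans (hs.trans
      ((ball_subset_ball h2.le).trans H.sub))), ?_⟩
    rintro x ⟨hx, hxΩ⟩
    rw [hL, closure_union, (isClosed_sphere.inter hS).closure_eq] at hx
    rcases hx with hx | hx
    · refine Or.inl ⟨H.pair.relClosed.2 ⟨closure_mono diff_subset hx, hxΩ⟩, fun hxb => ?_⟩
      have : closure (K \ ball (0 : Euc N) ρ) ⊆ (ball 0 ρ)ᶜ := closure_minimal (fun _ h => h.2) isOpen_ball.isClosed_compl
      exact this hx hxb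
    · exact Or.inr hx
  have hcomp : TopCompetitor Ω u K (ball 0 ρ') v L := by
    refine ⟨⟨AdmissiblePair.of_h1At H.pair.open_amb hrel fun p hp => ?_, ?_, ae_of_all _ fun x hx => ?_⟩,
      keepsSep_patch h1 hO (fun p hp => (hout p hp).1) hsep⟩
    · by_cases hpb : p ∈ ball (0 : Euc N) ρ
      · exact (hV p hpb).congr (hvV p hpb)
      · obtain ⟨h3, h4⟩ := hvu p hp hpb
        exact (H.pair.h1At ⟨hp.1, h3⟩).congr h4
    · ext x
      constructor
      · rintro ⟨h | h, h'⟩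
        · exact ⟨h.1, h'⟩
        · exact absurd (hs h.1) h'
      · rintro ⟨h, h'⟩
        exact ⟨Or.inl ⟨h, fun h3 => h' (hb h3)⟩, h'⟩
    · exact piecewise_eq_of_notMem _ _ _ fun h => hx.2 (Or.inr (hb h))
  have hmin := H.minimality ρ' h0 h2 v L hcomp
  set A := ball (0 : Euc N) ρ' \ ball 0 ρ with hA
  have hKo : IsOpen (ball (0 : Euc N) ρ \ K) :=
    H.pair.open_ball_diff isOpen_ball ((hb.trans (ball_subset_ball h2.le)).trans H.sub)
  have e1 : elastic 𝓒 u (ball 0 ρ' \ K) = elastic 𝓒 u (ball 0 ρ \ K) + elastic 𝓒 u (A \ K) := by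
    have : ball (0 : Euc N) ρ' \ K = (A \ K) ∪ (ball 0 ρ \ K) := by
      rw [← union_diff_distrib, hA, diff_union_of_subset hb]
    rw [elastic, this, lintegral_union hKo.measurableSet (disjoint_sdiff_left.mono diff_subset diff_subset), add_comm]
    rfl
  have e2 : Hm N (K ∩ ball 0 ρ') = Hm N (K ∩ ball 0 ρ) + Hm N (K ∩ A) := by
    rw [← measure_inter_add_diff (K ∩ ball 0 ρ') (measurableSet_ball (x := (0 : Euc N)) (ε := ρ)), inter_assoc,
      inter_eq_right.2 hb, inter_diff_assoc]
  have f1 : elastic 𝓒 v (ball 0 ρ' \ L) ≤ elastic 𝓒 V (ball 0 ρ) + elastic 𝓒 u (A \ K) := by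
    have hsub : ball (0 : Euc N) ρ' \ L ⊆ ball 0 ρ ∪ (A \ L) := fun x hx => by
      by_cases hxb : x ∈ ball (0 : Euc N) ρ
      · exact Or.inl hxb
      · exact Or.inr ⟨⟨hx.1, hxb⟩, hx.2⟩
    have hAL : ∀ x ∈ A \ L, x ∉ K ∧ u =ᶠ[𝓝 x] v := fun x hx =>
      hvu x ⟨H.sub (ball_subset_ball h2.le hx.1.1), hx.2⟩ hx.1.2
    refine (lintegral_mono_set hsub).trans ((lintegral_union_le _ _ _).trans (add_le_add (le_of_eq ?_) ?_))
    · refine setLIntegral_congr_fun measurableSet_ball fun x hx => ?_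
      simp only [eSym_eq, (hvV x hx).fderiv_eq]
    · have hALm : MeasurableSet (A \ L) := by
        have : A \ L = (ball 0 ρ' ∩ (Ω \ L)) \ ball 0 ρ := by
          ext x
          exact ⟨fun h => ⟨⟨h.1.1, H.sub (ball_subset_ball h2.le h.1.1), h.2⟩, h.1.2⟩, fun h => ⟨⟨h.1.1, h.2⟩, h.1.2.2⟩⟩
        rw [this]
        exact (isOpen_ball.inter (measSet_diff hcomp.compet.pair)).measurableSet.diff measurableSet_ball
      refine le_trans (le_of_eq ?_) (lintegral_mono_set (fun x hx => ⟨hx.1, (hAL x hx).1⟩ : A \ L ⊆ A \ K))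
      refine setLIntegral_congr_fun hALm fun x hx => ?_
      simp only [eSym_eq, (hAL x hx).2.fderiv_eq]
  have f2 : Hm N (L ∩ ball 0 ρ') ≤ Hm N (sphere 0 ρ ∩ S) + Hm N (K ∩ A) := by
    refine (measure_mono ?_).trans (measure_union_le (sphere 0 ρ ∩ S) (K ∩ A))
    rintro x ⟨h | h, h'⟩
    · exact Or.inr ⟨h.1, h', h.2⟩
    · exact Or.inl h
  have g1 : elastic 𝓒 u (A \ K) ≠ ⊤ := by
    refine ne_top_of_le_ne_top (mul_ne_top (ofReal_ne_top (r := Γ)) (H.finE ρ' h0 h2)) ((hΓe u _).1.trans ?_)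
    exact mul_le_mul_right (lintegral_mono_set (diff_subset_diff_left diff_subset)) _
  have g2 : Hm N (K ∩ A) ≠ ⊤ := ne_top_of_le_ne_top (H.finH ρ' h0 h2) (measure_mono (inter_subset_inter_right _ diff_subset))
  rw [e1, e2] at hmin
  have hfin := hmin.trans (add_le_add_left (add_le_add f1 f2) η)
  refine (ENNReal.add_le_add_iff_right (add_ne_top.2 ⟨g1, g2⟩)).1 (le_trans (le_of_eq ?_) (hfin.trans (le_of_eq ?_)))
  · ring
  · ring

lemma measurable_cross (𝓒 : Mat N →ₗ[ℝ] Mat N) (u φ : Euc N → Euc N) :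
    Measurable fun x => frob (𝓒 (eSym u x)) (eSym φ x) := by
  simp only [frob_tensor_expand]
  refine Finset.measurable_fun_sum _ fun i _ => Finset.measurable_fun_sum _ fun j _ => Finset.measurable_fun_sum _ fun k _ =>
    Finset.measurable_fun_sum _ fun l _ => ?_
  exact ((measurable_eSym_coord u k l).mul (measurable_eSym_coord φ i j)).const_mul _

lemma measurable_frobNorm (u : Euc N → Euc N) : Measurable fun x => frobNorm (eSym u x) := by
  unfold frobNorm
  have := (measurable_cross LinearMap.id u u).sqrt
  exact this

lemma frobNorm_eSym_le {φ : Euc N → Euc N} {m : ℝ} (h : ∀ x, ‖fderiv ℝ φ x‖ ≤ m) (x : Euc N) :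
    frobNorm (eSym φ x) ≤ N * m := by
  rw [eSym_eq]
  exact (frobNorm_eL_le _).trans (by gcongr; exact h x)

lemma integrable_sq_dens {u : Euc N → Euc N} {S : Set (Euc N)} (h : ∫⁻ x in S, dens u x ≠ ⊤) :
    IntegrableOn (fun x => frobNorm (eSym u x) ^ 2) S := by
  refine ⟨((measurable_frobNorm u).pow_const 2).aestronglyMeasurable, ?_⟩
  rw [HasFiniteIntegral, lt_top_iff_ne_top]
  convert h using 4 with x
  rw [dens, Real.enorm_eq_ofReal (by positivity)]

lemma integrable_cross {𝓒 : Mat N →ₗ[ℝ] Mat N} {Γ : ℝ} (hΓ0 : 0 ≤ Γ) (hΓ : ∀ ξ, frobNorm (𝓒 ξ) ≤ Γ * frobNorm ξ)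
    {u φ : Euc N → Euc N} {S : Set (Euc N)} (hu : ∫⁻ x in S, dens u x ≠ ⊤) (hφ : ∫⁻ x in S, dens φ x ≠ ⊤) :
    IntegrableOn (fun x => frob (𝓒 (eSym u x)) (eSym φ x)) S := by
  refine (((integrable_sq_dens hu).add (integrable_sq_dens hφ)).const_mul Γ).mono' (measurable_cross 𝓒 u φ).aestronglyMeasurable
    (ae_of_all _ fun x => ?_)
  refine (frob_tensor_le hΓ _ _).trans (mul_le_mul_of_nonneg_left ?_ hΓ0)
  simp only [Pi.add_apply]
  nlinarith [sq_nonneg (frobNorm (eSym u x) - frobNorm (eSym φ x)), sq_nonneg (frobNorm (eSym u x)), sq_nonneg (frobNorm (eSym φ x))]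

lemma elastic_eq {𝓒 : Mat N →ₗ[ℝ] Mat N} {c₀ : ℝ} (h𝓒 : IsElasticityTensor 𝓒 c₀) {Γ : ℝ} (hΓ0 : 0 ≤ Γ)
    (hΓ : ∀ ξ, frobNorm (𝓒 ξ) ≤ Γ * frobNorm ξ) {u : Euc N → Euc N} {S : Set (Euc N)} (hu : ∫⁻ x in S, dens u x ≠ ⊤) :
    elastic 𝓒 u S = ofReal (∫ x in S, frob (𝓒 (eSym u x)) (eSym u x)) :=
  (ofReal_integral_eq_lintegral_ofReal (integrable_cross hΓ0 hΓ hu hu) (ae_of_all _ fun x => frob_tensor_nonneg h𝓒 _)).symm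

lemma lint_dens_bdd {φ : Euc N → Euc N} {m : ℝ} (h : ∀ x, ‖fderiv ℝ φ x‖ ≤ m) (S : Set (Euc N)) :
    ∫⁻ x in S, dens φ x ≤ ofReal ((N * m) ^ 2) * volume S := by
  rw [← setLIntegral_const]
  exact lintegral_mono fun x => ofReal_le_ofReal
    (pow_le_pow_left₀ (frobNorm_nonneg _) (frobNorm_eSym_le h x) 2)

/-- Euler-Lagrange inequality for an almost minimizer -/
lemma UnitMin.EL_sq {𝓒 : Mat N →ₗ[ℝ] Mat N} {c₀ : ℝ} (h𝓒 : IsElasticityTensor 𝓒 c₀) : ∃ C > (0:ℝ),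
    ∀ (Ω K : Set (Euc N)) (u : Euc N → Euc N) (e : ℝ), UnitMin 𝓒 Ω u K (ofReal e) → 0 ≤ e →
    ∀ φ : Euc N → Euc N, ContDiff ℝ ∞ φ → tsupport φ ⊆ ball 0 (5/8) → ∀ m, (∀ x, ‖fderiv ℝ φ x‖ ≤ m) →
    (∫ x in ball 0 (5/8) \ K, frob (𝓒 (eSym u x)) (eSym φ x)) ^ 2 ≤ C * e * m ^ 2 := by
  obtain ⟨Γ, hΓ1, hΓ, hΓe⟩ := elastic_equiv h𝓒
  have hΓ0 : 0 ≤ Γ := by linarith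
  set β := (volume (ball (0 : Euc N) (5/8))).toReal with hβ
  refine ⟨Γ * (N ^ 2 * β) + 1, by positivity, fun Ω K u e H he φ hφ hφs m hm => ?_⟩
  set S := ball (0 : Euc N) (5/8) \ K with hS
  have hbΩ : ball (0 : Euc N) (5/8) ⊆ Ω := (ball_subset_ball (by norm_num)).trans H.sub
  have hSo : IsOpen S := H.pair.open_ball_diff isOpen_ball hbΩ
  have hud : ∀ x ∈ S, DifferentiableAt ℝ u x := fun x hx => H.pair.diffOn x ⟨hbΩ hx.1, hx.2⟩
  have hu : ∫⁻ x in S, dens u x ≠ ⊤ := H.finE _ (by norm_num) (by norm_num)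
  have hvS : volume S ≤ volume (ball (0 : Euc N) (5/8)) := measure_mono diff_subset
  have hφf : ∫⁻ x in S, dens φ x ≠ ⊤ := ne_top_of_le_ne_top (mul_ne_top ofReal_ne_top
    (ne_top_of_le_ne_top measure_ball_lt_top.ne hvS)) (lint_dens_bdd hm S)
  set X0 := ∫ x in S, frob (𝓒 (eSym u x)) (eSym u x)
  set X1 := ∫ x in S, frob (𝓒 (eSym u x)) (eSym φ x) with hX1
  set X2 := ∫ x in S, frob (𝓒 (eSym φ x)) (eSym φ x) with hX2
  have key : ∀ s : ℝ, 0 ≤ X2 * (s * s) + 2 * X1 * s + e := by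
    intro s
    set v := fun x => u x + s • φ x with hv
    have hev : ∀ x ∈ S, eSym v x = eSym u x + s • eSym φ x := fun x hx => by
      have hd := hφ.differentiable (by simp) x
      rw [eSym_eq, hv, fderiv_fun_add (hud x hx)
        (show DifferentiableAt ℝ (fun y => s • φ y) x from hd.const_smul s), fderiv_fun_const_smul hd, map_add, map_smul, ← eSym_eq,
        ← eSym_eq]
    have hexp : ∀ x ∈ S, frob (𝓒 (eSym v x)) (eSym v x) = frob (𝓒 (eSym u x)) (eSym u x) +
        (2 * s * frob (𝓒 (eSym u x)) (eSym φ x) + s * s * frob (𝓒 (eSym φ x)) (eSym φ x)) := fun x hx => by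
      rw [hev x hx, map_add, map_smul, frob_add_left, frob_add_right, frob_add_right, frob_smul_left, frob_smul_right,
        frob_smul_left, frob_smul_right, h𝓒.symm (eSym φ x) (eSym u x), frob_comm (eSym φ x)]
      ring
    have hcomp : TopCompetitor Ω u K (ball 0 (5/8)) v K := by
      refine ⟨⟨AdmissiblePair.of_h1At H.pair.open_amb H.pair.relClosed fun p hp => ?_, rfl, ae_of_all _ fun x hx => ?_⟩,
        fun x _ y _ h => h⟩
      · exact (H.pair.h1At hp).add (H1At.of_contDiffAt ((hφ.const_smul s).contDiffAt.of_le (by simp)))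
      · have : φ x = 0 := image_eq_zero_of_notMem_tsupport fun h => hx.2 (Or.inr (hφs h))
        simp [hv, this]
    have hmin := H.minimality (5/8) (by norm_num) (by norm_num) v K hcomp
    rw [add_right_comm] at hmin
    have hmin := (ENNReal.add_le_add_iff_right (H.finH (5/8) (by norm_num) (by norm_num))).1 hmin
    have hi0 := integrable_cross hΓ0 hΓ hu hu
    have hi1 := integrable_cross hΓ0 hΓ hu hφf
    have hi2 := integrable_cross hΓ0 hΓ hφf hφf
    have hi3 : IntegrableOn (fun x => frob (𝓒 (eSym u x)) (eSym u x) +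
        (2 * s * frob (𝓒 (eSym u x)) (eSym φ x) + s * s * frob (𝓒 (eSym φ x)) (eSym φ x))) S :=
      hi0.add ((hi1.const_mul _).add (hi2.const_mul _))
    have hXe : X0 + (2 * s * X1 + s * s * X2) = ∫ x in S, (frob (𝓒 (eSym u x)) (eSym u x) +
        (2 * s * frob (𝓒 (eSym u x)) (eSym φ x) + s * s * frob (𝓒 (eSym φ x)) (eSym φ x))) := by
      rw [← integral_const_mul, ← integral_const_mul, ← integral_add (hi1.const_mul _) (hi2.const_mul _)]
      exact (integral_add hi0 ((hi1.const_mul _).add (hi2.const_mul _))).symm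
    have e1 : elastic 𝓒 v S = ofReal (X0 + (2 * s * X1 + s * s * X2)) := by
      rw [hXe, ofReal_integral_eq_lintegral_ofReal hi3]
      · refine setLIntegral_congr_fun hSo.measurableSet fun x hx => ?_
        simp only [hexp x hx]
      · filter_upwards [ae_restrict_mem hSo.measurableSet] with x hx
        rw [← hexp x hx]
        exact frob_tensor_nonneg h𝓒 _
    have hX : 0 ≤ X0 + (2 * s * X1 + s * s * X2) := by
      rw [hXe]
      refine setIntegral_nonneg hSo.measurableSet fun x hx => ?_
      rw [← hexp x hx]
      exact frob_tensor_nonneg h𝓒 _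
    rw [elastic_eq h𝓒 hΓ0 hΓ hu, e1, ← ofReal_add hX he, ofReal_le_ofReal_iff (by linarith)] at hmin
    nlinarith
  have hd := discrim_le_zero key
  rw [discrim] at hd
  have h2 : X2 ≤ Γ * (N ^ 2 * β) * m ^ 2 := by
    have h3 := (hΓe φ S).1.trans (mul_le_mul_right ((lint_dens_bdd hm S).trans (mul_le_mul_right hvS _)) _)
    rw [elastic_eq h𝓒 hΓ0 hΓ hφf, ← ofReal_toReal (measure_ball_lt_top (x := (0 : Euc N)) (r := 5/8)).ne, ← hβ,
      ← ofReal_mul (by positivity), ← ofReal_mul (by positivity),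
      ofReal_le_ofReal_iff (by positivity)] at h3
    refine h3.trans (le_of_eq (by ring))
  have h5 : e * X2 ≤ e * (Γ * (N ^ 2 * β) * m ^ 2) := by gcongr
  nlinarith [mul_nonneg he (sq_nonneg m)]

/-- Euler-Lagrange inequality for the interpolated map -/
lemma UnitMin.EL_interp {𝓒 : Mat N →ₗ[ℝ] Mat N} {c₀ : ℝ} (h𝓒 : IsElasticityTensor 𝓒 c₀) : ∃ C > (0:ℝ),
    ∀ (Ω K U : Set (Euc N)) (u v : Euc N → Euc N) (e μ E : ℝ), UnitMin 𝓒 Ω u K (ofReal e) → 0 ≤ e → 0 ≤ μ → 0 ≤ E →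
    MeasurableSet U → volume U ≤ ofReal μ →
    (∀ x ∈ ball 0 (5/8) \ U, eSym v x = eSym u x) → (∫⁻ x in ball 0 (5/8) \ K, dens u x) ≤ ofReal E →
    (∫⁻ x in ball 0 (5/8), dens v x) ≤ ofReal E →
    ∃ l, 0 ≤ l ∧ l ^ 2 = C * (e + μ * E) ∧ EL 𝓒 v (5/8) l := by
  obtain ⟨C, hC, H1⟩ := UnitMin.EL_sq h𝓒
  obtain ⟨Γ, hΓ1, hΓ, hΓe⟩ := elastic_equiv h𝓒
  have hΓ0 : 0 ≤ Γ := by linarith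
  refine ⟨2 * C + 8 * (Γ * N) ^ 2, by positivity, fun Ω K U u v e μ E H he hμ hE hU hUv hvu hu hv => ?_⟩
  set M := 2 * C + 8 * (Γ * N) ^ 2 with hM
  have hbΩ : ball (0 : Euc N) (5/8) ⊆ Ω := (ball_subset_ball (by norm_num)).trans H.sub
  refine ⟨√(M * (e + μ * E)), sqrt_nonneg _, sq_sqrt (by positivity), ?_⟩
  intro φ hφ hφc hφs m hm
  have hm0 : 0 ≤ m := (norm_nonneg _).trans (hm 0)
  set S := ball (0 : Euc N) (5/8) \ K with hS
  have hSo : IsOpen S := H.pair.open_ball_diff isOpen_ball hbΩ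
  have hK0 : volume (K ∩ ball (0 : Euc N) (5/8)) = 0 := vol_zero_of_Hm (H.finH _ (by norm_num) (by norm_num))
  have e0 : ∫ x, frob (𝓒 (eSym v x)) (eSym φ x) = ∫ x in S, frob (𝓒 (eSym v x)) (eSym φ x) := by
    have e1 : ∫ x, frob (𝓒 (eSym v x)) (eSym φ x) = ∫ x in ball 0 (5/8), frob (𝓒 (eSym v x)) (eSym φ x) := by
      refine (setIntegral_eq_integral_of_forall_compl_eq_zero fun x hx => ?_).symm
      have : fderiv ℝ φ x = 0 := fderiv_of_notMem_tsupport ℝ (fun h => hx (hφs h))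
      simp [eSym_eq φ, this, frob]
    rw [e1]
    refine setIntegral_congr_set ?_
    rw [hS]
    refine (diff_ae_eq_self.2 ?_).symm
    rwa [inter_comm]
  have hvS : volume S ≠ ⊤ := ne_top_of_le_ne_top measure_ball_lt_top.ne (measure_mono diff_subset)
  have hφf : ∫⁻ x in S, dens φ x ≠ ⊤ := ne_top_of_le_ne_top (mul_ne_top ofReal_ne_top hvS) (lint_dens_bdd hm S)
  have hv' : (∫⁻ x in S, dens v x) ≤ ofReal E := (lintegral_mono_set diff_subset).trans hv
  have hiu := integrable_cross hΓ0 hΓ (ne_top_of_le_ne_top ofReal_ne_top hu) hφf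
  have hiv := integrable_cross hΓ0 hΓ (ne_top_of_le_ne_top ofReal_ne_top hv') hφf
  rw [e0]
  set Xv := ∫ x in S, frob (𝓒 (eSym v x)) (eSym φ x)
  set Xu := ∫ x in S, frob (𝓒 (eSym u x)) (eSym φ x)
  have h1 : Xu ^ 2 ≤ C * e * m ^ 2 := H1 Ω K u e H he φ hφ hφs m hm
  set g := fun x => ofReal (Γ * (N * m) * (frobNorm (eSym v x) + frobNorm (eSym u x))) with hg
  have hgm : Measurable g := (((measurable_frobNorm v).add (measurable_frobNorm u)).const_mul _).ennreal_ofReal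
  have h2 : ‖Xv - Xu‖ₑ ≤ ∫⁻ x in S ∩ U, g x := by
    rw [← integral_sub hiv hiu]
    refine (enorm_integral_le_lintegral_enorm _).trans ?_
    rw [inter_comm, ← Measure.restrict_restrict hU, ← lintegral_indicator hU]
    refine setLIntegral_mono' hSo.measurableSet fun x hx => ?_
    by_cases hxU : x ∈ U
    · rw [indicator_of_mem hxU, hg, Real.enorm_eq_ofReal_abs]
      refine ofReal_le_ofReal ?_
      have hp : ∀ w : Euc N → Euc N, |frob (𝓒 (eSym w x)) (eSym φ x)| ≤ Γ * (frobNorm (eSym w x) * (N * m)) := fun w =>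
        (frob_tensor_le hΓ _ _).trans (mul_le_mul_of_nonneg_left (mul_le_mul_of_nonneg_left (frobNorm_eSym_le hm x)
          (frobNorm_nonneg _)) hΓ0)
      have := abs_sub (frob (𝓒 (eSym v x)) (eSym φ x)) (frob (𝓒 (eSym u x)) (eSym φ x))
      linarith [hp u, hp v]
    · rw [hvu x ⟨hx.1, hxU⟩, sub_self, enorm_zero]; exact zero_le
  have h3 : ‖Xv - Xu‖ₑ ^ 2 ≤ ofReal (4 * (Γ * N) ^ 2 * (μ * E) * m ^ 2) := by
    refine (pow_le_pow_left' h2 2).trans ((lintegral_sq_le hgm.aemeasurable).trans ?_)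
    have a1 : (volume.restrict (S ∩ U)) univ ≤ ofReal μ := by
      rw [Measure.restrict_apply_univ]
      exact (measure_mono inter_subset_right).trans hUv
    have a2 : ∫⁻ x in S ∩ U, g x ^ 2 ≤ ofReal ((Γ * (N * m)) ^ 2) * ofReal (4 * E) := by
      calc ∫⁻ x in S ∩ U, g x ^ 2 ≤ ∫⁻ x in S, ofReal ((Γ * (N * m)) ^ 2) * (2 * dens v x + 2 * dens u x) := by
            refine (lintegral_mono_set inter_subset_left).trans (lintegral_mono fun x => ?_)
            have hv0 := frobNorm_nonneg (eSym v x)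
            have hu0 := frobNorm_nonneg (eSym u x)
            rw [hg, ← ofReal_pow (by positivity), dens, dens, show (2:ℝ≥0∞) = ofReal 2 by simp,
              ← ofReal_mul (by norm_num), ← ofReal_mul (by norm_num), ← ofReal_add (by positivity)
              (by positivity), ← ofReal_mul (by positivity), mul_pow]
            exact ofReal_le_ofReal (mul_le_mul_of_nonneg_left (sq_add_le _ _) (by positivity))
        _ = ofReal ((Γ * (N * m)) ^ 2) * (2 * (∫⁻ x in S, dens v x) + 2 * ∫⁻ x in S, dens u x) := by
            rw [lintegral_const_mul' _ _ ofReal_ne_top, lintegral_add_left ((measurable_dens v).const_mul 2),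
              lintegral_const_mul' _ _ (by simp), lintegral_const_mul' _ _ (by simp)]
        _ ≤ ofReal ((Γ * (N * m)) ^ 2) * (2 * ofReal E + 2 * ofReal E) := by gcongr
        _ = _ := by
            rw [← add_mul, ofReal_mul (by norm_num)]; congr 2; norm_num
    refine (mul_le_mul' a1 a2).trans (le_of_eq ?_)
    rw [← ofReal_mul (by positivity), ← ofReal_mul hμ]
    congr 1; ring
  have h4 : (Xv - Xu) ^ 2 ≤ 4 * (Γ * N) ^ 2 * (μ * E) * m ^ 2 := by
    rw [Real.enorm_eq_ofReal_abs, ← ofReal_pow (abs_nonneg _), sq_abs, ofReal_le_ofReal_iff (by positivity)] at h3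
    exact h3
  refine abs_le_of_sq_le_sq' ?_ (by positivity) |> abs_le.2
  rw [mul_pow, sq_sqrt (by positivity)]
  have h5 := sq_add_le (Xv - Xu) Xu
  rw [sub_add_cancel] at h5
  have p1 : 0 ≤ C * (μ * E) * m ^ 2 := by positivity
  have p2 : 0 ≤ (Γ * N) ^ 2 * e * m ^ 2 := by positivity
  rw [hM]
  nlinarith

lemma comp_seg {F : Set (Euc N)} {x a b : Euc N} (h : ∀ s ∈ Icc (0:ℝ) 1, a + s • (b - a) ∈ F) :
    a ∈ connectedComponentIn F x ↔ b ∈ connectedComponentIn F x := by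
  have hpre : IsPreconnected ((fun s : ℝ => a + s • (b - a)) '' Icc 0 1) :=
    isPreconnected_Icc.image _ (by fun_prop)
  have ha : a ∈ (fun s : ℝ => a + s • (b - a)) '' Icc 0 1 := ⟨0, by simp, by simp⟩
  have hb : b ∈ (fun s : ℝ => a + s • (b - a)) '' Icc 0 1 := ⟨1, by simp, by simp⟩
  have hs : (fun s : ℝ => a + s • (b - a)) '' Icc 0 1 ⊆ F := by rintro _ ⟨s, hs, rfl⟩; exact h s hs
  constructor <;> intro hx
  · rw [← mem_comp_of_mem hx]; exact hpre.subset_connectedComponentIn ha hs hb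
  · rw [← mem_comp_of_mem hx]; exact hpre.subset_connectedComponentIn hb hs ha

/-- points far from the crack lie in one connected component -/
lemma sep_const {F K : Set (Euc N)} {d : Euc N → ℝ} {σ τ : ℝ} (hF : IsOpen F) (hd : ScaleFn d σ τ)
    (hsub : ∀ p ∈ ball (0 : Euc N) (3/4), ball p (10 * d p) \ K ⊆ F)
    (hS : ∀ p ∈ ball (0 : Euc N) (3/4), SepData K d p) {p q : Euc N} (hp : p ∈ ball (0 : Euc N) (3/4))
    (hq : q ∈ ball (0 : Euc N) (3/4)) (hpK : 30 * d p < infDist p K) (hqK : 30 * d q < infDist q K) :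
    q ∈ connectedComponentIn F p := by
  set C := connectedComponentIn F p with hC
  have hCm : MeasurableSet C := hF.connectedComponentIn.measurableSet
  set Q : Euc N → Prop := fun x => 2 * volume (ball x (d x) \ C) < volume (ball x (d x)) with hQ
  have hfree : ∀ x ∈ ball (0 : Euc N) (3/4), 30 * d x < infDist x K → ball x (d x) ⊆ F := fun x hx hxK y hy => by
    have h0 := hd.pos x
    refine hsub x hx ⟨ball_subset_ball (by linarith) hy, fun hyK => ?_⟩
    have := infDist_le_dist_of_mem (x := x) hyK
    rw [mem_ball, dist_comm] at hy
    linarith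
  have hloc : ∀ x ∈ ball (0 : Euc N) (3/4), ∀ᶠ y in 𝓝[ball 0 (3/4)] x, (Q x ↔ Q y) := by
    intro x hx
    obtain ⟨G, x1, hGm, hG, hx1, hseg, hvol⟩ := hS x hx
    have hseg' : ∀ y ∈ G, (x1 ∈ C ↔ y ∈ C) := fun y hy => comp_seg fun s hs => hsub x hx (hseg y hy s hs)
    have hx0 : x ∈ ball x (d x) := mem_ball_self (hd.pos x)
    suffices h : ∀ y ∈ ball x (d x), (Q y ↔ x1 ∈ C) by
      filter_upwards [mem_nhdsWithin_of_mem_nhds (isOpen_ball.mem_nhds hx0)] with y hy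
      rw [h x hx0, h y hy]
    intro y hy
    obtain ⟨h1, h2⟩ := hvol y hy
    constructor
    · intro hQy
      by_contra hx1C
      have h3 : ball y (d y) ∩ C ⊆ ball x (10 * d x) \ G := fun z hz =>
        ⟨h1 hz.1, fun hzG => hx1C ((hseg' z hzG).2 hz.2)⟩
      have h4 : 2 * volume (ball y (d y) ∩ C) < volume (ball y (d y)) :=
        (mul_le_mul_right (measure_mono h3) 2).trans_lt h2
      have h5 := ENNReal.add_lt_add h4 hQy
      rw [← mul_add, measure_inter_add_diff _ hCm, two_mul] at h5
      exact lt_irrefl _ h5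
    · intro hx1C
      have h3 : ball y (d y) \ C ⊆ ball x (10 * d x) \ G := fun z hz =>
        ⟨h1 hz.1, fun hzG => hz.2 ((hseg' z hzG).1 hx1C)⟩
      exact (mul_le_mul_right (measure_mono h3) 2).trans_lt h2
  have hconst : Q p ↔ Q q := (convex_ball (0 : Euc N) (3/4)).isPreconnected.induction₂ (fun x y => (Q x ↔ Q y)) hloc
    (fun x y z _ _ _ h h' => h.trans h') (fun x y _ _ h => h.symm) hp hq
  have hQp : Q p := by
    have : ball p (d p) ⊆ C := (convex_ball p (d p)).isPreconnected.subset_connectedComponentIn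
      (mem_ball_self (hd.pos p)) (hfree p hp hpK)
    simp only [hQ, diff_eq_empty.2 this, measure_empty, mul_zero]
    exact measure_ball_pos _ _ (hd.pos p)
  obtain ⟨y, hy, hyC⟩ : ∃ y ∈ ball q (d q), y ∈ C := by
    by_contra! h
    have h1 : ball q (d q) \ C = ball q (d q) := sdiff_eq_left.2 (disjoint_left.2 h)
    have h2 := hconst.1 hQp
    simp only [hQ, h1, two_mul] at h2
    exact absurd (le_add_self (a := volume (ball q (d q)))) (not_le.2 h2)
  rw [hC, ← mem_comp_of_mem hyC]
  exact (convex_ball q (d q)).isPreconnected.subset_connectedComponentIn hy (hfree q hq hqK) (mem_ball_self (hd.pos q))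

lemma dens_cut {φ : Euc N → ℝ} {v w : Euc N → Euc N} {x : Euc N} {D : ℝ} (hφ : DifferentiableAt ℝ φ x)
    (hv : DifferentiableAt ℝ v x) (hw : DifferentiableAt ℝ w x) (h0 : 0 ≤ φ x) (h1 : φ x ≤ 1)
    (hD : ‖fderiv ℝ φ x‖ ≤ D) : dens (fun y => v y + φ y • (w y - v y)) x ≤
      ofReal 3 * (dens w x + ofReal ((1 - φ x) ^ 2) * dens v x +
        ofReal ((N * D) ^ 2) * ‖v x - w x‖ₑ ^ 2) := by
  have hd : HasFDerivAt (fun y => v y + φ y • (w y - v y))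
      (fderiv ℝ v x + (φ x • (fderiv ℝ w x - fderiv ℝ v x) + (fderiv ℝ φ x).smulRight (w x - v x))) x :=
    hv.hasFDerivAt.add (hφ.hasFDerivAt.smul (hw.hasFDerivAt.sub hv.hasFDerivAt))
  have he : eSym (fun y => v y + φ y • (w y - v y)) x = (φ x • eSym w x + (1 - φ x) • eSym v x) +
      eL ((fderiv ℝ φ x).smulRight (w x - v x)) := by
    rw [eSym_eq, hd.fderiv, map_add, map_add, map_smul, map_sub, ← eSym_eq, ← eSym_eq, smul_sub, sub_smul, one_smul]
    abel
  have hD0 : 0 ≤ D := (norm_nonneg _).trans hD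
  have hb : frobNorm (eSym (fun y => v y + φ y • (w y - v y)) x) ≤ frobNorm (eSym w x) +
      (1 - φ x) * frobNorm (eSym v x) + N * D * ‖v x - w x‖ := by
    rw [he]
    refine (frobNorm_add_le _ _).trans (add_le_add ((frobNorm_add_le _ _).trans (add_le_add ?_ ?_)) ?_)
    · rw [frobNorm_smul, abs_of_nonneg h0]; exact mul_le_of_le_one_left (frobNorm_nonneg _) h1
    · rw [frobNorm_smul, abs_of_nonneg (by linarith)]
    · refine (frobNorm_smulRight _ _).trans ?_
      rw [norm_sub_rev, ← mul_assoc]; gcongr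
  rw [enorm_sq_eq]
  unfold dens
  rw [← ofReal_mul (by positivity), ← ofReal_mul (by positivity), ← ofReal_add (by positivity)
    (by positivity), ← ofReal_add (by positivity) (by positivity), ← ofReal_mul (by norm_num)]
  refine ofReal_le_ofReal ((pow_le_pow_left₀ (frobNorm_nonneg _) hb 2).trans ?_)
  set a := frobNorm (eSym w x)
  set b := (1 - φ x) * frobNorm (eSym v x) with hb'
  set c := N * D * ‖v x - w x‖ with hc'
  rw [← mul_pow, ← mul_pow, ← hb', ← hc']
  nlinarith [sq_nonneg (a - b), sq_nonneg (a - c), sq_nonneg (b - c)]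

/-- cut-off function adapted to the balls of radii `a < b` -/
def IsCut (a b D : ℝ) (φ : Euc N → ℝ) : Prop :=
  ContDiff ℝ ∞ φ ∧ (∀ x, 0 ≤ φ x ∧ φ x ≤ 1 ∧ ‖fderiv ℝ φ x‖ ≤ D) ∧ (∀ x, ‖x‖ ≤ a → φ x = 1) ∧ ∀ x, b ≤ ‖x‖ → φ x = 0

lemma exists_cut {a b : ℝ} (ha : 0 < a) (hab : a < b) : ∃ (D : ℝ) (φ : Euc N → ℝ), IsCut a b D φ := by
  set f : ContDiffBump (0 : Euc N) := ⟨a, b, ha, hab⟩ with hf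
  have hs : ContDiff ℝ ∞ f := f.contDiff
  obtain ⟨D, hD⟩ := (hs.continuous_fderiv (by simp)).bounded_above_of_compact_support (f.hasCompactSupport.fderiv ℝ)
  exact ⟨D, f, hs, fun x => ⟨f.nonneg, f.le_one, hD x⟩, fun x hx => f.one_of_mem_closedBall (by simpa [hf] using hx),
    fun x hx => f.zero_of_le_dist (by simpa [hf] using hx)⟩

lemma exists_cuts {r s : ℝ} (hr : 0 < r) (hs : 0 < s) (M : ℕ) : ∃ D : ℝ, 0 ≤ D ∧ ∀ k < M, ∃ φ : Euc N → ℝ,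
    IsCut (r + k * s) (r + k * s + s / 2) D φ := by
  have h : ∀ k : ℕ, ∃ (D : ℝ) (φ : Euc N → ℝ), IsCut (r + k * s) (r + k * s + s / 2) D φ := fun k =>
    exists_cut (by positivity) (by linarith)
  choose D φ hφ using h
  refine ⟨∑ k ∈ Finset.range M, |D k|, by positivity, fun k hk => ⟨φ k, (hφ k).1, fun x => ?_, (hφ k).2.2⟩⟩
  obtain ⟨h1, h2, h3⟩ := (hφ k).2.1 x
  exact ⟨h1, h2, h3.trans ((le_abs_self _).trans (single_le_sum (f := fun k => |D k|) (fun i _ => abs_nonneg _)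
    (Finset.mem_range.2 hk)))⟩

lemma shell_pick {f : Euc N → ℝ≥0∞} {r s R T : ℝ} (hr : 0 < r) (hs : 0 < s) {M : ℕ} (hM : 0 < M) (hR : r + M * s ≤ R) (hT : 0 ≤ T)
    (h : ∫⁻ x in ball 0 R, f x ≤ ofReal T) : ∃ k < M,
      ∫⁻ x in ball 0 (r + k * s + s) \ closedBall 0 (r + k * s), f x ≤ ofReal (T / M) := by
  set A : ℕ → Set (Euc N) := fun k => ball 0 (r + k * s + s) \ closedBall 0 (r + k * s) with hA
  by_contra! hc
  have hAm : ∀ k, MeasurableSet (A k) := fun k => measurableSet_ball.diff measurableSet_closedBall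
  have hlt : ∀ i j : ℕ, i < j → Disjoint (A i) (A j) := fun i j hij => disjoint_left.2 fun x hx hy => by
    have h1 : ((i:ℝ) + 1) ≤ j := by exact_mod_cast hij
    have h2 := hx.1
    have h3 := hy.2
    rw [mem_ball_zero_iff] at h2
    rw [mem_closedBall_zero_iff, not_le] at h3
    nlinarith
  have hdis : (↑(Finset.range M) : Set ℕ).PairwiseDisjoint A := fun i _ j _ hij =>
    (lt_or_gt_of_ne hij).elim (hlt i j) (fun h => (hlt j i h).symm)
  have h1 := lintegral_biUnion_finset (μ := volume) hdis (fun k _ => hAm k) f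
  have h2 : (∫⁻ x in ⋃ k ∈ Finset.range M, A k, f x) ≤ ofReal T := by
    refine (lintegral_mono_set (iUnion₂_subset fun k hk => diff_subset.trans (ball_subset_ball (le_trans ?_ hR)))).trans h
    have h1 : ((k:ℝ) + 1) ≤ M := by exact_mod_cast Finset.mem_range.1 hk
    nlinarith
  have h3 : ∑ k ∈ Finset.range M, ofReal (T / M) < ∑ k ∈ Finset.range M, ∫⁻ x in A k, f x :=
    ENNReal.sum_lt_sum_of_nonempty ⟨0, Finset.mem_range.2 hM⟩ fun k hk => hc k (Finset.mem_range.1 hk)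
  rw [sum_const, Finset.card_range, nsmul_eq_mul, ← ofReal_natCast, ← ofReal_mul (by positivity),
    mul_div_cancel₀ _ (by positivity), ← h1] at h3
  exact absurd h2 (not_le.2 h3)

lemma H1At.cut {v w : Euc N → Euc N} {φ : Euc N → ℝ} {p : Euc N} (hv : H1At v p) (hw : ContDiff ℝ ∞ w) (hφ : ContDiff ℝ ∞ φ) :
    H1At (fun x => v x + φ x • (w x - v x)) p := by
  refine hv.add (H1At.smul (hφ.contDiffAt.of_le (by simp)) ?_)
  refine ((H1At.of_contDiffAt (hw.contDiffAt.of_le (by simp))).add (H1At.smul (φ := fun _ => -1) contDiffAt_const hv)).congr ?_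
  filter_upwards with x
  simp [sub_eq_add_neg]

lemma energy_close {𝓒 : Mat N →ₗ[ℝ] Mat N} {Γ r ρ T Y q : ℝ} {K S : Set (Euc N)} {u V : Euc N → Euc N} {η : ℝ≥0∞} (hΓ1 : 1 ≤ Γ)
    (hΓe : ∀ (u : Euc N → Euc N) (S : Set (Euc N)), elastic 𝓒 u S ≤ ofReal Γ * (∫⁻ x in S, dens u x) ∧
      (∫⁻ x in S, dens u x) ≤ ofReal Γ * elastic 𝓒 u S) (hr : r ≤ ρ) (hT : 0 ≤ T) (hY : 0 ≤ Y) (hq : 0 ≤ q)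
    (hpat : elastic 𝓒 u (ball 0 ρ \ K) + Hm N (K ∩ ball 0 ρ) ≤ elastic 𝓒 V (ball 0 ρ) + Hm N (sphere 0 ρ ∩ S) + η)
    (hV : ∫⁻ x in ball 0 ρ, dens V x ≤ ofReal T) (hS : Hm N (sphere 0 ρ ∩ S) ≤ ofReal Y)
    (hη : η ≤ ofReal q) :
    (∫⁻ x in ball 0 r \ K, dens u x) + Hm N (K ∩ ball 0 r) ≤ ofReal (Γ * (Γ * T + Y + q)) := by
  have hΓ0 : 0 ≤ Γ := by linarith
  calc _ ≤ ofReal Γ * elastic 𝓒 u (ball 0 ρ \ K) + ofReal Γ * Hm N (K ∩ ball 0 ρ) := by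
        have hb : ball (0 : Euc N) r ⊆ ball 0 ρ := ball_subset_ball hr
        refine add_le_add ((lintegral_mono_set (diff_subset_diff_left hb)).trans (hΓe u _).2) ?_
        exact (measure_mono (inter_subset_inter_right _ hb)).trans
          (le_mul_of_one_le_left zero_le (ENNReal.one_le_ofReal.2 hΓ1))
    _ ≤ ofReal Γ * (ofReal Γ * ofReal T + ofReal Y + ofReal q) := by
        rw [← mul_add]
        refine mul_le_mul_right (hpat.trans ?_) _
        gcongr
        exact (hΓe V _).1.trans (mul_le_mul_right hV _)
    _ = _ := by
        rw [← ofReal_mul hΓ0, ← ofReal_add (by positivity) hY, ← ofReal_add (by positivity) hq,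
          ← ofReal_mul hΓ0]

lemma exists_small {c a : ℝ} (hc : 0 < c) (ha : 0 < a) (A : ℝ) (hA : 0 ≤ A) : ∃ t, 0 < t ∧ t ≤ c ∧ A * t ≤ a := by
  refine ⟨min c (a / (A + 1)), by positivity, min_le_left _ _, ?_⟩
  calc A * min c (a / (A + 1)) ≤ (A + 1) * (a / (A + 1)) := by gcongr; linarith; exact min_le_right _ _
    _ = a := by field_simp

lemma lint_cut {φ : Euc N → ℝ} {v w : Euc N → Euc N} {a b ρ D s : ℝ} (hφ : IsCut a b D φ) (hρ : ρ ≤ a + s) (hρ' : ρ ≤ 3/4)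
    (hv : ∀ p ∈ ball (0 : Euc N) (3/4), H1At v p) (hw : ContDiff ℝ ∞ w) :
    ∫⁻ x in ball 0 ρ, dens (fun y => v y + φ y • (w y - v y)) x ≤ ofReal 3 * ((∫⁻ x in ball 0 ρ, dens w x) +
      (∫⁻ x in ball 0 (a + s) \ closedBall 0 a, dens v x) + ofReal ((N * D) ^ 2) * ∫⁻ x in ball 0 ρ, ‖v x - w x‖ₑ ^ 2) := by
  set S := ball (0 : Euc N) (a + s) \ closedBall 0 a with hS
  have hSm : MeasurableSet S := measurableSet_ball.diff measurableSet_closedBall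
  have h1 : ∫⁻ x in ball 0 ρ, dens (fun y => v y + φ y • (w y - v y)) x ≤ ∫⁻ x in ball 0 ρ, ofReal 3 *
      (dens w x + S.indicator (dens v) x + ofReal ((N * D) ^ 2) * ‖v x - w x‖ₑ ^ 2) := by
    refine setLIntegral_mono' measurableSet_ball fun x hx => ?_
    obtain ⟨h0, h1, hD⟩ := hφ.2.1 x
    refine (dens_cut (hφ.1.differentiable (by simp) x) (hv x (ball_subset_ball hρ' hx)).diff
      (hw.differentiable (by simp) x) h0 h1 hD).trans ?_
    gcongr
    by_cases hxa : ‖x‖ ≤ a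
    · simp [hφ.2.2.1 x hxa]
    · have hxS : x ∈ S := ⟨ball_subset_ball hρ hx, by simpa using hxa⟩
      rw [indicator_of_mem hxS]
      exact mul_le_of_le_one_left zero_le (ENNReal.ofReal_le_one.2 (by nlinarith))
  refine h1.trans ?_
  rw [lintegral_const_mul' _ _ ofReal_ne_top, lintegral_add_left (f := fun x => dens w x + S.indicator (dens v) x)
    ((measurable_dens w).add ((measurable_dens v).indicator hSm)), lintegral_add_left (measurable_dens w), lintegral_const_mul' _ _ ofReal_ne_top]
  refine mul_le_mul_right (add_le_add_left (add_le_add_right ?_ _) _) _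
  rw [← lintegral_indicator hSm]
  exact setLIntegral_le_lintegral _ _

set_option maxHeartbeats 2000000 in
/-- one-step decay of the total energy -/
lemma one_step (hN : 2 ≤ N) {𝓒 : Mat N →ₗ[ℝ] Mat N} {c₀ : ℝ} (h𝓒 : IsElasticityTensor 𝓒 c₀) :
    ∃ r ε κ : ℝ, 0 < r ∧ r ≤ 1/8 ∧ 0 < ε ∧ ε ≤ r ^ (N - 1) * (1/4) ^ N ∧ 0 < κ ∧
    ∀ (Ω K : Set (Euc N)) (u : Euc N → Euc N) (η : ℝ≥0∞), UnitMin 𝓒 Ω u K η → η ≤ ofReal κ → (0 : Euc N) ∈ K →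
      (∫⁻ x in ball 0 1 \ K, dens u x) + Hm N (K ∩ ball 0 1) ≤ ofReal ε →
      (∫⁻ x in ball 0 r \ K, dens u x) + Hm N (K ∩ ball 0 r) ≤ ofReal (r ^ (N - 1) * ε) := by
  have : NeZero N := ⟨by omega⟩
  obtain ⟨δ, hδ, Ci, hCi, hInt⟩ := exists_interp (N := N) hN
  obtain ⟨Cs, hCs, hsc⟩ := exists_scale hN hδ
  obtain ⟨Ce, hCe, heil⟩ := eilenberg hN
  obtain ⟨Γ, hΓ1, hΓ, hΓe⟩ := elastic_equiv h𝓒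
  obtain ⟨CE, hCE, hEL⟩ := UnitMin.EL_interp h𝓒
  obtain ⟨Cw, hCw, r₁, hr₁, hsm⟩ := exists_smooth hN h𝓒
  have hΓ0 : 0 < Γ := by linarith
  obtain ⟨r, hr, hrc, hrA⟩ := exists_small (c := min (1/8) (r₁/2)) (a := 1) (by positivity) one_pos
    (24 * Γ ^ 2 * Cw * (Ci + 1) * 2 ^ N) (by positivity)
  have hr8 : r ≤ 1/8 := hrc.trans (min_le_left _ _)
  have hr1 : r ≤ r₁/2 := hrc.trans (min_le_right _ _)
  set P := r ^ (N - 1) with hP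
  have hP0 : 0 < P := by positivity
  have hP1 : P * r = r ^ N := by rw [hP, ← pow_succ]; congr 1; omega
  obtain ⟨M, hM⟩ := exists_nat_gt (24 * Γ ^ 2 * Ci / P)
  have hM0 : (0:ℝ) < M := lt_of_le_of_lt (by positivity) hM
  have hMP : 24 * Γ ^ 2 * Ci ≤ P * M := by rw [div_lt_iff₀ hP0] at hM; linarith
  set s := r / M with hs
  have hs0 : 0 < s := by positivity
  have hMs : M * s = r := by rw [hs]; field_simp
  obtain ⟨D, hD0, hcut⟩ := exists_cuts (N := N) hr hs0 M
  obtain ⟨θ, hθ, hθ1, hθA⟩ := exists_small (c := 1/16) (a := P) (by norm_num) hP0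
    (24 * Γ ^ 2 * (N * D) ^ 2 * Cw * Ci) (by positivity)
  obtain ⟨Cl, hCl, hsm⟩ := hsm θ hθ hθ1
  obtain ⟨τ, hτ, hτ1, hτA⟩ := exists_small (c := 1/400) (a := min (1/2) P) (by norm_num) (by positivity)
    (Cl * CE * (Cs + 1) * (Ci + 1) + 8 * Γ * (Ce * (2 * (Cs + 1)) / (s / 2))) (by positivity)
  obtain ⟨κ, hκ, hκ1, hκA⟩ := exists_small (c := 1) (a := min (1/2) P) (by norm_num) (by positivity)
    (Cl * CE + 8 * Γ) (by positivity)
  have hτ2 : Cl * CE * (Cs + 1) * (Ci + 1) * τ ≤ 1/2 := by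
    refine le_trans ?_ (hτA.trans (min_le_left _ _)); gcongr; exact le_add_of_nonneg_right (by positivity)
  have hτ3 : 8 * Γ * (Ce * (2 * (Cs + 1)) / (s / 2)) * τ ≤ P := by
    refine le_trans ?_ (hτA.trans (min_le_right _ _)); gcongr; exact le_add_of_nonneg_left (by positivity)
  have hκ2 : Cl * CE * κ ≤ 1/2 := by
    refine le_trans ?_ (hκA.trans (min_le_left _ _)); gcongr; exact le_add_of_nonneg_right (by positivity)
  have hκ3 : 8 * Γ * κ ≤ P := by
    refine le_trans ?_ (hκA.trans (min_le_right _ _)); gcongr; exact le_add_of_nonneg_left (by positivity)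
  set ε := min (δ * τ ^ (N - 1)) (min 1 (P * (1/4) ^ N)) with hε
  have hε0 : 0 < ε := by positivity
  have hε1 : ε ≤ δ * τ ^ (N - 1) := min_le_left _ _
  have hε2 : ε ≤ 1 := (min_le_right _ _).trans (min_le_left _ _)
  refine ⟨r, ε, κ * ε, hr, hr8, hε0, (min_le_right _ _).trans (min_le_right _ _), by positivity,
    fun Ω K u η H hη h0K hEH => ?_⟩
  replace H : UnitMin 𝓒 Ω u K (ofReal (κ * ε)) := ⟨H.pair, H.sub, H.finE, H.finH, fun ρ h0 h1 v L hc =>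
    (H.minimality ρ h0 h1 v L hc).trans (by gcongr)⟩
  have hcΩ : closedBall (0 : Euc N) (7/8) ⊆ Ω := (closedBall_subset_ball (by norm_num)).trans H.sub
  set K' := K ∩ closedBall (0 : Euc N) (7/8) with hK'
  have hK'c : IsClosed K' := by
    refine isClosed_of_closure_subset fun x hx => ?_
    have h1 : x ∈ closedBall (0 : Euc N) (7/8) := closure_minimal inter_subset_right isClosed_closedBall hx
    exact ⟨H.pair.relClosed.2 ⟨closure_mono inter_subset_left hx, hcΩ h1⟩, h1⟩
  have hK'H : Hm N K' ≤ ofReal ε := (measure_mono (inter_subset_inter_right _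
    (closedBall_subset_ball (by norm_num)))).trans (le_add_self.trans hEH)
  have hK'v : volume K' = 0 := vol_zero_of_Hm (ne_top_of_le_ne_top ofReal_ne_top hK'H)
  obtain ⟨d, σ, hσ, hdb, hdl, hdK, hU⟩ := hsc K' τ (τ * ε) hτ (by positivity)
    ((isCompact_closedBall _ _).of_isClosed_subset hK'c inter_subset_right) ⟨0, h0K, by rw [mem_closedBall_zero_iff, norm_zero]; norm_num⟩
    (hK'H.trans (ofReal_le_ofReal hε1))
  have hd : ScaleFn d σ τ := ⟨hσ, fun x => (hdb x).1, fun x => (hdb x).2, hdl⟩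
  have hbK : ball (0 : Euc N) (7/8) \ K' = ball 0 (7/8) \ K := by
    ext x; constructor
    · exact fun hx => ⟨hx.1, fun h => hx.2 ⟨h, ball_subset_closedBall hx.1⟩⟩
    · exact fun hx => ⟨hx.1, fun h => hx.2 h.1⟩
  obtain ⟨v, hv, hvu, hvd, hvs⟩ := hInt K' u d σ τ hK'c hK'v hd hτ1 hdK
    (fun p hp => by rw [hbK] at hp; exact H.pair.h1At ⟨hcΩ (ball_subset_closedBall hp.1), hp.2⟩)
    (by rw [hbK]; exact H.finE _ (by norm_num) (by norm_num))
  set U := {x | infDist x K' ≤ 30 * d x} with hUd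
  have hdc : Continuous d := by
    refine LipschitzWith.continuous (K := 1) (LipschitzWith.of_dist_le_mul fun x y => ?_)
    rw [Real.dist_eq]; have := hdl x y; have := dist_nonneg (x := x) (y := y); push_cast; linarith
  have hUc : IsClosed U := isClosed_le (continuous_infDist_pt _) (by fun_prop)
  have hUv : volume U ≤ ofReal ((Cs + 1) * τ * ε) := by
    refine hU.trans ?_
    rw [show (Cs + 1) * τ * ε = Cs * τ * ε + τ * ε by ring, ofReal_add (by positivity) (by positivity),
      ofReal_mul (p := Cs * τ) (by positivity)]
    gcongr
  have hvε : ∫⁻ x in ball 0 (3/4), dens v x ≤ ofReal (Ci * ε) := by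
    refine (hvd _ Subset.rfl).trans ?_
    rw [ofReal_mul hCi.le]
    gcongr
    refine le_trans (lintegral_mono_set fun x hx => ?_) (le_self_add.trans hEH)
    have := hbK ▸ (show x ∈ ball (0 : Euc N) (7/8) \ K' from ⟨hx.1.2, hx.2⟩)
    exact ⟨ball_subset_ball (by norm_num) this.1, this.2⟩
  have hvev : ∀ p ∈ ball (0 : Euc N) (3/4), p ∉ U → v =ᶠ[𝓝 p] u := fun p hp hpU => by
    filter_upwards [isOpen_ball.mem_nhds hp, hUc.isOpen_compl.mem_nhds hpU] with x hx hxU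
    exact hvu x hx (not_le.1 hxU)
  obtain ⟨l, hl0, hl, hELl⟩ := hEL Ω K U u v (κ * ε) ((Cs + 1) * τ * ε) ((Ci + 1) * ε) H (by positivity) (by positivity)
    (by positivity) hUc.measurableSet hUv
    (fun x hx => by rw [eSym_eq, eSym_eq, (hvev x (ball_subset_ball (by norm_num) hx.1) hx.2).fderiv_eq])
    ((lintegral_mono_set (diff_subset_diff_left (ball_subset_ball (by norm_num)))).trans ((le_self_add.trans hEH).trans
      (ofReal_le_ofReal (by nlinarith))))
    ((lintegral_mono_set (ball_subset_ball (by norm_num))).trans (hvε.trans (ofReal_le_ofReal (by linarith))))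
  obtain ⟨w, hw, hwd, hwv⟩ := hsm v l hv hl0 hELl (ne_top_of_le_ne_top ofReal_ne_top hvε)
  have hll : Cl * l ^ 2 ≤ ε := by
    rw [hl]
    have h1 : (Cs + 1) * τ * ε * ((Ci + 1) * ε) ≤ (Cs + 1) * τ * (Ci + 1) * ε := by
      calc (Cs + 1) * τ * ε * ((Ci + 1) * ε) = (Cs + 1) * τ * (Ci + 1) * ε * ε := by ring
        _ ≤ _ := mul_le_of_le_one_right (by positivity) hε2
    have h2 : Cl * (CE * (κ * ε + (Cs + 1) * τ * ε * ((Ci + 1) * ε))) ≤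
        Cl * (CE * (κ * ε + (Cs + 1) * τ * (Ci + 1) * ε)) := by gcongr
    have h3 : Cl * (CE * (κ * ε + (Cs + 1) * τ * (Ci + 1) * ε)) =
      (Cl * CE * κ + Cl * CE * (Cs + 1) * (Ci + 1) * τ) * ε := by ring
    have h4 : (Cl * CE * κ + Cl * CE * (Cs + 1) * (Ci + 1) * τ) * ε ≤ 1 * ε := by gcongr; linarith
    linarith
  obtain ⟨k, hk, hshell⟩ := shell_pick (f := dens v) (R := 3/4) hr hs0 (M := M) (by exact_mod_cast hM0) (by linarith)
    (by positivity) hvε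
  obtain ⟨φ, hφ⟩ := hcut k hk
  set a := r + k * s with ha
  have hk1 : ((k:ℝ) + 1) ≤ M := by exact_mod_cast hk
  have ha2 : a + s ≤ 2 * r := by rw [ha]; nlinarith
  have har : r ≤ a := by rw [ha]; have : (0:ℝ) ≤ k * s := by positivity
                         linarith
  obtain ⟨ρ, ⟨hρa, hρb⟩, hρU⟩ := heil U (a + s / 2) (a + s) (2 * ((Cs + 1) * τ * ε)) (by linarith)
    (hUv.trans_lt ((ENNReal.ofReal_lt_ofReal_iff (by positivity)).2 (by linarith [show 0 < (Cs + 1) * τ * ε by positivity])))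
  set V := fun y => v y + φ y • (w y - v y) with hV
  have hρ4 : ρ ≤ 1/4 := by linarith
  have hsph : ∀ p ∈ sphere (0 : Euc N) ρ \ U, p ∈ ball (0 : Euc N) (3/4) := fun p hp => by
    have := mem_sphere_zero_iff_norm.1 hp.1
    rw [mem_ball_zero_iff]; linarith
  have hpat := H.patch h𝓒 (V := V) (ρ := ρ) (by linarith) (by linarith) hUc
    (fun p hp => by
      exact (hv p (ball_subset_ball (by linarith) hp)).cut hw hφ.1)
    (fun p hp => by
      have hp3 := hsph p hp
      refine ⟨fun hpK => hp.2 ?_, ?_⟩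
      · have : p ∈ K' := ⟨hpK, ball_subset_closedBall (ball_subset_ball (by norm_num) hp3)⟩
        simp only [hUd, mem_setOf_eq, infDist_zero_of_mem this]
        linarith [hd.pos p]
      · have h1 : a + s / 2 < ‖p‖ := by rw [mem_sphere_zero_iff_norm.1 hp.1]; exact hρa
        filter_upwards [hvev p hp3 hp.2, continuous_norm.continuousAt.eventually_const_lt h1] with x hx hx'
        simp [hV, hφ.2.2.2 x hx'.le, hx])
    (fun p hp q hq => sep_const (measSet_diff H.pair) hd (fun x hx y hy => by
        have h1 : y ∈ closedBall (0 : Euc N) (7/8) := by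
          have h2 := mem_ball_zero_iff.1 hx
          have h3 := mem_ball_iff_norm.1 hy.1
          have h4 := hd.le x
          rw [mem_closedBall_zero_iff]
          have := norm_le_norm_add_norm_sub' y x
          linarith
        exact ⟨hcΩ h1, fun h => hy.2 ⟨h, h1⟩⟩) hvs (hsph p hp) (hsph q hq) (not_le.1 hp.2) (not_le.1 hq.2))
  have hVd := lint_cut (s := s) hφ hρb.le (by linarith) hv hw
  have h2r : ∫⁻ x in ball 0 ρ, dens w x ≤ ofReal (Cw * (2 * r) ^ N * ((Ci + 1) * ε)) := by
    refine (lintegral_mono_set (ball_subset_ball (hρb.le.trans ha2))).trans ((hwd (2 * r) (by positivity) (by linarith)).trans ?_)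
    rw [ofReal_mul (p := Cw * (2 * r) ^ N) (by positivity), add_mul, one_mul, ofReal_add (by positivity) hε0.le]
    gcongr
  have h3r : ∫⁻ x in ball 0 ρ, ‖v x - w x‖ₑ ^ 2 ≤ ofReal (Cw * θ ^ 2 * (Ci * ε)) := by
    refine (lintegral_mono_set (ball_subset_ball hρ4)).trans (hwv.trans ?_)
    rw [ofReal_mul (p := Cw * θ ^ 2) (by positivity)]
    gcongr
  have hVd2 : ∫⁻ x in ball 0 ρ, dens V x ≤ ofReal (3 * (Cw * (2 * r) ^ N * ((Ci + 1) * ε) + Ci * ε / M +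
      (N * D) ^ 2 * (Cw * θ ^ 2 * (Ci * ε)))) := by
    refine hVd.trans ?_
    rw [ofReal_mul (by norm_num), ofReal_add (by positivity) (by positivity),
      ofReal_add (by positivity) (by positivity), ofReal_mul (p := (N * D) ^ 2) (by positivity)]
    gcongr
  set T := 3 * (Cw * (2 * r) ^ N * ((Ci + 1) * ε) + Ci * ε / M + (N * D) ^ 2 * (Cw * θ ^ 2 * (Ci * ε))) with hT
  have hT0 : 0 ≤ T := by positivity
  set Y := Ce * (2 * ((Cs + 1) * τ * ε)) / (a + s - (a + s / 2)) with hY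
  have hYe : Y = Ce * (2 * (Cs + 1)) / (s / 2) * τ * ε := by
    rw [hY, show a + s - (a + s / 2) = s / 2 by ring]; ring
  have hY0 : 0 ≤ Y := by rw [hYe]; positivity
  refine (energy_close (q := κ * ε) hΓ1 hΓe (by linarith) hT0 hY0 (by positivity) hpat hVd2 (by rwa [inter_comm]) le_rfl).trans
    (ofReal_le_ofReal ?_)
  have q1 : 24 * Γ ^ 2 * (Cw * (2 * r) ^ N * (Ci + 1)) ≤ P := by
    rw [mul_pow, ← hP1]
    calc _ = 24 * Γ ^ 2 * Cw * (Ci + 1) * 2 ^ N * r * P := by ring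
      _ ≤ 1 * P := by gcongr
      _ = P := one_mul P
  have q2 : 24 * Γ ^ 2 * (Ci / M) ≤ P := by
    rw [← mul_div_assoc, div_le_iff₀ hM0]; exact hMP
  have q3 : 24 * Γ ^ 2 * ((N * D) ^ 2 * (Cw * θ ^ 2 * Ci)) ≤ P := by
    refine le_trans ?_ hθA
    have : θ ^ 2 ≤ θ := by nlinarith
    calc _ = 24 * Γ ^ 2 * (N * D) ^ 2 * Cw * Ci * θ ^ 2 := by ring
      _ ≤ _ := by gcongr
  have q4 : Γ * (Γ * T + Y + κ * ε) = (24 * Γ ^ 2 * (Cw * (2 * r) ^ N * (Ci + 1)) + 24 * Γ ^ 2 * (Ci / M) +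
      24 * Γ ^ 2 * ((N * D) ^ 2 * (Cw * θ ^ 2 * Ci)) + 8 * Γ * (Ce * (2 * (Cs + 1)) / (s / 2)) * τ + 8 * Γ * κ) / 8 * ε := by
    rw [hT, hYe]; ring
  rw [q4]
  gcongr
  linarith

/-- one side of the slab of width `b` in the unit ball -/
def side (ν : Euc N) (b : ℝ) : Set (Euc N) := ball 0 1 ∩ {x | b < ⟪ν, x⟫}

lemma side_convex (ν : Euc N) (b : ℝ) : Convex ℝ (side ν b) :=
  (convex_ball _ _).inter (convex_halfSpace_gt (innerₗ (Euc N) ν).isLinear b)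

lemma side_open (ν : Euc N) (b : ℝ) : IsOpen (side ν b) :=
  isOpen_ball.inter (isOpen_lt continuous_const (by fun_prop))

lemma abs_inner_unit {ν : Euc N} (hν : ‖ν‖ = 1) (x : Euc N) : |⟪ν, x⟫| ≤ ‖x‖ := by
  simpa [hν] using abs_real_inner_le_norm ν x

lemma ball_sub_side {ν y : Euc N} {b t : ℝ} (hν : ‖ν‖ = 1) (ht : 0 < t) (ht1 : t < 1/2) (hbt : 8 * b ≤ t) (hy : ‖y‖ < 1/2)
    (hyν : ⟪ν, y⟫ = 0) : ball (y + (t/2) • ν) (t/4) ⊆ side ν b ∩ ball y t := by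
  intro x hx
  have h1 := mem_ball_iff_norm.1 hx
  have h2 : ⟪ν, x⟫ = ⟪ν, x - (y + (t/2) • ν)⟫ + t/2 := by
    rw [inner_sub_right, inner_add_right, hyν, inner_smul_right, real_inner_self_eq_norm_sq, hν]; ring
  have h3 := abs_le.1 (abs_inner_unit hν (x - (y + (t/2) • ν)))
  have h4 : ‖x - y‖ < t := by
    have : x - y = (x - (y + (t/2) • ν)) + (t/2) • ν := by abel
    rw [this]
    refine (norm_add_le _ _).trans_lt ?_
    rw [norm_smul, hν, norm_eq_abs, abs_of_pos (by positivity)]; linarith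
  refine ⟨⟨?_, ?_⟩, mem_ball_iff_norm.2 h4⟩
  · rw [mem_ball_zero_iff]; have := norm_le_norm_add_norm_sub' x y; linarith
  · show b < ⟪ν, x⟫
    rw [h2]; linarith [h3.1]

/-- control of `u - a` on one side, through the hole -/
lemma half_fit (hN : 2 ≤ N) : ∃ C > (0:ℝ), ∀ (ν y : Euc N) (b t W : ℝ) (u : Euc N → Euc N) (b0 : Euc N) (A0 : Euc N →L[ℝ] Euc N),
    ‖ν‖ = 1 → b ≤ 1/16 → 0 < t → t < 1/2 → 8 * b ≤ t → ‖y‖ < 1/2 → ⟪ν, y⟫ = 0 → 0 ≤ W →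
    (∀ x ∈ side ν b, DifferentiableAt ℝ u x) → ∫⁻ x in side ν b, dens u x ≤ ofReal W →
    ∫⁻ x in ball y t, ofReal (‖u x - (b0 + A0 x)‖ ^ 2) ≤ ofReal W →
    ∫⁻ x in side ν b, ofReal (‖u x - (b0 + A0 x)‖ ^ 2) ≤ ofReal (C * (W / t ^ (N + 2))) := by
  have : NeZero N := ⟨by omega⟩
  obtain ⟨δ0, hδ0, C1, hC1, hkp⟩ := kp hN 8 (by norm_num)
  obtain ⟨δ1, hδ1, C2, hC2, haff⟩ := aff_sup hN
  set ϑ := (volume (ball (0 : Euc N) 1)).toReal with hϑ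
  have hϑ' : volume (ball (0 : Euc N) 1) = ofReal ϑ := (ofReal_toReal measure_ball_lt_top.ne).symm
  refine ⟨2 * C1 + 2 * (130 * (C2 * (2 * C1 + 2) * 4 ^ N) * ϑ), by positivity,
    fun ν y b t W u b0 A0 hν hb ht ht1 hbt hy hyν hW hu hE hhole => ?_⟩
  set D := side ν b with hD
  have hDm : MeasurableSet D := (side_open ν b).measurableSet
  have hBz : ball ((1/2:ℝ) • ν) (1/4) ⊆ D := fun x hx => by
    have h1 := mem_ball_iff_norm.1 hx
    have h2 : ⟪ν, x⟫ = ⟪ν, x - (1/2:ℝ) • ν⟫ + 1/2 := by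
      rw [inner_sub_right, inner_smul_right, real_inner_self_eq_norm_sq, hν]; ring
    have h3 := abs_le.1 (abs_inner_unit hν (x - (1/2:ℝ) • ν))
    have h4 : ‖(1/2:ℝ) • ν‖ = 1/2 := by rw [norm_smul, hν]; norm_num
    refine ⟨?_, ?_⟩
    · rw [mem_ball_zero_iff]; have := norm_le_norm_add_norm_sub' x ((1/2:ℝ) • ν); linarith
    · show b < ⟪ν, x⟫
      rw [h2]; linarith [h3.1]
  obtain ⟨b1, A1, -, G, -, -, -, hG, hGD, -⟩ := hkp ((1/2:ℝ) • ν) (1/4) (by norm_num) D ∅ u (side_convex ν b) (side_open ν b) hBz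
    (fun x hx => by
      have h1 := mem_ball_zero_iff.1 hx.1
      have h4 : ‖(1/2:ℝ) • ν‖ = 1/2 := by rw [norm_smul, hν]; norm_num
      rw [mem_ball_iff_norm]; have := norm_sub_le x ((1/2:ℝ) • ν); linarith)
    (by simp) (fun x hx => hu x hx.1) (by rw [diff_empty]; exact ne_top_of_le_ne_top ofReal_ne_top hE) (by simp)
  rw [hGD (by simp), diff_empty] at hG
  replace hG : ∫⁻ x in D, ofReal (‖u x - (b1 + A1 x)‖ ^ 2) ≤ ofReal (C1 * W) := by
    refine hG.trans ?_
    rw [ofReal_mul (q := W) hC1.le]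
    exact mul_le_mul' (ofReal_le_ofReal (by linarith)) hE
  have hmeas : ∀ S ⊆ D, MeasurableSet S → AEMeasurable (fun x => ofReal (‖u x - (b1 + A1 x)‖ ^ 2)) (volume.restrict S) := by
    intro S hS hSm
    have hc : ContinuousOn u S := fun x hx => (hu x (hS hx)).continuousAt.continuousWithinAt
    exact (ContinuousOn.aemeasurable (by fun_prop) hSm : AEMeasurable (fun x => ‖u x - (b1 + A1 x)‖ ^ 2) _).ennreal_ofReal
  have heq : ∀ x, (b1 - b0) + (A1 - A0) x = (u x - (b0 + A0 x)) - (u x - (b1 + A1 x)) := fun x => by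
    rw [ContinuousLinearMap.sub_apply]; abel
  set z := y + (t/2) • ν with hz
  have hB := ball_sub_side hν ht ht1 hbt hy hyν
  have h1 := haff z (t/4) (by positivity) (b1 - b0) (A1 - A0) (ball z (t/4)) measurableSet_ball (by simp)
  have h2 : ∫⁻ x in ball z (t/4), ofReal (‖(b1 - b0) + (A1 - A0) x‖ ^ 2) ≤ ofReal ((2 * C1 + 2) * W) := by
    refine (lintegral_sq_tri (f := fun x => ‖u x - (b1 + A1 x)‖) (g := fun x => ‖u x - (b0 + A0 x)‖)
      (hmeas _ (hB.trans inter_subset_left) measurableSet_ball) measurableSet_ball fun x _ => ?_).trans ?_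
    · rw [heq, abs_norm, abs_norm, abs_norm]; exact (norm_sub_le _ _).trans (add_comm _ _).le
    · rw [show (2 * C1 + 2) * W = 2 * (C1 * W) + 2 * W by ring, ofReal_add (by positivity) (by positivity),
        ofReal_mul (by norm_num), ofReal_mul (p := 2) (by norm_num)]
      gcongr
      · exact (lintegral_mono_set (hB.trans inter_subset_left)).trans hG
      · exact (lintegral_mono_set (hB.trans inter_subset_right)).trans hhole
  set X := ‖(b1 - b0) + (A1 - A0) z‖ with hX
  set Y := ‖A1 - A0‖ with hY
  have h3 : (X ^ 2 + (t/4) ^ 2 * Y ^ 2) * (t/4) ^ N ≤ C2 * ((2 * C1 + 2) * W) := by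
    have := h1.trans (mul_le_mul_right h2 _)
    rwa [← ofReal_mul (by positivity), ← ofReal_mul (by positivity),
      ofReal_le_ofReal_iff (by positivity)] at this
  have h4 : ∀ x ∈ D, ‖(b1 - b0) + (A1 - A0) x‖ ^ 2 ≤ 130 * (C2 * (2 * C1 + 2) * 4 ^ N) * (W / t ^ (N + 2)) := by
    intro x hx
    have hxz : ‖x - z‖ ≤ 2 := by
      have h5 := mem_ball_zero_iff.1 hx.1
      have h6 := mem_ball_zero_iff.1 (hB (mem_ball_self (by positivity))).1.1
      have := norm_sub_le x z; linarith
    have h5 : ‖(b1 - b0) + (A1 - A0) x‖ ≤ X + Y * 2 := by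
      have : (b1 - b0) + (A1 - A0) x = ((b1 - b0) + (A1 - A0) z) + (A1 - A0) (x - z) := by rw [map_sub]; abel
      rw [this]
      refine (norm_add_le _ _).trans (add_le_add le_rfl (((A1 - A0).le_opNorm _).trans ?_)); gcongr
    have h6 : (X + Y * 2) ^ 2 * t ^ 2 ≤ 130 * (X ^ 2 + (t/4) ^ 2 * Y ^ 2) := by
      have : t ^ 2 ≤ 1 := by nlinarith
      nlinarith [sq_nonneg (X - Y * 2), sq_nonneg (t * Y), sq_nonneg (t * (X - Y * 2)), mul_le_mul_of_nonneg_left this (sq_nonneg X)]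
    rw [← mul_div_assoc, le_div_iff₀ (by positivity)]
    have h7 : (t/4) ^ N * 4 ^ N = t ^ N := by rw [← mul_pow]; congr 1; ring
    calc ‖(b1 - b0) + (A1 - A0) x‖ ^ 2 * t ^ (N + 2) ≤ (X + Y * 2) ^ 2 * t ^ (N + 2) := by gcongr
      _ = ((X + Y * 2) ^ 2 * t ^ 2) * ((t/4) ^ N * 4 ^ N) := by rw [h7, pow_add]; ring
      _ ≤ (130 * (X ^ 2 + (t/4) ^ 2 * Y ^ 2)) * ((t/4) ^ N * 4 ^ N) := by gcongr
      _ = 130 * 4 ^ N * ((X ^ 2 + (t/4) ^ 2 * Y ^ 2) * (t/4) ^ N) := by ring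
      _ ≤ 130 * 4 ^ N * (C2 * ((2 * C1 + 2) * W)) := by gcongr
      _ = _ := by ring
  set Z := 130 * (C2 * (2 * C1 + 2) * 4 ^ N) with hZ
  have hZ0 : 0 < Z := by positivity
  refine (lintegral_sq_tri (f := fun x => ‖u x - (b1 + A1 x)‖) (g := fun x => ‖(b1 - b0) + (A1 - A0) x‖)
      (hmeas _ Subset.rfl hDm) hDm fun x _ => ?_).trans ?_
  · rw [abs_norm, abs_norm, abs_norm]
    refine le_trans (le_of_eq ?_) (norm_add_le _ _)
    rw [heq]; congr 1; abel
  · have h5 : ∫⁻ x in D, ofReal (‖(b1 - b0) + (A1 - A0) x‖ ^ 2) ≤ ofReal (Z * (W / t ^ (N + 2)) * ϑ) := by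
      refine (setLIntegral_mono' hDm fun x hx => ofReal_le_ofReal (h4 x hx)).trans ?_
      rw [setLIntegral_const, ofReal_mul (q := ϑ) (by positivity), ← hϑ']
      gcongr
      exact inter_subset_left
    have h6 : W ≤ W / t ^ (N + 2) := le_div_self hW (by positivity) (pow_le_one₀ ht.le (by linarith))
    calc _ ≤ ofReal 2 * ofReal (C1 * (W / t ^ (N + 2))) + ofReal 2 * ofReal (Z * (W / t ^ (N + 2)) * ϑ) := by
          gcongr
          exact hG.trans (ofReal_le_ofReal (by gcongr))
      _ = _ := by
          rw [← ofReal_mul (by norm_num), ← ofReal_mul (by norm_num), ← ofReal_add (by positivity) (by positivity)]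
          congr 1; ring

/-- volume of a thin slab -/
lemma slab_vol {ν : Euc N} (hν : ‖ν‖ = 1) {n : ℕ} (hn : 0 < n) :
    n * volume (ball (0 : Euc N) 1 ∩ {x | |⟪ν, x⟫| ≤ 1 / (3 * n)}) ≤ volume (ball (0 : Euc N) 2) := by
  have hn0 : (0:ℝ) < n := by exact_mod_cast hn
  set S := ball (0 : Euc N) 1 ∩ {x | |⟪ν, x⟫| ≤ 1 / (3 * n)} with hS
  set T : ℕ → Set (Euc N) := fun k => (fun x => (-((k:ℝ) / n) • ν) + x) ⁻¹' S with hT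
  have hSm : MeasurableSet S := measurableSet_ball.inter (isClosed_le (by fun_prop) continuous_const).measurableSet
  have hTm : ∀ k, MeasurableSet (T k) := fun k => (measurable_const_add _) hSm
  have hmem : ∀ k x, x ∈ T k → ‖x‖ < 1 + k / n ∧ |⟪ν, x⟫ * n - k| ≤ 1/3 := fun k x hx => by
    obtain ⟨h1, h2⟩ := hx
    have h3 : |⟪ν, (-((k:ℝ) / n) • ν) + x⟫| ≤ 1 / (3 * n) := h2
    rw [inner_add_right, inner_smul_right, real_inner_self_eq_norm_sq, hν] at h3
    constructor
    · have h4 := norm_sub_le ((-((k:ℝ) / n) • ν) + x) (-((k:ℝ) / n) • ν)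
      rw [add_sub_cancel_left, norm_smul, hν, norm_neg, norm_of_nonneg (by positivity)] at h4
      have := mem_ball_zero_iff.1 h1; linarith
    · have h5 : ⟪ν, x⟫ * n - k = (-((k:ℝ) / n) * 1 ^ 2 + ⟪ν, x⟫) * n := by field_simp; ring
      rw [h5, abs_mul, abs_of_pos hn0]
      calc _ ≤ 1 / (3 * n) * (n:ℝ) := by gcongr
        _ = 1/3 := by field_simp
  have hdis : (↑(Finset.range n) : Set ℕ).PairwiseDisjoint T := fun i _ j _ hij => disjoint_left.2 fun x hx hy => by
    have h1 := abs_le.1 (hmem i x hx).2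
    have h2 := abs_le.1 (hmem j x hy).2
    rcases lt_or_gt_of_ne hij with h | h
    · have : (i:ℝ) + 1 ≤ j := by exact_mod_cast h
      linarith [h1.1, h1.2, h2.1, h2.2]
    · have : (j:ℝ) + 1 ≤ i := by exact_mod_cast h
      linarith [h1.1, h1.2, h2.1, h2.2]
  calc n * volume S = ∑ k ∈ Finset.range n, volume (T k) := by
        simp [hT, measure_preimage_add]
    _ = volume (⋃ k ∈ Finset.range n, T k) := (measure_biUnion_finset hdis fun k _ => hTm k).symm
    _ ≤ _ := measure_mono (iUnion₂_subset fun k hk x hx => by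
        have h1 := (hmem k x hx).1
        have h2 : (k:ℝ) / n ≤ 1 := (div_le_one hn0).2 (by exact_mod_cast (Finset.mem_range.1 hk).le)
        rw [mem_ball_zero_iff]; linarith)

/-- total energy in a ball -/
def EH (u : Euc N → Euc N) (K : Set (Euc N)) (x : Euc N) (r : ℝ) : ℝ≥0∞ :=
  (∫⁻ y in ball x r \ K, dens u y) + Hm N (K ∩ ball x r)

lemma exists_slabCut {s : ℝ} (hs : 0 < s) : ∃ D : ℝ, ∀ ν : Euc N, ‖ν‖ = 1 → ∃ φ : Euc N → ℝ, ContDiff ℝ ∞ φ ∧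
    (∀ x, 0 ≤ φ x ∧ φ x ≤ 1 ∧ ‖fderiv ℝ φ x‖ ≤ D) ∧ (∀ x, |⟪ν, x⟫| ≤ s / 2 → φ x = 1) ∧ ∀ x, s ≤ |⟪ν, x⟫| → φ x = 0 := by
  set f : ContDiffBump (0 : ℝ) := ⟨s / 2, s, by positivity, by linarith⟩ with hf
  have hfs : ContDiff ℝ ∞ f := f.contDiff
  obtain ⟨D, hD⟩ := (hfs.continuous_fderiv (by simp)).bounded_above_of_compact_support (f.hasCompactSupport.fderiv ℝ)
  refine ⟨D, fun ν hν => ⟨fun x => f (innerSL ℝ ν x), hfs.comp (innerSL ℝ ν).contDiff, fun x => ⟨f.nonneg, f.le_one, ?_⟩,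
    fun x hx => f.one_of_mem_closedBall (by simpa [hf] using hx), fun x hx => f.zero_of_le_dist (by simpa [hf] using hx)⟩⟩
  have h1 := ((hfs.differentiable (by simp) (innerSL ℝ ν x)).hasFDerivAt.comp x (innerSL ℝ ν).hasFDerivAt).fderiv
  rw [show (fun x => f (innerSL ℝ ν x)) = f ∘ (innerSL ℝ ν) from rfl, h1]
  refine (opNorm_comp_le _ _).trans ?_
  rw [innerSL_apply_norm, hν, mul_one]
  exact hD _

set_option maxHeartbeats 1000000 in
/-- a hole in a flat crack forces small energy -/
lemma hole (hN : 2 ≤ N) {𝓒 : Mat N →ₗ[ℝ] Mat N} {c₀ : ℝ} (h𝓒 : IsElasticityTensor 𝓒 c₀) {e : ℝ} (he : 0 < e) :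
    ∃ b₀ c κ : ℝ, 0 < b₀ ∧ 0 < c ∧ 0 < κ ∧ ∀ (Ω K : Set (Euc N)) (u : Euc N → Euc N) (η : ℝ≥0∞), UnitMin 𝓒 Ω u K η →
      η ≤ ofReal κ → ∀ (ν y : Euc N) (b t : ℝ), ‖ν‖ = 1 → 0 ≤ b → b ≤ b₀ → 0 < t → t < 1/2 → 8 * b ≤ t → ‖y‖ < 1/2 →
      ⟪ν, y⟫ = 0 → (∀ x ∈ K ∩ ball 0 1, |⟪ν, x⟫| ≤ b) → (∀ x ∈ ball y t, x ∉ K) →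
      ∫⁻ x in ball 0 1 \ K, dens u x ≤ ofReal (c * t ^ (N + 2)) → EH u K 0 (1/2) ≤ ofReal e := by
  obtain ⟨Ce, hCe, heil⟩ := eilenberg hN
  obtain ⟨Γ, hΓ1, hΓ, hΓe⟩ := elastic_equiv h𝓒
  obtain ⟨C1, hC1, hhalf⟩ := half_fit hN
  obtain ⟨C2, hC2, hfit⟩ := fit_ball hN
  have hΓ0 : 0 < Γ := by linarith
  set ϑ := (volume (ball (0 : Euc N) 2)).toReal with hϑ
  have hϑ' : volume (ball (0 : Euc N) 2) = ofReal ϑ := (ofReal_toReal measure_ball_lt_top.ne).symm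
  have hϑ0 : 0 ≤ ϑ := toReal_nonneg
  obtain ⟨n, hn⟩ := exists_nat_gt (3 * Γ * (Ce * (4 * (ϑ + 1))) / e)
  have hn0 : (0:ℝ) < n := lt_of_le_of_lt (by positivity) hn
  have hn1 : (1:ℝ) ≤ n := by exact_mod_cast hn0
  set s : ℝ := 1 / (3 * n) with hs
  have hs0 : 0 < s := by positivity
  have hs1 : s ≤ 1/3 := by rw [hs]; gcongr; linarith
  obtain ⟨D, hcut⟩ := exists_slabCut (N := N) hs0
  obtain ⟨c, hc, -, hcA⟩ := exists_small (c := 1) (a := e / 3) one_pos (by positivity)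
    (Γ ^ 2 * (6 * (1 + (N * D) ^ 2 * (C1 * (1 + C2))))) (by positivity)
  refine ⟨min (s / 4) (1/16), c, e / (3 * Γ), by positivity, hc, by positivity,
    fun Ω K u η H hη ν y b t hν hb hbb ht ht1 hbt hy hyν hK hhole hω => ?_⟩
  have hbs : b ≤ s / 4 := hbb.trans (min_le_left _ _)
  have hb16 : b ≤ 1/16 := hbb.trans (min_le_right _ _)
  set W := c * t ^ (N + 2) with hW
  have hB1 : ball y t ⊆ ball 0 1 := fun x hx => by
    have h1 := mem_ball_iff_norm.1 hx
    rw [mem_ball_zero_iff]; have := norm_le_norm_add_norm_sub' x y; linarith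
  have hside : ∀ μ : Euc N, (μ = ν ∨ μ = -ν) → side μ b ⊆ ball 0 1 \ K := fun μ hμ x hx => ⟨hx.1, fun hxK => by
    have h1 := abs_le.1 (hK x ⟨hxK, hx.1⟩)
    have h2 : b < ⟪μ, x⟫ := hx.2
    rcases hμ with rfl | rfl
    · linarith [h1.2]
    · rw [inner_neg_left] at h2; linarith [h1.1]⟩
  have hdiff : ∀ x ∈ ball 0 1 \ K, DifferentiableAt ℝ u x := fun x hx => H.pair.diffOn x ⟨H.sub hx.1, hx.2⟩
  have hBK : ball y t ⊆ ball 0 1 \ K := fun x hx => ⟨hB1 hx, hhole x hx⟩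
  have hBE := (lintegral_mono_set (μ := volume) (f := dens u) hBK).trans hω
  obtain ⟨a0, A0, hA0, hfit⟩ := hfit y t ht u (fun x hx => hdiff x (hBK hx)) (ne_top_of_le_ne_top ofReal_ne_top hBE)
  set a := fun x => a0 + A0 x with ha
  have hfit' : ∫⁻ x in ball y t, ofReal (‖u x - (a0 + A0 x)‖ ^ 2) ≤ ofReal ((1 + C2) * W) := by
    simp only [← enorm_sq_eq]
    refine hfit.trans ?_
    rw [ofReal_mul (q := W) (by positivity)]
    have ht2 : t ^ 2 ≤ 1 := by nlinarith
    exact mul_le_mul' (ofReal_le_ofReal (by nlinarith [mul_le_mul_of_nonneg_left ht2 hC2.le])) hBE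
  have hsideE : ∀ μ : Euc N, (μ = ν ∨ μ = -ν) → ∫⁻ x in side μ b, dens u x ≤ ofReal W := fun μ hμ =>
    (lintegral_mono_set (hside μ hμ)).trans hω
  have hμ1 : ∀ μ : Euc N, (μ = ν ∨ μ = -ν) → ‖μ‖ = 1 ∧ ⟪μ, y⟫ = 0 := by
    rintro μ (rfl | rfl)
    · exact ⟨hν, hyν⟩
    · exact ⟨by rw [norm_neg, hν], by rw [inner_neg_left, hyν, neg_zero]⟩
  have hsideF : ∀ μ : Euc N, (μ = ν ∨ μ = -ν) → ∫⁻ x in side μ b, ofReal (‖u x - (a0 + A0 x)‖ ^ 2) ≤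
      ofReal (C1 * ((1 + C2) * c)) := fun μ hμ => by
    have h1 := hhalf μ y b t ((1 + C2) * W) u a0 A0 (hμ1 μ hμ).1 hb16 ht ht1 hbt hy (hμ1 μ hμ).2 (by positivity)
      (fun x hx => hdiff x (hside μ hμ hx)) ((hsideE μ hμ).trans (ofReal_le_ofReal
        (le_mul_of_one_le_left (by positivity) (by linarith)))) hfit'
    rwa [show (1 + C2) * W / t ^ (N + 2) = (1 + C2) * c by rw [hW]; field_simp] at h1
  obtain ⟨φ, hφs, hφ, hφ1, hφ0⟩ := hcut ν hν
  set V := fun x => u x + φ x • (a x - u x) with hV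
  have hsplit : ∀ x ∈ ball (0 : Euc N) 1, b < |⟪ν, x⟫| → x ∈ side ν b ∪ side (-ν) b := fun x hx hbx => by
    rcases lt_abs.1 hbx with h | h
    · exact Or.inl ⟨hx, h⟩
    · exact Or.inr ⟨hx, by simpa [inner_neg_left] using h⟩
  have hsd : side ν b ∪ side (-ν) b ⊆ ball 0 1 \ K := union_subset (hside _ (Or.inl rfl)) (hside _ (Or.inr rfl))
  have hVa : ∀ x, |⟪ν, x⟫| ≤ b → V =ᶠ[𝓝 x] a := fun x hx => by
    have hc : Continuous fun x : Euc N => |⟪ν, x⟫| := by fun_prop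
    filter_upwards [hc.continuousAt.eventually_lt_const (show |⟪ν, x⟫| < s / 2 by linarith)] with z hz
    simp [hV, hφ1 z hz.le]
  have had : ContDiff ℝ ∞ a := by fun_prop
  set S := {x : Euc N | |⟪ν, x⟫| ≤ s} with hS
  have hSc : IsClosed S := isClosed_le (by fun_prop) continuous_const
  have hSv : volume (ball (0 : Euc N) 1 ∩ S) < ofReal ((ϑ + 1) / n) := by
    have h1 := slab_vol hν (n := n) (by exact_mod_cast hn0)
    rw [mul_comm, ← ofReal_natCast, hϑ', ← ENNReal.le_div_iff_mul_le (Or.inl (ofReal_pos.2 hn0).ne')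
      (Or.inl ofReal_ne_top), ← ENNReal.ofReal_div_of_pos hn0] at h1
    exact h1.trans_lt ((ENNReal.ofReal_lt_ofReal_iff (by positivity)).2 (by gcongr; linarith))
  obtain ⟨ρ, ⟨hρa, hρb⟩, hρ⟩ := heil _ (1/2) (3/4) _ (by norm_num) hSv
  have hsp : ∀ p ∈ sphere (0 : Euc N) ρ \ S, p ∈ side ν b ∪ side (-ν) b := fun p hp => by
    have h1 : s < |⟪ν, p⟫| := not_le.1 hp.2
    refine hsplit p ?_ (by linarith)
    rw [mem_ball_zero_iff, mem_sphere_zero_iff_norm.1 hp.1]; linarith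
  have hpat := H.patch h𝓒 (V := V) (ρ := ρ) (by linarith) (by linarith) hSc
    (fun p hp => by
      by_cases hpb : |⟪ν, p⟫| ≤ b
      · exact (H1At.of_contDiffAt (had.contDiffAt.of_le (by simp))).congr (hVa p hpb).symm
      · have h1 := hsd (hsplit p (ball_subset_ball (by linarith) hp) (not_le.1 hpb))
        exact (H.pair.h1At ⟨H.sub h1.1, h1.2⟩).cut had hφs)
    (fun p hp => by
      refine ⟨(hsd (hsp p hp)).2, ?_⟩
      filter_upwards [hSc.isOpen_compl.mem_nhds hp.2] with x hx
      simp [hV, hφ0 x (not_le.1 (show ¬ |⟪ν, x⟫| ≤ s from hx)).le])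
    (fun p hp q hq => by
      have hm : ∀ μ : Euc N, (μ = ν ∨ μ = -ν) → y + (t/2) • μ ∈ side μ b ∩ ball y t := fun μ hμ =>
        ball_sub_side (hμ1 μ hμ).1 ht ht1 hbt hy (hμ1 μ hμ).2 (mem_ball_self (by positivity))
      have h1 := IsPreconnected.union _ (hm ν (Or.inl rfl)).1 (hm ν (Or.inl rfl)).2 (side_convex ν b).isPreconnected
        (convex_ball y t).isPreconnected
      have h2 := IsPreconnected.union _ (show y + (t/2) • (-ν) ∈ side ν b ∪ ball y t from Or.inr (hm (-ν) (Or.inr rfl)).2) (hm (-ν) (Or.inr rfl)).1 h1 (side_convex (-ν) b).isPreconnected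
      refine h2.subset_connectedComponentIn ?_ (fun x hx => ?_) ?_
      · exact (hsp p hp).elim (fun h => Or.inl (Or.inl h)) Or.inr
      · have : x ∈ ball 0 1 \ K := hx.elim (fun h => h.elim (fun h => hsd (Or.inl h)) (fun h => hBK h)) (fun h => hsd (Or.inr h))
        exact ⟨H.sub this.1, this.2⟩
      · exact (hsp q hq).elim (fun h => Or.inl (Or.inl h)) Or.inr)
  set T := 3 * (c + (N * D) ^ 2 * (C1 * ((1 + C2) * c))) with hT
  have hsideV : ∀ μ : Euc N, (μ = ν ∨ μ = -ν) → ∫⁻ x in side μ b, dens V x ≤ ofReal T := fun μ hμ => by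
    have h1 : ∫⁻ x in side μ b, dens V x ≤ ∫⁻ x in side μ b, ofReal 3 * (dens u x +
        ofReal ((N * D) ^ 2) * ofReal (‖u x - (a0 + A0 x)‖ ^ 2)) := by
      refine setLIntegral_mono' (side_open μ b).measurableSet fun x hx => ?_
      obtain ⟨h0, h1, h2⟩ := hφ x
      refine (dens_cut (hφs.differentiable (by simp) x) (hdiff x (hside μ hμ hx)) (had.differentiable (by simp) x) h0 h1 h2).trans ?_
      rw [ha, dens_rigid hA0, zero_add, enorm_sq_eq]
      gcongr
      exact mul_le_of_le_one_left zero_le (ENNReal.ofReal_le_one.2 (by nlinarith))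
    refine h1.trans ?_
    rw [lintegral_const_mul' _ _ ofReal_ne_top, lintegral_add_left (measurable_dens u),
      lintegral_const_mul' _ _ ofReal_ne_top, hT, ofReal_mul (by norm_num), ofReal_add (by positivity)
      (by positivity), ofReal_mul (p := (N * D) ^ 2) (by positivity)]
    gcongr
    · exact (hsideE μ hμ).trans (ofReal_le_ofReal (mul_le_of_le_one_right hc.le (pow_le_one₀ ht.le (by linarith))))
    · exact hsideF μ hμ
  have hVd : ∫⁻ x in ball 0 ρ, dens V x ≤ ofReal (2 * T) := by
    have h1 : ball (0 : Euc N) ρ ⊆ {x | |⟪ν, x⟫| ≤ b} ∪ (side ν b ∪ side (-ν) b) := fun x hx => by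
      by_cases h : |⟪ν, x⟫| ≤ b
      · exact Or.inl h
      · exact Or.inr (hsplit x (ball_subset_ball (by linarith) hx) (not_le.1 h))
    have h2 : ∫⁻ x in {x | |⟪ν, x⟫| ≤ b}, dens V x = 0 := by
      rw [setLIntegral_congr_fun (g := fun _ => 0) (isClosed_le (by fun_prop) continuous_const).measurableSet, lintegral_zero]
      intro x hx
      simp only
      rw [← dens_rigid hA0 a0 x, dens, dens, eSym_eq, eSym_eq, (hVa x hx).fderiv_eq]
    refine (lintegral_mono_set h1).trans ((lintegral_union_le _ _ _).trans ?_)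
    rw [h2, zero_add, two_mul, ofReal_add (by positivity) (by positivity)]
    exact (lintegral_union_le _ _ _).trans (add_le_add (hsideV ν (Or.inl rfl)) (hsideV _ (Or.inr rfl)))
  set Y := Ce * ((ϑ + 1) / n) / (3/4 - 1/2) with hY
  have hsub : sphere 0 ρ ∩ S ⊆ (ball 0 1 ∩ S) ∩ sphere 0 ρ := fun x hx =>
    ⟨⟨by rw [mem_ball_zero_iff, mem_sphere_zero_iff_norm.1 hx.1]; linarith, hx.2⟩, hx.1⟩
  refine (energy_close (q := e / (3 * Γ)) hΓ1 hΓe hρa.le (by positivity) (by rw [hY]; norm_num; positivity) (by positivity) hpat hVd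
    ((measure_mono hsub).trans hρ) hη).trans (ofReal_le_ofReal ?_)
  rw [div_lt_iff₀ he] at hn
  have q1 : Γ * Y ≤ e / 3 := by
    rw [show Γ * Y = (3 * Γ * (Ce * (4 * (ϑ + 1)))) / n / 3 by rw [hY]; field_simp; norm_num]
    gcongr
    rw [div_le_iff₀ hn0]; linarith
  have q2 : Γ * (e / (3 * Γ)) = e / 3 := by field_simp
  have q3 : Γ * (Γ * (2 * T)) ≤ e / 3 := le_trans (le_of_eq (by rw [hT]; ring)) hcA
  linarith

lemma eh_scale (hN : 2 ≤ N) {Ω K : Set (Euc N)} {u : Euc N → Euc N} (H : AdmissiblePair Ω u K) (z : Euc N) {r : ℝ} (hr : 0 < r)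
    (t : ℝ) (hsub : ball z (r * t) ⊆ Ω) :
    ofReal (r ^ (N - 1)) * EH (scl (sqrt r)⁻¹ z r u) (hmt z r ⁻¹' K) 0 t = EH u K z (r * t) := by
  have h1 := dens_scale1 hN z hr (H.open_ball_diff isOpen_ball hsub).measurableSet
    (fun x hx => H.diffOn x ⟨hsub hx.1, hx.2⟩)
  have h2 := Hm_scale hN z hr (K ∩ ball z (r * t))
  rw [preimage_diff, hmt_preimage_ball0 z hr t] at h1
  rw [preimage_inter, hmt_preimage_ball0 z hr t] at h2
  rw [EH, EH, mul_add, h1, h2]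

/-- the total energy of an almost-minimizer is bounded from below at points of the crack -/
lemma no_small (hN : 2 ≤ N) {𝓒 : Mat N →ₗ[ℝ] Mat N} {c₀ : ℝ} (h𝓒 : IsElasticityTensor 𝓒 c₀) :
    ∃ e κ : ℝ, 0 < e ∧ 0 < κ ∧ ∀ (Ω : Set (Euc N)) (u : Euc N → Euc N) (K : Set (Euc N)) (h : ℝ → ℝ≥0∞),
      TopAlmostMin 𝓒 Ω u K h → ∀ x₀ ∈ K, ∀ R : ℝ, 0 < R → ball x₀ R ⊆ Ω → h R ≤ ofReal κ →
      ¬ EH u K x₀ R ≤ ofReal (e * R ^ (N - 1)) := by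
  obtain ⟨r, ε, κ, hr, hr1, hε, hεr, hκ, hstep⟩ := one_step hN h𝓒
  refine ⟨ε / 2 ^ (N - 1), κ, by positivity, hκ, fun Ω u K h H x₀ hx₀ R hR hsub hhR hsm => ?_⟩
  have hfin : EH u K x₀ R ≠ ⊤ := ne_top_of_le_ne_top ofReal_ne_top hsm
  have hin : ∀ x ∈ ball x₀ (R / 2), ball x (R / 2) ⊆ ball x₀ R := fun x hx =>
    ball_subset_ball' (by have := mem_ball.1 hx; linarith)
  have hiter : ∀ x ∈ K ∩ ball x₀ (R / 2), ∀ k : ℕ,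
      EH u K x (R / 2 * r ^ k) ≤ ofReal ((R / 2 * r ^ k) ^ (N - 1) * ε) := by
    intro x hx k
    induction k with
    | zero =>
      rw [pow_zero, mul_one]
      refine le_trans ?_ (hsm.trans (ofReal_le_ofReal (le_of_eq ?_)))
      · have := hin x hx.2
        unfold EH
        gcongr
      · rw [div_pow]; ring
    | succ k ih =>
      set s := R / 2 * r ^ k with hs
      have hs0 : 0 < s := by positivity
      have hsR : s ≤ R / 2 := mul_le_of_le_one_right (by positivity) (pow_le_one₀ hr.le (by linarith))
      have hsΩ : ball x s ⊆ Ω := (ball_subset_ball hsR).trans ((hin x hx.2).trans hsub)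
      have hp0 : ofReal (s ^ (N - 1)) ≠ 0 := (ofReal_pos.2 (by positivity)).ne'
      have h1 := eh_scale hN H.pair x hs0 1 (by rwa [mul_one])
      have h2 := eh_scale hN H.pair x hs0 r ((ball_subset_ball (by nlinarith)).trans hsΩ)
      rw [mul_one] at h1
      rw [← h1, ofReal_mul (by positivity), ENNReal.mul_le_mul_iff_right hp0 ofReal_ne_top] at ih
      have h3 := hstep _ _ _ _ (UnitMin.of_topAlmostMin hN H hs0 hsΩ)
        ((H.gauge.mono hs0 (by linarith)).trans hhR) (by simpa [hmt] using hx.1) ih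
      rw [show R / 2 * r ^ (k + 1) = s * r by rw [hs]; ring, ← h2,
        show (s * r) ^ (N - 1) * ε = s ^ (N - 1) * (r ^ (N - 1) * ε) by rw [mul_pow]; ring, ofReal_mul (by positivity)]
      exact mul_le_mul_right h3 _
  have hKm : MeasurableSet (K ∩ ball x₀ (R / 2)) := by
    have : K ∩ ball x₀ (R / 2) = closure K ∩ ball x₀ (R / 2) := by
      refine Subset.antisymm (inter_subset_inter_left _ subset_closure) fun x hx => ⟨H.pair.relClosed.2 ⟨hx.1, ?_⟩, hx.2⟩
      exact hsub (ball_subset_ball (by linarith) hx.2)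
    rw [this]
    exact isClosed_closure.measurableSet.inter measurableSet_ball
  refine density_contra hN hKm inter_subset_left ?_ (H.coral x₀ hx₀ _ (by positivity)) (r1 := R / 2) (by positivity) ?_
  · refine ne_top_of_le_ne_top hfin (le_trans (measure_mono ?_) le_add_self)
    exact inter_subset_inter_right _ (ball_subset_ball (by linarith))
  · intro x hx s hs hsR
    obtain ⟨k, hk1, hk2⟩ := exists_nat_pow_near_of_lt_one (x := s / (R / 2)) (y := r) (by positivity)
      ((div_le_one (by positivity)).2 hsR.le) hr (by linarith)
    rw [lt_div_iff₀ (by positivity), pow_succ] at hk1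
    rw [div_le_iff₀ (by positivity)] at hk2
    calc Hm N (K ∩ ball x s) ≤ EH u K x (R / 2 * r ^ k) :=
          le_trans (measure_mono (inter_subset_inter_right _ (ball_subset_ball (by linarith)))) le_add_self
      _ ≤ _ := hiter x hx k
      _ ≤ _ := ofReal_le_ofReal ?_
    calc (R / 2 * r ^ k) ^ (N - 1) * ε ≤ (R / 2 * r ^ k) ^ (N - 1) * (r ^ (N - 1) * (1 / 4) ^ N) := by gcongr
      _ = (1 / 4) ^ N * (r ^ k * r * (R / 2)) ^ (N - 1) := by rw [← mul_assoc, ← mul_pow]; ring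
      _ ≤ _ := by gcongr

lemma omega_eq (hN : 2 ≤ N) (u : Euc N → Euc N) (K : Set (Euc N)) (x : Euc N) {r : ℝ} (hr : 0 < r) :
    ofReal (r ^ (N - 1)) * omegaP u K 2 x r = ∫⁻ y in ball x r \ K, dens u y := by
  have h1 : r ^ (1 - 2 * (N : ℝ) / 2) = (r ^ (N - 1))⁻¹ := by
    rw [← Real.rpow_natCast, ← Real.rpow_neg hr.le, Nat.cast_sub (by omega)]
    congr 1
    push_cast; ring
  rw [omegaP, h1, ← mul_assoc, ← ofReal_mul (by positivity), mul_inv_cancel₀ (by positivity), ofReal_one,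
    one_mul, div_self two_ne_zero, ENNReal.rpow_one]
  simp only [dens, Real.rpow_two]

set_option maxHeartbeats 400000 in
/-- Bilateral flatness controlled by flatness and energy. -/
theorem bilateral_flatness_control
    (N : ℕ) (hN : 2 ≤ N) (𝓒 : Mat N →ₗ[ℝ] Mat N) (c₀ : ℝ)
    (h𝓒 : IsElasticityTensor 𝓒 c₀) :
    ∃ ε₀ > (0:ℝ), ∃ C : ℝ, 1 ≤ C ∧
      ∀ (Ω : Set (Euc N)) (u : Euc N → Euc N) (K : Set (Euc N)) (h : ℝ → ℝ≥0∞),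
        TopAlmostMin 𝓒 Ω u K h →
        ∀ x₀ ∈ K, ∀ r₀ : ℝ, 0 < r₀ → ball x₀ r₀ ⊆ Ω → h r₀ ≤ ofReal ε₀ →
          ofReal (bilFlatness K x₀ (r₀ / 2)) ≤
            ofReal C * (ofReal (flatness K x₀ r₀) +
              (omegaP u K 2 x₀ r₀) ^ (1 / (6 * ((N : ℝ) - 1)))) := by
  obtain ⟨e, κ, he, hκ, hno⟩ := no_small hN h𝓒
  obtain ⟨b₀, c, κ', hb₀, hc, hκ', hho⟩ := hole hN h𝓒 (e := e / 2 ^ (N - 1)) (by positivity)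
  set C := max 16 (max (1 / b₀) (2 / c)) with hC
  have hC16 : 16 ≤ C := le_max_left _ _
  have hCb : 1 / b₀ ≤ C := (le_max_left _ _).trans (le_max_right _ _)
  have hCc : 2 / c ≤ C := (le_max_right _ _).trans (le_max_right _ _)
  refine ⟨min κ κ', lt_min hκ hκ', C, by linarith, fun Ω u K h H x₀ hx₀ r₀ hr₀ hsub hh => ?_⟩
  have hNr : (0:ℝ) < (N:ℝ) - 1 := by
    have : (2:ℝ) ≤ N := by exact_mod_cast hN
    linarith
  by_cases hω : omegaP u K 2 x₀ r₀ = ⊤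
  · rw [hω, ENNReal.top_rpow_of_pos (by positivity), add_top, ENNReal.mul_top (ofReal_pos.2 (by linarith)).ne']
    exact le_top
  set w := (omegaP u K 2 x₀ r₀).toReal with hw
  have hw0 : 0 ≤ w := toReal_nonneg
  have hwω : omegaP u K 2 x₀ r₀ = ofReal w := (ofReal_toReal hω).symm
  set m := 6 * (N - 1) with hm
  have hmr : 6 * ((N : ℝ) - 1) = (m : ℝ) := by rw [hm, Nat.cast_mul, Nat.cast_sub (by omega)]; simp
  set γ := w ^ (1 / (6 * ((N : ℝ) - 1))) with hγ
  have hγ0 : 0 ≤ γ := Real.rpow_nonneg hw0 _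
  have hγm : γ ^ m = w := by rw [hγ, hmr, one_div, Real.rpow_inv_natCast_pow hw0 (by omega)]
  have hfl0 : 0 ≤ flatness K x₀ r₀ := Real.sInf_nonneg fun t ht => ht.1
  rw [hwω, ENNReal.ofReal_rpow_of_nonneg hw0 (by positivity), ← hγ, ← ofReal_add hfl0 hγ0,
    ← ofReal_mul (by linarith)]
  refine ofReal_le_ofReal ?_
  by_contra! hlt
  have hunit : ∀ (ν x : Euc N) (R : ℝ), ‖ν‖ = 1 → x ∈ ball x₀ R → |rInner ν (x - x₀)| ≤ 1 * R := fun ν x R hν hx => by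
    refine (abs_real_inner_le_norm _ _).trans ?_
    rw [hν]
    have := (mem_ball_iff_norm.1 hx).le
    linarith
  set ν₀ : Euc N := ev ⟨0, by omega⟩ with hν₀
  have hbil1 : bilFlatness K x₀ (r₀ / 2) ≤ 1 := by
    refine csInf_le ⟨0, fun t ht => ht.1⟩ ⟨zero_le_one, ν₀, norm_ev _, fun x hx => hunit _ _ _ (norm_ev _) hx.2, fun y hy _ => ?_⟩
    have := infDist_le_dist_of_mem (x := y) hx₀
    have := mem_ball.1 hy
    linarith
  obtain ⟨b, ⟨hb, ν, hν, hνK⟩, hbb⟩ := exists_lt_of_csInf_lt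
    (s := {t : ℝ | 0 ≤ t ∧ ∃ ν : Euc N, ‖ν‖ = 1 ∧ ∀ x ∈ K ∩ ball x₀ r₀, |rInner ν (x - x₀)| ≤ t * r₀})
    ⟨1, zero_le_one, ν₀, norm_ev _, fun x hx => hunit _ _ _ (norm_ev _) hx.2⟩
    (show flatness K x₀ r₀ < bilFlatness K x₀ (r₀ / 2) / C - γ by rw [lt_sub_iff_add_lt, lt_div_iff₀ (by linarith)]; linarith)
  rw [lt_sub_iff_add_lt, lt_div_iff₀ (by linarith)] at hbb
  set T := (b + γ) * C with hT
  have hT0 : 0 ≤ T := mul_nonneg (by positivity) (by linarith)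
  have hbT : 16 * b ≤ T := by rw [hT]; nlinarith
  obtain ⟨y, hy, hyν, hyK⟩ : ∃ y ∈ ball x₀ (r₀ / 2), rInner ν (y - x₀) = 0 ∧ T * (r₀ / 2) < infDist y K := by
    by_contra! hcon
    refine absurd (csInf_le ⟨0, fun t ht => ht.1⟩ (show T ∈ {t : ℝ | 0 ≤ t ∧ ∃ ν : Euc N, ‖ν‖ = 1 ∧
      (∀ x ∈ K ∩ ball x₀ (r₀ / 2), |rInner ν (x - x₀)| ≤ t * (r₀ / 2)) ∧
      (∀ y ∈ ball x₀ (r₀ / 2), rInner ν (y - x₀) = 0 → infDist y K ≤ t * (r₀ / 2))} from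
      ⟨hT0, ν, hν, fun x hx => (hνK x ⟨hx.1, ball_subset_ball (by linarith) hx.2⟩).trans ?_, hcon⟩)) (not_le.2 hbb)
    nlinarith
  have hyd : infDist y K < r₀ / 2 := (infDist_le_dist_of_mem hx₀).trans_lt (mem_ball.1 hy)
  set t := infDist y K / r₀ with ht
  have htr : infDist y K = r₀ * t := by rw [ht]; field_simp
  have htT : T / 2 < t := by rw [ht, lt_div_iff₀ hr₀]; linarith
  have ht0 : 0 < t := by linarith
  have ht2 : t < 1 / 2 := by rw [ht, div_lt_iff₀ hr₀]; linarith
  have hb1 : b ≤ b₀ := by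
    have h1 : b * C ≤ T := by rw [hT]; gcongr; linarith
    rw [div_le_iff₀ hb₀] at hCb
    by_contra! hcon
    nlinarith
  have hγt : γ ≤ 2 / C * t := by
    have h1 : γ * C ≤ T := by rw [hT]; gcongr; linarith
    rw [div_mul_eq_mul_div, le_div_iff₀ (by linarith)]
    linarith
  have hC0 : 0 < C := by linarith
  have hwt : w ≤ c * t ^ (N + 2) := by
    rw [← hγm]
    refine (pow_le_pow_left₀ hγ0 hγt m).trans ?_
    rw [mul_pow]
    have h2 : 2 / C ≤ 1 := by rw [div_le_one hC0]; linarith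
    have h3 : (2 / C) ^ m ≤ c := (pow_le_of_le_one (by positivity) h2 (by omega)).trans
      (by rw [div_le_iff₀ hc] at hCc; rw [div_le_iff₀ hC0]; linarith)
    have h4 : t ^ m ≤ t ^ (N + 2) := pow_le_pow_of_le_one ht0.le (by linarith) (by omega)
    gcongr
  have hp0 : ofReal (r₀ ^ (N - 1)) ≠ 0 := (ofReal_pos.2 (by positivity)).ne'
  have hE : ∫⁻ x in ball 0 1 \ hmt x₀ r₀ ⁻¹' K, dens (scl (sqrt r₀)⁻¹ x₀ r₀ u) x = ofReal w := by
    have h1 := dens_scale1 hN x₀ hr₀ (H.pair.open_ball_diff isOpen_ball hsub).measurableSet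
      (fun x hx => H.pair.diffOn x ⟨hsub hx.1, hx.2⟩)
    have h2 := hmt_preimage_ball0 x₀ hr₀ 1
    rw [mul_one] at h2
    rw [preimage_diff, h2, ← omega_eq hN u K x₀ hr₀, hwω] at h1
    exact (ENNReal.mul_right_inj hp0 ofReal_ne_top).1 h1
  set y' : Euc N := r₀⁻¹ • (y - x₀) with hy'
  have a1 : ‖y'‖ < 1 / 2 := by
    rw [hy', norm_smul, norm_inv, norm_of_nonneg hr₀.le, ← div_eq_inv_mul, div_lt_iff₀ hr₀]
    have := mem_ball_iff_norm.1 hy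
    linarith
  have a2 : ⟪ν, y'⟫ = 0 := by rw [hy', real_inner_smul_right, show ⟪ν, y - x₀⟫ = 0 from hyν, mul_zero]
  have a3 : ∀ x ∈ hmt x₀ r₀ ⁻¹' K ∩ ball 0 1, |⟪ν, x⟫| ≤ b := fun x hx => by
    have h0 : x ∈ ball (0 : Euc N) 1 := hx.2
    rw [← hmt_preimage_ball0 x₀ hr₀ 1, mul_one] at h0
    have h1 := hνK (hmt x₀ r₀ x) ⟨hx.1, h0⟩
    rw [hmt, add_sub_cancel_left, rInner, real_inner_smul_right, abs_mul, abs_of_pos hr₀, mul_comm] at h1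
    exact le_of_mul_le_mul_right h1 hr₀
  have a4 : ∀ x ∈ ball y' t, x ∉ hmt x₀ r₀ ⁻¹' K := fun x hx hxK => by
    have h1 : x ∈ hmt x₀ r₀ ⁻¹' ball (hmt x₀ r₀ y') (r₀ * t) := by rw [hmt_preimage_ball x₀ hr₀]; exact hx
    have h2 : dist (hmt x₀ r₀ x) (hmt x₀ r₀ y') < r₀ * t := h1
    have h3 : hmt x₀ r₀ y' = y := hmt_inv x₀ hr₀ y
    have h4 : infDist y K ≤ dist y (hmt x₀ r₀ x) := infDist_le_dist_of_mem (show hmt x₀ r₀ x ∈ K from hxK)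
    rw [h3, dist_comm] at h2
    linarith
  have hfin := hho (hmt x₀ r₀ ⁻¹' Ω) (hmt x₀ r₀ ⁻¹' K) (scl (sqrt r₀)⁻¹ x₀ r₀ u) (h r₀)
    (UnitMin.of_topAlmostMin hN H hr₀ hsub) (hh.trans (ofReal_le_ofReal (min_le_right _ _)))
    ν y' b t hν hb hb1 ht0 ht2 (by linarith) a1 a2 a3 a4 (hE.trans_le (ofReal_le_ofReal hwt))
  have hhalf : ball x₀ (r₀ / 2) ⊆ Ω := (ball_subset_ball (by linarith)).trans hsub
  refine hno Ω u K h H x₀ hx₀ (r₀ / 2) (by positivity) hhalf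
    ((H.gauge.mono (by positivity) (by linarith)).trans (hh.trans (ofReal_le_ofReal (min_le_left _ _)))) ?_
  have h1 := eh_scale hN H.pair x₀ hr₀ (1 / 2) (by rwa [mul_one_div])
  rw [mul_one_div] at h1
  rw [← h1, show e * (r₀ / 2) ^ (N - 1) = r₀ ^ (N - 1) * (e / 2 ^ (N - 1)) by rw [div_pow]; ring,
    ofReal_mul (by positivity)]
  exact mul_le_mul_right hfin _

end Griffith
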